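/- Let f: N → N be a C³ map of a compact interval or circle N all of whose critical points are quadratic (i.e. D²f(c) ≠ 0 at every critical point c), and suppose f has no neutral periodic orbits (no periodic point p of period n with |Df^n(p)| = 1). Then there exist a neighbourhood F of f in the C³ topology and a natural number n₀ such that for every g ∈ F and every attracting periodic orbit O of g, either the period of O is less than n₀ or there is a critical point c of g whose forward iterates under g converge to O. Consequently every g ∈ F has finitely many periodic attractors, their number being bounded by the number of periodic attractors of f plus the number of critical points of f. -/

import Mathlib

open Set Filter Topology MeasureTheory

noncomputable section

/-- The length of a set of reals (its Lebesgue measure). -/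
def slen (S : Set ℝ) : ℝ := (volume S).toReal

/-- The cross-ratio `D(T,J)` for intervals `T = [t1,t2] ⊇ J = [j1,j2]`. -/
def crossRatio (t1 j1 j2 t2 : ℝ) : ℝ :=
  ((t2 - t1) * (j2 - j1)) / ((j1 - t1) * (t2 - j2))

/-- The cross-ratio distortion `B(f,T,J)` for `T = [t1,t2] ⊇ J = [j1,j2]`. -/
def crDist (f : ℝ → ℝ) (t1 j1 j2 t2 : ℝ) : ℝ :=
  crossRatio (f t1) (f j1) (f j2) (f t2) / crossRatio t1 j1 j2 t2

/-- The Schwarzian derivative of `f`. -/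
def schwarzian (f : ℝ → ℝ) (x : ℝ) : ℝ :=
  iteratedDeriv 3 f x / deriv f x - (3 / 2) * (iteratedDeriv 2 f x / deriv f x) ^ 2

/-- The `l`-scaling `lI` of the interval `I` with endpoints `x ≤ y`
(same centre, half-width multiplied by `l`). -/
def scaledIcc (l x y : ℝ) : Set ℝ :=
  Icc ((x + y) / 2 - l * (y - x) / 2) ((x + y) / 2 + l * (y - x) / 2)

/-- The `l`-scaling of a bounded interval given as a set. -/
def scaledSet (l : ℝ) (S : Set ℝ) : Set ℝ := scaledIcc l (sInf S) (sSup S)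

/-- `p` is a periodic point of `g` of (exact) period `n`. -/
def PeriodicPt (g : ℝ → ℝ) (p : ℝ) (n : ℕ) : Prop :=
  0 < n ∧ g^[n] p = p ∧ ∀ m, 0 < m → m < n → g^[m] p ≠ p

/-- The forward orbit of `p` under `g`. -/
def orbitSet (g : ℝ → ℝ) (p : ℝ) : Set ℝ := Set.range fun k => g^[k] p

/-- The iterates of `x` converge to the set `O`. -/
def ConvergesToOrbit (g : ℝ → ℝ) (x : ℝ) (O : Set ℝ) : Prop :=
  Tendsto (fun k => Metric.infDist (g^[k] x) O) atTop (nhds 0)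

/-- The basin of attraction of the set `O`. -/
def Basin (g : ℝ → ℝ) (O : Set ℝ) : Set ℝ := {x | ConvergesToOrbit g x O}

/-- The immediate basin of attraction of `O` within `N`: the union of the connected
components of the basin which contain points of `O`. -/
def ImmBasinIn (g : ℝ → ℝ) (N : Set ℝ) (O : Set ℝ) : Set ℝ :=
  ⋃ y ∈ O, connectedComponentIn (Basin g O ∩ N) y

/-- `p` is an attracting periodic point of period `n` for the map `g : N → N`. -/
def AttractingIn (g : ℝ → ℝ) (N : Set ℝ) (p : ℝ) (n : ℕ) : Prop :=
  PeriodicPt g p n ∧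
    ∃ U : Set ℝ, IsOpen U ∧ p ∈ U ∧ ∀ x ∈ U ∩ N, ConvergesToOrbit g x (orbitSet g p)

/-- `p` is a neutral periodic point of `g`. -/
def NeutralPeriodicPt (g : ℝ → ℝ) (p : ℝ) (n : ℕ) : Prop :=
  0 < n ∧ g^[n] p = p ∧ |deriv (g^[n]) p| = 1

/-- `g` is `η`-close to `f` in the `C^k` topology on `N`. -/
def CkClose (k : ℕ) (f g : ℝ → ℝ) (N : Set ℝ) (η : ℝ) : Prop :=
  ∀ i ≤ k, ∀ x ∈ N, |iteratedDeriv i g x - iteratedDeriv i f x| ≤ η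

/-- `{T k}_{k=0}^m` is a chain for the map `g : N → N`:
each `T k` is a connected component of `g⁻¹(T (k+1))` (within `N`). -/
def IsChainIn (g : ℝ → ℝ) (N : Set ℝ) (m : ℕ) (T : ℕ → Set ℝ) : Prop :=
  ∀ k < m, (T k).Nonempty ∧ ∀ x ∈ T k, T k = connectedComponentIn (g ⁻¹' T (k + 1) ∩ N) x

/-- `[u,v]` is a periodic interval of period `n` for `g`. -/
def IsPeriodicInterval (g : ℝ → ℝ) (u v : ℝ) (n : ℕ) : Prop :=
  u ≤ v ∧ 0 < n ∧ g^[n] '' Icc u v = Icc u v ∧ InjOn (g^[n]) (Icc u v)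

/-- The periodic points of `g` lying in `S`. -/
def periodicPtsIn (g : ℝ → ℝ) (S : Set ℝ) : Set ℝ :=
  {x ∈ S | ∃ m : ℕ, 0 < m ∧ g^[m] x = x}

/-- A pack of periodic points of `g`: the set of all periodic points in some closed
(possibly degenerate) periodic interval such that no larger periodic interval
contains more periodic points. -/
def IsPack (g : ℝ → ℝ) (P : Set ℝ) : Prop :=
  ∃ u v n, IsPeriodicInterval g u v n ∧ P = periodicPtsIn g (Icc u v) ∧
    ∀ u' v' n', Icc u v ⊆ Icc u' v' → IsPeriodicInterval g u' v' n' →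
      periodicPtsIn g (Icc u' v') = P

/-- `f : N → N` has a wandering interval: a nondegenerate interval whose iterates are
pairwise disjoint and which is not contained in the basin of a periodic attractor. -/
def HasWanderingInterval (f : ℝ → ℝ) (N : Set ℝ) : Prop :=
  ∃ u v : ℝ, u < v ∧ Ioo u v ⊆ N ∧
    (∀ m n : ℕ, m ≠ n → Disjoint (f^[m] '' Ioo u v) (f^[n] '' Ioo u v)) ∧
    ¬ ∃ p ∈ N, ∃ k : ℕ, AttractingIn f N p k ∧
        ∀ x ∈ Ioo u v, ConvergesToOrbit f x (orbitSet f p)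

/-- `n` is the orientation preserving period of the periodic point `p`: it is `2m` if
`Dg^m(p) < 0` and `m` if `Dg^m(p) ≥ 0`, where `m` is the period of `p`. -/
def OrientationPreservingPeriod (g : ℝ → ℝ) (p : ℝ) (n : ℕ) : Prop :=
  ∃ m : ℕ, PeriodicPt g p m ∧
    ((deriv (g^[m]) p < 0 ∧ n = 2 * m) ∨ (0 ≤ deriv (g^[m]) p ∧ n = m))

/-- A three times differentiable map with uniform bounds on `[A, B]` whose first two derivatives
never vanish simultaneously there. -/
structure Cls (A B K μ : ℝ) (g g1 g2 g3 : ℝ → ℝ) : Prop where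
  d0 : ∀ x, HasDerivAt g (g1 x) x
  d1 : ∀ x, HasDerivAt g1 (g2 x) x
  d2 : ∀ x, HasDerivAt g2 (g3 x) x
  b1 : ∀ x ∈ Icc A B, |g1 x| ≤ K
  b2 : ∀ x ∈ Icc A B, |g2 x| ≤ K
  b3 : ∀ x ∈ Icc A B, |g3 x| ≤ K
  nd : ∀ x ∈ Icc A B, μ ≤ |g1 x| + |g2 x|

namespace Cls

variable {A B K μ : ℝ} {g g1 g2 g3 : ℝ → ℝ}

lemma neg (h : Cls A B K μ g g1 g2 g3) :
    Cls A B K μ (fun x => -g x) (fun x => -g1 x) (fun x => -g2 x) (fun x => -g3 x) where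
  d0 x := (h.d0 x).neg
  d1 x := (h.d1 x).neg
  d2 x := (h.d2 x).neg
  b1 x hx := by simpa using h.b1 x hx
  b2 x hx := by simpa using h.b2 x hx
  b3 x hx := by simpa using h.b3 x hx
  nd x hx := by simpa using h.nd x hx

lemma cont (h : Cls A B K μ g g1 g2 g3) : Continuous g :=
  continuous_iff_continuousAt.2 fun x => (h.d0 x).continuousAt

lemma cont1 (h : Cls A B K μ g g1 g2 g3) : Continuous g1 :=
  continuous_iff_continuousAt.2 fun x => (h.d1 x).continuousAt

lemma lip1 (h : Cls A B K μ g g1 g2 g3) {x y : ℝ} (hx : x ∈ Icc A B) (hy : y ∈ Icc A B) :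
    |g1 y - g1 x| ≤ K * |y - x| := by
  have := (convex_Icc A B).norm_image_sub_le_of_norm_hasDerivWithin_le
    (fun z _ => (h.d1 z).hasDerivWithinAt) (fun z hz => h.b2 z hz) hx hy
  simpa using this

lemma lip2 (h : Cls A B K μ g g1 g2 g3) {x y : ℝ} (hx : x ∈ Icc A B) (hy : y ∈ Icc A B) :
    |g2 y - g2 x| ≤ K * |y - x| := by
  have := (convex_Icc A B).norm_image_sub_le_of_norm_hasDerivWithin_le
    (fun z _ => (h.d2 z).hasDerivWithinAt) (fun z hz => h.b3 z hz) hx hy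
  simpa using this

end Cls

/-- A continuous function without zeros on an open interval has constant sign there. -/
lemma sign_of_ne {φ : ℝ → ℝ} (hφ : Continuous φ) {u w : ℝ}
    (h : ∀ v ∈ Ioo u w, φ v ≠ 0) : (∀ v ∈ Ioo u w, 0 < φ v) ∨ (∀ v ∈ Ioo u w, φ v < 0) := by
  by_contra! hc
  obtain ⟨⟨x, hx, hx0⟩, ⟨y, hy, hy0⟩⟩ := hc
  obtain ⟨z, hz, hz0⟩ := isPreconnected_Ioo.intermediate_value hx hy hφ.continuousOn ⟨hx0, hy0⟩
  exact h z hz hz0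

/-- The Schwarzian derivative is bounded above, and very negative near critical points. -/
lemma Cls.schwarz_bound (K μ : ℝ) (hμ : 0 < μ) : ∃ c K3 : ℝ, 0 < c ∧ 0 < K3 ∧
    ∀ (A B : ℝ) (g g1 g2 g3 : ℝ → ℝ), Cls A B K μ g g1 g2 g3 → ∀ x ∈ Icc A B,
      g3 x * g1 x - 3 / 2 * g2 x ^ 2 ≤ K3 * g1 x ^ 2 - c := by
  set K0 := |K| + 1
  have hK0 : 0 < K0 := by positivity
  refine ⟨μ ^ 2 / 8, 2 * K0 ^ 2 / μ ^ 2 + 3 / 2, by positivity, by positivity, ?_⟩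
  intro A B g g1 g2 g3 h x hx
  have h3 := (h.b3 x hx).trans ((le_abs_self K).trans (le_add_of_nonneg_right zero_le_one) : K ≤ K0)
  have hnd := h.nd x hx
  have e1 : g3 x * g1 x ≤ K0 * |g1 x| := by
    calc g3 x * g1 x ≤ |g3 x * g1 x| := le_abs_self _
      _ = |g3 x| * |g1 x| := abs_mul _ _
      _ ≤ _ := by gcongr
  have e2 : μ ^ 2 / 2 ≤ g1 x ^ 2 + g2 x ^ 2 := by
    rw [← sq_abs (g1 x), ← sq_abs (g2 x)]
    nlinarith [sq_nonneg (|g1 x| - |g2 x|), abs_nonneg (g1 x), abs_nonneg (g2 x)]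
  have e3 : K0 * |g1 x| ≤ 2 * K0 ^ 2 / μ ^ 2 * g1 x ^ 2 + μ ^ 2 / 8 := by
    rw [← sq_abs (g1 x)]
    have : 0 ≤ (2 * K0 * |g1 x| / μ - μ / 2) ^ 2 := sq_nonneg _
    have e : (2 * K0 * |g1 x| / μ - μ / 2) ^ 2
        = 2 * (2 * K0 ^ 2 / μ ^ 2 * |g1 x| ^ 2 + μ ^ 2 / 8 - K0 * |g1 x|) := by
      field_simp; ring
    linarith
  nlinarith [sq_nonneg (g1 x)]

/-- A monotone branch over a long interval has a long image. -/
lemma Cls.long_image (K μ : ℝ) (hμ : 0 < μ) (ρ : ℝ) (hρ : 0 < ρ) : ∃ c : ℝ, 0 < c ∧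
    ∀ (A B : ℝ) (g g1 g2 g3 : ℝ → ℝ), Cls A B K μ g g1 g2 g3 →
    ∀ u w, u ∈ Icc A B → w ∈ Icc A B → ρ ≤ w - u → (∀ v ∈ Ioo u w, g1 v ≠ 0) →
      c ≤ |g w - g u| := by
  set K0 := |K| + 1
  have hK0 : 0 < K0 := by positivity
  have hKK : K ≤ K0 := (le_abs_self K).trans (le_add_of_nonneg_right zero_le_one)
  set r := min (ρ / 2) (μ / (4 * K0)) with hr
  have hr0 : 0 < r := by positivity
  set δ := min (μ / 2) (μ * r / 8) with hδ
  have hδ0 : 0 < δ := by positivity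
  set r' := min (ρ / 2) (δ / (2 * K0)) with hr'
  have hr'0 : 0 < r' := by positivity
  refine ⟨δ / 2 * r', by positivity, ?_⟩
  intro A B g g1 g2 g3
  suffices H : ∀ (g g1 g2 g3 : ℝ → ℝ), Cls A B K μ g g1 g2 g3 →
    ∀ u w, u ∈ Icc A B → w ∈ Icc A B → ρ ≤ w - u → (∀ v ∈ Ioo u w, 0 < g1 v) →
      δ / 2 * r' ≤ g w - g u by
    intro h u w hu hw huw hne
    rcases sign_of_ne h.cont1 hne with hp | hp
    · exact (H g g1 g2 g3 h u w hu hw huw hp).trans (le_abs_self _)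
    · have := H _ _ _ _ h.neg u w hu hw huw (fun v hv => by simpa using hp v hv)
      refine this.trans ?_
      rw [abs_sub_comm]
      refine le_trans (le_of_eq (by ring)) (le_abs_self _)
  clear g g1 g2 g3
  intro g g1 g2 g3 h u w hu hw huw hp
  have hsub : Icc u w ⊆ Icc A B := Icc_subset_Icc hu.1 hw.2
  have hp' : ∀ v ∈ Icc u w, 0 ≤ g1 v := by
    intro v hv
    have hcl : closure (Ioo u w) = Icc u w := closure_Ioo (by linarith)
    have : IsClosed {v | 0 ≤ g1 v} := isClosed_le continuous_const h.cont1
    exact closure_minimal (fun v hv => (hp v hv).le) this (hcl ▸ hv)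
  have hmono : MonotoneOn g (Icc u w) :=
    monotoneOn_of_deriv_nonneg (convex_Icc u w) h.cont.continuousOn
      (fun v _ => (h.d0 v).differentiableAt.differentiableWithinAt)
      (fun v hv => by rw [(h.d0 v).deriv]; exact hp' v (interior_subset hv))
  set m := (u + w) / 2 with hm
  have hr1 : r ≤ ρ / 2 := min_le_left _ _
  have hr2 : r * (4 * K0) ≤ μ := by
    have : r ≤ μ / (4 * K0) := min_le_right _ _
    rwa [le_div_iff₀ (by positivity)] at this
  have hr'1 : r' ≤ ρ / 2 := min_le_left _ _
  have hr'2 : r' * (2 * K0) ≤ δ := by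
    have : r' ≤ δ / (2 * K0) := min_le_right _ _
    rwa [le_div_iff₀ (by positivity)] at this
  have hδ1 : δ ≤ μ / 2 := min_le_left _ _
  have hδ2 : δ ≤ μ * r / 8 := min_le_right _ _
  have hmI : m ∈ Icc u w := ⟨by linarith, by linarith⟩
  by_cases hc : δ ≤ g1 m
  · have key : ∀ v ∈ Icc m (m + r'), δ / 2 ≤ g1 v := by
      intro v hv
      have hv' : v ∈ Icc u w := ⟨by linarith [hv.1], by linarith [hv.2]⟩
      have := h.lip1 (hsub hmI) (hsub hv')
      rw [abs_of_nonneg (show 0 ≤ v - m by linarith [hv.1])] at this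
      have h2 := neg_le_of_abs_le this
      have : K * (v - m) ≤ K0 * r' := by
        apply mul_le_mul hKK (by linarith [hv.2]) (by linarith [hv.1]) hK0.le
      nlinarith
    have := (convex_Icc m (m + r')).mul_sub_le_image_sub_of_le_deriv (C := δ / 2)
      h.cont.continuousOn (fun v _ => (h.d0 v).differentiableAt.differentiableWithinAt)
      (fun v hv => by rw [(h.d0 v).deriv]; exact key v (interior_subset hv)) m ⟨le_rfl, by linarith⟩
      (m + r') ⟨by linarith, le_rfl⟩ (by linarith)
    have e1 := hmono (left_mem_Icc.2 (by linarith)) hmI (by linarith)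
    have e2 := hmono (⟨by linarith, by linarith⟩ : m + r' ∈ Icc u w)
      (right_mem_Icc.2 (by linarith)) (by linarith)
    have e3 : m + r' - m = r' := by ring
    rw [e3] at this
    linarith
  · exfalso
    push Not at hc
    have hm0 := hp' m hmI
    have hnd := h.nd m (hsub hmI)
    rw [abs_of_nonneg hm0] at hnd
    have hg2 : μ / 2 ≤ |g2 m| := by linarith
    have near : ∀ v ∈ Icc (m - r) (m + r), |g2 v - g2 m| ≤ μ / 4 := by
      intro v hv
      have hv' : v ∈ Icc u w := ⟨by linarith [hv.1], by linarith [hv.2]⟩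
      refine (h.lip2 (hsub hmI) (hsub hv')).trans ?_
      have : K * |v - m| ≤ K0 * r := by
        apply mul_le_mul hKK _ (abs_nonneg _) hK0.le
        rw [abs_le]; constructor <;> linarith [hv.1, hv.2]
      linarith
    rcases le_abs.1 hg2 with hpos | hneg
    · have := (convex_Icc (m - r) m).mul_sub_le_image_sub_of_le_deriv (C := μ / 4)
        h.cont1.continuousOn (fun v _ => (h.d1 v).differentiableAt.differentiableWithinAt)
        (fun v hv => by
          rw [(h.d1 v).deriv]
          have hv := interior_subset hv
          have := neg_le_of_abs_le (near v ⟨hv.1, by linarith [hv.2]⟩)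
          linarith) (m - r) ⟨le_rfl, by linarith⟩ m ⟨by linarith, le_rfl⟩ (by linarith)
      have h3 := hp' (m - r) ⟨by linarith, by linarith⟩
      have e3 : m - (m - r) = r := by ring
      rw [e3] at this
      nlinarith
    · have := (convex_Icc m (m + r)).image_sub_le_mul_sub_of_deriv_le (C := -(μ / 4))
        h.cont1.continuousOn (fun v _ => (h.d1 v).differentiableAt.differentiableWithinAt)
        (fun v hv => by
          rw [(h.d1 v).deriv]
          have hv := interior_subset hv
          have := le_of_abs_le (near v ⟨by linarith [hv.1], hv.2⟩)
          linarith) m ⟨le_rfl, by linarith⟩ (m + r) ⟨by linarith, le_rfl⟩ (by linarith)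
      have h3 := hp' (m + r) ⟨by linarith, by linarith⟩
      have e3 : m + r - m = r := by ring
      rw [e3] at this
      nlinarith

lemma uIoo_pos_or {φ : ℝ → ℝ} (hφ : Continuous φ) {u w : ℝ}
    (h : ∀ v ∈ uIoo u w, φ v ≠ 0) : (∀ v ∈ uIoo u w, 0 < φ v) ∨ (∀ v ∈ uIoo u w, φ v < 0) :=
  sign_of_ne hφ h

/-- Distance to a critical value controls the derivative. -/
lemma Cls.crit_dist {A B K μ : ℝ} {g g1 g2 g3 : ℝ → ℝ} (h : Cls A B K μ g g1 g2 g3)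
    {x e : ℝ} (hx : x ∈ Icc A B) (he : e ∈ Icc A B) (h0 : g1 e = 0)
    (hne : ∀ v ∈ uIoo x e, g1 v ≠ 0) : g1 x ^ 2 ≤ 2 * K * |g x - g e| := by
  have hsub : uIcc x e ⊆ Icc A B := by
    exact uIcc_subset_Icc hx he
  have hK : 0 ≤ K := (abs_nonneg _).trans (h.b1 x hx)
  suffices H : ∀ g g1 g2 g3 : ℝ → ℝ, Cls A B K μ g g1 g2 g3 → g1 e = 0 →
      (∀ v ∈ uIoo x e, 0 < g1 v) → g1 x ^ 2 ≤ 2 * K * |g x - g e| by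
    rcases uIoo_pos_or h.cont1 hne with hp | hp
    · exact H g g1 g2 g3 h h0 hp
    · have := H _ _ _ _ h.neg (by simpa using h0) (fun v hv => by simpa using hp v hv)
      have e1 : |-g x - -g e| = |g x - g e| := by rw [← abs_neg]; congr 1; ring
      rw [e1] at this
      simpa using this
  clear h0 hne h g g1 g2 g3
  intro g g1 g2 g3 h h0 hp
  have hb : ∀ v ∈ uIoo x e, |g1 v * g2 v| ≤ K * g1 v := by
    intro v hv
    rw [abs_mul, abs_of_pos (hp v hv), mul_comm]
    exact mul_le_mul_of_nonneg_right (h.b2 v (hsub (Ioo_subset_Icc_self hv))) (hp v hv).le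
  rcases lt_trichotomy x e with hlt | rfl | hgt
  · rw [uIoo_of_le hlt.le] at *
    have key : MonotoneOn (fun t => g1 t ^ 2 + 2 * K * g t) (Icc x e) := by
      have hd : ∀ t, HasDerivAt (fun t => g1 t ^ 2 + 2 * K * g t)
        (2 * (g1 t * g2 t) + 2 * K * g1 t) t := fun t => by
        refine (((h.d1 t).pow 2).add ((h.d0 t).const_mul (2 * K))).congr_deriv ?_
        push_cast; ring
      refine monotoneOn_of_deriv_nonneg (convex_Icc _ _)
        (fun t _ => (hd t).continuousAt.continuousWithinAt)
        (fun t _ => (hd t).differentiableAt.differentiableWithinAt) fun t ht => ?_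
      rw [(hd t).deriv]
      rw [interior_Icc] at ht
      have := neg_le_of_abs_le (hb t ht)
      linarith
    have := key (left_mem_Icc.2 hlt.le) (right_mem_Icc.2 hlt.le) hlt.le
    simp only [h0] at this
    have h4 : g e - g x ≤ |g x - g e| := by rw [abs_sub_comm]; exact le_abs_self _
    nlinarith
  · simp [h0]
  · rw [uIoo_of_ge hgt.le] at *
    have key : AntitoneOn (fun t => g1 t ^ 2 - 2 * K * g t) (Icc e x) := by
      have hd : ∀ t, HasDerivAt (fun t => g1 t ^ 2 - 2 * K * g t)
        (2 * (g1 t * g2 t) - 2 * K * g1 t) t := fun t => by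
        refine (((h.d1 t).pow 2).sub ((h.d0 t).const_mul (2 * K))).congr_deriv ?_
        push_cast; ring
      refine antitoneOn_of_deriv_nonpos (convex_Icc _ _)
        (fun t _ => (hd t).continuousAt.continuousWithinAt)
        (fun t _ => (hd t).differentiableAt.differentiableWithinAt) fun t ht => ?_
      rw [(hd t).deriv]
      rw [interior_Icc] at ht
      have := le_of_abs_le (hb t ht)
      linarith
    have := key (left_mem_Icc.2 hgt.le) (right_mem_Icc.2 hgt.le) hgt.le
    simp only [h0] at this
    have h4 : g x - g e ≤ |g x - g e| := le_abs_self _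
    nlinarith

/-- The Sturm comparison estimate on a short interval. -/
lemma sturm_short {g g1 g2 g3 : ℝ → ℝ} {u w ω : ℝ} (huw : u < w)
    (d0 : ∀ x, HasDerivAt g (g1 x) x) (d1 : ∀ x, HasDerivAt g1 (g2 x) x)
    (d2 : ∀ x, HasDerivAt g2 (g3 x) x) (hp : ∀ v ∈ Icc u w, 0 < g1 v)
    (hS : ∀ v ∈ Icc u w, g3 v * g1 v - 3 / 2 * g2 v ^ 2 ≤ 2 * ω * g1 v ^ 2)
    (hω : 0 ≤ ω) (hsh : ω * (w - u) ^ 2 ≤ 1) :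
    g1 u * g1 w * (w - u) ^ 2 ≤ (1 + ω * (w - u) ^ 2) * (g w - g u) ^ 2 := by
  set s : ℝ → ℝ := fun t => √(g1 t) with hs
  set y : ℝ → ℝ := fun t => (g t - g u) / s t with hy
  set y1 : ℝ → ℝ := fun t => s t - (g t - g u) * g2 t / (2 * s t ^ 3) with hy1
  have hspos : ∀ t ∈ Icc u w, 0 < s t := fun t ht => Real.sqrt_pos.2 (hp t ht)
  have hssq : ∀ t ∈ Icc u w, g1 t = s t ^ 2 := fun t ht => (Real.sq_sqrt (hp t ht).le).symm
  have hds : ∀ t ∈ Icc u w, HasDerivAt s (g2 t / (2 * s t)) t := fun t ht =>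
    (d1 t).sqrt (hp t ht).ne'
  have hdy : ∀ t ∈ Icc u w, HasDerivAt y (y1 t) t := fun t ht => by
    have h0 := (hspos t ht).ne'
    refine (((d0 t).sub_const (g u)).div (hds t ht) h0).congr_deriv ?_
    rw [hssq t ht]; simp only [hy1]; field_simp
  have hdy1 : ∀ t ∈ Icc u w, HasDerivAt y1
      (-((g3 t * g1 t - 3 / 2 * g2 t ^ 2) / g1 t ^ 2 / 2) * y t) t := fun t ht => by
    have h0 := (hspos t ht).ne'
    refine ((hds t ht).sub ((((d0 t).sub_const (g u)).mul (d2 t)).div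
      (((hds t ht).pow 3).const_mul 2) (mul_ne_zero two_ne_zero (pow_ne_zero 3 h0)))).congr_deriv ?_
    simp only [hy, Pi.pow_apply, Pi.mul_apply]; rw [hssq t ht]; field_simp; push_cast; ring
  have hynn : ∀ t ∈ Icc u w, 0 ≤ y t := fun t ht => by
    refine div_nonneg ?_ (hspos t ht).le
    have hmono : MonotoneOn g (Icc u w) :=
      monotoneOn_of_deriv_nonneg (convex_Icc u w)
      (fun v _ => (d0 v).continuousAt.continuousWithinAt)
      (fun v _ => (d0 v).differentiableAt.differentiableWithinAt)
      (fun v hv => by rw [(d0 v).deriv]; exact (hp v (interior_subset hv)).le)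
    linarith [hmono (left_mem_Icc.2 huw.le) ht ht.1]
  set v : ℝ → ℝ := fun t => (w - t) - ω * (w - t) ^ 3 / 6 with hv
  have hdv : ∀ t, HasDerivAt v (-(1 - ω * (w - t) ^ 2 / 2)) t := fun t => by
    have hid : HasDerivAt (fun t : ℝ => w - t) (-1) t := by
      simpa using (hasDerivAt_id t).const_sub w
    refine (hid.sub (((hid.pow 3).const_mul ω).div_const 6)).congr_deriv ?_
    push_cast; ring
  set v1 : ℝ → ℝ := fun t => -(1 - ω * (w - t) ^ 2 / 2) with hv1
  have hdv1 : ∀ t, HasDerivAt v1 (-(ω * (w - t))) t := fun t => by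
    have hid : HasDerivAt (fun t : ℝ => w - t) (-1) t := by
      simpa using (hasDerivAt_id t).const_sub w
    refine ((((hid.pow 2).const_mul ω).div_const 2).const_sub 1).neg.congr_deriv ?_
    push_cast; ring
  have hvle : ∀ t ∈ Icc u w, 0 ≤ v t ∧ v t ≤ w - t := fun t ht => by
    have e1 : 0 ≤ w - t := by linarith [ht.2]
    have e2 : ω * (w - t) ^ 2 ≤ 1 := le_trans (by gcongr; exact ht.1) hsh
    have e3 : v t = (w - t) * (1 - ω * (w - t) ^ 2 / 6) := by simp only [hv]; ring
    have e4 : 0 ≤ ω * (w - t) ^ 2 := by positivity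
    constructor
    · rw [e3]; apply mul_nonneg e1; linarith
    · rw [e3]; nlinarith
  have key : MonotoneOn (fun t => y1 t * v t - y t * v1 t) (Icc u w) := by
    have hd : ∀ t ∈ Icc u w, HasDerivAt (fun t => y1 t * v t - y t * v1 t)
        (-((g3 t * g1 t - 3 / 2 * g2 t ^ 2) / g1 t ^ 2 / 2) * y t * v t
          + y t * (ω * (w - t))) t := fun t ht => by
      refine (((hdy1 t ht).mul (hdv t)).sub ((hdy t ht).mul (hdv1 t))).congr_deriv ?_
      simp only [hv1]; ring
    refine monotoneOn_of_deriv_nonneg (convex_Icc _ _)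
      (fun t ht => (hd t ht).continuousAt.continuousWithinAt)
      (fun t ht => (hd t (interior_subset ht)).differentiableAt.differentiableWithinAt)
      fun t ht => ?_
    have ht := interior_subset ht
    rw [(hd t ht).deriv]
    have hg := hp t ht
    have e1 : (g3 t * g1 t - 3 / 2 * g2 t ^ 2) / g1 t ^ 2 / 2 ≤ ω := by
      rw [div_div, div_le_iff₀ (by positivity)]; linarith [hS t ht]
    have e2 := hynn t ht
    obtain ⟨e3, e4⟩ := hvle t ht
    have e5 : (g3 t * g1 t - 3 / 2 * g2 t ^ 2) / g1 t ^ 2 / 2 * (y t * v t) ≤ ω * (y t * v t) := by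
      gcongr
    have e6 : ω * (y t * v t) ≤ ω * (y t * (w - t)) := by gcongr
    linarith
  have := key (left_mem_Icc.2 huw.le) (right_mem_Icc.2 huw.le) huw.le
  have hu0 : y u = 0 := by simp [hy]
  have hvw : v w = 0 := by simp [hv]
  have hv1w : v1 w = -1 := by simp [hv1]
  have hy1u : y1 u = s u := by simp [hy1]
  simp only [hu0, hvw, hv1w, hy1u] at this
  have hsu := hspos u (left_mem_Icc.2 huw.le)
  have hsw := hspos w (right_mem_Icc.2 huw.le)
  rw [hssq u (left_mem_Icc.2 huw.le), hssq w (right_mem_Icc.2 huw.le)]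
  have e1 : s u * v u * s w ≤ g w - g u := by
    have : s u * v u ≤ (g w - g u) / s w := by simpa [hy] using this
    rwa [le_div_iff₀ hsw] at this
  set q := ω * (w - u) ^ 2 with hq
  have hq0 : 0 ≤ q := by positivity
  have e3 : v u = (w - u) * (1 - q / 6) := by simp only [hv, hq]; ring
  have e4 : 0 ≤ s u * v u * s w := by
    have := (hvle u (left_mem_Icc.2 huw.le)).1; positivity
  have e5 : (s u * v u * s w) ^ 2 ≤ (g w - g u) ^ 2 := by gcongr
  have e6 : 1 ≤ (1 + q) * (1 - q / 6) ^ 2 := by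
    nlinarith [mul_nonneg hq0 (sub_nonneg.2 hsh), pow_nonneg hq0 3]
  calc s u ^ 2 * s w ^ 2 * (w - u) ^ 2 = (s u ^ 2 * s w ^ 2 * (w - u) ^ 2) * 1 := by ring
    _ ≤ (s u ^ 2 * s w ^ 2 * (w - u) ^ 2) * ((1 + q) * (1 - q / 6) ^ 2) := by gcongr
    _ = (1 + q) * (s u * v u * s w) ^ 2 := by rw [e3]; ring
    _ ≤ _ := by gcongr

/-- The second-order distortion estimate, uniform over the class. -/
lemma Cls.sturm (K μ : ℝ) (hμ : 0 < μ) : ∃ K' : ℝ, 0 < K' ∧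
    ∀ (A B : ℝ) (g g1 g2 g3 : ℝ → ℝ), Cls A B K μ g g1 g2 g3 →
    ∀ u w, u ∈ Icc A B → w ∈ Icc A B → u ≤ w → (∀ v ∈ Ioo u w, g1 v ≠ 0) →
      g1 u * g1 w * (w - u) ^ 2 ≤ (1 + K' * (w - u) ^ 2) * (g w - g u) ^ 2 := by
  obtain ⟨c, K3, hc, hK3, hS⟩ := Cls.schwarz_bound K μ hμ
  set ω := K3 / 2 with hω
  have hω0 : 0 < ω := by positivity
  set ρ := 1 / √ω with hρ
  have hρ0 : 0 < ρ := by positivity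
  obtain ⟨c2, hc2, hL⟩ := Cls.long_image K μ hμ ρ hρ0
  refine ⟨max ω (K ^ 2 / c2 ^ 2), lt_max_of_lt_left hω0, ?_⟩
  set K' := max ω (K ^ 2 / c2 ^ 2)
  intro A B g g1 g2 g3
  suffices H : ∀ (g g1 g2 g3 : ℝ → ℝ), Cls A B K μ g g1 g2 g3 →
    ∀ u w, u ∈ Icc A B → w ∈ Icc A B → u ≤ w → (∀ v ∈ Ioo u w, 0 < g1 v) →
      g1 u * g1 w * (w - u) ^ 2 ≤ (1 + K' * (w - u) ^ 2) * (g w - g u) ^ 2 by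
    intro h u w hu hw huw hne
    rcases sign_of_ne h.cont1 hne with hp | hp
    · exact H g g1 g2 g3 h u w hu hw huw hp
    · have := H _ _ _ _ h.neg u w hu hw huw (fun v hv => by simpa using hp v hv)
      have e : (-g w - -g u) ^ 2 = (g w - g u) ^ 2 := by ring
      rw [e] at this
      simpa using this
  clear g g1 g2 g3
  intro g g1 g2 g3 h u w hu hw huw hp
  have hRnn : 0 ≤ (1 + K' * (w - u) ^ 2) * (g w - g u) ^ 2 := by
    have : 0 ≤ K' := hω0.le.trans (le_max_left _ _)
    positivity
  rcases huw.eq_or_lt with rfl | huw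
  · simp
  by_cases hlong : ρ ≤ w - u
  · have hΔ := hL A B g g1 g2 g3 h u w hu hw hlong (fun v hv => (hp v hv).ne')
    have e1 : g1 u * g1 w ≤ K ^ 2 := by
      calc g1 u * g1 w ≤ |g1 u * g1 w| := le_abs_self _
        _ = |g1 u| * |g1 w| := abs_mul _ _
        _ ≤ K * K := mul_le_mul (h.b1 u hu) (h.b1 w hw) (abs_nonneg _)
            ((abs_nonneg _).trans (h.b1 u hu))
        _ = K ^ 2 := by ring
    have e2 : c2 ^ 2 ≤ (g w - g u) ^ 2 := by rw [← sq_abs (g w - g u)]; gcongr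
    calc g1 u * g1 w * (w - u) ^ 2 ≤ K ^ 2 * (w - u) ^ 2 := by gcongr
      _ = K ^ 2 / c2 ^ 2 * (w - u) ^ 2 * c2 ^ 2 := by field_simp
      _ ≤ K' * (w - u) ^ 2 * (g w - g u) ^ 2 := by
          gcongr; exact le_max_right _ _
      _ ≤ _ := by nlinarith [sq_nonneg (g w - g u)]
  · push Not at hlong
    have hcl : ∀ v ∈ Icc u w, 0 ≤ g1 v := by
      intro v hv
      have hcl : closure (Ioo u w) = Icc u w := closure_Ioo huw.ne
      exact closure_minimal (fun v hv => (hp v hv).le) (isClosed_le continuous_const h.cont1)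
        (hcl ▸ hv)
    rcases (hcl u (left_mem_Icc.2 huw.le)).eq_or_lt with h0 | hu0
    · rw [← h0]; simpa using hRnn
    rcases (hcl w (right_mem_Icc.2 huw.le)).eq_or_lt with h0 | hw0
    · rw [← h0]; simpa using hRnn
    have hp' : ∀ v ∈ Icc u w, 0 < g1 v := by
      intro v hv
      rcases hv.1.eq_or_lt with rfl | h1
      · exact hu0
      rcases hv.2.eq_or_lt with rfl | h2
      · exact hw0
      exact hp v ⟨h1, h2⟩
    have hsh : ω * (w - u) ^ 2 ≤ 1 := by
      have : (w - u) ^ 2 ≤ ρ ^ 2 := by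
        have : 0 ≤ w - u := by linarith
        gcongr
      have e : ω * ρ ^ 2 = 1 := by
        rw [hρ, div_pow, Real.sq_sqrt hω0.le]; field_simp
      nlinarith
    have := sturm_short huw h.d0 h.d1 h.d2 hp' (ω := ω) (fun v hv => by
      have := hS A B g g1 g2 g3 h v (Icc_subset_Icc hu.1 hw.2 hv)
      have e : 2 * ω = K3 := by rw [hω]; ring
      rw [e]; linarith) hω0.le hsh
    refine this.trans ?_
    gcongr; exact le_max_left _ _

/-- Four points in increasing or decreasing order. -/
def Ord4 (p0 p1 p2 p3 : ℝ) : Prop := (p0 < p1 ∧ p1 < p2 ∧ p2 < p3) ∨ (p3 < p2 ∧ p2 < p1 ∧ p1 < p0)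

/-- The cross-ratio of four points. -/
noncomputable def cr4 (p0 p1 p2 p3 : ℝ) : ℝ := (p2 - p0) * (p3 - p1) / ((p3 - p0) * (p2 - p1))

/-- Sum of the inverse distances of `x` to two points. -/
noncomputable def invd (l x r : ℝ) : ℝ := 1 / |x - l| + 1 / |r - x|

lemma invd_comm (l x r : ℝ) : invd l x r = invd r x l := by
  unfold invd; rw [abs_sub_comm x l, abs_sub_comm r x, add_comm]

lemma cr4_rev (p0 p1 p2 p3 : ℝ) : cr4 p3 p2 p1 p0 = cr4 p0 p1 p2 p3 := by
  unfold cr4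
  have e1 : (p1 - p3) * (p0 - p2) = (p2 - p0) * (p3 - p1) := by ring
  have e2 : (p0 - p3) * (p1 - p2) = (p3 - p0) * (p2 - p1) := by ring
  rw [e1, e2]

lemma cr4_neg (p0 p1 p2 p3 : ℝ) : cr4 (-p0) (-p1) (-p2) (-p3) = cr4 p0 p1 p2 p3 := by
  unfold cr4
  have e1 : (-p2 - -p0) * (-p3 - -p1) = (p2 - p0) * (p3 - p1) := by ring
  have e2 : (-p3 - -p0) * (-p2 - -p1) = (p3 - p0) * (p2 - p1) := by ring
  rw [e1, e2]

lemma invd_neg (l x r : ℝ) : invd (-l) (-x) (-r) = invd l x r := by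
  unfold invd
  have e1 : -x - -l = -(x - l) := by ring
  have e2 : -r - -x = -(r - x) := by ring
  rw [e1, e2, abs_neg, abs_neg]

/-- The basic inequality from which all distortion estimates are deduced. -/
def Sturm (A B K' : ℝ) (g g1 : ℝ → ℝ) : Prop :=
  (∀ x, HasDerivAt g (g1 x) x) ∧ Continuous g1 ∧ 0 < K' ∧
    ∀ u w, u ∈ Icc A B → w ∈ Icc A B → u ≤ w → (∀ v ∈ Ioo u w, g1 v ≠ 0) →
      g1 u * g1 w * (w - u) ^ 2 ≤ (1 + K' * (w - u) ^ 2) * (g w - g u) ^ 2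

namespace Sturm

variable {A B K' : ℝ} {g g1 : ℝ → ℝ}

lemma neg (h : Sturm A B K' g g1) : Sturm A B K' (fun x => -g x) (fun x => -g1 x) := by
  refine ⟨fun x => (h.1 x).neg, h.2.1.neg, h.2.2.1, fun u w hu hw huw hne => ?_⟩
  have := h.2.2.2 u w hu hw huw (fun v hv => by simpa using hne v hv)
  have e : (-g w - -g u) ^ 2 = (g w - g u) ^ 2 := by ring
  rw [e]; simpa using this

lemma cont (h : Sturm A B K' g g1) : Continuous g :=
  continuous_iff_continuousAt.2 fun x => (h.1 x).continuousAt

lemma mono (h : Sturm A B K' g g1) {u w : ℝ} (hp : ∀ v ∈ Ioo u w, 0 < g1 v) :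
    StrictMonoOn g (Icc u w) :=
  strictMonoOn_of_deriv_pos (convex_Icc _ _) h.cont.continuousOn fun x hx => by
    rw [(h.1 x).deriv]; exact hp x (by rwa [interior_Icc] at hx)

lemma two_point (h : Sturm A B K' g g1) {u w : ℝ} (hu : u ∈ Icc A B) (hw : w ∈ Icc A B)
    (hne : ∀ v ∈ uIoo u w, g1 v ≠ 0) :
    |g1 u| * |g1 w| * (w - u) ^ 2 ≤ Real.exp (K' * (w - u) ^ 2) * (g w - g u) ^ 2 := by
  wlog huw : u ≤ w generalizing u w
  · have := this hw hu (by rwa [uIoo_comm]) (le_of_not_ge huw)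
    have e1 : (w - u) ^ 2 = (u - w) ^ 2 := by ring
    have e2 : (g w - g u) ^ 2 = (g u - g w) ^ 2 := by ring
    rw [e1, e2, mul_comm (|g1 u|)]; exact this
  rw [uIoo_of_le huw] at hne
  have h1 := h.2.2.2 u w hu hw huw hne
  rcases huw.eq_or_lt with rfl | hlt
  · simp
  have hnn : 0 ≤ g1 u * g1 w := by
    have hcl : closure (Ioo u w) = Icc u w := closure_Ioo hlt.ne
    have hu' := left_mem_Icc.2 huw
    have hw' := right_mem_Icc.2 huw
    rw [← hcl] at hu' hw'
    rcases sign_of_ne h.2.1 hne with hp | hp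
    · have : closure (Ioo u w) ⊆ {v | 0 ≤ g1 v} :=
        closure_minimal (fun v hv => (hp v hv).le) (isClosed_le continuous_const h.2.1)
      exact mul_nonneg (this hu') (this hw')
    · have : closure (Ioo u w) ⊆ {v | g1 v ≤ 0} :=
        closure_minimal (fun v hv => (hp v hv).le) (isClosed_le h.2.1 continuous_const)
      exact mul_nonneg_of_nonpos_of_nonpos (this hu') (this hw')
  rw [← abs_mul, abs_of_nonneg hnn]
  refine h1.trans ?_
  gcongr
  rw [add_comm]; exact Real.add_one_le_exp _

lemma cr4_le_aux (h : Sturm A B K' g g1) {p0 p1 p2 p3 : ℝ} (h0 : p0 ∈ Icc A B) (h3 : p3 ∈ Icc A B)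
    (h01 : p0 < p1) (h12 : p1 < p2) (h23 : p2 < p3) (hp : ∀ v ∈ Ioo p0 p3, 0 < g1 v) :
    cr4 (g p0) (g p1) (g p2) (g p3) ≤
      cr4 p0 p1 p2 p3 * Real.exp (K' * (|p1 - p0| * |p3 - p2|)) := by
  have hmono := h.mono hp
  have hlt : ∀ s t, p0 ≤ s → s < t → t ≤ p3 → g s < g t := fun s t hs hst ht =>
    hmono ⟨hs, hst.le.trans ht⟩ ⟨hs.trans hst.le, ht⟩ hst
  set k : ℝ → ℝ → ℝ := fun s t => g1 t / (g t - g s) - 1 / (t - s) with hk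
  set ψ : ℝ → ℝ → ℝ := fun s t => Real.log (g t - g s) - Real.log (t - s) with hψ
  have hk1 : ∀ t ∈ Icc p2 p3, k p1 t - k p0 t ≤ K' * (p1 - p0) := by
    intro t ht
    have hd : ∀ s ∈ Icc p0 p1, HasDerivAt (fun s => k s t)
        (g1 s * g1 t / (g t - g s) ^ 2 - 1 / (t - s) ^ 2) s := by
      intro s hs
      have hst : s < t := by linarith [hs.2, ht.1]
      have hg : g t - g s ≠ 0 := (sub_pos.2 (hlt s t hs.1 hst ht.2)).ne'
      have hts : t - s ≠ 0 := (sub_pos.2 hst).ne'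
      refine (((hasDerivAt_const s (g1 t)).div ((h.1 s).const_sub (g t)) hg).sub
        ((hasDerivAt_const s (1 : ℝ)).div ((hasDerivAt_id s).const_sub t) hts)).congr_deriv ?_
      simp; ring
    refine (convex_Icc p0 p1).image_sub_le_mul_sub_of_deriv_le (f := fun s => k s t)
      (fun s hs => (hd s hs).continuousAt.continuousWithinAt)
      (fun s hs => (hd s (interior_subset hs)).differentiableAt.differentiableWithinAt)
      (fun s hs => ?_) p0 ⟨le_rfl, h01.le⟩ p1 ⟨h01.le, le_rfl⟩ h01.le
    have hs := interior_subset hs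
    rw [(hd s hs).deriv]
    have hst : s < t := by linarith [hs.2, ht.1]
    have hg : 0 < g t - g s := sub_pos.2 (hlt s t hs.1 hst ht.2)
    have hts : 0 < t - s := sub_pos.2 hst
    have hsub : Icc p0 p3 ⊆ Icc A B := Icc_subset_Icc h0.1 h3.2
    have := h.2.2.2 s t (hsub ⟨hs.1, by linarith [ht.2]⟩) (hsub ⟨by linarith [hs.1], ht.2⟩) hst.le
      (fun v hv => (hp v ⟨by linarith [hs.1, hv.1], by linarith [hv.2, ht.2]⟩).ne')
    have e : g1 s * g1 t / (g t - g s) ^ 2 ≤ (1 + K' * (t - s) ^ 2) / (t - s) ^ 2 := by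
      rw [div_le_div_iff₀ (by positivity) (by positivity)]; exact this
    have e2 : (1 + K' * (t - s) ^ 2) / (t - s) ^ 2 = 1 / (t - s) ^ 2 + K' := by field_simp
    linarith
  have hψ1 : (ψ p1 p3 - ψ p0 p3) - (ψ p1 p2 - ψ p0 p2) ≤ K' * (p1 - p0) * (p3 - p2) := by
    have hd : ∀ t ∈ Icc p2 p3, HasDerivAt (fun t => ψ p1 t - ψ p0 t) (k p1 t - k p0 t) t := by
      intro t ht
      have a1 : g t - g p1 ≠ 0 := (sub_pos.2 (hlt p1 t h01.le (by linarith [ht.1]) ht.2)).ne'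
      have a0 : g t - g p0 ≠ 0 := (sub_pos.2 (hlt p0 t le_rfl (by linarith [ht.1]) ht.2)).ne'
      have b1 : t - p1 ≠ 0 := (show 0 < t - p1 by linarith [ht.1]).ne'
      have b0 : t - p0 ≠ 0 := (show 0 < t - p0 by linarith [ht.1]).ne'
      exact ((((h.1 t).sub_const _).log a1).sub (((hasDerivAt_id t).sub_const _).log b1)).sub
        ((((h.1 t).sub_const _).log a0).sub (((hasDerivAt_id t).sub_const _).log b0))
    exact (convex_Icc p2 p3).image_sub_le_mul_sub_of_deriv_le
      (fun s hs => (hd s hs).continuousAt.continuousWithinAt)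
      (fun s hs => (hd s (interior_subset hs)).differentiableAt.differentiableWithinAt)
      (fun s hs => by rw [(hd s (interior_subset hs)).deriv]; exact hk1 s (interior_subset hs))
      p2 ⟨le_rfl, h23.le⟩ p3 ⟨h23.le, le_rfl⟩ h23.le
  rw [abs_of_pos (sub_pos.2 h01), abs_of_pos (sub_pos.2 h23)]
  have g20 := sub_pos.2 (hlt p0 p2 le_rfl (h01.trans h12) h23.le)
  have g31 := sub_pos.2 (hlt p1 p3 h01.le (h12.trans h23) le_rfl)
  have g30 := sub_pos.2 (hlt p0 p3 le_rfl (h01.trans (h12.trans h23)) le_rfl)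
  have g21 := sub_pos.2 (hlt p1 p2 h01.le h12 h23.le)
  have q20 := sub_pos.2 (h01.trans h12)
  have q31 := sub_pos.2 (h12.trans h23)
  have q30 := sub_pos.2 (h01.trans (h12.trans h23))
  have q21 := sub_pos.2 h12
  have hl : Real.log (cr4 (g p0) (g p1) (g p2) (g p3)) ≤
      Real.log (cr4 p0 p1 p2 p3 * Real.exp (K' * ((p1 - p0) * (p3 - p2)))) := by
    unfold cr4
    rw [Real.log_mul (by positivity) (Real.exp_pos _).ne', Real.log_exp,
      Real.log_div (by positivity) (by positivity), Real.log_div (by positivity) (by positivity),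
      Real.log_mul g20.ne' g31.ne', Real.log_mul g30.ne' g21.ne',
      Real.log_mul q20.ne' q31.ne', Real.log_mul q30.ne' q21.ne']
    simp only [hψ] at hψ1
    linarith
  refine (Real.log_le_log_iff ?_ ?_).1 hl
  · unfold cr4; positivity
  · unfold cr4; positivity

lemma cr4_le (h : Sturm A B K' g g1) {p0 p1 p2 p3 : ℝ} (h0 : p0 ∈ Icc A B) (h3 : p3 ∈ Icc A B)
    (ho : Ord4 p0 p1 p2 p3) (hne : ∀ v ∈ uIoo p0 p3, g1 v ≠ 0) :
    cr4 (g p0) (g p1) (g p2) (g p3) ≤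
      cr4 p0 p1 p2 p3 * Real.exp (K' * (|p1 - p0| * |p3 - p2|)) := by
  wlog hlt : p0 < p3 generalizing p0 p1 p2 p3
  · have ho' : Ord4 p3 p2 p1 p0 := ho.symm
    have hlt' : p3 < p0 := by
      rcases ho with ⟨a, b, c⟩ | ⟨a, b, c⟩ <;> [exact absurd (by linarith) hlt; linarith]
    have := this h3 h0 ho' (by rwa [uIoo_comm]) hlt'
    rw [cr4_rev, cr4_rev p0, abs_sub_comm p2 p3, abs_sub_comm p0 p1, mul_comm (|p3 - p2|)] at this
    exact this
  rcases ho with ⟨a, b, c⟩ | ⟨a, b, c⟩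
  swap; · linarith
  rw [uIoo_of_le hlt.le] at hne
  rcases sign_of_ne h.2.1 hne with hp | hp
  · exact h.cr4_le_aux h0 h3 a b c hp
  · have := h.neg.cr4_le_aux h0 h3 a b c (fun v hv => by simpa using hp v hv)
    rwa [cr4_neg] at this

lemma three_point_aux (h : Sturm A B K' g g1) {l x r : ℝ} (hl : l ∈ Icc A B) (hr : r ∈ Icc A B)
    (hlx : l < x) (hxr : x < r) (hp : ∀ v ∈ Ioo l r, 0 < g1 v) :
    invd l x r ≤ Real.exp (K' * (|x - l| * |r - x|)) * |g1 x| * invd (g l) (g x) (g r) := by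
  have hmono := h.mono hp
  have hx0 : 0 < g1 x := hp x ⟨hlx, hxr⟩
  have hgl : 0 < g x - g l := sub_pos.2 (hmono ⟨le_rfl, (hlx.trans hxr).le⟩ ⟨hlx.le, hxr.le⟩ hlx)
  have hgr : 0 < g r - g x := sub_pos.2 (hmono ⟨hlx.le, hxr.le⟩ ⟨(hlx.trans hxr).le, le_rfl⟩ hxr)
  have ev : ∀ᶠ y in 𝓝[>] x, (g y - g l) * (g r - g x) / (g r - g l) ≤
      slope g x y * ((y - l) * (r - x) / (r - l) * Real.exp (K' * (|x - l| * |r - y|))) := by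
    filter_upwards [Ioo_mem_nhdsGT hxr] with y hy
    have h1 := h.cr4_le_aux hl hr hlx hy.1 hy.2 hp
    have hgy : 0 < g y - g x :=
      sub_pos.2 (hmono ⟨hlx.le, hxr.le⟩ ⟨by linarith [hy.1], hy.2.le⟩ hy.1)
    have hyx : 0 < y - x := sub_pos.2 hy.1
    have e1 : (g y - g l) * (g r - g x) / (g r - g l) = cr4 (g l) (g x) (g y) (g r) * (g y - g x) := by
      unfold cr4; have : g r - g l ≠ 0 := by linarith
      field_simp
    have e2 : slope g x y * ((y - l) * (r - x) / (r - l) * Real.exp (K' * (|x - l| * |r - y|)))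
      = cr4 l x y r * Real.exp (K' * (|x - l| * |r - y|)) * (g y - g x) := by
      unfold cr4; rw [slope_def_field]; have : r - l ≠ 0 := by linarith
      field_simp
    rw [e1, e2]; gcongr
  have hsl : Tendsto (slope g x) (𝓝[>] x) (𝓝 (g1 x)) :=
    (hasDerivAt_iff_tendsto_slope.1 (h.1 x)).mono_left
      (nhdsWithin_mono _ fun y hy => (ne_of_gt hy : y ≠ x))
  have t1 : Tendsto (fun y => (g y - g l) * (g r - g x) / (g r - g l)) (𝓝[>] x)
      (𝓝 ((g x - g l) * (g r - g x) / (g r - g l))) := by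
    refine Tendsto.mono_left ?_ nhdsWithin_le_nhds
    have : Continuous fun y => (g y - g l) * (g r - g x) / (g r - g l) := by
      have := h.cont; fun_prop
    exact this.tendsto x
  have t2 : Tendsto (fun y => (y - l) * (r - x) / (r - l) * Real.exp (K' * (|x - l| * |r - y|)))
      (𝓝[>] x) (𝓝 ((x - l) * (r - x) / (r - l) * Real.exp (K' * (|x - l| * |r - x|)))) := by
    refine Tendsto.mono_left ?_ nhdsWithin_le_nhds
    have : Continuous fun y => (y - l) * (r - x) / (r - l) * Real.exp (K' * (|x - l| * |r - y|)) := by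
      fun_prop
    exact this.tendsto x
  have := le_of_tendsto_of_tendsto t1 (hsl.mul t2) ev
  have hlx' := sub_pos.2 hlx
  have hxr' := sub_pos.2 hxr
  have i1 : invd l x r = (r - l) / ((x - l) * (r - x)) := by
    unfold invd; rw [abs_of_pos hlx', abs_of_pos hxr']; field_simp; ring
  have i2 : invd (g l) (g x) (g r) = (g r - g l) / ((g x - g l) * (g r - g x)) := by
    unfold invd; rw [abs_of_pos hgl, abs_of_pos hgr]; field_simp; ring
  rw [i1, i2, abs_of_pos hx0]
  have hrl : 0 < r - l := by linarith
  have hgrl : 0 < g r - g l := by linarith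
  rw [div_le_iff₀ hgrl] at this
  rw [div_le_iff₀ (by positivity), mul_div_assoc', div_mul_eq_mul_div, le_div_iff₀ (by positivity)]
  have e3 : g1 x * ((x - l) * (r - x) / (r - l) * Real.exp (K' * (|x - l| * |r - x|))) * (g r - g l)
    = (g1 x * ((x - l) * (r - x)) * Real.exp (K' * (|x - l| * |r - x|)) * (g r - g l)) / (r - l) := by
    field_simp
  rw [e3, le_div_iff₀ hrl] at this
  linarith

/-- Points `x` strictly between `l` and `r`. -/
lemma three_point (h : Sturm A B K' g g1) {l x r : ℝ} (hl : l ∈ Icc A B) (hr : r ∈ Icc A B)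
    (hx : x ∈ uIoo l r) (hne : ∀ v ∈ uIoo l r, g1 v ≠ 0) :
    invd l x r ≤ Real.exp (K' * (|x - l| * |r - x|)) * |g1 x| * invd (g l) (g x) (g r) := by
  wlog hlt : l < r generalizing l r
  · have hlt' : r ≤ l := le_of_not_gt hlt
    rcases hlt'.eq_or_lt with rfl | hlt'
    · simp at hx
    have := this hr hl (by rwa [uIoo_comm]) (by rwa [uIoo_comm]) hlt'
    rw [invd_comm, invd_comm (g l), abs_sub_comm x l, abs_sub_comm r x, mul_comm (|l - x|)]
    exact this
  rw [uIoo_of_le hlt.le] at hx hne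
  rcases sign_of_ne h.2.1 hne with hp | hp
  · exact h.three_point_aux hl hr hx.1 hx.2 hp
  · have := h.neg.three_point_aux hl hr hx.1 hx.2 (fun v hv => by simpa using hp v hv)
    rw [invd_neg, abs_neg] at this
    exact this

end Sturm

/-- `g^[m]` is a monotone branch between `u` and `w`, with orbit pieces inside `[A, B]`. -/
def Mon (A B : ℝ) (g g1 : ℝ → ℝ) (m : ℕ) (u w : ℝ) : Prop :=
  ∀ j < m, ∀ v ∈ uIcc u w, g^[j] v ∈ Icc A B ∧ (v ≠ u → v ≠ w → g1 (g^[j] v) ≠ 0)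

/-- The derivative of the `m`-th iterate. -/
noncomputable def Dm (g g1 : ℝ → ℝ) (m : ℕ) (x : ℝ) : ℝ := ∏ j ∈ Finset.range m, g1 (g^[j] x)

section Dm
variable {g g1 : ℝ → ℝ}

@[simp] lemma Dm_zero (x : ℝ) : Dm g g1 0 x = 1 := by simp [Dm]

lemma Dm_succ (m : ℕ) (x : ℝ) : Dm g g1 (m + 1) x = Dm g g1 m x * g1 (g^[m] x) := by
  simp [Dm, Finset.prod_range_succ]

lemma Dm_add (m k : ℕ) (x : ℝ) : Dm g g1 (m + k) x = Dm g g1 m x * Dm g g1 k (g^[m] x) := by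
  simp only [Dm, Finset.prod_range_add]
  congr 1
  refine Finset.prod_congr rfl fun j _ => ?_
  rw [add_comm m j, Function.iterate_add_apply]

lemma Dm_succ' (m : ℕ) (x : ℝ) : Dm g g1 (m + 1) x = g1 x * Dm g g1 m (g x) := by
  rw [add_comm, Dm_add]; simp [Dm]

lemma Dm_ne_zero {m : ℕ} {x : ℝ} (h : ∀ j < m, g1 (g^[j] x) ≠ 0) : Dm g g1 m x ≠ 0 :=
  Finset.prod_ne_zero_iff.2 fun j hj => h j (Finset.mem_range.1 hj)

lemma hasDerivAt_iterate (h : ∀ x, HasDerivAt g (g1 x) x) (m : ℕ) (x : ℝ) :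
    HasDerivAt (g^[m]) (Dm g g1 m x) x := by
  induction m with
  | zero => simpa using hasDerivAt_id x
  | succ m ih =>
    rw [Function.iterate_succ', Dm_succ, mul_comm]
    exact (h _).comp x ih

lemma continuous_Dm (h : Continuous g) (h1 : Continuous g1) (m : ℕ) : Continuous (Dm g g1 m) := by
  unfold Dm
  exact continuous_finsetProd _ fun j _ => h1.comp (h.iterate j)

end Dm

lemma mem_uIoo_iff {u w v : ℝ} : v ∈ uIoo u w ↔ v ∈ uIcc u w ∧ v ≠ u ∧ v ≠ w := by
  rcases le_total u w with h | h
  · rw [uIoo_of_le h, uIcc_of_le h]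
    constructor
    · intro hv; exact ⟨Ioo_subset_Icc_self hv, hv.1.ne', hv.2.ne⟩
    · rintro ⟨hv, h1, h2⟩; exact ⟨lt_of_le_of_ne hv.1 h1.symm, lt_of_le_of_ne hv.2 h2⟩
  · rw [uIoo_of_ge h, uIcc_of_ge h]
    constructor
    · intro hv; exact ⟨Ioo_subset_Icc_self hv, hv.2.ne, hv.1.ne'⟩
    · rintro ⟨hv, h1, h2⟩; exact ⟨lt_of_le_of_ne hv.1 h2.symm, lt_of_le_of_ne hv.2 h1⟩

lemma uIoo_subset_uIoo {u w u' w' : ℝ} (hu : u' ∈ uIcc u w) (hw : w' ∈ uIcc u w) :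
    uIoo u' w' ⊆ uIoo u w := by
  rw [mem_uIcc] at hu hw
  intro v hv
  simp only [uIoo, mem_Ioo, lt_sup_iff, inf_lt_iff] at hv ⊢
  rcases hv with ⟨h1 | h1, h2 | h2⟩ <;> rcases hu with ⟨a, b⟩ | ⟨a, b⟩ <;>
    rcases hw with ⟨c, d⟩ | ⟨c, d⟩ <;> constructor <;>
    first
      | (left; linarith)
      | (right; linarith)

namespace Mon

variable {A B K' : ℝ} {g g1 : ℝ → ℝ} {m k : ℕ} {u w u' w' x : ℝ}

lemma zero : Mon A B g g1 0 u w := fun j hj => absurd hj (Nat.not_lt_zero j)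

lemma symm (h : Mon A B g g1 m u w) : Mon A B g g1 m w u := fun j hj v hv =>
  ⟨(h j hj v (uIcc_comm w u ▸ hv)).1, fun a b => (h j hj v (uIcc_comm w u ▸ hv)).2 b a⟩

lemma le (h : Mon A B g g1 m u w) (hk : k ≤ m) : Mon A B g g1 k u w :=
  fun j hj => h j (hj.trans_le hk)

lemma sub (h : Mon A B g g1 m u w) (hu : u' ∈ uIcc u w) (hw : w' ∈ uIcc u w) :
    Mon A B g g1 m u' w' := fun j hj v hv => by
  refine ⟨(h j hj v (uIcc_subset_uIcc hu hw hv)).1, fun a b => ?_⟩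
  obtain ⟨c, d, e⟩ := mem_uIoo_iff.1 (uIoo_subset_uIoo hu hw (mem_uIoo_iff.2 ⟨hv, a, b⟩))
  exact (h j hj v c).2 d e

lemma ne (h : Mon A B g g1 m u w) {v : ℝ} (hv : v ∈ uIoo u w) {j : ℕ} (hj : j < m) :
    g1 (g^[j] v) ≠ 0 := by
  obtain ⟨c, d, e⟩ := mem_uIoo_iff.1 hv
  exact (h j hj v c).2 d e

/-- Branches glue at a regular point. -/
lemma concat (h1 : Mon A B g g1 m x u) (h2 : Mon A B g g1 m x w)
    (hx : ∀ j < m, g1 (g^[j] x) ≠ 0) (hxm : x ∈ uIcc u w) : Mon A B g g1 m u w := by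
  intro j hj v hv
  have : v ∈ uIcc x u ∨ v ∈ uIcc x w := by
    simp only [mem_uIcc] at *
    rcases le_total v x with h | h <;> rcases hv with ⟨a, b⟩ | ⟨a, b⟩ <;>
      rcases hxm with ⟨c, d⟩ | ⟨c, d⟩
    all_goals
      first
        | (left; left; constructor <;> linarith)
        | (left; right; constructor <;> linarith)
        | (right; left; constructor <;> linarith)
        | (right; right; constructor <;> linarith)
  by_cases hvx : v = x
  · subst hvx
    exact ⟨(h1 j hj v left_mem_uIcc).1, fun _ _ => hx j hj⟩
  rcases this with h | h
  · exact ⟨(h1 j hj v h).1, fun a b => (h1 j hj v h).2 hvx a⟩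
  · exact ⟨(h2 j hj v h).1, fun a b => (h2 j hj v h).2 hvx b⟩

lemma strict (hg : ∀ x, HasDerivAt g (g1 x) x) (hg1 : Continuous g1) (h : Mon A B g g1 m u w) :
    StrictMonoOn (g^[m]) (uIcc u w) ∨ StrictAntiOn (g^[m]) (uIcc u w) := by
  have hgc : Continuous g := continuous_iff_continuousAt.2 fun x => (hg x).continuousAt
  have hne : ∀ v ∈ uIoo u w, Dm g g1 m v ≠ 0 := fun v hv => Dm_ne_zero fun j hj => h.ne hv hj
  rcases uIoo_pos_or (continuous_Dm hgc hg1 m) hne with hp | hp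
  · left
    refine strictMonoOn_of_deriv_pos (convex_uIcc _ _) (hgc.iterate m).continuousOn fun v hv => ?_
    rw [(hasDerivAt_iterate hg m v).deriv]
    exact hp v (by rwa [uIcc, interior_Icc] at hv)
  · right
    refine strictAntiOn_of_deriv_neg (convex_uIcc _ _) (hgc.iterate m).continuousOn fun v hv => ?_
    rw [(hasDerivAt_iterate hg m v).deriv]
    exact hp v (by rwa [uIcc, interior_Icc] at hv)

lemma injOn (hg : ∀ x, HasDerivAt g (g1 x) x) (hg1 : Continuous g1) (h : Mon A B g g1 m u w) :
    InjOn (g^[m]) (uIcc u w) :=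
  (h.strict hg hg1).elim (fun h => h.injOn) (fun h => h.injOn)

lemma mem (hg : ∀ x, HasDerivAt g (g1 x) x) (hg1 : Continuous g1) (h : Mon A B g g1 m u w) {v : ℝ}
    (hv : v ∈ uIcc u w) : g^[m] v ∈ uIcc (g^[m] u) (g^[m] w) := by
  rcases h.strict hg hg1 with h | h
  · exact h.monotoneOn.mapsTo_uIcc hv
  · exact h.antitoneOn.mapsTo_uIcc hv

lemma mem' (hg : ∀ x, HasDerivAt g (g1 x) x) (hg1 : Continuous g1) (h : Mon A B g g1 m u w) {v : ℝ}
    (hv : v ∈ uIoo u w) : g^[m] v ∈ uIoo (g^[m] u) (g^[m] w) := by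
  obtain ⟨c, d, e⟩ := mem_uIoo_iff.1 hv
  refine mem_uIoo_iff.2 ⟨h.mem hg hg1 c, fun H => d ?_, fun H => e ?_⟩
  · exact h.injOn hg hg1 c left_mem_uIcc H
  · exact h.injOn hg hg1 c right_mem_uIcc H

lemma surj (hg : ∀ x, HasDerivAt g (g1 x) x) (m : ℕ) {y : ℝ}
    (hy : y ∈ uIcc (g^[m] u) (g^[m] w)) : ∃ v ∈ uIcc u w, g^[m] v = y := by
  have hgc : Continuous g := continuous_iff_continuousAt.2 fun x => (hg x).continuousAt
  exact intermediate_value_uIcc (hgc.iterate m).continuousOn hy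

lemma step_ne (hg : ∀ x, HasDerivAt g (g1 x) x) (h : Mon A B g g1 m u w) {j : ℕ} (hj : j < m) :
    ∀ y ∈ uIoo (g^[j] u) (g^[j] w), g1 y ≠ 0 := by
  intro y hy
  obtain ⟨hc, hd, he⟩ := mem_uIoo_iff.1 hy
  obtain ⟨v, hv, rfl⟩ := surj hg j hc
  exact (h j hj v hv).2 (fun H => hd (by rw [H])) (fun H => he (by rw [H]))

/-- Splitting a branch into two successive branches. -/
lemma add_iff (hg : ∀ x, HasDerivAt g (g1 x) x) (hg1 : Continuous g1) :
    Mon A B g g1 (m + k) u w ↔ Mon A B g g1 m u w ∧ Mon A B g g1 k (g^[m] u) (g^[m] w) := by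
  constructor
  · intro h
    refine ⟨h.le (Nat.le_add_right _ _), fun j hj v hv => ?_⟩
    obtain ⟨y, hy, rfl⟩ := surj hg m hv
    rw [← Function.iterate_add_apply]
    have := h (j + m) (by omega) y hy
    exact ⟨this.1, fun a b => this.2 (fun H => a (by rw [H])) (fun H => b (by rw [H]))⟩
  · rintro ⟨h1, h2⟩ j hj v hv
    by_cases hjm : j < m
    · exact h1 j hjm v hv
    · obtain ⟨i, rfl⟩ := Nat.exists_eq_add_of_le (not_lt.1 hjm)
      rw [add_comm m i, Function.iterate_add_apply]
      have := h2 i (by omega) _ (h1.mem hg hg1 hv)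
      refine ⟨this.1, fun a b => this.2 (fun H => a ?_) (fun H => b ?_)⟩
      · exact h1.injOn hg hg1 hv left_mem_uIcc H
      · exact h1.injOn hg hg1 hv right_mem_uIcc H

lemma ord4 (hg : ∀ x, HasDerivAt g (g1 x) x) (hg1 : Continuous g1) {p0 p1 p2 p3 : ℝ}
    (h : Mon A B g g1 m p0 p3) (ho : Ord4 p0 p1 p2 p3) :
    Ord4 (g^[m] p0) (g^[m] p1) (g^[m] p2) (g^[m] p3) := by
  have h1 : p1 ∈ uIcc p0 p3 := by
    rw [mem_uIcc]; rcases ho with ⟨a, b, c⟩ | ⟨a, b, c⟩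
    · left; constructor <;> linarith
    · right; constructor <;> linarith
  have h2 : p2 ∈ uIcc p0 p3 := by
    rw [mem_uIcc]; rcases ho with ⟨a, b, c⟩ | ⟨a, b, c⟩
    · left; constructor <;> linarith
    · right; constructor <;> linarith
  have h0 : p0 ∈ uIcc p0 p3 := left_mem_uIcc
  have h3 : p3 ∈ uIcc p0 p3 := right_mem_uIcc
  rcases h.strict hg hg1 with hs | hs <;> rcases ho with ⟨a, b, c⟩ | ⟨a, b, c⟩
  · exact Or.inl ⟨hs h0 h1 a, hs h1 h2 b, hs h2 h3 c⟩
  · exact Or.inr ⟨hs h3 h2 a, hs h2 h1 b, hs h1 h0 c⟩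
  · exact Or.inr ⟨hs h2 h3 c, hs h1 h2 b, hs h0 h1 a⟩
  · exact Or.inl ⟨hs h1 h0 c, hs h2 h1 b, hs h3 h2 a⟩

lemma cr4_le (hS : Sturm A B K' g g1) {p0 p1 p2 p3 : ℝ}
    (h : Mon A B g g1 m p0 p3) (ho : Ord4 p0 p1 p2 p3) :
    cr4 (g^[m] p0) (g^[m] p1) (g^[m] p2) (g^[m] p3) ≤ cr4 p0 p1 p2 p3 *
      Real.exp (K' * ∑ j ∈ Finset.range m, |g^[j] p1 - g^[j] p0| * |g^[j] p3 - g^[j] p2|) := by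
  induction m with
  | zero => simp
  | succ m ih =>
    have hm := h.le (Nat.le_succ m)
    rw [Finset.sum_range_succ, mul_add, Real.exp_add, ← mul_assoc]
    simp only [Function.iterate_succ_apply']
    refine (hS.cr4_le (h m (Nat.lt_succ_self m) p0 left_mem_uIcc).1
      (h m (Nat.lt_succ_self m) p3 right_mem_uIcc).1 (hm.ord4 hS.1 hS.2.1 ho)
      (h.step_ne hS.1 (Nat.lt_succ_self m))).trans ?_
    gcongr
    exact ih hm

lemma two_point (hS : Sturm A B K' g g1) (h : Mon A B g g1 m u w) :
    |Dm g g1 m u| * |Dm g g1 m w| * (w - u) ^ 2 ≤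
      Real.exp (K' * ∑ j ∈ Finset.range m, (g^[j] w - g^[j] u) ^ 2) * (g^[m] w - g^[m] u) ^ 2 := by
  induction m with
  | zero => simp
  | succ m ih =>
    have hm := h.le (Nat.le_succ m)
    have h1 := hS.two_point (h m (Nat.lt_succ_self m) u left_mem_uIcc).1
      (h m (Nat.lt_succ_self m) w right_mem_uIcc).1 (h.step_ne hS.1 (Nat.lt_succ_self m))
    have h2 := ih hm
    rw [Finset.sum_range_succ, mul_add, Real.exp_add]
    simp only [Function.iterate_succ_apply', Dm_succ, abs_mul]
    set E1 := Real.exp (K' * ∑ j ∈ Finset.range m, (g^[j] w - g^[j] u) ^ 2)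
    set E2 := Real.exp (K' * (g^[m] w - g^[m] u) ^ 2)
    calc |Dm g g1 m u| * |g1 (g^[m] u)| * (|Dm g g1 m w| * |g1 (g^[m] w)|) * (w - u) ^ 2
        = |g1 (g^[m] u)| * |g1 (g^[m] w)| * (|Dm g g1 m u| * |Dm g g1 m w| * (w - u) ^ 2) := by ring
      _ ≤ |g1 (g^[m] u)| * |g1 (g^[m] w)| * (E1 * (g^[m] w - g^[m] u) ^ 2) := by gcongr
      _ = E1 * (|g1 (g^[m] u)| * |g1 (g^[m] w)| * (g^[m] w - g^[m] u) ^ 2) := by ring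
      _ ≤ E1 * (E2 * (g (g^[m] w) - g (g^[m] u)) ^ 2) := by
          have : 0 ≤ E1 := (Real.exp_pos _).le
          gcongr
      _ = _ := by ring

lemma three_point (hS : Sturm A B K' g g1) {l r : ℝ} (h : Mon A B g g1 m l r) (hx : x ∈ uIoo l r) :
    invd l x r ≤
      Real.exp (K' * ∑ j ∈ Finset.range m, |g^[j] x - g^[j] l| * |g^[j] r - g^[j] x|) *
      |Dm g g1 m x| * invd (g^[m] l) (g^[m] x) (g^[m] r) := by
  induction m with
  | zero => simp
  | succ m ih =>
    have hm := h.le (Nat.le_succ m)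
    have h1 := hS.three_point (h m (Nat.lt_succ_self m) l left_mem_uIcc).1
      (h m (Nat.lt_succ_self m) r right_mem_uIcc).1 (hm.mem' hS.1 hS.2.1 hx)
      (h.step_ne hS.1 (Nat.lt_succ_self m))
    have h2 := ih hm
    rw [Finset.sum_range_succ, mul_add, Real.exp_add]
    simp only [Function.iterate_succ_apply', Dm_succ, abs_mul]
    refine h2.trans ?_
    set E1 := Real.exp (K' * ∑ j ∈ Finset.range m, |g^[j] x - g^[j] l| * |g^[j] r - g^[j] x|)
    set E2 := Real.exp (K' * (|g^[m] x - g^[m] l| * |g^[m] r - g^[m] x|))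
    calc E1 * |Dm g g1 m x| * invd (g^[m] l) (g^[m] x) (g^[m] r)
        ≤ E1 * |Dm g g1 m x| * (E2 * |g1 (g^[m] x)| *
          invd (g (g^[m] l)) (g (g^[m] x)) (g (g^[m] r))) := by
          have : 0 ≤ E1 := (Real.exp_pos _).le
          gcongr
      _ = _ := by ring

end Mon

/-- Obstructions to pulling back: critical points and the endpoints of `[A, B]`. -/
def Gam (A B : ℝ) (g1 : ℝ → ℝ) (e : ℝ) : Prop := e ∈ Icc A B ∧ (g1 e = 0 ∨ e = A ∨ e = B)

lemma reach_right {φ φ1 : ℝ → ℝ} {z B y' : ℝ} (hd : ∀ x, HasDerivAt φ (φ1 x) x)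
    (hc : Continuous φ1) (hzB : z < B) (hz : 0 < φ1 z) (hy : φ z ≤ y') :
    ∃ e ∈ Icc z B, (∀ v ∈ Ico z e, 0 < φ1 v) ∧
      (φ e = y' ∨ ((φ1 e = 0 ∨ e = B) ∧ z < e ∧ φ e ≤ y')) := by
  set S : Set ℝ := {v | v ∈ Icc z B ∧ (φ1 v ≤ 0 ∨ v = B)} with hS
  have hSc : IsClosed S := isClosed_Icc.inter
    ((isClosed_le hc continuous_const).union (isClosed_singleton (x := B)))
  have hBS : B ∈ S := ⟨⟨hzB.le, le_rfl⟩, Or.inr rfl⟩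
  have hbdd : BddBelow S := ⟨z, fun v hv => hv.1.1⟩
  set e := sInf S with he
  have heS : e ∈ S := hSc.csInf_mem ⟨B, hBS⟩ hbdd
  have hpos : ∀ v ∈ Ico z e, 0 < φ1 v := by
    intro v hv
    by_contra hn
    push Not at hn
    have : e ≤ v := csInf_le hbdd ⟨⟨hv.1, (hv.2.le.trans heS.1.2)⟩, Or.inl hn⟩
    linarith [hv.2]
  have hze : z < e := by
    rcases heS.1.1.eq_or_lt with h | h
    · rcases heS.2 with h2 | h2
      · rw [← h] at h2; linarith
      · linarith
    · exact h
  by_cases hle : φ e ≤ y'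
  · refine ⟨e, heS.1, hpos, Or.inr ⟨?_, hze, hle⟩⟩
    rcases heS.2 with h2 | h2
    · left
      refine le_antisymm h2 ?_
      have hcl : closure (Ioo z e) = Icc z e := closure_Ioo hze.ne
      have : closure (Ioo z e) ⊆ {v | 0 ≤ φ1 v} :=
        closure_minimal (fun v hv => (hpos v ⟨hv.1.le, hv.2⟩).le) (isClosed_le continuous_const hc)
      exact this (hcl ▸ right_mem_Icc.2 hze.le)
    · exact Or.inr h2
  · push Not at hle
    have hcφ : Continuous φ := continuous_iff_continuousAt.2 fun x => (hd x).continuousAt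
    obtain ⟨y, hy1, hy2⟩ := intermediate_value_Icc hze.le hcφ.continuousOn ⟨hy, hle.le⟩
    exact ⟨y, ⟨hy1.1, hy1.2.trans heS.1.2⟩, fun v hv => hpos v ⟨hv.1, hv.2.trans_le hy1.2⟩,
      Or.inl hy2⟩

/-- Lifting a point through one iterate, or meeting an obstruction. -/
lemma reach {A B : ℝ} {g g1 : ℝ → ℝ} (hg : ∀ x, HasDerivAt g (g1 x) x) (hg1 : Continuous g1)
    {z y' : ℝ} (hz : z ∈ Ioo A B) (hz1 : g1 z ≠ 0) :
    ∃ e, Mon A B g g1 1 z e ∧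
      (g e = y' ∨ (Gam A B g1 e ∧ e ≠ z ∧ g e ∈ uIcc (g z) y')) := by
  have right : ∀ e ∈ Icc z B, (∀ v ∈ Ico z e, g1 v ≠ 0) → Mon A B g g1 1 z e := by
    intro e he h j hj v hv
    obtain rfl : j = 0 := by omega
    rw [uIcc_of_le he.1] at hv
    simp only [Function.iterate_zero, id]
    exact ⟨⟨by linarith [hz.1, hv.1], hv.2.trans he.2⟩, fun _ hve => h v ⟨hv.1, lt_of_le_of_ne hv.2 hve⟩⟩
  have left : ∀ e ∈ Icc A z, (∀ v ∈ Ioc e z, g1 v ≠ 0) → Mon A B g g1 1 z e := by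
    intro e he h j hj v hv
    obtain rfl : j = 0 := by omega
    rw [uIcc_of_ge he.2] at hv
    simp only [Function.iterate_zero, id]
    exact ⟨⟨he.1.trans hv.1, by linarith [hz.2, hv.2]⟩,
      fun _ hve => h v ⟨lt_of_le_of_ne hv.1 (Ne.symm hve), hv.2⟩⟩
  have hdn : ∀ x, HasDerivAt (fun x => -g x) (-g1 x) x := fun x => (hg x).neg
  have hdr : ∀ x, HasDerivAt (fun x => g (-x)) (-g1 (-x)) x := fun x =>
    (HasDerivAt.comp x (hg (-x)) (hasDerivAt_neg x)).congr_deriv (by ring)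
  have hdrn : ∀ x, HasDerivAt (fun x => -g (-x)) (g1 (-x)) x := fun x =>
    (hdr x).neg.congr_deriv (by ring)
  have hneg : Continuous fun x => g1 (-x) := hg1.comp continuous_neg
  rcases lt_or_gt_of_ne hz1 with hs | hs <;> rcases le_total (g z) y' with hy | hy
  · obtain ⟨e, he, hp, hc⟩ := reach_right (z := -z) (B := -A) (y' := y') hdr hneg.neg
      (by linarith [hz.1]) (by simpa using hs) (by simpa using hy)
    refine ⟨-e, left _ ⟨by linarith [he.2], by linarith [he.1]⟩ fun v hv => ?_, ?_⟩
    · have := hp (-v) ⟨by linarith [hv.2], by linarith [hv.1]⟩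
      simp at this; exact this.ne
    · rcases hc with h | ⟨h1, h2, h3⟩
      · exact Or.inl h
      · refine Or.inr ⟨⟨⟨by linarith [he.2], by linarith [he.1, hz.2]⟩, ?_⟩, (show -e < z by linarith).ne, ?_⟩
        · rcases h1 with h1 | h1
          · left; simpa using h1
          · right; left; linarith
        · rw [uIcc_of_le hy]
          refine ⟨?_, h3⟩
          have hm : StrictMonoOn (fun x => g (-x)) (Icc (-z) e) :=
            strictMonoOn_of_deriv_pos (convex_Icc _ _)
              (fun x _ => (hdr x).continuousAt.continuousWithinAt) fun x hx => by
                rw [interior_Icc] at hx; rw [(hdr x).deriv]; exact hp x ⟨hx.1.le, hx.2⟩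
          have := hm.monotoneOn (left_mem_Icc.2 h2.le) (right_mem_Icc.2 h2.le) h2.le
          simpa using this
  · obtain ⟨e, he, hp, hc⟩ := reach_right (z := z) (B := B) (y' := -y') hdn hg1.neg
      hz.2 (by simpa using hs) (by simpa using hy)
    refine ⟨e, right _ he fun v hv => ?_, ?_⟩
    · have := hp v hv
      simp at this; exact this.ne
    · rcases hc with h | ⟨h1, h2, h3⟩
      · exact Or.inl (by linarith)
      · refine Or.inr ⟨⟨⟨by linarith [he.1, hz.1], he.2⟩, ?_⟩, h2.ne', ?_⟩
        · rcases h1 with h1 | h1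
          · left; simpa using h1
          · right; right; exact h1
        · rw [uIcc_of_ge hy]
          refine ⟨by linarith, ?_⟩
          have hm : StrictMonoOn (fun x => -g x) (Icc z e) :=
            strictMonoOn_of_deriv_pos (convex_Icc _ _)
              (fun x _ => (hdn x).continuousAt.continuousWithinAt) fun x hx => by
                rw [interior_Icc] at hx; rw [(hdn x).deriv]; exact hp x ⟨hx.1.le, hx.2⟩
          have := hm.monotoneOn (left_mem_Icc.2 h2.le) (right_mem_Icc.2 h2.le) h2.le
          simpa using this
  · obtain ⟨e, he, hp, hc⟩ := reach_right (z := z) (B := B) (y' := y') hg hg1 hz.2 hs hy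
    refine ⟨e, right _ he fun v hv => (hp v hv).ne', ?_⟩
    rcases hc with h | ⟨h1, h2, h3⟩
    · exact Or.inl h
    · refine Or.inr ⟨⟨⟨by linarith [he.1, hz.1], he.2⟩, ?_⟩, h2.ne', ?_⟩
      · tauto
      · rw [uIcc_of_le hy]
        refine ⟨?_, h3⟩
        have hm : StrictMonoOn g (Icc z e) :=
          strictMonoOn_of_deriv_pos (convex_Icc _ _)
            (fun x _ => (hg x).continuousAt.continuousWithinAt) fun x hx => by
              rw [interior_Icc] at hx; rw [(hg x).deriv]; exact hp x ⟨hx.1.le, hx.2⟩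
        exact hm.monotoneOn (left_mem_Icc.2 h2.le) (right_mem_Icc.2 h2.le) h2.le
  · obtain ⟨e, he, hp, hc⟩ := reach_right (z := -z) (B := -A) (y' := -y') hdrn hneg
      (by linarith [hz.1]) (by simpa using hs) (by simpa using hy)
    refine ⟨-e, left _ ⟨by linarith [he.2], by linarith [he.1]⟩ fun v hv => ?_, ?_⟩
    · have := hp (-v) ⟨by linarith [hv.2], by linarith [hv.1]⟩
      simp at this; exact this.ne'
    · rcases hc with h | ⟨h1, h2, h3⟩
      · exact Or.inl (by linarith)
      · refine Or.inr ⟨⟨⟨by linarith [he.2], by linarith [he.1, hz.2]⟩, ?_⟩, (show -e < z by linarith).ne, ?_⟩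
        · rcases h1 with h1 | h1
          · left; simpa using h1
          · right; left; linarith
        · rw [uIcc_of_ge hy]
          refine ⟨by linarith, ?_⟩
          have hm : StrictMonoOn (fun x => -g (-x)) (Icc (-z) e) :=
            strictMonoOn_of_deriv_pos (convex_Icc _ _)
              (fun x _ => (hdrn x).continuousAt.continuousWithinAt) fun x hx => by
                rw [interior_Icc] at hx; rw [(hdrn x).deriv]; exact hp x ⟨hx.1.le, hx.2⟩
          have := hm.monotoneOn (left_mem_Icc.2 h2.le) (right_mem_Icc.2 h2.le) h2.le
          simpa using this

section Hits

variable {A B : ℝ} {g g1 : ℝ → ℝ}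

/-- An obstruction cannot lie inside a branch. -/
lemma Gam.not_mem {m : ℕ} {z y e : ℝ} (he : Gam A B g1 e) (h : Mon A B g g1 m z y) (hm : 0 < m) :
    e ∉ uIoo z y := by
  intro hmem
  have hz := (h 0 hm z left_mem_uIcc).1
  have hy := (h 0 hm y right_mem_uIcc).1
  simp only [Function.iterate_zero, id] at hz hy
  have h1 := h.ne hmem hm
  simp only [Function.iterate_zero, id] at h1
  have hlt : e ∈ Ioo A B := ⟨(le_min hz.1 hy.1).trans_lt hmem.1, hmem.2.trans_le (max_le hz.2 hy.2)⟩
  rcases he.2 with h2 | h2 | h2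
  · exact h1 h2
  · linarith [hlt.1]
  · linarith [hlt.2]

lemma Mon.same_sign (hg : ∀ x, HasDerivAt g (g1 x) x) (hg1 : Continuous g1) {m : ℕ} {z y : ℝ}
    (h : Mon A B g g1 m z y) (hz : ∀ j < m, g1 (g^[j] z) ≠ 0) (hyz : y ≠ z) :
    0 < (g^[m] y - g^[m] z) * (y - z) * Dm g g1 m z := by
  have hgc : Continuous g := continuous_iff_continuousAt.2 fun x => (hg x).continuousAt
  have hD := continuous_Dm hgc hg1 m
  have hpos : ∀ ξ ∈ uIoo z y, 0 < Dm g g1 m z * Dm g g1 m ξ := by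
    intro ξ hξ
    by_contra hn
    push Not at hn
    have h0 : (0 : ℝ) ∈ uIcc (Dm g g1 m z) (Dm g g1 m ξ) := by
      rw [mem_uIcc]
      rcases mul_nonpos_iff.1 hn with h | h
      · right; exact ⟨h.2, h.1⟩
      · left; exact h
    obtain ⟨v, hv, hv0⟩ := intermediate_value_uIcc hD.continuousOn h0
    refine Dm_ne_zero (fun j hj => ?_) hv0
    by_cases hvz : v = z
    · rw [hvz]; exact hz j hj
    · refine h.ne (mem_uIoo_iff.2 ⟨?_, hvz, ?_⟩) hj
      · exact uIcc_subset_uIcc left_mem_uIcc (Ioo_subset_Icc_self hξ) hv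
      · rintro rfl
        obtain ⟨a, b, c⟩ := mem_uIoo_iff.1 hξ
        rw [mem_uIcc] at a hv
        rcases a with a | a <;> rcases hv with hv | hv
        · exact c (by linarith)
        · exact hvz (by linarith)
        · exact hvz (by linarith)
        · exact c (by linarith)
  have : ∃ ξ ∈ uIoo z y, g^[m] y - g^[m] z = Dm g g1 m ξ * (y - z) := by
    rcases lt_or_gt_of_ne hyz with hlt | hlt
    · obtain ⟨ξ, hξ, h2⟩ := exists_hasDerivAt_eq_slope (g^[m]) (Dm g g1 m) hlt
        (hgc.iterate m).continuousOn (fun x _ => hasDerivAt_iterate hg m x)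
      refine ⟨ξ, by rwa [uIoo_of_ge hlt.le], ?_⟩
      have : z - y ≠ 0 := by linarith
      rw [h2]; field_simp; ring
    · obtain ⟨ξ, hξ, h2⟩ := exists_hasDerivAt_eq_slope (g^[m]) (Dm g g1 m) hlt
        (hgc.iterate m).continuousOn (fun x _ => hasDerivAt_iterate hg m x)
      refine ⟨ξ, by rwa [uIoo_of_le (le_of_lt hlt)], ?_⟩
      have : y - z ≠ 0 := by linarith
      rw [h2]; field_simp
  obtain ⟨ξ, hξ, e⟩ := this
  rw [e]
  have h1 := hpos ξ hξ
  have h2 : 0 < (y - z) ^ 2 := by positivity [sub_ne_zero.2 hyz]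
  nlinarith [mul_pos h1 h2]

/-- Lifts on the same side are ordered like their images. -/
lemma Mon.compare (hg : ∀ x, HasDerivAt g (g1 x) x) (hg1 : Continuous g1) {m : ℕ} {z y y' σ s s' : ℝ}
    (h : Mon A B g g1 m z y) (h' : Mon A B g g1 m z y') (hz : ∀ j < m, g1 (g^[j] z) ≠ 0)
    (hσ : σ = 1 ∨ σ = -1) (hy : g^[m] y = g^[m] z + σ * s) (hy' : g^[m] y' = g^[m] z + σ * s')
    (hs : 0 ≤ s) (hss : s ≤ s') : y ∈ uIcc z y' := by
  by_cases hyz : y = z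
  · rw [hyz]; exact left_mem_uIcc
  have hσ2 : σ * σ = 1 := by rcases hσ with rfl | rfl <;> norm_num
  have hσ0 : σ ≠ 0 := by rintro rfl; simp at hσ2
  have hs0 : 0 < s := by
    rcases hs.eq_or_lt with h0 | h0
    · exfalso; apply hyz
      refine h.injOn hg hg1 right_mem_uIcc left_mem_uIcc ?_
      rw [hy, ← h0]; ring
    · exact h0
  have hyz' : y' ≠ z := by
    rintro rfl
    have : σ * s' = 0 := by linarith
    rcases mul_eq_zero.1 this with h | h
    · exact hσ0 h
    · linarith
  have p1 := h.same_sign hg hg1 hz hyz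
  have p2 := h'.same_sign hg hg1 hz hyz'
  rw [hy] at p1; rw [hy'] at p2
  have hsame : 0 < (y - z) * (y' - z) := by
    have := mul_pos p1 p2
    have e : (g^[m] z + σ * s - g^[m] z) * (y - z) * Dm g g1 m z *
        ((g^[m] z + σ * s' - g^[m] z) * (y' - z) * Dm g g1 m z)
        = (σ * σ) * (s * s') * (Dm g g1 m z) ^ 2 * ((y - z) * (y' - z)) := by ring
    rw [e, hσ2] at this
    have hnn : 0 ≤ 1 * (s * s') * (Dm g g1 m z) ^ 2 := by
      have : 0 ≤ s' := hs.trans hss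
      positivity
    by_contra hn
    push Not at hn
    linarith [mul_nonpos_of_nonneg_of_nonpos hnn hn]
  have hor : y ∈ uIcc z y' ∨ y' ∈ uIcc z y := by
    simp only [mem_uIcc]
    rcases pos_and_pos_or_neg_and_neg_of_mul_pos hsame with ⟨a, b⟩ | ⟨a, b⟩ <;>
      rcases le_total y y' with c | c
    · left; left; constructor <;> linarith
    · right; left; constructor <;> linarith
    · right; right; constructor <;> linarith
    · left; right; constructor <;> linarith
  rcases hor with h1 | h1
  · exact h1
  · have := h.mem hg hg1 h1
    rw [hy, hy', mem_uIcc] at this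
    have hss' : s' = s := by
      refine le_antisymm ?_ hss
      rcases hσ with rfl | rfl <;> rcases this with t | t <;> linarith
    have : y' = y := h.injOn hg hg1 h1 right_mem_uIcc (by rw [hy, hy', hss'])
    rw [this]; exact right_mem_uIcc

/-- The point `w` at time `q` can be lifted to time `i` along the orbit of `z`. -/
def Free (A B : ℝ) (g g1 : ℝ → ℝ) (z : ℝ) (q i : ℕ) (w : ℝ) : Prop :=
  ∃ y, Mon A B g g1 (q - i) (g^[i] z) y ∧ g^[q - i] y = w

lemma iterate_sub_apply {q i : ℕ} (h : i ≤ q) (z : ℝ) : g^[q - i] (g^[i] z) = g^[q] z := by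
  rw [← Function.iterate_add_apply, Nat.sub_add_cancel h]

lemma Free.mono (hg : ∀ x, HasDerivAt g (g1 x) x) {z : ℝ} {q i : ℕ} {w w' : ℝ} (hi : i ≤ q)
    (h : Free A B g g1 z q i w) (hw : w' ∈ uIcc (g^[q] z) w) : Free A B g g1 z q i w' := by
  obtain ⟨y, hy, rfl⟩ := h
  rw [← iterate_sub_apply hi z] at hw
  obtain ⟨v, hv, hv2⟩ := Mon.surj hg _ hw
  exact ⟨v, hy.sub left_mem_uIcc hv, hv2⟩

lemma Free.later (hg : ∀ x, HasDerivAt g (g1 x) x) (hg1 : Continuous g1) {z : ℝ} {q i j : ℕ} {w : ℝ}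
    (hij : i ≤ j) (hj : j ≤ q) (h : Free A B g g1 z q i w) : Free A B g g1 z q j w := by
  obtain ⟨y, hy, rfl⟩ := h
  obtain ⟨k, rfl⟩ := Nat.exists_eq_add_of_le hij
  have e : q - i = k + (q - (i + k)) := by omega
  rw [e, Mon.add_iff hg hg1] at hy
  refine ⟨g^[k] y, ?_, ?_⟩
  · rw [add_comm i k, Function.iterate_add_apply, add_comm k i]; exact hy.2
  · rw [← Function.iterate_add_apply]; congr 1; omega

/-- A hit: an obstruction `e` seen from time `i`, whose image at time `q` is at distance `s`. -/
structure Hit (A B : ℝ) (g g1 : ℝ → ℝ) (z : ℝ) (q : ℕ) (σ : ℝ) (i : ℕ) (e s : ℝ) : Prop where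
  lt : i < q
  gam : Gam A B g1 e
  ne : e ≠ g^[i] z
  mon : Mon A B g g1 (q - i) (g^[i] z) e
  val : g^[q - i] e = g^[q] z + σ * s
  pos : 0 < s

lemma mem_uIcc_add {σ z l v : ℝ} (hσ : σ = 1 ∨ σ = -1) (hl : 0 ≤ l) :
    v ∈ uIcc z (z + σ * l) ↔ ∃ s, 0 ≤ s ∧ s ≤ l ∧ v = z + σ * s := by
  constructor
  · intro h
    rw [mem_uIcc] at h
    rcases hσ with rfl | rfl
    · refine ⟨v - z, ?_, ?_, by ring⟩ <;> rcases h with h | h <;> linarith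
    · refine ⟨z - v, ?_, ?_, by ring⟩ <;> rcases h with h | h <;> linarith
  · rintro ⟨s, h0, h1, rfl⟩
    rw [mem_uIcc]
    rcases hσ with rfl | rfl
    · left; constructor <;> linarith
    · right; constructor <;> linarith

lemma exists_hit (hg : ∀ x, HasDerivAt g (g1 x) x) (hg1 : Continuous g1) {z σ l : ℝ} {q i : ℕ}
    (hi : i < q) (hz : g^[i] z ∈ Ioo A B) (hz1 : ∀ j < q, g1 (g^[j] z) ≠ 0)
    (hσ : σ = 1 ∨ σ = -1) (hl : 0 ≤ l)
    (hn : ¬ Free A B g g1 z q i (g^[q] z + σ * l)) (hf : Free A B g g1 z q (i + 1) (g^[q] z + σ * l)) :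
    ∃ e s, Hit A B g g1 z q σ i e s ∧ s ≤ l := by
  obtain ⟨y', hy', hv⟩ := hf
  obtain ⟨e, he, hor⟩ := reach (A := A) (B := B) (y' := y') hg hg1 hz (hz1 i hi)
  have eq : q - i = 1 + (q - (i + 1)) := by omega
  have hzz : g^[i + 1] z = g (g^[i] z) := Function.iterate_succ_apply' _ _ _
  rcases hor with h | ⟨h1, h2, h3⟩
  · exfalso
    refine hn ⟨e, ?_, ?_⟩
    · rw [eq, Mon.add_iff hg hg1]
      refine ⟨he, ?_⟩
      rw [Function.iterate_one, h, ← hzz]; exact hy'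
    · rw [eq, add_comm, Function.iterate_add_apply, Function.iterate_one, h, hv]
  · have hm : Mon A B g g1 (q - i) (g^[i] z) e := by
      rw [eq, Mon.add_iff hg hg1]
      refine ⟨he, ?_⟩
      rw [Function.iterate_one, ← hzz]
      rw [← hzz] at h3
      exact hy'.sub left_mem_uIcc h3
    rw [← hzz] at h3
    have h4 := hy'.mem hg hg1 h3
    have e2 : g^[q - (i + 1)] (g e) = g^[q - i] e := by
      rw [← Function.iterate_succ_apply, show (q - (i + 1)).succ = q - i by omega]
    rw [e2, hv, iterate_sub_apply hi] at h4
    obtain ⟨s, hs0, hsl, hs⟩ := (mem_uIcc_add hσ hl).1 h4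
    refine ⟨e, s, ⟨hi, h1, h2, hm, hs, lt_of_le_of_ne hs0 ?_⟩, hsl⟩
    rintro rfl
    apply h2
    refine hm.injOn hg hg1 right_mem_uIcc left_mem_uIcc ?_
    rw [hs, iterate_sub_apply hi.le]; ring

/-- Hits lie beyond every liftable level. -/
lemma Hit.le_of_free (hg : ∀ x, HasDerivAt g (g1 x) x) (hg1 : Continuous g1) {z σ l e s : ℝ}
    {q i : ℕ} (hz1 : ∀ j < q, g1 (g^[j] z) ≠ 0) (hσ : σ = 1 ∨ σ = -1)
    (h : Hit A B g g1 z q σ i e s)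
    (hf : Free A B g g1 z q i (g^[q] z + σ * l)) : l ≤ s := by
  by_contra hlt
  push Not at hlt
  obtain ⟨y, hy, hv⟩ := hf
  have hzi : ∀ j < q - i, g1 (g^[j] (g^[i] z)) ≠ 0 := fun j hj => by
    rw [← Function.iterate_add_apply]; exact hz1 _ (by omega)
  have hval := h.val
  rw [← iterate_sub_apply h.lt.le z] at hval hv
  have := h.mon.compare hg hg1 hy hzi hσ hval hv h.pos.le hlt.le
  refine h.gam.not_mem hy (by have := h.lt; omega) (mem_uIoo_iff.2 ⟨this, h.ne, ?_⟩)
  rintro rfl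
  rw [hval] at hv
  rcases hσ with rfl | rfl <;> linarith

/-- The pullback alternative: going back from time `q` along increasing levels, either some hit
leaves the next level liftable, or hits occur at strictly increasing times. -/
lemma hits (hg : ∀ x, HasDerivAt g (g1 x) x) (hg1 : Continuous g1) {z σ : ℝ} {q i₀ D : ℕ}
    {lam : ℕ → ℝ} (hi₀ : i₀ ≤ q) (hz : ∀ j < q, g^[j] z ∈ Ioo A B)
    (hz1 : ∀ j < q, g1 (g^[j] z) ≠ 0) (hσ : σ = 1 ∨ σ = -1) (hl0 : 0 ≤ lam 0) (hl : Monotone lam)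
    (hn : ¬ Free A B g g1 z q i₀ (g^[q] z + σ * lam 0)) :
    (∃ i e s k, i₀ ≤ i ∧ k < D ∧ Hit A B g g1 z q σ i e s ∧ s ≤ lam k ∧
      Free A B g g1 z q (i + 1) (g^[q] z + σ * lam (k + 1))) ∨
    (∃ (i : ℕ → ℕ) (e s : ℕ → ℝ), (∀ k ≤ D, i₀ ≤ i k ∧ Hit A B g g1 z q σ (i k) (e k) (s k) ∧
      s k ≤ lam k) ∧ ∀ k k', k < k' → k' ≤ D → i k < i k' ∧ s k ≤ s k') := by
  classical
  have hlnn : ∀ k, 0 ≤ lam k := fun k => hl0.trans (hl (Nat.zero_le k))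
  have mem : ∀ {k k'}, k ≤ k' → g^[q] z + σ * lam k ∈ uIcc (g^[q] z) (g^[q] z + σ * lam k') :=
    fun {k k'} h => (mem_uIcc_add hσ (hlnn _)).2 ⟨_, hlnn k, hl h, rfl⟩
  have hnk : ∀ k, ¬ Free A B g g1 z q i₀ (g^[q] z + σ * lam k) := fun k hk =>
    hn (hk.mono hg hi₀ (mem (Nat.zero_le k)))
  let i : ℕ → ℕ := fun k => Nat.findGreatest (fun j => ¬ Free A B g g1 z q j (g^[q] z + σ * lam k)) q
  have hispec : ∀ k, ¬ Free A B g g1 z q (i k) (g^[q] z + σ * lam k) := fun k =>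
    Nat.findGreatest_spec (P := fun j => ¬ Free A B g g1 z q j (g^[q] z + σ * lam k)) hi₀ (hnk k)
  have hile : ∀ k, i₀ ≤ i k := fun k => Nat.le_findGreatest hi₀ (hnk k)
  have hilt : ∀ k, i k < q := fun k => by
    refine lt_of_le_of_ne (Nat.findGreatest_le q) fun h => hispec k ?_
    rw [h]; exact ⟨g^[q] z + σ * lam k, by simpa using Mon.zero, by simp⟩
  have higr : ∀ k j, i k < j → j ≤ q → Free A B g g1 z q j (g^[q] z + σ * lam k) := fun k j h1 h2 =>
    not_not.1 (Nat.findGreatest_is_greatest h1 h2)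
  have hex : ∀ k, ∃ e s, Hit A B g g1 z q σ (i k) e s ∧ s ≤ lam k := fun k =>
    exists_hit hg hg1 (hilt k) (hz _ (hilt k)) hz1 hσ (hlnn k) (hispec k)
      (higr k _ (Nat.lt_succ_self _) (hilt k))
  choose e s hes using hex
  by_cases hc : ∃ k < D, Free A B g g1 z q (i k + 1) (g^[q] z + σ * lam (k + 1))
  · obtain ⟨k, hk, hf⟩ := hc
    exact Or.inl ⟨i k, e k, s k, k, hile k, hk, (hes k).1, (hes k).2, hf⟩
  · right
    push Not at hc
    refine ⟨i, e, s, fun k _ => ⟨hile k, hes k⟩, ?_⟩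
    have hstep : ∀ k < D, i k < i (k + 1) := by
      intro k hk
      by_contra hle
      push Not at hle
      exact hc k hk (higr (k + 1) _ (by omega) (hilt k))
    have hlt : ∀ k k', k < k' → k' ≤ D → i k < i k' := by
      intro k k' hkk
      induction k', hkk using Nat.le_induction with
      | base => intro h; exact hstep k h
      | succ n hn ih => intro h; exact (ih (by omega)).trans (hstep n h)
    intro k k' hkk hk'
    refine ⟨hlt k k' hkk hk', ?_⟩
    have hf := higr k (i k') (hlt k k' hkk hk') (hilt k').le
    exact (hes k).2.trans ((hes k').1.le_of_free hg hg1 hz1 hσ hf)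

end Hits

lemma cr4_eq {p0 p1 p2 p3 : ℝ} (h : Ord4 p0 p1 p2 p3) :
    cr4 p0 p1 p2 p3 = 1 + |p1 - p0| * |p3 - p2| / (|p3 - p0| * |p2 - p1|) := by
  have e : |p3 - p0| * |p2 - p1| = (p3 - p0) * (p2 - p1) ∧
      |p1 - p0| * |p3 - p2| = (p1 - p0) * (p3 - p2) ∧ (p3 - p0) * (p2 - p1) ≠ 0 := by
    rw [← abs_mul, ← abs_mul]
    rcases h with ⟨a, b, c⟩ | ⟨a, b, c⟩
    · have h1 : 0 < (p3 - p0) * (p2 - p1) := mul_pos (by linarith) (by linarith)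
      have h2 : 0 < (p1 - p0) * (p3 - p2) := mul_pos (by linarith) (by linarith)
      exact ⟨abs_of_pos h1, abs_of_pos h2, h1.ne'⟩
    · have h1 : 0 < (p3 - p0) * (p2 - p1) := mul_pos_of_neg_of_neg (by linarith) (by linarith)
      have h2 : 0 < (p1 - p0) * (p3 - p2) := mul_pos_of_neg_of_neg (by linarith) (by linarith)
      exact ⟨abs_of_pos h1, abs_of_pos h2, h1.ne'⟩
  rw [e.1, e.2.1, cr4, one_add_div e.2.2]
  congr 1
  ring

/-- A continuous injective self-map of a bounded interval has convergent even iterates. -/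
lemma trap {F : ℝ → ℝ} {Ω : Set ℝ} {A B : ℝ} (hΩ : OrdConnected Ω) (hb : Ω ⊆ Icc A B)
    (hc : ContinuousOn F Ω) (hi : InjOn F Ω) (hm : MapsTo F Ω Ω) {x : ℝ} (hx : x ∈ Ω) :
    ∃ y, Tendsto (fun m => F^[2 * m] x) atTop (𝓝 y) := by
  have hmono : StrictMonoOn (F ∘ F) Ω := by
    intro u hu w hw huw
    set p := min (min u w) (min (F u) (F w)) with hp
    set q := max (max u w) (max (F u) (F w)) with hq
    have hpΩ : p ∈ Ω := by
      rcases min_choice (min u w) (min (F u) (F w)) with h | h <;> rw [hp, h]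
      · rcases min_choice u w with h | h <;> rw [h] <;> assumption
      · rcases min_choice (F u) (F w) with h | h <;> rw [h]
        exacts [hm hu, hm hw]
    have hqΩ : q ∈ Ω := by
      rcases max_choice (max u w) (max (F u) (F w)) with h | h <;> rw [hq, h]
      · rcases max_choice u w with h | h <;> rw [h] <;> assumption
      · rcases max_choice (F u) (F w) with h | h <;> rw [h]
        exacts [hm hu, hm hw]
    have hsub : Icc p q ⊆ Ω := hΩ.out hpΩ hqΩ
    have m1 : u ∈ Icc p q := ⟨(min_le_left _ _).trans (min_le_left _ _),
      (le_max_left _ _).trans (le_max_left _ _)⟩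
    have m2 : w ∈ Icc p q := ⟨(min_le_left _ _).trans (min_le_right _ _),
      (le_max_right _ _).trans (le_max_left _ _)⟩
    have m3 : F u ∈ Icc p q := ⟨(min_le_right _ _).trans (min_le_left _ _),
      (le_max_left _ _).trans (le_max_right _ _)⟩
    have m4 : F w ∈ Icc p q := ⟨(min_le_right _ _).trans (min_le_right _ _),
      (le_max_right _ _).trans (le_max_right _ _)⟩
    rcases (hc.mono hsub).strictMonoOn_of_injOn_Icc' (m1.1.trans m1.2) (hi.mono hsub) with h | h
    · exact h m3 m4 (h m1 m2 huw)
    · exact h m4 m3 (h m1 m2 huw)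
  set u : ℕ → ℝ := fun m => (F ∘ F)^[m] x with hu
  have huF : ∀ m, F^[2 * m] x = u m := fun m => by
    rw [Function.iterate_mul]; rfl
  have hmem : ∀ m, u m ∈ Ω := fun m => (hm.comp hm).iterate m hx
  have hsucc : ∀ m, u (m + 1) = (F ∘ F) (u m) := fun m => Function.iterate_succ_apply' _ _ _
  simp only [huF]
  rcases le_total (u 0) (u 1) with h | h
  · have hle : ∀ m, u m ≤ u (m + 1) := by
      intro m
      induction m with
      | zero => exact h
      | succ k ih => rw [hsucc k, hsucc (k + 1)]; exact hmono.monotoneOn (hmem _) (hmem _) ih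
    exact ⟨_, tendsto_atTop_ciSup (monotone_nat_of_le_succ hle)
      ⟨B, by rintro _ ⟨m, rfl⟩; exact (hb (hmem m)).2⟩⟩
  · have hle : ∀ m, u (m + 1) ≤ u m := by
      intro m
      induction m with
      | zero => exact h
      | succ k ih => rw [hsucc k, hsucc (k + 1)]; exact hmono.monotoneOn (hmem _) (hmem _) ih
    exact ⟨_, tendsto_atTop_ciInf (antitone_nat_of_succ_le hle)
      ⟨A, by rintro _ ⟨m, rfl⟩; exact (hb (hmem m)).1⟩⟩

lemma abs_sub_lt_of_floor_eq {x y u δ : ℝ} (hδ : 0 < δ) (hx : u ≤ x) (hy : u ≤ y)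
    (h : ⌊(x - u) / δ⌋₊ = ⌊(y - u) / δ⌋₊) : |x - y| < δ := by
  have hx0 : 0 ≤ (x - u) / δ := div_nonneg (by linarith) hδ.le
  have hy0 : 0 ≤ (y - u) / δ := div_nonneg (by linarith) hδ.le
  have a1 := Nat.floor_le hx0
  have a2 := Nat.lt_floor_add_one ((x - u) / δ)
  have b1 := Nat.floor_le hy0
  have b2 := Nat.lt_floor_add_one ((y - u) / δ)
  rw [h] at a1 a2
  rw [le_div_iff₀ hδ] at a1 b1
  rw [div_lt_iff₀ hδ] at a2 b2
  rw [abs_lt]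
  constructor <;> nlinarith

lemma sep_card {ι : Type*} (s : Finset ι) (p : ι → ℝ) {u L δ : ℝ} (hδ : 0 < δ)
    (hp : ∀ i ∈ s, p i ∈ Icc u (u + L)) (hs : ∀ i ∈ s, ∀ j ∈ s, i ≠ j → δ ≤ |p i - p j|) (hL : 0 ≤ L) :
    (s.card : ℝ) ≤ L / δ + 1 := by
  have hcard : s.card ≤ (Finset.range (⌊L / δ⌋₊ + 1)).card := by
    refine Finset.card_le_card_of_injOn (fun i => ⌊(p i - u) / δ⌋₊) (fun i hi => ?_) ?_
    · have := hp i hi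
      simp only [Finset.coe_range, mem_Iio, Nat.lt_succ_iff]
      exact Nat.floor_le_floor (by gcongr; linarith [this.2])
    · intro i hi j hj hij
      by_contra hne
      exact absurd (abs_sub_lt_of_floor_eq hδ (hp i hi).1 (hp j hj).1 hij) (not_lt.2 (hs i hi j hj hne))
  rw [Finset.card_range] at hcard
  have h2 : (⌊L / δ⌋₊ : ℝ) ≤ L / δ := Nat.floor_le (by positivity)
  have h3 : (s.card : ℝ) ≤ ((⌊L / δ⌋₊ + 1 : ℕ) : ℝ) := by exact_mod_cast hcard
  push_cast at h3
  linarith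

/-- Total length of intervals with bounded overlap. -/
lemma sum_len_le {ι : Type*} (s : Finset ι) (u w : ι → ℝ) {A B : ℝ} (hAB : A ≤ B) (M : ℕ)
    (hu : ∀ i ∈ s, u i ∈ Icc A B) (hw : ∀ i ∈ s, w i ∈ Icc A B)
    (hM : ∀ v, ∀ t ⊆ s, (∀ i ∈ t, v ∈ uIoo (u i) (w i)) → t.card ≤ M) :
    ∑ i ∈ s, |w i - u i| ≤ M * (B - A) := by
  classical
  have hInt : ∀ i ∈ s, Integrable ((uIoo (u i) (w i)).indicator (fun _ => (1 : ℝ)))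
      (volume.restrict (Icc A B)) := fun i _ =>
    ((integrable_const (1 : ℝ)).indicator (by rw [uIoo]; exact measurableSet_Ioo))
  have h1 : ∀ i ∈ s, |w i - u i| =
      ∫ v in Icc A B, (uIoo (u i) (w i)).indicator (fun _ => (1 : ℝ)) v := by
    intro i hi
    have hsub : uIoo (u i) (w i) ⊆ Icc A B := fun v hv =>
      ⟨(le_min (hu i hi).1 (hw i hi).1).trans hv.1.le, hv.2.le.trans (max_le (hu i hi).2 (hw i hi).2)⟩
    have hms : MeasurableSet (uIoo (u i) (w i)) := by rw [uIoo]; exact measurableSet_Ioo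
    rw [setIntegral_indicator hms, inter_eq_self_of_subset_right hsub, setIntegral_const, smul_eq_mul,
      mul_one, Measure.real, uIoo, Real.volume_Ioo, ENNReal.toReal_ofReal (by
        simp [max_sub_min_eq_abs])]
    rw [max_sub_min_eq_abs']
    exact abs_sub_comm _ _
  rw [Finset.sum_congr rfl h1, ← integral_finsetSum _ hInt]
  calc ∫ v in Icc A B, ∑ i ∈ s, (uIoo (u i) (w i)).indicator (fun _ => (1 : ℝ)) v
      ≤ ∫ v in Icc A B, (M : ℝ) := by
        refine integral_mono (integrable_finsetSum _ hInt) (integrable_const _) fun v => ?_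
        have : ∑ i ∈ s, (uIoo (u i) (w i)).indicator (fun _ => (1 : ℝ)) v
            = ((s.filter fun i => v ∈ uIoo (u i) (w i)).card : ℝ) := by
          rw [Finset.card_filter]; push_cast
          exact Finset.sum_congr rfl fun i _ => by rw [indicator_apply]
        simp only [this]
        exact_mod_cast hM v _ (Finset.filter_subset _ _) fun i hi => (Finset.mem_filter.1 hi).2
    _ = M * (B - A) := by
        rw [setIntegral_const, smul_eq_mul, Measure.real, Real.volume_Icc,
          ENNReal.toReal_ofReal (by linarith)]; ring

/-- Obstructions can be coloured injectively with a uniformly bounded number of colours. -/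
lemma Cls.coloring (A B K μ : ℝ) (hμ : 0 < μ) : ∃ N : ℕ, ∀ g g1 g2 g3 : ℝ → ℝ,
    Cls A B K μ g g1 g2 g3 → ∃ col : ℝ → Fin N, InjOn col {e | Gam A B g1 e} := by
  set K0 := |K| + 1
  have hK0 : 0 < K0 := by positivity
  set δ := μ / K0
  have hδ : 0 < δ := by positivity
  set N0 := ⌊(B - A) / δ⌋₊ with hN0
  refine ⟨N0 + 3, fun g g1 g2 g3 h => ?_⟩
  have hsep : ∀ e e', e ∈ Icc A B → e' ∈ Icc A B → g1 e = 0 → g1 e' = 0 → e < e' → δ ≤ e' - e := by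
    intro e e' he he' h0 h0' hlt
    obtain ⟨ξ, hξ, hξ2⟩ := exists_hasDerivAt_eq_zero hlt h.cont1.continuousOn (h0.trans h0'.symm)
      (fun x _ => h.d1 x)
    have hξ3 : ξ ∈ Icc A B := ⟨he.1.trans hξ.1.le, hξ.2.le.trans he'.2⟩
    have h1 := h.nd ξ hξ3
    have h2 := h.lip1 he hξ3
    rw [hξ2, abs_zero, add_zero] at h1
    rw [h0, sub_zero, abs_of_pos (sub_pos.2 hξ.1)] at h2
    have h3 : K * (ξ - e) ≤ K0 * (ξ - e) :=
      mul_le_mul_of_nonneg_right (by linarith [le_abs_self K]) (by linarith [hξ.1])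
    rw [div_le_iff₀ hK0]
    nlinarith [hξ.2]
  let col : ℝ → Fin (N0 + 3) := fun e => if g1 e = 0 then
    ⟨min ⌊(e - A) / δ⌋₊ N0, by omega⟩ else if e = A then ⟨N0 + 1, by omega⟩ else ⟨N0 + 2, by omega⟩
  refine ⟨col, ?_⟩
  intro e he e' he' heq
  have hmin : ∀ e, e ∈ Icc A B → min ⌊(e - A) / δ⌋₊ N0 = ⌊(e - A) / δ⌋₊ := fun e he =>
    min_eq_left (Nat.floor_le_floor (by gcongr; exact he.2))
  by_cases h0 : g1 e = 0 <;> by_cases h0' : g1 e' = 0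
  · simp only [col, h0, h0', if_true, Fin.mk.injEq, hmin e he.1, hmin e' he'.1] at heq
    have := abs_sub_lt_of_floor_eq hδ he.1.1 he'.1.1 heq
    rw [abs_lt] at this
    rcases lt_trichotomy e e' with hl | hl | hl
    · linarith [hsep e e' he.1 he'.1 h0 h0' hl]
    · exact hl
    · linarith [hsep e' e he'.1 he.1 h0' h0 hl]
  · simp only [col, h0, h0', if_true, if_false] at heq
    split_ifs at heq <;> simp only [Fin.mk.injEq] at heq <;> omega
  · simp only [col, h0, h0', if_true, if_false] at heq
    split_ifs at heq <;> simp only [Fin.mk.injEq] at heq <;> omega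
  · have h1 : e = A ∨ e = B := he.2.resolve_left h0
    have h2 : e' = A ∨ e' = B := he'.2.resolve_left h0'
    simp only [col, h0, h0', if_false] at heq
    split_ifs at heq with h3 h4 h4
    · rw [h3, h4]
    · simp at heq
    · simp at heq
    · rw [h1.resolve_left h3, h2.resolve_left h4]

/-- The cross-ratio excess: `cr4 = 1 + xr`. -/
noncomputable def xr (p0 p1 p2 p3 : ℝ) : ℝ := |p1 - p0| * |p3 - p2| / (|p3 - p0| * |p2 - p1|)

lemma Mon.xr_le {A B K' ε : ℝ} {g g1 : ℝ → ℝ} {m : ℕ} (hS : Sturm A B K' g g1) {p0 p1 p2 p3 : ℝ}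
    (h : Mon A B g g1 m p0 p3) (ho : Ord4 p0 p1 p2 p3)
    (hε : ∑ j ∈ Finset.range m, |g^[j] p1 - g^[j] p0| * |g^[j] p3 - g^[j] p2| ≤ ε) :
    1 + xr (g^[m] p0) (g^[m] p1) (g^[m] p2) (g^[m] p3) ≤ (1 + xr p0 p1 p2 p3) * Real.exp (K' * ε) := by
  have := Mon.cr4_le hS h ho
  rw [cr4_eq (h.ord4 hS.1 hS.2.1 ho), cr4_eq ho] at this
  refine this.trans (mul_le_mul_of_nonneg_left ?_ (by positivity))
  exact Real.exp_le_exp.2 (mul_le_mul_of_nonneg_left hε hS.2.2.1.le)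

section Seg

variable {A B : ℝ} {f f1 : ℝ → ℝ}

/-- All iterates stay in `[A, B]` and avoid critical points. -/
def Hom (A B : ℝ) (f f1 : ℝ → ℝ) (v : ℝ) : Prop := ∀ j, f^[j] v ∈ Icc A B ∧ f1 (f^[j] v) ≠ 0

/-- The maximal homterval around `z`. -/
def Seg (A B : ℝ) (f f1 : ℝ → ℝ) (z : ℝ) : Set ℝ := {v | ∀ u ∈ uIcc z v, Hom A B f f1 u}

lemma Hom.iter {v : ℝ} (h : Hom A B f f1 v) (k : ℕ) : Hom A B f f1 (f^[k] v) := fun j => by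
  rw [← Function.iterate_add_apply]; exact h _

lemma Seg.mon {z v : ℝ} (h : v ∈ Seg A B f f1 z) (m : ℕ) : Mon A B f f1 m z v := fun j _ u hu =>
  ⟨(h u hu j).1, fun _ _ => (h u hu j).2⟩

lemma Seg.image (hf : ∀ x, HasDerivAt f (f1 x) x) {z v : ℝ} (h : v ∈ Seg A B f f1 z) (k : ℕ) :
    f^[k] v ∈ Seg A B f f1 (f^[k] z) := by
  intro u hu
  obtain ⟨w, hw, rfl⟩ := Mon.surj hf k hu
  exact (h w hw).iter k

lemma Seg.sub {z v u : ℝ} (h : v ∈ Seg A B f f1 z) (hu : u ∈ uIcc z v) : u ∈ Seg A B f f1 z :=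
  fun w hw => h w (uIcc_subset_uIcc left_mem_uIcc hu hw)

lemma Seg.concat {z z' v : ℝ} (h : v ∈ Seg A B f f1 z) (h' : v ∈ Seg A B f f1 z') :
    z' ∈ Seg A B f f1 z := by
  intro u hu
  rcases uIcc_subset_uIcc_union_uIcc (b := v) hu with h1 | h1
  · exact h u h1
  · rw [uIcc_comm] at h1; exact h' u h1

lemma Seg.attracted (hf : ∀ x, HasDerivAt f (f1 x) x) (hf1 : Continuous f1) {z : ℝ} {k : ℕ}
    (h : f^[k] z ∈ Seg A B f f1 z) :
    ∃ y, Tendsto (fun m => f^[(2 * k) * m] z) atTop (𝓝 y) := by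
  set F := f^[k] with hF
  set y : ℕ → ℝ := fun m => F^[m] z with hy
  have hFm : ∀ m, F^[m] = f^[k * m] := fun m => (Function.iterate_mul f k m).symm
  have hseg : ∀ m, y (m + 1) ∈ Seg A B f f1 (y m) := by
    intro m
    have := Seg.image hf h (k * m)
    rw [← hFm] at this
    exact this
  have hHom : ∀ v ∈ ⋃ m, uIcc (y m) (y (m + 1)), Hom A B f f1 v := by
    intro v hv
    obtain ⟨m, hm⟩ := mem_iUnion.1 hv
    exact hseg m v hm
  have hpre : IsPreconnected (⋃ m, uIcc (y m) (y (m + 1))) := by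
    refine IsPreconnected.iUnion_of_chain (fun n => isPreconnected_uIcc) fun n => ?_
    exact ⟨y (n + 1), right_mem_uIcc, left_mem_uIcc⟩
  have hord := hpre.ordConnected
  have hfc : Continuous f := continuous_iff_continuousAt.2 fun x => (hf x).continuousAt
  obtain ⟨w, hw⟩ := trap (F := F) (A := A) (B := B) hord (fun v hv => by simpa using (hHom v hv 0).1)
    (hfc.iterate k).continuousOn
    (fun u hu w hw he => by
      have hm : Mon A B f f1 k u w := fun j _ v hv =>
        have := hHom v (hord.uIcc_subset hu hw hv) j
        ⟨this.1, fun _ _ => this.2⟩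
      exact hm.injOn hf hf1 left_mem_uIcc right_mem_uIcc he)
    (fun v hv => by
      obtain ⟨m, hm⟩ := mem_iUnion.1 hv
      refine mem_iUnion.2 ⟨m + 1, ?_⟩
      have := (Seg.mon (hseg m) k).mem hf hf1 hm
      simp only [hy, Function.iterate_succ_apply'] at this ⊢
      exact this)
    (x := z) (mem_iUnion.2 ⟨0, (left_mem_uIcc : y 0 ∈ _)⟩)
  refine ⟨w, ?_⟩
  convert hw using 2 with m
  rw [hFm]; congr 1; ring

end Seg

/-- Data of a limiting homterval with summable sizes comparable to the derivatives at a
point which is not attracted by a periodic orbit. -/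
structure Wand (A B a b K μ K' α c C : ℝ) (f f1 f2 f3 : ℝ → ℝ) (x l r : ℝ) : Prop where
  cls : Cls A B K μ f f1 f2 f3
  st : Sturm A B K' f f1
  hμ : 0 < μ
  aA : A < a
  bB : b < B
  maps : MapsTo f (Icc a b) (Icc a b)
  hx : x ∈ Icc a b
  lx : l < x
  hxr : x < r
  hom : ∀ v ∈ Icc l r, Hom A B f f1 v
  hα : 0 < α
  hc : 0 < c
  hC : 0 < C
  bl : ∀ i, c * (α * |Dm f f1 i x|) ≤ |f^[i] l - f^[i] x| ∧
    |f^[i] l - f^[i] x| ≤ C * (α * |Dm f f1 i x|)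
  br : ∀ i, c * (α * |Dm f f1 i x|) ≤ |f^[i] r - f^[i] x| ∧
    |f^[i] r - f^[i] x| ≤ C * (α * |Dm f f1 i x|)
  sum : Summable fun i => α * |Dm f f1 i x|
  rat : Tendsto (fun i => α * |Dm f f1 i x| / |f1 (f^[i] x)|) atTop (𝓝 0)
  nattr : ∀ k, 0 < k → ∀ i, ¬ ∃ y, Tendsto (fun m => f^[k * m] (f^[i] x)) atTop (𝓝 y)

namespace Wand

variable {A B a b K μ K' α c C : ℝ} {f f1 f2 f3 : ℝ → ℝ} {x l r : ℝ}

/-- One of the two endpoints of the `i`-th image of the homterval. -/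
def IsEnd (f : ℝ → ℝ) (l r : ℝ) (i : ℕ) (h : ℝ) : Prop := h = f^[i] l ∨ h = f^[i] r

lemma IsEnd.iter {i : ℕ} {h : ℝ} (he : IsEnd f l r i h) (k : ℕ) : IsEnd f l r (k + i) (f^[k] h) := by
  rcases he with rfl | rfl
  · left; rw [← Function.iterate_add_apply]
  · right; rw [← Function.iterate_add_apply]

section
variable (W : Wand A B a b K μ K' α c C f f1 f2 f3 x l r)
include W

lemma hd : ∀ x, HasDerivAt f (f1 x) x := W.cls.d0
lemma hc1 : Continuous f1 := W.cls.cont1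

lemma AB : A < B := by linarith [W.aA, W.bB, W.hx.1, W.hx.2]

lemma orb (i : ℕ) : f^[i] x ∈ Icc a b := W.maps.iterate i W.hx

lemma orb' (i : ℕ) : f^[i] x ∈ Ioo A B :=
  ⟨W.aA.trans_le (W.orb i).1, (W.orb i).2.trans_lt W.bB⟩

lemma ne (i : ℕ) : f1 (f^[i] x) ≠ 0 := (W.hom x ⟨W.lx.le, W.hxr.le⟩ i).2

lemma apos (i : ℕ) : 0 < α * |Dm f f1 i x| :=
  mul_pos W.hα (abs_pos.2 (Dm_ne_zero fun j _ => W.ne j))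

lemma end_seg {i : ℕ} {h : ℝ} (he : IsEnd f l r i h) : h ∈ Seg A B f f1 (f^[i] x) := by
  rcases he with rfl | rfl
  · refine Seg.image W.hd (fun u hu => W.hom u ?_) i
    rw [uIcc_of_ge W.lx.le] at hu
    exact ⟨hu.1, hu.2.trans W.hxr.le⟩
  · refine Seg.image W.hd (fun u hu => W.hom u ?_) i
    rw [uIcc_of_le W.hxr.le] at hu
    exact ⟨W.lx.le.trans hu.1, hu.2⟩

lemma end_bd {i : ℕ} {h : ℝ} (he : IsEnd f l r i h) : c * (α * |Dm f f1 i x|) ≤ |h - f^[i] x| ∧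
    |h - f^[i] x| ≤ C * (α * |Dm f f1 i x|) := by
  rcases he with rfl | rfl
  exacts [W.bl i, W.br i]

lemma mem_ends (i : ℕ) : f^[i] x ∈ uIoo (f^[i] l) (f^[i] r) := by
  have hm : Mon A B f f1 i l r := fun j _ v hv => by
    rw [uIcc_of_le (W.lx.trans W.hxr).le] at hv
    exact ⟨(W.hom v hv j).1, fun _ _ => (W.hom v hv j).2⟩
  refine hm.mem' W.hd W.hc1 ?_
  rw [uIoo_of_le (W.lx.trans W.hxr).le]
  exact ⟨W.lx, W.hxr⟩

/-- There is an endpoint on the prescribed side. -/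
lemma exists_end (i : ℕ) {y : ℝ} (hy : y ≠ f^[i] x) :
    ∃ h, IsEnd f l r i h ∧ 0 < (h - f^[i] x) * (y - f^[i] x) := by
  have h1 := W.mem_ends i
  rw [uIoo] at h1
  rcases le_total (f^[i] l) (f^[i] r) with hlr | hlr
  · rw [min_eq_left hlr, max_eq_right hlr] at h1
    rcases lt_or_gt_of_ne hy with h | h
    · exact ⟨_, Or.inl rfl, mul_pos_of_neg_of_neg (by linarith [h1.1]) (by linarith)⟩
    · exact ⟨_, Or.inr rfl, mul_pos (by linarith [h1.2]) (by linarith)⟩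
  · rw [min_eq_right hlr, max_eq_left hlr] at h1
    rcases lt_or_gt_of_ne hy with h | h
    · exact ⟨_, Or.inr rfl, mul_pos_of_neg_of_neg (by linarith [h1.1]) (by linarith)⟩
    · exact ⟨_, Or.inl rfl, mul_pos (by linarith [h1.2]) (by linarith)⟩

lemma exists_opp (i : ℕ) {y : ℝ} (hy : y ≠ f^[i] x) :
    ∃ h, IsEnd f l r i h ∧ (h - f^[i] x) * (y - f^[i] x) < 0 := by
  obtain ⟨h, he, hh⟩ := W.exists_end i (y := 2 * f^[i] x - y) (by
    intro h; apply hy; linarith)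
  exact ⟨h, he, by nlinarith⟩

lemma disj {i j : ℕ} (hij : i ≠ j) {v : ℝ} (hi : v ∈ Seg A B f f1 (f^[i] x)) :
    v ∉ Seg A B f f1 (f^[j] x) := by
  intro hj
  wlog h : i < j generalizing i j
  · exact this hij.symm hj hi (by omega)
  obtain ⟨k, rfl⟩ := Nat.exists_eq_add_of_lt h
  have := Seg.concat hi hj
  rw [show i + k + 1 = (k + 1) + i by ring, Function.iterate_add_apply] at this
  exact W.nattr (2 * (k + 1)) (by omega) i (Seg.attracted W.hd W.hc1 this)

lemma far {i : ℕ} {v : ℝ} (h : v ∉ Seg A B f f1 (f^[i] x)) :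
    c * (α * |Dm f f1 i x|) ≤ |v - f^[i] x| := by
  by_contra hlt
  push Not at hlt
  by_cases hv : v = f^[i] x
  · apply h
    intro u hu
    rw [hv, uIcc_self, mem_singleton_iff] at hu
    rw [hu]
    exact (W.hom x ⟨W.lx.le, W.hxr.le⟩).iter i
  obtain ⟨e, he, hpos⟩ := W.exists_end i hv
  refine h (Seg.sub (W.end_seg he) ?_)
  have := hlt.trans_le (W.end_bd he).1
  rw [mem_uIcc]
  rcases pos_and_pos_or_neg_and_neg_of_mul_pos hpos with ⟨h1, h2⟩ | ⟨h1, h2⟩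
  · rw [abs_of_pos h1, abs_of_pos h2] at this
    left; constructor <;> linarith
  · rw [abs_of_neg h1, abs_of_neg h2] at this
    right; constructor <;> linarith

lemma self_seg (i : ℕ) : f^[i] x ∈ Seg A B f f1 (f^[i] x) := by
  intro u hu
  rw [uIcc_self, mem_singleton_iff] at hu
  rw [hu]
  exact (W.hom x ⟨W.lx.le, W.hxr.le⟩).iter i

lemma sep {i j : ℕ} (hij : i ≠ j) : c * (α * |Dm f f1 i x|) ≤ |f^[j] x - f^[i] x| :=
  W.far (W.disj hij.symm (W.self_seg j))

omit W in
lemma seg_mem {i : ℕ} {v : ℝ} (h : v ∈ Seg A B f f1 (f^[i] x)) : v ∈ Icc A B := by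
  simpa using (h v right_mem_uIcc 0).1

lemma sum_seg (s : Finset ℕ) (v : ℕ → ℝ) (hv : ∀ i ∈ s, v i ∈ Seg A B f f1 (f^[i] x)) :
    ∑ i ∈ s, |v i - f^[i] x| ≤ B - A := by
  have := sum_len_le s (fun i => f^[i] x) v W.AB.le 1
    (fun i _ => Ioo_subset_Icc_self (W.orb' i)) (fun i hi => seg_mem (hv i hi)) (by
      intro w t ht h
      rw [Finset.card_le_one]
      intro i hi j hj
      by_contra hij
      exact W.disj hij (Seg.sub (hv i (ht hi)) (Ioo_subset_Icc_self (h i hi)))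
        (Seg.sub (hv j (ht hj)) (Ioo_subset_Icc_self (h j hj))))
  simpa using this

lemma tendsto_a : Tendsto (fun i => α * |Dm f f1 i x|) atTop (𝓝 0) := W.sum.tendsto_atTop_zero

/-- Infinitely many times are records. -/
lemma exists_record (M : ℕ) : ∃ n, M ≤ n ∧ ∀ j ≤ n, α * |Dm f f1 n x| ≤ α * |Dm f f1 j x| := by
  classical
  obtain ⟨j₀, _, hj₀⟩ := Finset.exists_min_image (Finset.range (M + 1)) (fun j => α * |Dm f f1 j x|)
    ⟨0, by simp⟩
  have hex : ∃ n, α * |Dm f f1 n x| < α * |Dm f f1 j₀ x| :=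
    (W.tendsto_a.eventually (gt_mem_nhds (W.apos j₀))).exists
  have hs := Nat.find_spec hex
  refine ⟨Nat.find hex, ?_, fun j hj => ?_⟩
  · by_contra hlt
    have := hj₀ (Nat.find hex) (Finset.mem_range.2 (by omega))
    linarith
  · rcases hj.eq_or_lt with h | h
    · rw [h]
    · have := Nat.find_min hex h
      linarith

/-- Eventually tails of the sizes are small. -/
lemma tail (ε : ℝ) (hε : 0 < ε) : ∃ i₁, ∀ i ≥ i₁, ∀ m,
    ∑ j ∈ Finset.range m, α * |Dm f f1 (j + i) x| ≤ ε := by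
  have h1 := tendsto_sum_nat_add fun i => α * |Dm f f1 i x|
  obtain ⟨i₁, hi⟩ := eventually_atTop.1 (h1.eventually (gt_mem_nhds hε))
  refine ⟨i₁, fun i h m => ?_⟩
  refine le_trans ?_ (hi i h).le
  exact ((summable_nat_add_iff i).2 W.sum).sum_le_tsum _ (fun j _ => (W.apos _).le)

end

end Wand

namespace Wand

variable {A B a b K μ K' α c C : ℝ} {f f1 f2 f3 : ℝ → ℝ} {x l r : ℝ}
variable (W : Wand A B a b K μ K' α c C f f1 f2 f3 x l r)
include W

lemma pull : ∃ i₀, ∀ i ≥ i₀, ∀ v' ∈ Seg A B f f1 (f^[i + 1] x), ∃ v ∈ Seg A B f f1 (f^[i] x),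
    f v = v' := by
  classical
  obtain ⟨N, hN⟩ := Cls.coloring A B K μ W.hμ
  obtain ⟨col, hcol⟩ := hN _ _ _ _ W.cls
  set bad : Set ℕ := {i | ∃ e, Gam A B f1 e ∧ e ≠ f^[i] x ∧ uIoo (f^[i] x) e ⊆ Seg A B f f1 (f^[i] x)}
    with hbad
  have hfin : bad.Finite := by
    have hch : ∀ i : ℕ, ∃ e, i ∈ bad → Gam A B f1 e ∧ e ≠ f^[i] x ∧
        uIoo (f^[i] x) e ⊆ Seg A B f f1 (f^[i] x) := fun i => by
      by_cases hi : i ∈ bad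
      · obtain ⟨e, he⟩ := hi
        exact ⟨e, fun _ => he⟩
      · exact ⟨0, fun h => absurd h hi⟩
    choose e he using hch
    refine Set.Finite.of_injOn (f := fun i => (col (e i), decide (e i < f^[i] x)))
      (t := Set.univ) (fun _ _ => mem_univ _) ?_ Set.finite_univ
    intro i hi j hj hij
    by_contra hne
    simp only [Prod.mk.injEq, decide_eq_decide] at hij
    have hee : e i = e j := hcol (he i hi).1 (he j hj).1 hij.1
    have h2 := hij.2
    rw [← hee] at h2
    have hi3 := (he i hi).2.2
    have hj3 := (he j hj).2.2
    have hi2 := (he i hi).2.1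
    have hj2 := (he j hj).2.1
    rw [← hee] at hj2 hj3
    by_cases hlt : e i < f^[i] x
    · have hlt' := h2.1 hlt
      have m1 := min_le_left (f^[i] x) (f^[j] x)
      have m2 := min_le_right (f^[i] x) (f^[j] x)
      have m3 := lt_min hlt hlt'
      refine W.disj hne (v := (e i + min (f^[i] x) (f^[j] x)) / 2) (hi3 ?_) (hj3 ?_)
      · rw [uIoo_of_ge hlt.le]
        constructor <;> linarith
      · rw [uIoo_of_ge hlt'.le]
        constructor <;> linarith
    · have hlt' := mt h2.2 hlt
      have hlt := lt_of_le_of_ne (not_lt.1 hlt) (Ne.symm hi2)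
      have hlt' := lt_of_le_of_ne (not_lt.1 hlt') (Ne.symm hj2)
      have m1 := le_max_left (f^[i] x) (f^[j] x)
      have m2 := le_max_right (f^[i] x) (f^[j] x)
      have m3 := max_lt hlt hlt'
      refine W.disj hne (v := (e i + max (f^[i] x) (f^[j] x)) / 2) (hi3 ?_) (hj3 ?_)
      · rw [uIoo_of_le hlt.le]
        constructor <;> linarith
      · rw [uIoo_of_le hlt'.le]
        constructor <;> linarith
  obtain ⟨i₁, hi₁⟩ := hfin.bddAbove
  refine ⟨i₁ + 1, fun i hi v' hv' => ?_⟩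
  have hnb : i ∉ bad := fun h => by have := hi₁ h; omega
  obtain ⟨e, hm, hor⟩ := reach (y' := v') W.hd W.hc1 (W.orb' i) (W.ne i)
  have hfe : f e ∈ uIcc (f (f^[i] x)) v' := by
    rcases hor with h | h
    · rw [h]; exact right_mem_uIcc
    · exact h.2.2
  have hHom : ∀ u ∈ uIcc (f^[i] x) e, u ∈ Icc A B → f1 u ≠ 0 → Hom A B f f1 u := by
    intro u hu hu1 hu2 j
    rcases j with _ | j
    · exact ⟨hu1, hu2⟩
    · rw [Function.iterate_succ_apply]
      refine hv' (f u) ?_ j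
      rw [Function.iterate_succ_apply']
      have := hm.mem W.hd W.hc1 hu
      simp only [Function.iterate_one] at this
      exact uIcc_subset_uIcc left_mem_uIcc hfe this
  have hsub : uIoo (f^[i] x) e ⊆ Seg A B f f1 (f^[i] x) := by
    intro v hv u hu
    have hu2 : u ∈ uIcc (f^[i] x) e := uIcc_subset_uIcc left_mem_uIcc (Ioo_subset_Icc_self hv) hu
    have hA := (hm 0 one_pos u hu2).1
    simp only [Function.iterate_zero, id] at hA
    refine hHom u hu2 hA ?_
    by_cases hux : u = f^[i] x
    · rw [hux]; exact W.ne i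
    have h2 := hm.ne (v := u) (j := 0) ?_ one_pos
    · simpa using h2
    refine mem_uIoo_iff.2 ⟨hu2, hux, ?_⟩
    rintro rfl
    obtain ⟨p1, p2, p3⟩ := mem_uIoo_iff.1 hv
    rw [mem_uIcc] at p1 hu
    rcases p1 with p | p <;> rcases hu with q | q
    · exact p3 (by linarith)
    · exact p2 (by linarith)
    · exact p2 (by linarith)
    · exact p3 (by linarith)
  have hng : e ≠ f^[i] x → ¬ Gam A B f1 e := fun h1 h2 => hnb ⟨e, h2, h1, hsub⟩
  rcases hor with h | h
  · refine ⟨e, ?_, h⟩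
    have heA := (hm 0 one_pos e right_mem_uIcc).1
    simp only [Function.iterate_zero, id] at heA
    intro u hu
    by_cases hue : u = e
    · refine hHom u hu (by rw [hue]; exact heA) ?_
      rw [hue]
      by_cases hex : e = f^[i] x
      · rw [hex]; exact W.ne i
      · exact fun h0 => hng hex ⟨heA, Or.inl h0⟩
    by_cases hux : u = f^[i] x
    · rw [hux]; exact W.self_seg i _ left_mem_uIcc
    exact hsub (mem_uIoo_iff.2 ⟨hu, hux, hue⟩) u right_mem_uIcc
  · exact absurd h.1 (hng h.2.1)

lemma pulls : ∃ i₀, ∀ i ≥ i₀, ∀ k, ∀ v' ∈ Seg A B f f1 (f^[k + i] x),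
    ∃ v ∈ Seg A B f f1 (f^[i] x), f^[k] v = v' := by
  obtain ⟨i₀, h⟩ := W.pull
  refine ⟨i₀, fun i hi k => ?_⟩
  induction k with
  | zero => intro v' hv'; exact ⟨v', by simpa using hv', rfl⟩
  | succ k ih =>
    intro v' hv'
    rw [show k + 1 + i = k + i + 1 by ring] at hv'
    obtain ⟨w, hw, hw2⟩ := h (k + i) (by omega) v' hv'
    obtain ⟨v, hv, hv2⟩ := ih w hw
    exact ⟨v, hv, by rw [Function.iterate_succ_apply', hv2, hw2]⟩

/-- Cross-ratio control along a branch, with one side inside the homterval. -/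
lemma xr_bd {i m : ℕ} {v y h : ℝ} (he : IsEnd f l r i h) (ho : (h - f^[i] x) * (y - f^[i] x) < 0)
    (hm : Mon A B f f1 m (f^[i] x) y) (hv : v ∈ uIoo (f^[i] x) y) :
    Ord4 h (f^[i] x) v y ∧ Ord4 (f^[m] h) (f^[m + i] x) (f^[m] v) (f^[m] y) ∧
    1 + xr (f^[m] h) (f^[m + i] x) (f^[m] v) (f^[m] y) ≤ (1 + xr h (f^[i] x) v y) *
      Real.exp (K' * (C * (B - A) * ∑ j ∈ Finset.range m, α * |Dm f f1 (j + i) x|)) := by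
  have hord : Ord4 h (f^[i] x) v y := by
    rw [uIoo] at hv
    rcases mul_neg_iff.1 ho with ⟨h1, h2⟩ | ⟨h1, h2⟩
    · rw [min_eq_right (by linarith), max_eq_left (by linarith)] at hv
      right; exact ⟨hv.1, hv.2, by linarith⟩
    · rw [min_eq_left (by linarith), max_eq_right (by linarith)] at hv
      left; exact ⟨by linarith, hv.1, hv.2⟩
  have hmem : f^[i] x ∈ uIcc h y := by
    rw [mem_uIcc]
    rcases hord with h | h
    · left; constructor <;> linarith [h.1, h.2.1, h.2.2]
    · right; constructor <;> linarith [h.1, h.2.1, h.2.2]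
  have hM : Mon A B f f1 m h y := (Seg.mon (W.end_seg he) m).concat hm
    (fun j _ => by rw [← Function.iterate_add_apply]; exact W.ne _) hmem
  refine ⟨hord, ?_, ?_⟩
  · rw [Function.iterate_add_apply]; exact hM.ord4 W.hd W.hc1 hord
  rw [Function.iterate_add_apply]
  refine hM.xr_le W.st hord ?_
  rw [Finset.mul_sum]
  refine Finset.sum_le_sum fun j hj => ?_
  have hj := Finset.mem_range.1 hj
  have h1 := (W.end_bd (he.iter j)).2
  rw [Function.iterate_add_apply, abs_sub_comm, ← Function.iterate_add_apply] at h1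
  rw [← Function.iterate_add_apply]
  have h2 := (hm j hj y right_mem_uIcc).1
  have h3 := (hm j hj v (Ioo_subset_Icc_self hv)).1
  have h4 : |f^[j] y - f^[j] v| ≤ B - A := by
    rw [abs_le]; constructor <;> linarith [h2.1, h2.2, h3.1, h3.2]
  calc _ ≤ C * (α * |Dm f f1 (j + i) x|) * (B - A) :=
        mul_le_mul h1 h4 (abs_nonneg _) (mul_nonneg W.hC.le (W.apos _).le)
    _ = _ := by ring

/-- Far along the orbit, cross-ratio excesses at most double. -/
lemma xr_half (ρ : ℝ) (hρ : 0 < ρ) : ∃ i₁, ∀ i ≥ i₁, ∀ m v y h, IsEnd f l r i h →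
    (h - f^[i] x) * (y - f^[i] x) < 0 → Mon A B f f1 m (f^[i] x) y → v ∈ uIoo (f^[i] x) y →
    ρ ≤ xr (f^[m] h) (f^[m + i] x) (f^[m] v) (f^[m] y) → ρ / 2 ≤ xr h (f^[i] x) v y := by
  set q := (1 + ρ) / (1 + ρ / 2) with hq
  have hq1 : 1 < q := by rw [hq, lt_div_iff₀ (by positivity)]; linarith
  have hK := W.st.2.2.1
  have hAB := W.AB
  have hCB : 0 < C * (B - A) := mul_pos W.hC (by linarith)
  obtain ⟨i₁, hi⟩ := W.tail (Real.log q / K' / (C * (B - A))) (by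
    have := Real.log_pos hq1
    positivity)
  refine ⟨i₁, fun i hi' m v y h he ho hm hv hx => ?_⟩
  have h1 := (W.xr_bd he ho hm hv).2.2
  have h2 := hi i hi' m
  rw [le_div_iff₀ hCB, le_div_iff₀ hK] at h2
  have h3 : Real.exp (K' * (C * (B - A) * ∑ j ∈ Finset.range m, α * |Dm f f1 (j + i) x|)) ≤ q := by
    rw [← Real.exp_log (by linarith : 0 < q)]
    exact Real.exp_le_exp.2 (by linarith)
  have hnn : 0 ≤ xr h (f^[i] x) v y := by rw [xr]; positivity
  have h4 : 1 + ρ ≤ (1 + xr h (f^[i] x) v y) * q :=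
    (add_le_add_right hx 1).trans (h1.trans (mul_le_mul_of_nonneg_left h3 (by linarith)))
  rw [hq, mul_div_assoc', le_div_iff₀ (by positivity)] at h4
  have h5 : 1 + ρ / 2 ≤ 1 + xr h (f^[i] x) v y := le_of_mul_le_mul_left (by linarith) (by linarith : 0 < 1 + ρ)
  linarith

omit W in
lemma xr_ge {h z v y σ s t a' : ℝ} (hσ : σ = 1 ∨ σ = -1) (hs : 0 < s) (hst : s < t)
    (hv : v = z + σ * s) (hy : y = z + σ * t) (_ : 0 < a') (_ : 0 < c)
    (h1 : c * a' ≤ |h - z|) (h2 : |h - z| ≤ C * a') (ho : Ord4 h z v y) :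
    c * a' * (t - s) / ((C * a' + t) * s) ≤ xr h z v y := by
  have e1 : |v - z| = s := by
    rw [hv]; rcases hσ with rfl | rfl
    · simp [abs_of_pos hs]
    · simp [abs_of_pos hs]
  have e2 : |y - v| = t - s := by
    rw [hv, hy]
    rcases hσ with rfl | rfl
    · rw [abs_of_pos] <;> linarith
    · rw [abs_of_neg] <;> linarith
  have e3 : |y - h| ≤ C * a' + t := by
    have : |y - z| = t := by
      rw [hy]; rcases hσ with rfl | rfl
      · simp [abs_of_pos (hs.trans hst)]
      · simp [abs_of_pos (hs.trans hst)]
    calc |y - h| ≤ |y - z| + |z - h| := abs_sub_le _ _ _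
      _ ≤ _ := by rw [this, abs_sub_comm z h]; linarith
  have e4 : 0 < |y - h| := by
    rw [abs_pos]
    rcases ho with o | o
    · linarith [o.1, o.2.1, o.2.2]
    · have : y - h < 0 := by linarith [o.1, o.2.1, o.2.2]
      exact this.ne
  rw [xr, e1, e2, abs_sub_comm z h]
  have hts : 0 < t - s := by linarith
  gcongr

end Wand

namespace Wand

variable {A B a b K μ K' α c C : ℝ} {f f1 f2 f3 : ℝ → ℝ} {x l r : ℝ}

/-- A small cross-ratio excess bounds the middle interval. -/
lemma mid_le {h z v y ρ L : ℝ} (ho : Ord4 h z v y) (hρ : 0 < ρ) (hx : ρ ≤ xr h z v y)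
    (hL : |h - z| ≤ L) : |v - z| ≤ L / ρ := by
  have h1 : |y - v| ≤ |y - h| := by
    rcases ho with o | o
    · rw [abs_of_pos (by linarith [o.1, o.2.1, o.2.2]), abs_of_pos (by linarith [o.1, o.2.1, o.2.2])]
      linarith [o.1, o.2.1, o.2.2]
    · rw [abs_of_neg (by linarith [o.1, o.2.1, o.2.2]), abs_of_neg (by linarith [o.1, o.2.1, o.2.2])]
      linarith [o.1, o.2.1, o.2.2]
  have h2 : 0 < |y - h| := by
    rw [abs_pos]
    rcases ho with o | o
    · exact ne_of_gt (by linarith [o.1, o.2.1, o.2.2])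
    · exact ne_of_lt (by linarith [o.1, o.2.1, o.2.2])
  have h3 : 0 < |v - z| := by
    rw [abs_pos]
    rcases ho with o | o
    · exact ne_of_gt (by linarith [o.1, o.2.1, o.2.2])
    · exact ne_of_lt (by linarith [o.1, o.2.1, o.2.2])
  rw [xr, le_div_iff₀ (by positivity), abs_sub_comm z h] at hx
  rw [le_div_iff₀ hρ]
  refine le_of_mul_le_mul_right (a := |y - h|) ?_ h2
  calc |v - z| * ρ * |y - h| = ρ * (|y - h| * |v - z|) := by ring
    _ ≤ |h - z| * |y - v| := hx
    _ ≤ L * |y - h| := mul_le_mul hL h1 (abs_nonneg _) ((abs_nonneg _).trans hL)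

lemma a_succ (i : ℕ) : α * |Dm f f1 (i + 1) x| = α * |Dm f f1 i x| * |f1 (f^[i] x)| := by
  rw [Dm_succ, abs_mul]; ring

variable (W : Wand A B a b K μ K' α c C f f1 f2 f3 x l r)
include W

lemma Kpos : 0 < K := by
  have h := W.cls.b1 x (Ioo_subset_Icc_self (by simpa using W.orb' 0))
  exact (abs_pos.2 (by simpa using W.ne 0)).trans_le h

/-- Late in the orbit no obstruction lies within the size of the homterval. -/
lemma far_gam (C' : ℝ) : ∃ i₁, ∀ i ≥ i₁, ∀ e, Gam A B f1 e → Mon A B f f1 1 (f^[i] x) e →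
    C' * (α * |Dm f f1 (i + 1) x|) < |f e - f^[i + 1] x| := by
  wlog hC' : 0 < C' generalizing C'
  · obtain ⟨i₁, h⟩ := this (C' := 1) one_pos
    refine ⟨i₁, fun i hi e he hm => lt_of_le_of_lt ?_ (h i hi e he hm)⟩
    exact mul_le_mul_of_nonneg_right (by linarith) (W.apos _).le
  obtain ⟨c', hc', hlong⟩ := Cls.long_image K μ W.hμ (min (a - A) (B - b))
    (lt_min (by linarith [W.aA]) (by linarith [W.bB]))
  have hK := W.Kpos
  have e1 := W.rat.eventually (gt_mem_nhds (show (0:ℝ) < 1 / (2 * K * C') by positivity))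
  have e2 := ((tendsto_add_atTop_iff_nat 1).2 W.tendsto_a).eventually
    (gt_mem_nhds (show (0:ℝ) < c' / C' by positivity))
  obtain ⟨i₁, hi₁⟩ := eventually_atTop.1 (e1.and e2)
  refine ⟨i₁, fun i hi e he hm => ?_⟩
  obtain ⟨h1, h2⟩ := hi₁ i hi
  have hne : ∀ v ∈ uIoo (f^[i] x) e, f1 v ≠ 0 := fun v hv => by
    simpa using hm.ne hv (j := 0) one_pos
  have horb := Ioo_subset_Icc_self (W.orb' i)
  by_contra hcon
  push Not at hcon
  rw [lt_div_iff₀ hC'] at h2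
  rw [Function.iterate_succ_apply'] at hcon
  obtain ⟨heI, he | he | he⟩ := he
  · have h3 := W.cls.crit_dist horb heI he hne
    have h4 := abs_pos.2 (W.ne i)
    rw [div_lt_div_iff₀ h4 (by positivity)] at h1
    rw [abs_sub_comm, a_succ] at hcon
    rw [← sq_abs] at h3
    have h5 : |f1 (f^[i] x)| * |f1 (f^[i] x)| ≤ (α * |Dm f f1 i x| * (2 * K * C')) * |f1 (f^[i] x)| := by
      calc _ = |f1 (f^[i] x)| ^ 2 := by ring
        _ ≤ _ := h3
        _ ≤ 2 * K * (C' * (α * |Dm f f1 i x| * |f1 (f^[i] x)|)) := by gcongr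
        _ = _ := by ring
    have := le_of_mul_le_mul_right h5 h4
    linarith
  · have h3 := hlong A B f f1 f2 f3 W.cls e (f^[i] x) heI horb ?_ ?_
    · rw [abs_sub_comm] at h3; linarith
    · rw [he]; exact (min_le_left _ _).trans (by linarith [(W.orb i).1])
    · rw [← uIoo_of_le (by rw [he]; exact horb.1), uIoo_comm]; exact hne
  · have h3 := hlong A B f f1 f2 f3 W.cls (f^[i] x) e horb heI ?_ ?_
    · linarith
    · rw [he]; exact (min_le_right _ _).trans (by linarith [(W.orb i).2])
    · rw [← uIoo_of_le (by rw [he]; exact horb.2)]; exact hne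

lemma no_hit (E : ℝ) (hE : 0 < E) (D : ℕ) (hD : 0 < D) : ∃ i₁, ∀ i ≥ i₁, ∀ n e s k σ,
    (σ = 1 ∨ σ = -1) → Hit A B f f1 x n σ i e s → k < D →
    s ≤ E * (α * |Dm f f1 n x|) * (1 + k / D) →
    ¬ Free A B f f1 x n (i + 1) (f^[n] x + σ * (E * (α * |Dm f f1 n x|) * (1 + (k + 1 : ℕ) / D))) := by
  set ρ := c * (E / D) / ((C + 2 * E) * (2 * E)) with hρ
  have hc := W.hc
  have hC := W.hC
  have hD' : (0:ℝ) < D := by exact_mod_cast hD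
  have hρ0 : 0 < ρ := by positivity
  obtain ⟨i₁, hi₁⟩ := W.xr_half ρ hρ0
  obtain ⟨i₂, hi₂⟩ := W.far_gam (C / (ρ / 2))
  refine ⟨max i₁ i₂, fun i hi n e s k σ hσ hit hk hs hfree => ?_⟩
  obtain ⟨y, hy, hy2⟩ := hfree
  obtain ⟨m, rfl⟩ : ∃ m, n = m + (i + 1) := ⟨n - (i + 1), by have := hit.lt; omega⟩
  rw [show m + (i + 1) - (i + 1) = m by omega] at hy hy2
  have han := W.apos (m + (i + 1))
  set an := α * |Dm f f1 (m + (i + 1)) x| with han'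
  set t := E * an * (1 + (k + 1 : ℕ) / D) with ht
  have hts : E * an / D ≤ t - s := by
    have : t = E * an * (1 + k / D) + E * an / D := by rw [ht]; push_cast; ring
    linarith
  have hEan : 0 < E * an := by positivity
  have hst : s < t := by
    have : 0 < E * an / D := by positivity
    linarith
  have ht2 : t ≤ 2 * E * an := by
    have : ((k + 1 : ℕ) : ℝ) / D ≤ 1 := by
      rw [div_le_one hD']; exact_mod_cast hk
    rw [ht]; nlinarith
  have hmon := hit.mon
  rw [show m + (i + 1) - i = 1 + m by omega, Mon.add_iff W.hd W.hc1] at hmon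
  obtain ⟨hm1, hm2⟩ := hmon
  simp only [Function.iterate_one] at hm2
  rw [← Function.iterate_succ_apply' f] at hm2
  have hval := hit.val
  rw [show m + (i + 1) - i = m + 1 by omega, Function.iterate_succ_apply] at hval
  have hadd : f^[m] (f^[i + 1] x) = f^[m + (i + 1)] x := by rw [← Function.iterate_add_apply]
  have hv : f e ∈ uIoo (f^[i + 1] x) y := by
    rw [mem_uIoo_iff]
    refine ⟨Mon.compare W.hd W.hc1 hm2 hy (fun j _ => ?_) hσ (by rw [hval, hadd]) (by rw [hy2, hadd])
      hit.pos.le hst.le, ?_, ?_⟩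
    · rw [← Function.iterate_add_apply]; exact W.ne _
    · intro h0
      rw [h0, hadd] at hval
      have := hit.pos
      rcases hσ with rfl | rfl <;> linarith
    · intro h0
      rw [h0, hy2] at hval
      rcases hσ with rfl | rfl <;> linarith
  have hyne : y ≠ f^[i + 1] x := by
    rintro rfl
    rw [hadd] at hy2
    have := hit.pos.trans hst
    rcases hσ with rfl | rfl <;> linarith
  obtain ⟨h, hend, hopp⟩ := W.exists_opp (i + 1) hyne
  obtain ⟨o1, o2, _⟩ := W.xr_bd hend hopp hy hv
  have hb := W.end_bd (hend.iter m)
  have hge := xr_ge (c := c) (C := C) hσ hit.pos hst hval hy2 han hc hb.1 hb.2 o2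
  have hρle : ρ ≤ xr (f^[m] h) (f^[m + (i + 1)] x) (f^[m] (f e)) (f^[m] y) := by
    refine le_trans ?_ hge
    have hs0 := hit.pos
    calc ρ = c * an * (E * an / D) / ((C * an + 2 * E * an) * (2 * E * an)) := by
          rw [hρ]; field_simp
      _ ≤ _ := by
        have hs2 : s ≤ 2 * E * an := by linarith
        gcongr
  have hx := hi₁ (i + 1) (by have := le_max_left i₁ i₂; omega) m (f e) y h hend hopp hy hv hρle
  have hL := mid_le o1 (by positivity) hx (W.end_bd hend).2
  have := hi₂ i ((le_max_right _ _).trans hi) e hit.gam hm1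
  rw [div_mul_eq_mul_div] at this
  linarith

end Wand

namespace Wand

variable {A B a b K μ K' α c C : ℝ} {f f1 f2 f3 : ℝ → ℝ} {x l r : ℝ}
variable (W : Wand A B a b K μ K' α c C f f1 f2 f3 x l r)
include W

/-- Two hits at the same obstruction from the same side: the later orbit point is farther away. -/
lemma hit_order {n i i' : ℕ} {σ e s s' : ℝ} (hσ : σ = 1 ∨ σ = -1) (h : Hit A B f f1 x n σ i e s)
    (h' : Hit A B f f1 x n σ i' e s') (hi : i < i') (hs : s ≤ s')
    (hside : e < f^[i] x ↔ e < f^[i'] x) : f^[i] x ∈ uIcc (f^[i'] x) e := by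
  by_contra hcon
  have hmem : f^[i'] x ∈ uIcc (f^[i] x) e := by
    have h1 := h.ne
    have h2 := h'.ne
    rw [mem_uIcc] at hcon ⊢
    by_contra hcon'
    push Not at hcon hcon'
    rcases lt_or_gt_of_ne h1 with g | g
    · have g2 := hside.1 g
      linarith [hcon.2 g.le, hcon'.2 g2.le]
    · have g2 : f^[i'] x < e := lt_of_le_of_ne (not_lt.1 (fun hh => absurd (hside.2 hh) (by linarith))) h2.symm
      by_cases h3 : f^[i'] x ≤ f^[i] x
      · linarith [hcon.1 h3]
      · linarith [hcon'.1 (by linarith)]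
  obtain ⟨d, rfl⟩ := Nat.exists_eq_add_of_lt hi
  have hlt := h'.lt
  have hmon := h.mon
  rw [show n - i = (d + 1) + (n - (i + d + 1)) by omega, Mon.add_iff W.hd W.hc1] at hmon
  obtain ⟨hm1, hm2⟩ := hmon
  have hx1 : f^[d + 1] (f^[i] x) = f^[i + d + 1] x := by
    rw [← Function.iterate_add_apply]; congr 1; omega
  rw [hx1] at hm2
  have hv := h.val
  rw [show n - i = (n - (i + d + 1)) + (d + 1) by omega, Function.iterate_add_apply] at hv
  have hz : f^[n - (i + d + 1)] (f^[i + d + 1] x) = f^[n] x := iterate_sub_apply (by omega) x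
  have hcomp : f^[d + 1] e ∈ uIcc (f^[i + d + 1] x) e :=
    Mon.compare W.hd W.hc1 hm2 h'.mon (fun j _ => by rw [← Function.iterate_add_apply]; exact W.ne _)
      hσ (by rw [hv, hz]) (by rw [h'.val, hz]) h.pos.le hs
  have hfc : Continuous f := continuous_iff_continuousAt.2 fun x => (W.hd x).continuousAt
  obtain ⟨y, hy⟩ := trap (F := f^[d + 1]) (A := A) (B := B) (Ω := uIcc (f^[i] x) e) ordConnected_uIcc
    (by
      intro v hv
      simpa using (hm1 0 (by omega) v hv).1)
    (hfc.iterate _).continuousOn (hm1.injOn W.hd W.hc1) (fun v hv => by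
      have := hm1.mem W.hd W.hc1 hv
      rw [hx1] at this
      exact uIcc_subset_uIcc hmem (uIcc_subset_uIcc hmem right_mem_uIcc hcomp) this)
    (x := f^[i] x) left_mem_uIcc
  refine W.nattr (2 * (d + 1)) (by omega) i ⟨y, ?_⟩
  convert hy using 2 with m
  rw [← Function.iterate_mul]; congr 1; ring

lemma no_tower (E : ℝ) : ∃ D : ℕ, 0 < D ∧ ∀ n σ (i : ℕ → ℕ) (e s : ℕ → ℝ),
    (σ = 1 ∨ σ = -1) → (∀ j ≤ n, α * |Dm f f1 n x| ≤ α * |Dm f f1 j x|) →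
    (∀ k ≤ D, Hit A B f f1 x n σ (i k) (e k) (s k) ∧ s k ≤ 2 * E * (α * |Dm f f1 n x|)) →
    ¬ (∀ k k', k < k' → k' ≤ D → i k < i k' ∧ s k ≤ s k') := by
  classical
  have hc := W.hc
  obtain ⟨N, hN⟩ := Cls.coloring A B K μ W.hμ
  obtain ⟨col, hcol⟩ := hN _ _ _ _ W.cls
  obtain ⟨Q, hQ⟩ := exists_nat_gt (2 * E / c + 1)
  refine ⟨N * 2 * Q + 1, by omega, fun n σ i e s hσ hrec hit hmono => ?_⟩
  set D := N * 2 * Q + 1 with hD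
  obtain ⟨⟨cc, bb⟩, -, hcard⟩ := Finset.exists_lt_card_fiber_of_mul_lt_card_of_maps_to
    (s := Finset.range (D + 1)) (t := (Finset.univ : Finset (Fin N × Bool)))
    (f := fun k => (col (e k), decide (e k < f^[i k] x))) (n := Q) (fun _ _ => Finset.mem_univ _)
    (by simp [hD])
  set S := {k ∈ Finset.range (D + 1) | (col (e k), decide (e k < f^[i k] x)) = (cc, bb)} with hS
  have hne : S.Nonempty := Finset.card_pos.1 (by omega)
  set k₀ := S.max' hne with hk₀
  have hk₀S := S.max'_mem hne
  have hprop : ∀ k ∈ S, k ≤ D ∧ col (e k) = cc ∧ decide (e k < f^[i k] x) = bb := by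
    intro k hk
    simp only [hS, Finset.mem_filter, Finset.mem_range, Prod.mk.injEq] at hk
    exact ⟨by omega, hk.2⟩
  obtain ⟨hk₀D, hk₀c, hk₀b⟩ := hprop k₀ hk₀S
  obtain ⟨hit0, hs0⟩ := hit k₀ hk₀D
  have han := W.apos n
  have hle : ∀ k ∈ S, i k ≤ i k₀ := by
    intro k hk
    rcases (S.le_max' k hk).eq_or_lt with h | h
    · rw [hk₀, ← h]
    · exact (hmono k k₀ h hk₀D).1.le
  have hpt : ∀ k ∈ S, f^[n - i k₀ + i k] x ∈ uIcc (f^[n] x) (f^[n] x + σ * s k₀) := by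
    intro k hk
    rcases (S.le_max' k hk).eq_or_lt with h | h
    · rw [← hk₀] at h
      rw [h, show n - i k₀ + i k₀ = n by have := hit0.lt; omega]
      exact left_mem_uIcc
    · obtain ⟨hkD, hkc, hkb⟩ := hprop k hk
      obtain ⟨hit1, hs1⟩ := hit k hkD
      have hee : e k = e k₀ := hcol hit1.gam hit0.gam (hkc.trans hk₀c.symm)
      rw [hee] at hit1
      have := W.hit_order hσ hit1 hit0 (hmono k k₀ h hk₀D).1 (hmono k k₀ h hk₀D).2 (by
        have := hkb.trans hk₀b.symm
        rw [decide_eq_decide, hee] at this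
        exact this)
      have := hit0.mon.mem W.hd W.hc1 this
      rw [hit0.val, iterate_sub_apply hit0.lt.le, ← Function.iterate_add_apply] at this
      exact this
  have := sep_card S (fun k => f^[n - i k₀ + i k] x) (u := min (f^[n] x) (f^[n] x + σ * s k₀))
    (L := s k₀) (δ := c * (α * |Dm f f1 n x|)) (mul_pos hc han) (by
      intro k hk
      have := hpt k hk
      have hp := hit0.pos
      rw [mem_uIcc] at this
      rcases hσ with rfl | rfl
      · rw [min_eq_left (by linarith)]
        rcases this with h | h <;> constructor <;> linarith [h.1, h.2]
      · rw [min_eq_right (by linarith)]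
        rcases this with h | h <;> constructor <;> linarith [h.1, h.2]) (by
      intro k hk k' hk' hkk
      have hidx : i k ≠ i k' := by
        rcases lt_or_gt_of_ne hkk with h | h
        · exact (hmono k k' h (hprop k' hk').1).1.ne
        · exact (hmono k' k h (hprop k hk).1).1.ne'
      have := W.sep (i := n - i k₀ + i k') (j := n - i k₀ + i k) (by omega)
      refine le_trans (mul_le_mul_of_nonneg_left (hrec _ ?_) hc.le) this
      have := hle k' hk'
      have := hit0.lt
      omega) hit0.pos.le
  have h2 : s k₀ / (c * (α * |Dm f f1 n x|)) ≤ 2 * E / c := by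
    rw [div_le_div_iff₀ (mul_pos hc han) hc]
    calc _ ≤ 2 * E * (α * |Dm f f1 n x|) * c := mul_le_mul_of_nonneg_right hs0 hc.le
      _ = _ := by ring
  have h3 : (Q : ℝ) < S.card := by exact_mod_cast hcard
  linarith

/-- At late record times the branches through the orbit have large reach. -/
lemma free (E : ℝ) (hE : 0 < E) : ∃ i₁, ∀ n ≥ i₁,
    (∀ j ≤ n, α * |Dm f f1 n x| ≤ α * |Dm f f1 j x|) → ∀ σ, (σ = 1 ∨ σ = -1) →
    Free A B f f1 x n i₁ (f^[n] x + σ * (E * (α * |Dm f f1 n x|))) := by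
  obtain ⟨D, hD, htower⟩ := W.no_tower E
  obtain ⟨i₁, hi₁⟩ := W.no_hit E hE D hD
  refine ⟨i₁, fun n hn hrec σ hσ => ?_⟩
  by_contra hcon
  have han := W.apos n
  have hD' : (0:ℝ) < D := by exact_mod_cast hD
  have hEan : 0 < E * (α * |Dm f f1 n x|) := mul_pos hE han
  rcases hits (D := D) (lam := fun k => E * (α * |Dm f f1 n x|) * (1 + (k : ℝ) / D)) W.hd W.hc1 hn
    (fun j _ => W.orb' j) (fun j _ => W.ne j) hσ (by positivity) (by
      intro k k' hkk
      have : (k : ℝ) ≤ k' := by exact_mod_cast hkk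
      dsimp only
      gcongr) (by simpa using hcon) with ⟨i, e, s, k, hi, hk, hit, hs, hfree⟩ | ⟨i, e, s, h1, h2⟩
  · exact hi₁ i hi n e s k σ hσ hit hk hs hfree
  · refine htower n σ i e s hσ hrec (fun k hk => ⟨(h1 k hk).2.1, (h1 k hk).2.2.trans ?_⟩) h2
    have : (k : ℝ) / D ≤ 1 := by rw [div_le_one hD']; exact_mod_cast hk
    nlinarith

end Wand

/-- Branches of unbounded length with uniform reach beyond their marked points give a homterval. -/
lemma Seg.of_unif {A B z τ δ : ℝ} {f f1 : ℝ → ℝ} {S : Set ℕ} {i : ℕ} {d : ℕ → ℝ} (hτ : τ = 1 ∨ τ = -1)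
    (hδ : 0 < δ) (hS : S.Infinite) (hd : ∀ n ∈ S, 0 ≤ d n)
    (hm : ∀ n ∈ S, Mon A B f f1 (n - i) z (z + τ * (d n + δ))) (hz : Hom A B f f1 z) :
    ∃ n ∈ S, z + τ * d n ∈ Seg A B f f1 z := by
  have hb : BddBelow (d '' S) := ⟨0, by rintro _ ⟨n, hn, rfl⟩; exact hd n hn⟩
  obtain ⟨_, ⟨n, hn, rfl⟩, hlt⟩ := exists_lt_of_csInf_lt (hS.nonempty.image d)
    (lt_add_of_pos_right (sInf (d '' S)) hδ)
  refine ⟨n, hn, fun u hu j => ?_⟩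
  obtain ⟨s, hs0, hs, rfl⟩ := (mem_uIcc_add hτ (hd n hn)).1 hu
  obtain ⟨n', hn', hlt'⟩ := hS.exists_gt (i + j)
  have h1 : sInf (d '' S) ≤ d n' := csInf_le hb ⟨n', hn', rfl⟩
  obtain ⟨h2, h3⟩ := hm n' hn' j (by omega) (z + τ * s)
    ((mem_uIcc_add hτ (by linarith [hd n' hn'])).2 ⟨s, hs0, by linarith, rfl⟩)
  refine ⟨h2, ?_⟩
  rcases hs0.eq_or_lt with h0 | h0
  · rw [← h0, mul_zero, add_zero]; exact (hz j).2
  · refine h3 ?_ ?_ <;> intro h <;> rcases hτ with rfl | rfl <;> linarith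

namespace Wand

variable {A B a b K μ K' α c C : ℝ} {f f1 f2 f3 : ℝ → ℝ} {x l r : ℝ}
variable (W : Wand A B a b K μ K' α c C f f1 f2 f3 x l r)
include W

lemma lift_bd {i n : ℕ} {u w E : ℝ} (hi : i ≤ n) (hu : u ∈ Seg A B f f1 (f^[i] x))
    (hw : w ∈ Seg A B f f1 (f^[i] x)) (hE : C < E)
    (hu2 : f^[n - i] u = f^[n] x + -1 * (E * (α * |Dm f f1 n x|)))
    (hw2 : f^[n - i] w = f^[n] x + 1 * (E * (α * |Dm f f1 n x|))) :
    1 + (E - C) / (2 * C) ≤ (1 + (B - A) / (c * (α * |Dm f f1 i x|))) * Real.exp (K' * (B - A) ^ 2) := by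
  obtain ⟨m, rfl⟩ := Nat.exists_eq_add_of_le' hi
  rw [show m + i - i = m by omega] at hu2 hw2
  have hC := W.hC
  have hc := W.hc
  have han := W.apos (m + i)
  have hai := W.apos i
  set an := α * |Dm f f1 (m + i) x| with han'
  set ai := α * |Dm f f1 i x| with hai'
  have hAB := W.AB
  have hE0 : 0 < E * an := mul_pos (hC.trans hE) han
  have hz : ∀ j < m, f1 (f^[j] (f^[i] x)) ≠ 0 := fun j _ => by
    rw [← Function.iterate_add_apply]; exact W.ne _
  have hadd : ∀ j, f^[j] (f^[i] x) = f^[j + i] x := fun j => by rw [← Function.iterate_add_apply]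
  have hux : u ≠ f^[i] x := by rintro rfl; rw [hadd] at hu2; linarith
  have hwx : w ≠ f^[i] x := by rintro rfl; rw [hadd] at hw2; linarith
  have s1 := (Seg.mon hu m).same_sign W.hd W.hc1 hz hux
  have s2 := (Seg.mon hw m).same_sign W.hd W.hc1 hz hwx
  rw [hadd, hu2] at s1
  rw [hadd, hw2] at s2
  obtain ⟨h, he, hside⟩ := W.exists_end i hwx
  have hhx : h ≠ f^[i] x := by rintro rfl; simp at hside
  have s3 := (Seg.mon (W.end_seg he) m).same_sign W.hd W.hc1 hz hhx
  rw [hadd] at s3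
  have hb := W.end_bd he
  have hb2 := W.end_bd (he.iter m)
  have hCE : C * an < E * an := mul_lt_mul_of_pos_right hE han
  -- the image of `h` lies on the right
  have hpos : 0 < f^[m] h - f^[m + i] x := by
    by_contra hcon
    push Not at hcon
    have e1 : 0 < (w - f^[i] x) * Dm f f1 m (f^[i] x) := by
      refine pos_of_mul_pos_right (a := E * an) ?_ hE0.le
      calc 0 < _ := s2
        _ = _ := by ring
    have e2 : (h - f^[i] x) * Dm f f1 m (f^[i] x) < 0 := by
      by_contra h0
      push Not at h0
      nlinarith [mul_nonneg (neg_nonneg.2 hcon) h0]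
    nlinarith [mul_pos e1 (neg_pos.2 e2), sq_nonneg (Dm f f1 m (f^[i] x))]
  rw [abs_of_pos hpos] at hb2
  have hmem : h ∈ uIcc (f^[i] x) w := Mon.compare W.hd W.hc1 (Seg.mon (W.end_seg he) m) (Seg.mon hw m) hz
    (σ := 1) (Or.inl rfl) (s := f^[m] h - f^[m + i] x) (s' := E * an)
    (by rw [hadd]; ring) (by rw [hadd, hw2]) hpos.le (by linarith [hb2.2])
  have hhw : h ≠ w := by rintro rfl; rw [hw2] at hb2; linarith [hb2.2]
  have hopp : (u - f^[i] x) * (w - f^[i] x) < 0 := by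
    by_contra h0
    push Not at h0
    nlinarith [mul_pos s1 s2, mul_nonneg h0 (sq_nonneg (Dm f f1 m (f^[i] x))), mul_pos hE0 hE0]
  have hord : Ord4 u (f^[i] x) h w := by
    have h' := mem_uIoo_iff.2 ⟨hmem, hhx, hhw⟩
    rw [uIoo] at h'
    rcases mul_neg_iff.1 hopp with ⟨h1, h2⟩ | ⟨h1, h2⟩
    · rw [min_eq_right (by linarith), max_eq_left (by linarith)] at h'
      right; exact ⟨h'.1, h'.2, by linarith⟩
    · rw [min_eq_left (by linarith), max_eq_right (by linarith)] at h'
      left; exact ⟨by linarith, h'.1, h'.2⟩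
  have hmem2 : f^[i] x ∈ uIcc u w := by
    rw [mem_uIcc]
    rcases hord with h | h
    · left; constructor <;> linarith [h.1, h.2.1, h.2.2]
    · right; constructor <;> linarith [h.1, h.2.1, h.2.2]
  have hM : Mon A B f f1 m u w := (Seg.mon hu m).concat (Seg.mon hw m) hz hmem2
  have hsum : ∑ j ∈ Finset.range m, |f^[j] (f^[i] x) - f^[j] u| * |f^[j] w - f^[j] h| ≤ (B - A) ^ 2 := by
    have e1 := W.sum_seg ((Finset.range m).map (addRightEmbedding i)) (fun j => f^[j - i] u) (by
      intro j hj
      simp only [Finset.mem_map, Finset.mem_range, addRightEmbedding_apply] at hj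
      obtain ⟨j, hj, rfl⟩ := hj
      rw [Nat.add_sub_cancel, ← hadd]
      exact Seg.image W.hd hu j)
    rw [Finset.sum_map] at e1
    simp only [addRightEmbedding_apply, Nat.add_sub_cancel] at e1
    calc _ ≤ ∑ j ∈ Finset.range m, |f^[j] u - f^[j + i] x| * (B - A) := by
          refine Finset.sum_le_sum fun j hj => ?_
          rw [hadd, abs_sub_comm]
          refine mul_le_mul_of_nonneg_left ?_ (abs_nonneg _)
          have h2 := (hM j (Finset.mem_range.1 hj) w right_mem_uIcc).1
          have h3 := (W.end_seg he h right_mem_uIcc j).1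
          rw [abs_le]; constructor <;> linarith [h2.1, h2.2, h3.1, h3.2]
      _ = (∑ j ∈ Finset.range m, |f^[j] u - f^[j + i] x|) * (B - A) := by rw [Finset.sum_mul]
      _ ≤ (B - A) * (B - A) := mul_le_mul_of_nonneg_right e1 (by linarith)
      _ = _ := by ring
  have hle := hM.xr_le W.st hord hsum
  refine le_trans ?_ (hle.trans (mul_le_mul_of_nonneg_right ?_ (Real.exp_pos _).le))
  · rw [xr, hadd, hu2, hw2]
    have d1 : |f^[m + i] x - (f^[m + i] x + -1 * (E * an))| = E * an := by
      rw [show f^[m + i] x - (f^[m + i] x + -1 * (E * an)) = E * an by ring, abs_of_pos hE0]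
    have d2 : |f^[m + i] x + 1 * (E * an) - (f^[m + i] x + -1 * (E * an))| = 2 * (E * an) := by
      rw [show f^[m + i] x + 1 * (E * an) - (f^[m + i] x + -1 * (E * an)) = 2 * (E * an) by ring,
        abs_of_pos (by positivity)]
    have d3 : (E - C) * an ≤ |f^[m + i] x + 1 * (E * an) - f^[m] h| := by
      refine le_trans ?_ (le_abs_self _)
      linarith [hb2.2]
    rw [d1, d2, abs_of_pos hpos]
    have : (E - C) / (2 * C) ≤ E * an * |f^[m + i] x + 1 * (E * an) - f^[m] h| /
        (2 * (E * an) * (f^[m] h - f^[m + i] x)) := by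
      calc (E - C) / (2 * C) = E * an * ((E - C) * an) / (2 * (E * an) * (C * an)) := by
            have := hC.trans hE
            field_simp
        _ ≤ _ := by
          have : 0 ≤ (E - C) * an := mul_nonneg (by linarith) han.le
          gcongr
          exact hb2.2
    linarith
  · refine add_le_add le_rfl ?_
    rw [xr]
    have g1 : |w - h| ≤ |w - u| := by
      rcases hord with o | o
      · rw [abs_of_pos (by linarith [o.1, o.2.1, o.2.2]), abs_of_pos (by linarith [o.1, o.2.1, o.2.2])]
        linarith [o.1, o.2.1, o.2.2]
      · rw [abs_of_neg (by linarith [o.1, o.2.1, o.2.2]), abs_of_neg (by linarith [o.1, o.2.1, o.2.2])]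
        linarith [o.1, o.2.1, o.2.2]
    have g2 : 0 < |w - h| := abs_pos.2 (sub_ne_zero.2 hhw.symm)
    have g3 : |f^[i] x - u| ≤ B - A := by
      have p1 := Ioo_subset_Icc_self (W.orb' i)
      have p2 := seg_mem hu
      rw [abs_le]; constructor <;> linarith [p1.1, p1.2, p2.1, p2.2]
    have g4 : 0 < c * ai := mul_pos hc hai
    have g5 : 0 < |w - u| := g2.trans_le g1
    have g6 : 0 < B - A := by linarith
    calc _ ≤ (B - A) * |w - u| / (|w - u| * (c * ai)) := by
          gcongr
          exact hb.1
      _ = _ := by field_simp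

end Wand

namespace Wand

variable {A B a b K μ K' α c C : ℝ} {f f1 f2 f3 : ℝ → ℝ} {x l r : ℝ}
variable (W : Wand A B a b K μ K' α c C f f1 f2 f3 x l r)
include W

/-- If the half-way lift is not in the homterval, the branch reaches definitely further. -/
lemma overshoot (E : ℝ) (hE : 0 < E) : ∃ i₁, ∀ i ≥ i₁, ∃ δ > 0, ∀ n ≥ i, ∀ σ, (σ = 1 ∨ σ = -1) →
    Free A B f f1 x n i (f^[n] x + σ * (E * (α * |Dm f f1 n x|))) →
    (∃ v ∈ Seg A B f f1 (f^[i] x), f^[n - i] v = f^[n] x + σ * (E / 2 * (α * |Dm f f1 n x|))) ∨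
    ∃ τ d, (τ = 1 ∨ τ = -1) ∧ 0 ≤ d ∧ f^[i] x + τ * d ∉ Seg A B f f1 (f^[i] x) ∧
      Mon A B f f1 (n - i) (f^[i] x) (f^[i] x + τ * (d + δ)) := by
  have hc := W.hc
  have hC := W.hC
  set ρ := c / (C + E) with hρ
  have hρ0 : 0 < ρ := by positivity
  obtain ⟨i₁, hi₁⟩ := W.xr_half ρ hρ0
  refine ⟨i₁, fun i hi => ?_⟩
  have hai := W.apos i
  set ai := α * |Dm f f1 i x| with hai'
  refine ⟨(ρ / 2) * (c * ai) ^ 2 / (C * ai), by positivity, fun n hn σ hσ hfree => ?_⟩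
  obtain ⟨y, hy, hy2⟩ := hfree
  obtain ⟨m, rfl⟩ := Nat.exists_eq_add_of_le' hn
  rw [show m + i - i = m by omega] at hy hy2 ⊢
  have han := W.apos (m + i)
  set an := α * |Dm f f1 (m + i) x| with han'
  have hadd : ∀ j, f^[j] (f^[i] x) = f^[j + i] x := fun j => by rw [← Function.iterate_add_apply]
  have hEan : 0 < E * an := mul_pos hE han
  have hE2 : 0 < E / 2 * an := by positivity
  obtain ⟨v, hv, hv2⟩ := Mon.surj W.hd m (u := f^[i] x) (w := y) (y := f^[m + i] x + σ * (E / 2 * an))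
    (by rw [hadd, hy2, mem_uIcc_add hσ hEan.le]; exact ⟨_, hE2.le, by linarith, rfl⟩)
  by_cases hseg : v ∈ Seg A B f f1 (f^[i] x)
  · exact Or.inl ⟨v, hseg, hv2⟩
  right
  have hvx : v ≠ f^[i] x := fun h => hseg (by rw [h]; exact W.self_seg i)
  have hvy : v ≠ y := by
    rintro rfl
    rw [hv2] at hy2
    rcases hσ with rfl | rfl <;> linarith
  have hv' := mem_uIoo_iff.2 ⟨hv, hvx, hvy⟩
  have hyx : y ≠ f^[i] x := by
    rintro rfl; rw [uIcc_self] at hv; exact hvx hv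
  obtain ⟨h, hend, hopp⟩ := W.exists_opp i hyx
  obtain ⟨o1, o2, _⟩ := W.xr_bd hend hopp hy hv'
  have hb := W.end_bd (hend.iter m)
  have hge := xr_ge (c := c) (C := C) hσ hE2 (by linarith : E / 2 * an < E * an) hv2 hy2 han hc hb.1 hb.2 o2
  have hρle : ρ ≤ xr (f^[m] h) (f^[m + i] x) (f^[m] v) (f^[m] y) := by
    refine le_trans (le_of_eq ?_) hge
    rw [hρ]; field_simp; ring
  have hx := hi₁ i hi m v y h hend hopp hy hv' hρle
  have hJ := W.far hseg
  have hL := (W.end_bd hend).2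
  have h0 : 0 < |y - v| := abs_pos.2 (sub_ne_zero.2 hvy.symm)
  have hyh : |v - f^[i] x| ≤ |y - h| := by
    rcases o1 with o | o
    · rw [abs_of_pos (by linarith [o.1, o.2.1, o.2.2]), abs_of_pos (by linarith [o.1, o.2.1, o.2.2])]
      linarith [o.1, o.2.1, o.2.2]
    · rw [abs_of_neg (by linarith [o.1, o.2.1, o.2.2]), abs_of_neg (by linarith [o.1, o.2.1, o.2.2])]
      linarith [o.1, o.2.1, o.2.2]
  have hJ0 : 0 < c * ai := mul_pos hc hai
  have hδ : (ρ / 2) * (c * ai) ^ 2 / (C * ai) ≤ |y - v| := by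
    rw [div_le_iff₀ (by positivity)]
    rw [xr, le_div_iff₀ (mul_pos (by linarith) (by linarith)), abs_sub_comm (f^[i] x) h] at hx
    calc (ρ / 2) * (c * ai) ^ 2 = (ρ / 2) * ((c * ai) * (c * ai)) := by ring
      _ ≤ (ρ / 2) * (|y - h| * |v - f^[i] x|) := by gcongr; linarith
      _ ≤ |h - f^[i] x| * |y - v| := hx
      _ ≤ C * ai * |y - v| := mul_le_mul_of_nonneg_right hL h0.le
      _ = _ := by ring
  rcases o1 with o | o
  · refine ⟨1, v - f^[i] x, Or.inl rfl, by linarith [o.2.1], by simpa using hseg, ?_⟩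
    refine hy.sub left_mem_uIcc ?_
    rw [abs_of_pos (by linarith [o.2.2])] at hδ
    rw [mem_uIcc]
    left
    have : (0:ℝ) < (ρ / 2) * (c * ai) ^ 2 / (C * ai) := by positivity
    constructor <;> linarith [o.2.1]
  · refine ⟨-1, f^[i] x - v, Or.inr rfl, by linarith [o.2.1], by simpa using hseg, ?_⟩
    refine hy.sub left_mem_uIcc ?_
    rw [abs_of_neg (by linarith [o.1])] at hδ
    rw [mem_uIcc]
    right
    have : (0:ℝ) < (ρ / 2) * (c * ai) ^ 2 / (C * ai) := by positivity
    constructor <;> linarith [o.2.1]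

/-- At some late record time both half-way lifts lie in the homterval. -/
lemma exists_lifts (E : ℝ) (hE : 0 < E) (M : ℕ) : ∃ i ≥ M, ∃ n ≥ i, ∀ σ, (σ = 1 ∨ σ = -1) →
    ∃ v ∈ Seg A B f f1 (f^[i] x), f^[n - i] v = f^[n] x + σ * (E / 2 * (α * |Dm f f1 n x|)) := by
  obtain ⟨i₁, hi₁⟩ := W.free E hE
  obtain ⟨i₂, hi₂⟩ := W.overshoot E hE
  set i := max M (max i₁ i₂) with hi
  have hM : M ≤ i := le_max_left _ _
  have h1 : i₁ ≤ i := (le_max_left _ _).trans (le_max_right _ _)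
  have h2 : i₂ ≤ i := (le_max_right _ _).trans (le_max_right _ _)
  obtain ⟨δ, hδ, hover⟩ := hi₂ i h2
  set S : ℝ → Set ℕ := fun τ => {n | ∃ d, 0 ≤ d ∧ f^[i] x + τ * d ∉ Seg A B f f1 (f^[i] x) ∧
      Mon A B f f1 (n - i) (f^[i] x) (f^[i] x + τ * (d + δ))} with hS
  have hfin : ∀ τ, (τ = 1 ∨ τ = -1) → (S τ).Finite := by
    intro τ hτ
    by_contra hinf
    have hch : ∀ n, ∃ d, n ∈ S τ → 0 ≤ d ∧ f^[i] x + τ * d ∉ Seg A B f f1 (f^[i] x) ∧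
      Mon A B f f1 (n - i) (f^[i] x) (f^[i] x + τ * (d + δ)) := fun n => by
      by_cases hn : n ∈ S τ
      · obtain ⟨d, hd⟩ := hn; exact ⟨d, fun _ => hd⟩
      · exact ⟨0, fun h => absurd h hn⟩
    choose d hd using hch
    obtain ⟨n, hn, hseg⟩ := Seg.of_unif hτ hδ hinf (fun n hn => (hd n hn).1) (fun n hn => (hd n hn).2.2)
      ((W.hom x ⟨W.lx.le, W.hxr.le⟩).iter i)
    exact (hd n hn).2.1 hseg
  obtain ⟨M1, hM1⟩ := (hfin 1 (Or.inl rfl)).bddAbove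
  obtain ⟨M2, hM2⟩ := (hfin (-1) (Or.inr rfl)).bddAbove
  obtain ⟨n, hn, hrec⟩ := W.exists_record (i + M1 + M2 + 1)
  refine ⟨i, hM, n, by omega, fun σ hσ => ?_⟩
  rcases hover n (by omega) σ hσ (Free.later W.hd W.hc1 h1 (by omega) (hi₁ n (by omega) hrec σ hσ))
    with h | ⟨τ, d, hτ, hd⟩
  · exact h
  · exfalso
    rcases hτ with rfl | rfl
    · have := hM1 (show n ∈ S 1 from ⟨d, hd⟩); omega
    · have := hM2 (show n ∈ S (-1) from ⟨d, hd⟩); omega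

protected lemma false : False := by
  obtain ⟨i₀, h₀⟩ := W.pulls
  have hc := W.hc
  have hC := W.hC
  have hai := W.apos i₀
  have hAB := W.AB
  set M := (1 + (B - A) / (c * (α * |Dm f f1 i₀ x|))) * Real.exp (K' * (B - A) ^ 2) with hM
  have hM0 : 0 < M := by
    have : 0 < (B - A) / (c * (α * |Dm f f1 i₀ x|)) := div_pos (by linarith) (mul_pos hc hai)
    positivity
  obtain ⟨i, hi, n, hn, hl⟩ := W.exists_lifts (2 * (C + 2 * C * M)) (by positivity) i₀
  have key : ∀ σ, (σ = 1 ∨ σ = -1) → ∃ v ∈ Seg A B f f1 (f^[i₀] x),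
      f^[n - i₀] v = f^[n] x + σ * ((C + 2 * C * M) * (α * |Dm f f1 n x|)) := by
    intro σ hσ
    obtain ⟨v, hv, hv2⟩ := hl σ hσ
    obtain ⟨k, rfl⟩ := Nat.exists_eq_add_of_le' hi
    obtain ⟨u, hu, hu2⟩ := h₀ i₀ le_rfl k v hv
    refine ⟨u, hu, ?_⟩
    rw [show n - i₀ = n - (k + i₀) + k by omega, Function.iterate_add_apply, hu2, hv2]
    ring
  obtain ⟨w, hw, hw2⟩ := key 1 (Or.inl rfl)
  obtain ⟨u, hu, hu2⟩ := key (-1) (Or.inr rfl)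
  have := W.lift_bd (hi.trans hn) hu hw (E := C + 2 * C * M) (by nlinarith [mul_pos hC hM0]) hu2 hw2
  rw [← hM, show C + 2 * C * M - C = 2 * C * M by ring, mul_div_cancel_left₀ M (by positivity)] at this
  linarith

end Wand

/-- The nonlinearity of the `m`-th iterate. -/
noncomputable def Nl (g g1 g2 : ℝ → ℝ) (m : ℕ) (x : ℝ) : ℝ :=
  ∑ j ∈ Finset.range m, g2 (g^[j] x) / g1 (g^[j] x) * Dm g g1 j x

/-- The Schwarzian derivative of `g` in terms of given derivatives. -/
noncomputable def Sw (g1 g2 g3 : ℝ → ℝ) (x : ℝ) : ℝ := g3 x / g1 x - 3 / 2 * (g2 x / g1 x) ^ 2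

lemma Nl_succ (g g1 g2 : ℝ → ℝ) (m : ℕ) (x : ℝ) : Nl g g1 g2 (m + 1) x =
    Nl g g1 g2 m x + g2 (g^[m] x) / g1 (g^[m] x) * Dm g g1 m x := by
  simp [Nl, Finset.sum_range_succ]

section
variable {g g1 g2 g3 : ℝ → ℝ} (h0 : ∀ x, HasDerivAt g (g1 x) x) (h1 : ∀ x, HasDerivAt g1 (g2 x) x)
  (h2 : ∀ x, HasDerivAt g2 (g3 x) x)

include h0 h1 in
lemma hasDerivAt_Dm {m : ℕ} {x : ℝ} (hx : ∀ j < m, g1 (g^[j] x) ≠ 0) :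
    HasDerivAt (Dm g g1 m) (Nl g g1 g2 m x * Dm g g1 m x) x := by
  induction m with
  | zero =>
    have : Dm g g1 0 = fun _ => 1 := by funext y; exact Dm_zero ..
    rw [this]
    simpa [Nl] using hasDerivAt_const x (1:ℝ)
  | succ m ih =>
    have e : Dm g g1 (m + 1) = fun y => Dm g g1 m y * g1 (g^[m] y) := by
      funext y; exact Dm_succ ..
    rw [e]
    have hm := hx m (by omega)
    refine ((ih fun j hj => hx j (by omega)).mul
      ((h1 (g^[m] x)).comp x (hasDerivAt_iterate h0 m x))).congr_deriv ?_
    rw [Nl_succ]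
    simp only [Function.comp_apply]
    field_simp

include h0 h1 h2 in
lemma hasDerivAt_Nl {m : ℕ} {x : ℝ} (hx : ∀ j < m, g1 (g^[j] x) ≠ 0) :
    HasDerivAt (Nl g g1 g2 m)
      (∑ j ∈ Finset.range m, Sw g1 g2 g3 (g^[j] x) * Dm g g1 j x ^ 2 + Nl g g1 g2 m x ^ 2 / 2) x := by
  induction m with
  | zero =>
    have : Nl g g1 g2 0 = fun _ => 0 := by funext y; simp [Nl]
    rw [this]
    simpa using hasDerivAt_const x (0:ℝ)
  | succ m ih =>
    have e : Nl g g1 g2 (m + 1) = fun y => Nl g g1 g2 m y + g2 (g^[m] y) / g1 (g^[m] y) * Dm g g1 m y := by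
      funext y; exact Nl_succ ..
    have hm := hx m (by omega)
    have hx' : ∀ j < m, g1 (g^[j] x) ≠ 0 := fun j hj => hx j (by omega)
    have d := hasDerivAt_iterate h0 m x
    have key := (ih hx').add (((((h2 (g^[m] x)).comp x d).div ((h1 (g^[m] x)).comp x d) hm)).mul
      (hasDerivAt_Dm h0 h1 hx'))
    rw [Finset.sum_range_succ]
    rw [show Nl g g1 g2 (m + 1) x = Nl g g1 g2 m x + g2 (g^[m] x) / g1 (g^[m] x) * Dm g g1 m x by rw [e], e]
    refine key.congr_deriv ?_
    rw [Sw]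
    simp only [Function.comp_apply, Pi.div_apply]
    field_simp
    ring

/-- At an interior minimum of the derivative of an iterate the Schwarzian is nonnegative. -/
lemma schwarz_nonneg_of_min (h0 : ∀ x, HasDerivAt g (g1 x) x) (h1 : ∀ x, HasDerivAt g1 (g2 x) x)
    (h2 : ∀ x, HasDerivAt g2 (g3 x) x) {m : ℕ} {u v z : ℝ} (hz : z ∈ Ioo u v)
    (hne : ∀ x ∈ Ioo u v, ∀ j < m, g1 (g^[j] x) ≠ 0) (hpos : ∀ x ∈ Ioo u v, 0 < Dm g g1 m x)
    (hmin : ∀ x ∈ Ioo u v, Dm g g1 m z ≤ Dm g g1 m x) :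
    0 ≤ ∑ j ∈ Finset.range m, Sw g1 g2 g3 (g^[j] z) * Dm g g1 j z ^ 2 := by
  have hD : ∀ x ∈ Ioo u v, HasDerivAt (Dm g g1 m) (Nl g g1 g2 m x * Dm g g1 m x) x :=
    fun x hx => hasDerivAt_Dm h0 h1 (hne x hx)
  have hloc : IsLocalMin (Dm g g1 m) z := by
    filter_upwards [Ioo_mem_nhds hz.1 hz.2] with x hx using hmin x hx
  have hN : Nl g g1 g2 m z = 0 := by
    have := hloc.hasDerivAt_eq_zero (hD z hz)
    exact (mul_eq_zero.1 this).resolve_right (hpos z hz).ne'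
  have hN' := hasDerivAt_Nl h0 h1 h2 (hne z hz)
  rw [hN] at hN'
  set s := ∑ j ∈ Finset.range m, Sw g1 g2 g3 (g^[j] z) * Dm g g1 j z ^ 2
  by_contra hs
  push Not at hs
  have hlt : ∀ᶠ x in 𝓝[>] z, Nl g g1 g2 m x < 0 := by
    have h3 := hN'.hasDerivWithinAt (s := Ioi z)
    rw [hasDerivWithinAt_iff_tendsto_slope] at h3
    have h4 := h3.eventually (gt_mem_nhds (show s + 0 ^ 2 / 2 < 0 by simpa using hs))
    rw [show Ioi z \ {z} = Ioi z by simp] at h4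
    filter_upwards [h4, self_mem_nhdsWithin] with x hx hxz
    rw [slope_def_field, hN, sub_zero, div_neg_iff] at hx
    have : 0 < x - z := sub_pos.2 hxz
    rcases hx with ⟨_, h⟩ | ⟨h, _⟩
    · linarith
    · exact h
  obtain ⟨w, hw, hlt⟩ := mem_nhdsGT_iff_exists_Ioo_subset.1
    (hlt.and (Ioo_mem_nhdsGT hz.2))
  set y := (z + w) / 2
  have hzw : z < w := hw
  have hyI : y ∈ Ioo z w := ⟨by simp only [y]; linarith, by simp only [y]; linarith⟩
  have hyuv := (hlt hyI).2
  have hanti : StrictAntiOn (Dm g g1 m) (Icc z y) := by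
    refine strictAntiOn_of_deriv_neg (convex_Icc z y) (fun x hx => ?_) (fun x hx => ?_)
    · exact (hD x ⟨hz.1.trans_le hx.1, hx.2.trans_lt hyuv.2⟩).continuousAt.continuousWithinAt
    · rw [interior_Icc] at hx
      have hx' : x ∈ Ioo u v := ⟨hz.1.trans hx.1, hx.2.trans hyuv.2⟩
      rw [(hD x hx').deriv]
      exact mul_neg_of_neg_of_pos (hlt ⟨hx.1, hx.2.trans hyI.2⟩).1 (hpos x hx')
  have := hanti (left_mem_Icc.2 hyI.1.le) (right_mem_Icc.2 hyI.1.le) hyI.1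
  exact absurd (hmin y ⟨hz.1.trans hyI.1, hyuv.2⟩) (by linarith)

end

/-- A periodic orbit together with the cycle of intervals forming its immediate basin, for a map
whose critical points are not attracted by the orbit. -/
structure Cyc (A B a b K μ K' : ℝ) (g g1 g2 g3 : ℝ → ℝ) (n : ℕ) (p : ℝ) (u v : ℕ → ℝ) : Prop where
  cls : Cls A B K μ g g1 g2 g3
  st : Sturm A B K' g g1
  hμ : 0 < μ
  aA : A < a
  bB : b < B
  maps : MapsTo g (Icc a b) (Icc a b)
  n3 : 3 ≤ n
  sub : ∀ i, a ≤ u i ∧ v i ≤ b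
  img : ∀ i, ∀ x ∈ Ioo (u i) (v i), g x ∈ Ioo (u (i + 1)) (v (i + 1))
  ne : ∀ i, ∀ x ∈ Ioo (u i) (v i), g1 x ≠ 0
  disj : ∀ i j w, w ∈ Ioo (u i) (v i) → w ∈ Ioo (u j) (v j) → i % n = j % n
  peru : ∀ i, u (i + n) = u i
  perv : ∀ i, v (i + n) = v i
  fix : g^[n] p = p
  mem : ∀ i, g^[i] p ∈ Ioo (u i) (v i)
  endu : ∀ i, 1 ≤ Dm g g1 (2 * n) (u i)
  endv : ∀ i, 1 ≤ Dm g g1 (2 * n) (v i)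
  mid : ∀ i, Dm g g1 (2 * n) (g^[i] p) ≤ 1

/-- Three consecutive points of the orbit of `p` span at least `L`, with equality around `p`. -/
structure Tri (g : ℝ → ℝ) (p L : ℝ) : Prop where
  pos : 0 < L
  min : ∀ i j k, g^[i] p < g^[j] p → g^[j] p < g^[k] p → L ≤ g^[k] p - g^[i] p
  ex : ∃ i k, g^[i] p < p ∧ p < g^[k] p ∧ g^[k] p - g^[i] p = L

namespace Cyc
variable {A B a b K μ K' p L : ℝ} {g g1 g2 g3 : ℝ → ℝ} {n : ℕ} {u v : ℕ → ℝ}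

lemma shift (h : Cyc A B a b K μ K' g g1 g2 g3 n p u v) (k : ℕ) :
    Cyc A B a b K μ K' g g1 g2 g3 n (g^[k] p) (fun i => u (i + k)) (fun i => v (i + k)) where
  cls := h.cls
  st := h.st
  hμ := h.hμ
  aA := h.aA
  bB := h.bB
  maps := h.maps
  n3 := h.n3
  sub i := h.sub _
  img i x hx := by have := h.img _ x hx; rwa [add_right_comm] at this
  ne i x hx := h.ne _ x hx
  disj i j w hi hj := by
    have := h.disj _ _ w hi hj
    exact Nat.ModEq.add_right_cancel' k this
  peru i := by rw [add_right_comm]; exact h.peru _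
  perv i := by rw [add_right_comm]; exact h.perv _
  fix := by rw [← Function.iterate_add_apply, add_comm, Function.iterate_add_apply, h.fix]
  mem i := by rw [← Function.iterate_add_apply]; exact h.mem _
  endu i := h.endu _
  endv i := h.endv _
  mid i := by rw [← Function.iterate_add_apply]; exact h.mid _

lemma iter (h : Cyc A B a b K μ K' g g1 g2 g3 n p u v) {i : ℕ} {x : ℝ} (hx : x ∈ Ioo (u i) (v i))
    (m : ℕ) : g^[m] x ∈ Ioo (u (i + m)) (v (i + m)) := by
  induction m with
  | zero => exact hx
  | succ m ih => rw [Function.iterate_succ_apply']; exact h.img _ _ ih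

lemma orb (h : Cyc A B a b K μ K' g g1 g2 g3 n p u v) {z : ℝ} (hz : z ∈ Ioo (u 0) (v 0)) (m : ℕ) :
    g^[m] z ∈ Ioo (u m) (v m) := by have := h.iter hz m; rwa [zero_add] at this

lemma memIcc (h : Cyc A B a b K μ K' g g1 g2 g3 n p u v) {i : ℕ} {x : ℝ}
    (hx : x ∈ Ioo (u i) (v i)) : x ∈ Icc a b :=
  ⟨(h.sub i).1.trans hx.1.le, hx.2.le.trans (h.sub i).2⟩

lemma memIoo (h : Cyc A B a b K μ K' g g1 g2 g3 n p u v) {i : ℕ} {x : ℝ}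
    (hx : x ∈ Ioo (u i) (v i)) : x ∈ Ioo A B :=
  ⟨h.aA.trans_le (h.memIcc hx).1, (h.memIcc hx).2.trans_lt h.bB⟩

lemma ab (h : Cyc A B a b K μ K' g g1 g2 g3 n p u v) : a < b := by
  have := h.mem 0
  have h2 := h.sub 0
  linarith [this.1, this.2]

lemma inj (h : Cyc A B a b K μ K' g g1 g2 g3 n p u v) {i j : ℕ} (e : g^[i] p = g^[j] p) :
    i % n = j % n := h.disj i j _ (h.mem i) (e ▸ h.mem j)

lemma mod (h : Cyc A B a b K μ K' g g1 g2 g3 n p u v) (i : ℕ) : g^[i % n] p = g^[i] p := by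
  conv_rhs => rw [← Nat.mod_add_div i n, Function.iterate_add_apply, Function.iterate_mul]
  rw [Function.iterate_fixed h.fix]

lemma exists_tri (h : Cyc A B a b K μ K' g g1 g2 g3 n p u v) : ∃ j L, Tri g (g^[j] p) L := by
  classical
  set T : Finset (ℕ × ℕ × ℕ) := ((Finset.range n) ×ˢ (Finset.range n) ×ˢ (Finset.range n)).filter
    fun t => g^[t.1] p < g^[t.2.1] p ∧ g^[t.2.1] p < g^[t.2.2] p with hT
  have n0 : 0 < n := by have := h.n3; omega
  have mkT : ∀ i j k, g^[i] p < g^[j] p → g^[j] p < g^[k] p → (i % n, j % n, k % n) ∈ T := by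
    intro i j k h1 h2
    simp only [hT, Finset.mem_filter, Finset.mem_product, Finset.mem_range, h.mod]
    exact ⟨⟨Nat.mod_lt _ n0, Nat.mod_lt _ n0, Nat.mod_lt _ n0⟩, h1, h2⟩
  have hTne : T.Nonempty := by
    have d : ∀ i j, i < 3 → j < 3 → i ≠ j → g^[i] p ≠ g^[j] p := by
      intro i j hi hj hij e
      have := h.inj e
      have := h.n3
      rw [Nat.mod_eq_of_lt (by omega), Nat.mod_eq_of_lt (by omega)] at *
      omega
    have d01 := d 0 1 (by omega) (by omega) (by omega)
    have d12 := d 1 2 (by omega) (by omega) (by omega)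
    have d02 := d 0 2 (by omega) (by omega) (by omega)
    rcases lt_or_gt_of_ne d01 with x | x <;> rcases lt_or_gt_of_ne d12 with y | y <;>
      rcases lt_or_gt_of_ne d02 with w | w
    · exact ⟨_, mkT _ _ _ x y⟩
    · exact ⟨_, mkT _ _ _ x y⟩
    · exact ⟨_, mkT _ _ _ w y⟩
    · exact ⟨_, mkT _ _ _ w x⟩
    · exact ⟨_, mkT _ _ _ x w⟩
    · exact ⟨_, mkT _ _ _ y w⟩
    · exact ⟨_, mkT _ _ _ y x⟩
    · exact ⟨_, mkT _ _ _ y x⟩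
  obtain ⟨⟨i, j, k⟩, ht, hmin⟩ := Finset.exists_min_image T (fun t => g^[t.2.2] p - g^[t.1] p) hTne
  have ht' := (Finset.mem_filter.1 ht).2
  have hij : i < n ∧ j < n ∧ k < n := by
    have := (Finset.mem_filter.1 ht).1
    simpa [Finset.mem_product] using this
  simp only at ht'
  have back : ∀ i, i < n → ∃ i', g^[i'] (g^[j] p) = g^[i] p := by
    intro i hi
    refine ⟨i + (n - j), ?_⟩
    rw [← Function.iterate_add_apply, show i + (n - j) + j = i + n by omega,
      Function.iterate_add_apply, h.fix]
  refine ⟨j, g^[k] p - g^[i] p, by linarith, ?_, ?_⟩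
  · intro i' j' k' h1 h2
    simp only [← Function.iterate_add_apply] at *
    have := hmin _ (mkT _ _ _ h1 h2)
    simpa only [h.mod] using this
  · obtain ⟨i', hi'⟩ := back i hij.1
    obtain ⟨k', hk'⟩ := back k hij.2.2
    exact ⟨i', k', by rw [hi']; exact ht'.1, by rw [hk']; exact ht'.2, by rw [hi', hk']⟩

lemma count (h : Cyc A B a b K μ K' g g1 g2 g3 n p u v) (ht : Tri g p L) (S : Finset ℕ)
    (hS : ∀ i ∈ S, ∀ j ∈ S, i % n = j % n → i = j) (w : ℕ → ℝ)
    (hw : ∀ i ∈ S, w i ∈ Ioo (u i) (v i)) {c Λ : ℝ} (hΛ : 0 ≤ Λ)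
    (hc : ∀ i ∈ S, w i ∈ Icc c (c + Λ)) : (S.card : ℝ) ≤ 2 * (Λ / L + 1) + 2 := by
  classical
  set S1 := S.filter fun i => g^[i] p < c
  set S2 := S.filter fun i => c + Λ < g^[i] p
  set S3 := S.filter fun i => g^[i] p ∈ Icc c (c + Λ)
  have hsub : S ⊆ S1 ∪ S2 ∪ S3 := by
    intro i hi
    simp only [Finset.mem_union, S1, S2, S3, Finset.mem_filter, hi, true_and, mem_Icc]
    by_contra hn
    push Not at hn
    linarith [hn.2 hn.1.1, hn.1.2]
  have c1 : S1.card ≤ 1 := by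
    refine Finset.card_le_one.2 fun i hi j hj => ?_
    simp only [S1, Finset.mem_filter] at hi hj
    refine hS i hi.1 j hj.1 (h.disj i j c ?_ ?_)
    · exact ⟨(h.mem i).1.trans hi.2, (hc i hi.1).1.trans_lt (hw i hi.1).2⟩
    · exact ⟨(h.mem j).1.trans hj.2, (hc j hj.1).1.trans_lt (hw j hj.1).2⟩
  have c2 : S2.card ≤ 1 := by
    refine Finset.card_le_one.2 fun i hi j hj => ?_
    simp only [S2, Finset.mem_filter] at hi hj
    refine hS i hi.1 j hj.1 (h.disj i j (c + Λ) ?_ ?_)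
    · exact ⟨(hw i hi.1).1.trans_le (hc i hi.1).2, hi.2.trans (h.mem i).2⟩
    · exact ⟨(hw j hj.1).1.trans_le (hc j hj.1).2, hj.2.trans (h.mem j).2⟩
  have hL := ht.pos
  have c3 : S3.card ≤ 2 * (⌊Λ / L⌋₊ + 1) := by
    set φ : ℕ → ℕ := fun i => ⌊(g^[i] p - c) / L⌋₊
    have himg : S3.image φ ⊆ Finset.range (⌊Λ / L⌋₊ + 1) := by
      intro k hk
      obtain ⟨i, hi, rfl⟩ := Finset.mem_image.1 hk
      have := (Finset.mem_filter.1 hi).2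
      rw [Finset.mem_range, Nat.lt_succ_iff]
      exact Nat.floor_le_floor (by gcongr; linarith [this.2])
    refine (Finset.card_le_mul_card_image S3 2 fun k _ => ?_).trans
      (Nat.mul_le_mul_left 2 ((Finset.card_le_card himg).trans (Finset.card_range _).le))
    by_contra hn
    push Not at hn
    have bd : ∀ i ∈ S3.filter (fun i => φ i = k), c + k * L ≤ g^[i] p ∧ g^[i] p < c + k * L + L := by
      intro i hi
      obtain ⟨hi, e⟩ := Finset.mem_filter.1 hi
      have := (Finset.mem_filter.1 hi).2
      have h0 : 0 ≤ (g^[i] p - c) / L := div_nonneg (by linarith [this.1]) hL.le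
      obtain ⟨l1, l2⟩ := (Nat.floor_eq_iff h0).1 e
      rw [le_div_iff₀ hL] at l1
      rw [div_lt_iff₀ hL] at l2
      constructor <;> linarith
    have dn : ∀ i ∈ S3.filter (fun i => φ i = k), ∀ j ∈ S3.filter (fun i => φ i = k), i ≠ j →
        g^[i] p ≠ g^[j] p := fun i hi j hj hij e =>
      hij (hS i (Finset.mem_filter.1 (Finset.mem_filter.1 hi).1).1 j
        (Finset.mem_filter.1 (Finset.mem_filter.1 hj).1).1 (h.inj e))
    obtain ⟨x, y, w, hx, hy, hw', hxy, hxw, hyw⟩ := Finset.two_lt_card_iff.1 hn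
    have d1 := dn x hx y hy hxy
    have d2 := dn x hx w hw' hxw
    have d3 := dn y hy w hw' hyw
    have bx := bd x hx
    have by' := bd y hy
    have bw := bd w hw'
    have key : ∀ i j k, g^[i] p < g^[j] p → g^[j] p < g^[k] p → L ≤ g^[k] p - g^[i] p := ht.min
    rcases lt_or_gt_of_ne d1 with p1 | p1 <;> rcases lt_or_gt_of_ne d3 with p2 | p2 <;>
      rcases lt_or_gt_of_ne d2 with p3 | p3
    · linarith [key _ _ _ p1 p2]
    · linarith [key _ _ _ p1 p2]
    · linarith [key _ _ _ p3 p2]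
    · linarith [key _ _ _ p3 p1]
    · linarith [key _ _ _ p1 p3]
    · linarith [key _ _ _ p2 p3]
    · linarith [key _ _ _ p2 p1]
    · linarith [key _ _ _ p2 p1]
  have tot : S.card ≤ 1 + 1 + 2 * (⌊Λ / L⌋₊ + 1) :=
    (Finset.card_le_card hsub).trans ((Finset.card_union_le _ _).trans
      (add_le_add ((Finset.card_union_le _ _).trans (add_le_add c1 c2)) c3))
  have hfl : (⌊Λ / L⌋₊ : ℝ) ≤ Λ / L := Nat.floor_le (by positivity)
  have : (S.card : ℝ) ≤ 1 + 1 + 2 * (⌊Λ / L⌋₊ + 1) := by exact_mod_cast tot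
  linarith

lemma span_le (h : Cyc A B a b K μ K' g g1 g2 g3 n p u v) (ht : Tri g p L) :
    L * (n - 4) ≤ 2 * (b - a) := by
  have hab := h.ab
  have := h.count ht (Finset.range n) (fun i hi j hj e => by
    rwa [Nat.mod_eq_of_lt (Finset.mem_range.1 hi), Nat.mod_eq_of_lt (Finset.mem_range.1 hj)] at e)
    (fun i => g^[i] p) (fun i _ => h.mem i) (c := a) (Λ := b - a) (by linarith)
    (fun i _ => by simpa using h.memIcc (h.mem i))
  rw [Finset.card_range] at this
  have hL := ht.pos
  have e : L * ((b - a) / L) = b - a := by field_simp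
  have := mul_le_mul_of_nonneg_left this hL.le
  nlinarith

lemma side_card (h : Cyc A B a b K μ K' g g1 g2 g3 n p u v) (ht : Tri g p L) {z : ℝ}
    (hz : z ∈ Ioo (u 0) (v 0)) {Λ : ℝ} (t : Finset ℕ) (hlt : ∀ i ∈ t, i < 2 * n) {i' : ℕ}
    {y : ℝ} (hi' : i' ≤ 2 * n) (hy : Mon A B g g1 (2 * n - i') (g^[i'] z) y)
    (hyv : |g^[2 * n - i'] y - g^[2 * n] z| ≤ Λ) (hi : ∀ i ∈ t, g^[i] z ∈ uIcc (g^[i'] z) y) :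
    (t.card : ℝ) ≤ 2 * (2 * (Λ / L + 1) + 2) := by
  classical
  have key : ∀ s ⊆ t, (∀ i ∈ s, ∀ j ∈ s, i % n = j % n → i = j) →
      (s.card : ℝ) ≤ 2 * (Λ / L + 1) + 2 := by
    intro s hs hinj
    rw [← Finset.card_image_of_injective s (add_left_injective (2 * n - i'))]
    refine h.count ht _ ?_ (fun m => g^[m] z) (fun m _ => h.orb hz m)
      (c := min (g^[2 * n] z) (g^[2 * n - i'] y)) ((abs_nonneg _).trans hyv) ?_
    · intro i hi j hj e
      obtain ⟨i, hi2, rfl⟩ := Finset.mem_image.1 hi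
      obtain ⟨j, hj2, rfl⟩ := Finset.mem_image.1 hj
      rw [hinj i hi2 j hj2 (Nat.ModEq.add_right_cancel' _ e)]
    · intro m hm
      obtain ⟨i, hi2, rfl⟩ := Finset.mem_image.1 hm
      have := hy.mem h.cls.d0 h.cls.cont1 (hi i (hs hi2))
      rw [iterate_sub_apply hi', ← Function.iterate_add_apply, add_comm] at this
      have h3 := (abs_le.1 hyv)
      rw [mem_uIcc] at this
      rw [mem_Icc]
      simp only [min_le_iff]
      rcases le_total (g^[2 * n] z) (g^[2 * n - i'] y) with hh | hh
      · rw [min_eq_left hh]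
        rcases this with this | this
        · exact ⟨Or.inl this.1, by linarith⟩
        · exact ⟨Or.inl (by linarith), by linarith⟩
      · rw [min_eq_right hh]
        rcases this with this | this
        · exact ⟨Or.inl (by linarith), by linarith⟩
        · exact ⟨Or.inr this.1, by linarith⟩
  have k1 := key (t.filter (· < n)) (Finset.filter_subset _ _) (fun i hi j hj e => by
    rw [Finset.mem_filter] at hi hj
    rwa [Nat.mod_eq_of_lt hi.2, Nat.mod_eq_of_lt hj.2] at e)
  have k2 := key (t.filter (¬ · < n)) (Finset.filter_subset _ _) (fun i hi j hj e => by
    rw [Finset.mem_filter] at hi hj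
    have := hlt i hi.1
    have := hlt j hj.1
    rw [Nat.mod_eq_sub_mod (by omega), Nat.mod_eq_sub_mod (by omega : j ≥ n),
      Nat.mod_eq_of_lt (by omega), Nat.mod_eq_of_lt (by omega)] at e
    omega)
  have := Finset.card_filter_add_card_filter_not (s := t) (· < n)
  have : (t.card : ℝ) = (t.filter (· < n)).card + (t.filter (¬ · < n)).card := by exact_mod_cast this.symm
  linarith

lemma mult (h : Cyc A B a b K μ K' g g1 g2 g3 n p u v) (ht : Tri g p L) {z : ℝ}
    (hz : z ∈ Ioo (u 0) (v 0)) {Λ : ℝ} (hΛ : Λ ≤ 36 * L) (t : Finset ℕ) (hlt : ∀ i ∈ t, i < 2 * n)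
    {y : ℕ → ℝ} (hy : ∀ i ∈ t, Mon A B g g1 (2 * n - i) (g^[i] z) (y i))
    (hyv : ∀ i ∈ t, |g^[2 * n - i] (y i) - g^[2 * n] z| ≤ Λ) {x : ℝ}
    (hx : ∀ i ∈ t, x ∈ uIoo (g^[i] z) (y i)) : t.card ≤ 304 := by
  classical
  have hL := ht.pos
  have hbd : 2 * (2 * (Λ / L + 1) + 2) ≤ 152 := by
    have : Λ / L ≤ 36 := by rw [div_le_iff₀ hL]; exact hΛ
    linarith
  have s1 : ((t.filter fun i => g^[i] z < x).card : ℝ) ≤ 152 := by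
    rcases (t.filter fun i => g^[i] z < x).eq_empty_or_nonempty with e | e
    · rw [e]; norm_num
    · obtain ⟨i', hi', hmin⟩ := Finset.exists_min_image _ (fun i => g^[i] z) e
      obtain ⟨hi', hlt'⟩ := Finset.mem_filter.1 hi'
      refine (h.side_card ht hz _ (fun i hi => hlt i (Finset.mem_filter.1 hi).1) (hlt i' hi').le
        (hy i' hi') (hyv i' hi') fun i hi => ?_).trans hbd
      have h1 := hmin i hi
      have h2 := hx i' hi'
      simp only [uIoo, mem_Ioo, lt_sup_iff, inf_lt_iff] at h2
      rw [mem_uIcc]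
      left
      refine ⟨h1, (Finset.mem_filter.1 hi).2.le.trans ?_⟩
      rcases h2.2 with h3 | h3 <;> linarith
  have s2 : ((t.filter fun i => ¬ g^[i] z < x).card : ℝ) ≤ 152 := by
    rcases (t.filter fun i => ¬ g^[i] z < x).eq_empty_or_nonempty with e | e
    · rw [e]; norm_num
    · obtain ⟨i', hi', hmin⟩ := Finset.exists_max_image _ (fun i => g^[i] z) e
      obtain ⟨hi', hlt'⟩ := Finset.mem_filter.1 hi'
      refine (h.side_card ht hz _ (fun i hi => hlt i (Finset.mem_filter.1 hi).1) (hlt i' hi').le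
        (hy i' hi') (hyv i' hi') fun i hi => ?_).trans hbd
      have h1 := hmin i hi
      have h2 := hx i' hi'
      have h4 := (Finset.mem_filter.1 hi).2
      simp only [uIoo, mem_Ioo, lt_sup_iff, inf_lt_iff] at h2
      rw [mem_uIcc]
      right
      refine ⟨?_, h1⟩
      rcases h2.1 with h3 | h3 <;> linarith
  have := Finset.card_filter_add_card_filter_not (s := t) (fun i => g^[i] z < x)
  have e : (t.card : ℝ) = (t.filter fun i => g^[i] z < x).card + (t.filter fun i => ¬ g^[i] z < x).card := by
    exact_mod_cast this.symm
  have : (t.card : ℝ) ≤ 304 := by linarith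
  exact_mod_cast this

end Cyc

namespace Mon
variable {A B K' : ℝ} {g g1 : ℝ → ℝ} {m : ℕ} {l r ε : ℝ}

lemma dist_le (hg : ∀ x, HasDerivAt g (g1 x) x) (hg1 : Continuous g1) (h : Mon A B g g1 m l r)
    {j : ℕ} (hj : j ≤ m) {x y : ℝ} (hx : x ∈ uIcc l r) (hy : y ∈ uIcc l r) :
    |g^[j] y - g^[j] x| ≤ |g^[j] r - g^[j] l| :=
  abs_sub_le_of_uIcc_subset_uIcc
    (uIcc_subset_uIcc ((h.le hj).mem hg hg1 hx) ((h.le hj).mem hg hg1 hy))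

lemma two_point_unif (hS : Sturm A B K' g g1) (h : Mon A B g g1 m l r)
    (hE : K' * ∑ j ∈ Finset.range m, (g^[j] r - g^[j] l) ^ 2 ≤ ε) {x y : ℝ}
    (hx : x ∈ uIcc l r) (hy : y ∈ uIcc l r) :
    |Dm g g1 m x| * |Dm g g1 m y| * (y - x) ^ 2 ≤ Real.exp ε * (g^[m] y - g^[m] x) ^ 2 := by
  refine ((h.sub hx hy).two_point hS).trans ?_
  gcongr
  refine le_trans ?_ hE
  have := hS.2.2.1
  refine mul_le_mul_of_nonneg_left (Finset.sum_le_sum fun j hj => ?_) this.le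
  exact sq_le_sq.2 (h.dist_le hS.1 hS.2.1 (Finset.mem_range.1 hj).le hx hy)

lemma three_point_unif (hS : Sturm A B K' g g1) (h : Mon A B g g1 m l r)
    (hE : K' * ∑ j ∈ Finset.range m, (g^[j] r - g^[j] l) ^ 2 ≤ ε) {l1 x r1 : ℝ}
    (hl : l1 ∈ uIcc l r) (hr : r1 ∈ uIcc l r) (hx : x ∈ uIoo l1 r1) :
    invd l1 x r1 ≤ Real.exp ε * |Dm g g1 m x| * invd (g^[m] l1) (g^[m] x) (g^[m] r1) := by
  refine ((h.sub hl hr).three_point hS hx).trans ?_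
  have hx' : x ∈ uIcc l r := uIcc_subset_uIcc hl hr (mem_uIoo_iff.1 hx).1
  have hi : 0 ≤ invd (g^[m] l1) (g^[m] x) (g^[m] r1) := by unfold invd; positivity
  gcongr
  refine le_trans ?_ hE
  have := hS.2.2.1
  gcongr with j hj
  rw [← sq_abs, sq]
  have hj' := (Finset.mem_range.1 hj).le
  exact mul_le_mul (h.dist_le hS.1 hS.2.1 hj' hl hx') (h.dist_le hS.1 hS.2.1 hj' hx' hr)
    (abs_nonneg _) (abs_nonneg _)

/-- One-sided Koebe estimate for a branch with space `t` around the image of `z`. -/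
lemma koebe_side (hS : Sturm A B K' g g1) (h : Mon A B g g1 m l r)
    (hE : K' * ∑ j ∈ Finset.range m, (g^[j] r - g^[j] l) ^ 2 ≤ ε) {l' z R' R t : ℝ} (ht : 0 < t)
    (hl' : l' ∈ uIcc l r) (hR : R ∈ uIcc l r) (hR' : R' ∈ uIcc l r)
    (hz : z ∈ uIoo l' R') (hzR : R' ∈ uIoo z R) (hDz : Dm g g1 m z ≠ 0)
    (e1 : |g^[m] z - g^[m] l'| = t / 2) (e2 : |g^[m] R' - g^[m] z| = t / 2)
    (e3 : |g^[m] R - g^[m] R'| = t / 2) :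
    t / |Dm g g1 m z| / (4 * Real.exp ε) ≤ |R' - z| ∧
    |R' - z| ≤ Real.exp ε ^ 2 * (t / |Dm g g1 m z|) ∧
    t / |Dm g g1 m z| / (16 * Real.exp ε ^ 4) ≤ |R - R'| := by
  have hz' : z ∈ uIcc l r := uIcc_subset_uIcc hl' hR' (mem_uIoo_iff.1 hz).1
  have k1 := h.three_point_unif hS hE hl' hR' hz
  have k2 := h.three_point_unif hS hE hz' hR hzR
  have k3 := h.two_point_unif hS hE hz' hR'
  set E := Real.exp ε
  have hE0 : 0 < E := Real.exp_pos _
  set F := |Dm g g1 m z|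
  set G := |Dm g g1 m R'|
  have hF : 0 < F := abs_pos.2 hDz
  have hG : 0 ≤ G := abs_nonneg _
  obtain ⟨-, hz1, hz2⟩ := mem_uIoo_iff.1 hz
  obtain ⟨-, hr1, hr2⟩ := mem_uIoo_iff.1 hzR
  simp only [invd, e1, e2, e3] at k1 k2
  rw [← sq_abs (g^[m] R' - g^[m] z), e2, ← sq_abs] at k3
  set d := |R' - z|
  have hd : 0 < d := abs_pos.2 (sub_ne_zero.2 hr1)
  have hd' : 0 < |R - R'| := abs_pos.2 (sub_ne_zero.2 hr2.symm)
  have ht2 : 1 / (t / 2) + 1 / (t / 2) = 4 / t := by field_simp; norm_num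
  rw [ht2] at k1 k2
  have h1 : 1 / d ≤ E * F * (4 / t) := by
    have : 0 ≤ 1 / |z - l'| := by positivity
    linarith
  have h2 : 1 / d ≤ E * G * (4 / t) := by
    have : 0 ≤ 1 / |R - R'| := by positivity
    linarith
  have h3 : 1 / |R - R'| ≤ E * G * (4 / t) := by
    have : 0 ≤ 1 / d := by positivity
    linarith
  have g1' : t ≤ 4 * E * F * d := by
    rw [div_le_iff₀ hd] at h1
    have : E * F * (4 / t) * d = 4 * E * F * d / t := by ring
    rw [this, le_div_iff₀ ht] at h1; linarith
  have g2' : t ≤ 4 * E * G * d := by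
    rw [div_le_iff₀ hd] at h2
    have : E * G * (4 / t) * d = 4 * E * G * d / t := by ring
    rw [this, le_div_iff₀ ht] at h2; linarith
  have g3' : t ≤ 4 * E * G * |R - R'| := by
    rw [div_le_iff₀ hd'] at h3
    have : E * G * (4 / t) * |R - R'| = 4 * E * G * |R - R'| / t := by ring
    rw [this, le_div_iff₀ ht] at h3; linarith
  refine ⟨?_, ?_, ?_⟩
  · rw [div_div, div_le_iff₀ (by positivity)]; linarith
  · rw [← mul_div_assoc, le_div_iff₀ hF]
    have a1 : F * G * d ^ 2 * (4 * E) ≤ E * (t / 2) ^ 2 * (4 * E) := by gcongr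
    have a2 : d * F * t ≤ d * F * (4 * E * G * d) := by gcongr
    have : (d * F) * t ≤ (E ^ 2 * t) * t := by nlinarith
    exact le_of_mul_le_mul_right this ht
  · rw [div_div, div_le_iff₀ (by positivity)]
    have a1 : t ^ 2 ≤ (4 * E * F * d) ^ 2 := by gcongr
    have a3 : t ^ 2 * t ≤ (4 * E * F * d) ^ 2 * (4 * E * G * |R - R'|) := by gcongr
    have a4 : F * G * d ^ 2 * (64 * E ^ 3 * F * |R - R'|) ≤
        E * (t / 2) ^ 2 * (64 * E ^ 3 * F * |R - R'|) := by gcongr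
    have : t ^ 2 * t ≤ t ^ 2 * (|R - R'| * (F * (16 * E ^ 4))) := by nlinarith
    exact le_of_mul_le_mul_left this (by positivity)

end Mon

/-- A branch of the `m`-th iterate around `z` with space `t` on both sides of the image of `z`. -/
structure Fan (A B : ℝ) (g g1 : ℝ → ℝ) (m : ℕ) (z t l l' r' r : ℝ) : Prop where
  t0 : 0 < t
  mon : Mon A B g g1 m l r
  hz : z ∈ uIoo l' r'
  hl' : l' ∈ uIoo l z
  hr' : r' ∈ uIoo z r
  mem : z ∈ uIcc l r
  vl : g^[m] l = g^[m] z - t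
  vl' : g^[m] l' = g^[m] z - t / 2
  vr' : g^[m] r' = g^[m] z + t / 2
  vr : g^[m] r = g^[m] z + t
  ne : ∀ j < m, g1 (g^[j] z) ≠ 0

namespace Fan
variable {A B K' : ℝ} {g g1 : ℝ → ℝ} {m k : ℕ} {z t l l' r' r ε : ℝ}

lemma meml' (h : Fan A B g g1 m z t l l' r' r) : l' ∈ uIcc l r :=
  uIcc_subset_uIcc left_mem_uIcc h.mem (mem_uIoo_iff.1 h.hl').1

lemma memr' (h : Fan A B g g1 m z t l l' r' r) : r' ∈ uIcc l r :=
  uIcc_subset_uIcc h.mem right_mem_uIcc (mem_uIoo_iff.1 h.hr').1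

lemma later (hg : ∀ x, HasDerivAt g (g1 x) x) (hg1 : Continuous g1)
    (h : Fan A B g g1 (m + k) z t l l' r' r) :
    Fan A B g g1 k (g^[m] z) t (g^[m] l) (g^[m] l') (g^[m] r') (g^[m] r) := by
  have hm := ((Mon.add_iff hg hg1).1 h.mon)
  have e : ∀ x, g^[k] (g^[m] x) = g^[m + k] x := fun x => by
    rw [add_comm, Function.iterate_add_apply]
  refine ⟨h.t0, hm.2, ?_, ?_, ?_, hm.1.mem hg hg1 h.mem, ?_, ?_, ?_, ?_, fun j hj => ?_⟩
  · exact (hm.1.sub h.meml' h.memr').mem' hg hg1 h.hz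
  · exact (hm.1.sub left_mem_uIcc h.mem).mem' hg hg1 h.hl'
  · exact (hm.1.sub h.mem right_mem_uIcc).mem' hg hg1 h.hr'
  · rw [e, e, h.vl]
  · rw [e, e, h.vl']
  · rw [e, e, h.vr']
  · rw [e, e, h.vr]
  · rw [← Function.iterate_add_apply]; exact h.ne _ (by omega)

lemma later' (hg : ∀ x, HasDerivAt g (g1 x) x) (hg1 : Continuous g1) {i : ℕ} (hi : i ≤ m)
    (h : Fan A B g g1 m z t l l' r' r) :
    Fan A B g g1 (m - i) (g^[i] z) t (g^[i] l) (g^[i] l') (g^[i] r') (g^[i] r) := by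
  obtain ⟨k, rfl⟩ := Nat.exists_eq_add_of_le hi
  rw [Nat.add_sub_cancel_left]; exact h.later hg hg1

lemma exists_of (hg : ∀ x, HasDerivAt g (g1 x) x) (hg1 : Continuous g1) (ht : 0 < t)
    (hz : ∀ j < m, g1 (g^[j] z) ≠ 0)
    (hl : Mon A B g g1 m z l) (hlv : g^[m] l = g^[m] z - t)
    (hr : Mon A B g g1 m z r) (hrv : g^[m] r = g^[m] z + t) :
    ∃ l' r', Fan A B g g1 m z t l l' r' r := by
  obtain ⟨l', hl', hlv'⟩ := Mon.surj (u := z) (w := l) hg m (y := g^[m] z - t / 2)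
    (by rw [hlv, mem_uIcc]; right; constructor <;> linarith)
  obtain ⟨r', hr', hrv'⟩ := Mon.surj (u := z) (w := r) hg m (y := g^[m] z + t / 2)
    (by rw [hrv, mem_uIcc]; left; constructor <;> linarith)
  have opp : ∀ x y, Mon A B g g1 m z x → Mon A B g g1 m z y → g^[m] x < g^[m] z →
      g^[m] z < g^[m] y → z ∈ uIoo x y := by
    intro x y hx hy h1 h2
    have k1 := Mon.same_sign hg hg1 hx hz (by rintro rfl; exact h1.ne rfl)
    have k2 := Mon.same_sign hg hg1 hy hz (by rintro rfl; exact h2.ne rfl)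
    simp only [uIoo, mem_Ioo, lt_sup_iff, inf_lt_iff]
    rcases lt_trichotomy (Dm g g1 m z) 0 with hD | hD | hD
    · have : 0 < (g^[m] z - g^[m] x) * (-Dm g g1 m z) := mul_pos (by linarith) (by linarith)
      have : 0 < (g^[m] y - g^[m] z) * (-Dm g g1 m z) := mul_pos (by linarith) (by linarith)
      have a : z < x := by by_contra hn; push Not at hn; nlinarith
      have b : y < z := by by_contra hn; push Not at hn; nlinarith
      exact ⟨Or.inr b, Or.inl a⟩
    · rw [hD] at k1; simp at k1
    · have : 0 < (g^[m] z - g^[m] x) * (Dm g g1 m z) := mul_pos (by linarith) (by linarith)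
      have : 0 < (g^[m] y - g^[m] z) * (Dm g g1 m z) := mul_pos (by linarith) (by linarith)
      have a : x < z := by by_contra hn; push Not at hn; nlinarith
      have b : z < y := by by_contra hn; push Not at hn; nlinarith
      exact ⟨Or.inl a, Or.inr b⟩
  have hzlr : z ∈ uIcc l r := (mem_uIoo_iff.1 (opp l r hl hr (by linarith) (by linarith))).1
  refine ⟨l', r', ht, hl.concat hr hz hzlr, opp l' r' (hl.sub left_mem_uIcc hl')
    (hr.sub left_mem_uIcc hr') (by linarith) (by linarith), ?_, ?_, hzlr, hlv, hlv', hrv', hrv, hz⟩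
  · refine mem_uIoo_iff.2 ⟨uIcc_comm z l ▸ hl', ?_, ?_⟩ <;> rintro rfl <;> linarith
  · refine mem_uIoo_iff.2 ⟨hr', ?_, ?_⟩ <;> rintro rfl <;> linarith

lemma koebe (hS : Sturm A B K' g g1) (h : Fan A B g g1 m z t l l' r' r)
    (hE : K' * ∑ j ∈ Finset.range m, (g^[j] r - g^[j] l) ^ 2 ≤ ε) :
    (t / |Dm g g1 m z| / (4 * Real.exp ε) ≤ |l' - z| ∧
    |l' - z| ≤ Real.exp ε ^ 2 * (t / |Dm g g1 m z|) ∧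
    t / |Dm g g1 m z| / (16 * Real.exp ε ^ 4) ≤ |l - l'|) ∧
    (t / |Dm g g1 m z| / (4 * Real.exp ε) ≤ |r' - z| ∧
    |r' - z| ≤ Real.exp ε ^ 2 * (t / |Dm g g1 m z|) ∧
    t / |Dm g g1 m z| / (16 * Real.exp ε ^ 4) ≤ |r - r'|) := by
  have hD : Dm g g1 m z ≠ 0 := Dm_ne_zero h.ne
  have t2 : |t / 2| = t / 2 := abs_of_pos (by linarith [h.t0])
  constructor
  · refine h.mon.koebe_side hS hE h.t0 h.memr' left_mem_uIcc h.meml' (by rw [uIoo_comm]; exact h.hz)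
      (by rw [uIoo_comm]; exact h.hl') hD ?_ ?_ ?_
    · rw [h.vr', show g^[m] z - (g^[m] z + t / 2) = -(t / 2) by ring, abs_neg, t2]
    · rw [h.vl', show g^[m] z - t / 2 - g^[m] z = -(t / 2) by ring, abs_neg, t2]
    · rw [h.vl', h.vl, show g^[m] z - t - (g^[m] z - t / 2) = -(t / 2) by ring, abs_neg, t2]
  · refine h.mon.koebe_side hS hE h.t0 h.meml' right_mem_uIcc h.memr' h.hz h.hr' hD ?_ ?_ ?_
    · rw [h.vl', show g^[m] z - (g^[m] z - t / 2) = t / 2 by ring, t2]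
    · rw [h.vr', show g^[m] z + t / 2 - g^[m] z = t / 2 by ring, t2]
    · rw [h.vr', h.vr, show g^[m] z + t - (g^[m] z + t / 2) = t / 2 by ring, t2]

end Fan

/-- The scale at time `j` of a branch of `g^[q]` around `z` reaching size `t` at time `q`. -/
noncomputable def wt (g g1 : ℝ → ℝ) (q : ℕ) (z t : ℝ) (j : ℕ) : ℝ :=
  t / |Dm g g1 (q - j) (g^[j] z)|

section
variable {g g1 : ℝ → ℝ} {q : ℕ} {z t : ℝ}

lemma wt_pos (ht : 0 < t) (hne : ∀ j < q, g1 (g^[j] z) ≠ 0) (j : ℕ) : 0 < wt g g1 q z t j := by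
  refine div_pos ht (abs_pos.2 (Dm_ne_zero fun i hi => ?_))
  rw [← Function.iterate_add_apply]; exact hne _ (by omega)

lemma wt_succ (hne : ∀ j < q, g1 (g^[j] z) ≠ 0) {j : ℕ} (hj : j < q) :
    wt g g1 q z t (j + 1) = wt g g1 q z t j * |g1 (g^[j] z)| := by
  unfold wt
  rw [show q - j = (q - (j + 1)) + 1 by omega, Dm_succ', abs_mul,
    Function.iterate_succ_apply' g j z]
  have := abs_pos.2 (hne j hj)
  field_simp

lemma wt_add (hne : ∀ j < q, g1 (g^[j] z) ≠ 0) {j i : ℕ} (hj : j + i ≤ q) :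
    wt g g1 q z t (j + i) = wt g g1 q z t j * |Dm g g1 i (g^[j] z)| := by
  induction i with
  | zero => simp [Dm]
  | succ i ih =>
    rw [← add_assoc, wt_succ hne (by omega), ih (by omega), Dm_succ, abs_mul, mul_assoc,
      ← Function.iterate_add_apply, add_comm i j]

end

namespace Cyc
variable {A B a b K μ K' p L : ℝ} {g g1 g2 g3 : ℝ → ℝ} {n : ℕ} {u v : ℕ → ℝ}

lemma AB (h : Cyc A B a b K μ K' g g1 g2 g3 n p u v) : A < B := h.aA.trans (h.ab.trans h.bB)

lemma orb_ne (h : Cyc A B a b K μ K' g g1 g2 g3 n p u v) {z : ℝ} (hz : z ∈ Ioo (u 0) (v 0)) (j : ℕ) :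
    g1 (g^[j] z) ≠ 0 := h.ne _ _ (h.orb hz j)

lemma seg_sum (h : Cyc A B a b K μ K' g g1 g2 g3 n p u v) (ht : Tri g p L) {z : ℝ}
    (hz : z ∈ Ioo (u 0) (v 0)) {i : ℕ} (hi : i ≤ 2 * n) {y : ℝ}
    (hy : Mon A B g g1 (2 * n - i) (g^[i] z) y)
    (hyv : |g^[2 * n - i] y - g^[2 * n] z| ≤ 36 * L) :
    ∑ j ∈ Finset.range (2 * n - i), |g^[j] y - g^[j] (g^[i] z)| ≤ 304 * (B - A) := by
  classical
  refine (sum_len_le (Finset.range (2 * n - i)) (fun j => g^[j] (g^[i] z)) (fun j => g^[j] y)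
    h.AB.le 304 (fun j hj => (hy j (Finset.mem_range.1 hj) _ left_mem_uIcc).1)
    (fun j hj => (hy j (Finset.mem_range.1 hj) _ right_mem_uIcc).1) ?_).trans (by norm_num)
  intro x t htt hx
  rw [← Finset.card_image_of_injective t (add_left_injective i)]
  refine h.mult ht hz le_rfl _ ?_ (y := fun k => g^[k - i] y) ?_ ?_ (x := x) ?_ <;> intro k hk <;>
    obtain ⟨j, hj, rfl⟩ := Finset.mem_image.1 hk <;>
    have hj2 := Finset.mem_range.1 (htt hj)
  · omega
  · have e : 2 * n - i = j + (2 * n - (j + i)) := by omega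
    rw [e, Mon.add_iff h.cls.d0 h.cls.cont1] at hy
    simp only [Nat.add_sub_cancel]
    rw [Function.iterate_add_apply]; exact hy.2
  · simp only [Nat.add_sub_cancel]
    rw [← Function.iterate_add_apply, show 2 * n - (j + i) + j = 2 * n - i by omega]
    exact hyv
  · simp only [Nat.add_sub_cancel]
    rw [Function.iterate_add_apply]; exact hx j hj

lemma err_sum (h : Cyc A B a b K μ K' g g1 g2 g3 n p u v) (ht : Tri g p L) {z : ℝ}
    (hz : z ∈ Ioo (u 0) (v 0)) {i : ℕ} (hi : i ≤ 2 * n) {l r : ℝ}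
    (hl : Mon A B g g1 (2 * n - i) (g^[i] z) l) (hr : Mon A B g g1 (2 * n - i) (g^[i] z) r)
    (hlv : |g^[2 * n - i] l - g^[2 * n] z| ≤ 36 * L)
    (hrv : |g^[2 * n - i] r - g^[2 * n] z| ≤ 36 * L) :
    ∑ j ∈ Finset.range (2 * n - i), |g^[j] r - g^[j] l| ≤ 608 * (B - A) := by
  have h1 := h.seg_sum ht hz hi hl hlv
  have h2 := h.seg_sum ht hz hi hr hrv
  calc _ ≤ ∑ j ∈ Finset.range (2 * n - i), (|g^[j] r - g^[j] (g^[i] z)| + |g^[j] l - g^[j] (g^[i] z)|) := by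
        gcongr with j
        rw [abs_sub_comm (g^[j] l)]
        exact abs_sub_le _ _ _
    _ ≤ _ := by rw [Finset.sum_add_distrib]; linarith

lemma err (h : Cyc A B a b K μ K' g g1 g2 g3 n p u v) (ht : Tri g p L) {z : ℝ}
    (hz : z ∈ Ioo (u 0) (v 0)) {i : ℕ} (hi : i ≤ 2 * n) {l r : ℝ}
    (hl : Mon A B g g1 (2 * n - i) (g^[i] z) l) (hr : Mon A B g g1 (2 * n - i) (g^[i] z) r)
    (hlv : |g^[2 * n - i] l - g^[2 * n] z| ≤ 36 * L)
    (hrv : |g^[2 * n - i] r - g^[2 * n] z| ≤ 36 * L) :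
    K' * ∑ j ∈ Finset.range (2 * n - i), (g^[j] r - g^[j] l) ^ 2 ≤ K' * (608 * (B - A) ^ 2) := by
  have hK := h.st.2.2.1
  refine mul_le_mul_of_nonneg_left ?_ hK.le
  have hAB := h.AB
  calc _ ≤ ∑ j ∈ Finset.range (2 * n - i), (B - A) * |g^[j] r - g^[j] l| := by
        refine Finset.sum_le_sum fun j hj => ?_
        rw [← sq_abs, sq]
        refine mul_le_mul_of_nonneg_right ?_ (abs_nonneg _)
        have h1 := (hl j (Finset.mem_range.1 hj) _ right_mem_uIcc).1
        have h2 := (hr j (Finset.mem_range.1 hj) _ right_mem_uIcc).1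
        rw [abs_le]; constructor <;> linarith [h1.1, h1.2, h2.1, h2.2]
    _ ≤ _ := by
      rw [← Finset.mul_sum]
      have := h.err_sum ht hz hi hl hr hlv hrv
      nlinarith

lemma fan_err (h : Cyc A B a b K μ K' g g1 g2 g3 n p u v) (ht : Tri g p L) {z : ℝ}
    (hz : z ∈ Ioo (u 0) (v 0)) {i : ℕ} (hi : i ≤ 2 * n) {t l l' r' r : ℝ}
    (hF : Fan A B g g1 (2 * n - i) (g^[i] z) t l l' r' r) (htL : t ≤ 36 * L) :
    K' * ∑ j ∈ Finset.range (2 * n - i), (g^[j] r - g^[j] l) ^ 2 ≤ K' * (608 * (B - A) ^ 2) := by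
  refine h.err ht hz hi (hF.mon.sub hF.mem left_mem_uIcc) (hF.mon.sub hF.mem right_mem_uIcc) ?_ ?_
  · rw [hF.vl, iterate_sub_apply hi, show g^[2 * n] z - t - g^[2 * n] z = -t by ring, abs_neg,
      abs_of_pos hF.t0]
    exact htL
  · rw [hF.vr, iterate_sub_apply hi, show g^[2 * n] z + t - g^[2 * n] z = t by ring,
      abs_of_pos hF.t0]
    exact htL

lemma fan_koebe (h : Cyc A B a b K μ K' g g1 g2 g3 n p u v) (ht : Tri g p L) {z : ℝ}
    (hz : z ∈ Ioo (u 0) (v 0)) {i : ℕ} (hi : i ≤ 2 * n) {t l l' r' r : ℝ}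
    (hF : Fan A B g g1 (2 * n) z t l l' r' r) (htL : t ≤ 36 * L) {E : ℝ}
    (hE : E = Real.exp (K' * (608 * (B - A) ^ 2))) :
    (wt g g1 (2 * n) z t i / (4 * E) ≤ |g^[i] l' - g^[i] z| ∧
      |g^[i] l' - g^[i] z| ≤ E ^ 2 * wt g g1 (2 * n) z t i ∧
      wt g g1 (2 * n) z t i / (16 * E ^ 4) ≤ |g^[i] l - g^[i] l'|) ∧
    (wt g g1 (2 * n) z t i / (4 * E) ≤ |g^[i] r' - g^[i] z| ∧
      |g^[i] r' - g^[i] z| ≤ E ^ 2 * wt g g1 (2 * n) z t i ∧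
      wt g g1 (2 * n) z t i / (16 * E ^ 4) ≤ |g^[i] r - g^[i] r'|) := by
  have hF' := hF.later' h.cls.d0 h.cls.cont1 hi
  have := hF'.koebe h.st (h.fan_err ht hz hi hF' htL)
  rw [hE]
  exact this

lemma wt_sum (h : Cyc A B a b K μ K' g g1 g2 g3 n p u v) (ht : Tri g p L) {z : ℝ}
    (hz : z ∈ Ioo (u 0) (v 0)) {t l l' r' r : ℝ}
    (hF : Fan A B g g1 (2 * n) z t l l' r' r) (htL : t ≤ 36 * L) {E : ℝ}
    (hE : E = Real.exp (K' * (608 * (B - A) ^ 2))) :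
    ∑ i ∈ Finset.range (2 * n), wt g g1 (2 * n) z t i ≤ 4 * E * (304 * (B - A)) := by
  have hE0 : 0 < E := hE ▸ Real.exp_pos _
  have h1 := h.seg_sum ht hz (Nat.zero_le _) (y := r')
    (hF.mon.sub hF.mem hF.memr') (by
      rw [Nat.sub_zero, hF.vr', show g^[2 * n] z + t / 2 - g^[2 * n] z = t / 2 by ring,
        abs_of_pos (by linarith [hF.t0])]
      linarith [hF.t0])
  calc _ ≤ ∑ i ∈ Finset.range (2 * n), 4 * E * |g^[i] r' - g^[i] z| := by
        refine Finset.sum_le_sum fun i hi => ?_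
        have := (h.fan_koebe ht hz (Finset.mem_range.1 hi).le hF htL hE).2.1
        rw [div_le_iff₀ (by positivity)] at this
        linarith
    _ ≤ _ := by
      rw [← Finset.mul_sum]
      exact mul_le_mul_of_nonneg_left h1 (by positivity)

/-- The scales are square-summable relative to the derivative. -/
lemma wt_sq (h : Cyc A B a b K μ K' g g1 g2 g3 n p u v) {z : ℝ}
    (hz : z ∈ Ioo (u 0) (v 0)) {t c K3 : ℝ}
    (hSw : ∀ x ∈ Icc A B, g3 x * g1 x - 3 / 2 * g2 x ^ 2 ≤ K3 * g1 x ^ 2 - c)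
    (hsum : 0 ≤ ∑ j ∈ Finset.range (2 * n), Sw g1 g2 g3 (g^[j] z) * Dm g g1 j z ^ 2) :
    c * ∑ j ∈ Finset.range (2 * n), (wt g g1 (2 * n) z t j / g1 (g^[j] z)) ^ 2 ≤
      K3 * ∑ j ∈ Finset.range (2 * n), wt g g1 (2 * n) z t j ^ 2 := by
  have hne : ∀ j < 2 * n, g1 (g^[j] z) ≠ 0 := fun j _ => h.orb_ne hz j
  have e : ∀ j ∈ Finset.range (2 * n), wt g g1 (2 * n) z t j ^ 2 =
      wt g g1 (2 * n) z t 0 ^ 2 * Dm g g1 j z ^ 2 := fun j hj => by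
    have := wt_add (t := t) (i := j) (j := 0) hne (by have := Finset.mem_range.1 hj; omega)
    rw [zero_add] at this
    rw [this, mul_pow, sq_abs]; rfl
  have h1 : 0 ≤ ∑ j ∈ Finset.range (2 * n), Sw g1 g2 g3 (g^[j] z) * wt g g1 (2 * n) z t j ^ 2 := by
    have : ∑ j ∈ Finset.range (2 * n), Sw g1 g2 g3 (g^[j] z) * wt g g1 (2 * n) z t j ^ 2 =
        wt g g1 (2 * n) z t 0 ^ 2 *
          ∑ j ∈ Finset.range (2 * n), Sw g1 g2 g3 (g^[j] z) * Dm g g1 j z ^ 2 := by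
      rw [Finset.mul_sum]
      refine Finset.sum_congr rfl fun j hj => ?_
      rw [e j hj]; ring
    rw [this]; positivity
  rw [Finset.mul_sum, Finset.mul_sum, ← sub_nonneg, ← Finset.sum_sub_distrib]
  refine h1.trans (Finset.sum_le_sum fun j hj => ?_)
  have hg := h.orb_ne hz j
  have hx : g^[j] z ∈ Icc A B := Ioo_subset_Icc_self (h.memIoo (h.orb hz j))
  have := hSw _ hx
  have hg2 : 0 < g1 (g^[j] z) ^ 2 := by positivity
  have e1 : Sw g1 g2 g3 (g^[j] z) = (g3 (g^[j] z) * g1 (g^[j] z) - 3 / 2 * g2 (g^[j] z) ^ 2) /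
      g1 (g^[j] z) ^ 2 := by unfold Sw; field_simp
  have e2 : K3 * wt g g1 (2 * n) z t j ^ 2 - c * (wt g g1 (2 * n) z t j / g1 (g^[j] z)) ^ 2 =
      (K3 * g1 (g^[j] z) ^ 2 - c) / g1 (g^[j] z) ^ 2 * wt g g1 (2 * n) z t j ^ 2 := by field_simp
  rw [e1, e2]
  gcongr

/-- A hit leaves little room between the orbit of `z` and the obstruction, at the next time. -/
lemma hit_bound (h : Cyc A B a b K μ K' g g1 g2 g3 n p u v) (ht : Tri g p L) {z : ℝ}
    (hz : z ∈ Ioo (u 0) (v 0)) {σ e s s1 s2 t D E : ℝ} {i : ℕ} (hσ : σ = 1 ∨ σ = -1)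
    (hH : Hit A B g g1 z (2 * n) σ i e s) (hD : 1 ≤ D) (t0 : 0 < t) (hts : t ≤ s) (hs1 : s ≤ s1)
    (hs12 : s1 + t / D ≤ s2) (hs2 : s2 ≤ 3 * t) (htL : t ≤ 12 * L)
    (hfree : Free A B g g1 z (2 * n) (i + 1) (g^[2 * n] z + σ * s2))
    (hE : E = Real.exp (K' * (608 * (B - A) ^ 2))) :
    |g e - g (g^[i] z)| ≤ 9 * E ^ 2 * (1 + D) * wt g g1 (2 * n) z t (i + 1) := by
  have hi := hH.lt
  have hg := h.cls.d0
  have hg1 := h.cls.cont1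
  set m := 2 * n - (i + 1) with hm
  have em : 2 * n - i = 1 + m := by omega
  set z' := g^[i + 1] z with hz'
  have ez' : g (g^[i] z) = z' := (Function.iterate_succ_apply' g i z).symm
  have hmon : Mon A B g g1 m z' (g e) := by
    have := hH.mon
    rw [em, Mon.add_iff hg hg1] at this
    have := this.2
    rwa [Function.iterate_one, ez'] at this
  have hval : g^[m] (g e) = g^[2 * n] z + σ * s := by
    rw [← hH.val, em, add_comm 1 m]; rfl
  have hzm : g^[m] z' = g^[2 * n] z := iterate_sub_apply (by omega) z
  obtain ⟨y, hy, hyv⟩ := hfree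
  have hne : ∀ j < m, g1 (g^[j] z') ≠ 0 := fun j _ => by
    rw [hz', ← Function.iterate_add_apply]; exact h.orb_ne hz _
  have hDp : 0 < D := by linarith
  have htD : 0 < t / D := div_pos t0 hDp
  have hss2 : s < s2 := by linarith
  have s0 := hH.pos
  have hvy : g e ∈ uIcc z' y := Mon.compare hg hg1 hmon hy hne hσ (by rw [hzm]; exact hval)
    (by rw [hzm]; exact hyv) s0.le hss2.le
  have habs : ∀ x : ℝ, 0 ≤ x → |σ * x| = x := fun x hx => by
    rw [abs_mul, abs_of_nonneg hx]; rcases hσ with rfl | rfl <;> simp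
  have d1 : |g^[m] (g e) - g^[m] z'| = s := by
    rw [hval, hzm, add_sub_cancel_left, habs s s0.le]
  have d2 : |g^[m] y - g^[m] (g e)| = s2 - s := by
    rw [hval, hyv, show g^[2 * n] z + σ * s2 - (g^[2 * n] z + σ * s) = σ * (s2 - s) by ring,
      habs _ (by linarith)]
  have hv : g e ∈ uIoo z' y := by
    refine mem_uIoo_iff.2 ⟨hvy, fun H => ?_, fun H => ?_⟩
    · rw [H, sub_self, abs_zero] at d1; linarith
    · rw [← H, sub_self, abs_zero] at d2; linarith
  have herr := h.err ht hz (i := i + 1) (by omega) (l := z') (r := y)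
    (by
      intro j hj x hx
      rw [uIcc_self, mem_singleton_iff] at hx
      exact ⟨hx ▸ (hy j hj _ left_mem_uIcc).1, fun h => absurd hx h⟩) hy
    (by rw [← hm, hzm, sub_self, abs_zero]; linarith [ht.pos])
    (by rw [hyv, add_sub_cancel_left, habs _ (by linarith)]; linarith)
  have k1 := hy.three_point_unif h.st herr left_mem_uIcc right_mem_uIcc hv
  have k2 := hy.two_point_unif h.st herr left_mem_uIcc hvy
  rw [← hE] at k1 k2
  rw [← sq_abs (g^[m] (g e) - g^[m] z'), d1, ← sq_abs] at k2
  unfold invd at k1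
  rw [d1, d2] at k1
  have hE0 : 0 < E := hE ▸ Real.exp_pos _
  rw [ez']
  set d := |g e - z'|
  have hd : 0 < d := abs_pos.2 (sub_ne_zero.2 (mem_uIoo_iff.1 hv).2.1)
  set G := |Dm g g1 m (g e)|
  have hG : 0 ≤ G := abs_nonneg _
  have hF0 : 0 < |Dm g g1 m z'| := abs_pos.2 (Dm_ne_zero hne)
  change d ≤ 9 * E ^ 2 * (1 + D) * (t / |Dm g g1 m z'|)
  set F := |Dm g g1 m z'|
  have b1 : 1 / s + 1 / (s2 - s) ≤ (1 + D) / t := by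
    have : 1 / s ≤ 1 / t := one_div_le_one_div_of_le t0 hts
    have : 1 / (s2 - s) ≤ 1 / (t / D) := one_div_le_one_div_of_le htD (by linarith)
    have : 1 / (t / D) = D / t := by field_simp
    rw [add_div]; linarith
  have b2 : 1 / d ≤ E * G * ((1 + D) / t) := by
    have : 0 ≤ 1 / |y - g e| := by positivity
    have : E * G * (1 / s + 1 / (s2 - s)) ≤ E * G * ((1 + D) / t) := by gcongr
    linarith
  have b3 : t ≤ E * G * (1 + D) * d := by
    rw [div_le_iff₀ hd] at b2
    have : E * G * ((1 + D) / t) * d = E * G * (1 + D) * d / t := by ring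
    rw [this, le_div_iff₀ t0] at b2; linarith
  rw [← mul_div_assoc, le_div_iff₀ hF0]
  have b4 : F * G * d ^ 2 ≤ E * (3 * t) ^ 2 := k2.trans (by gcongr; linarith)
  have b5 : (d * F) * t ≤ (d * F) * (E * G * (1 + D) * d) := by gcongr
  have b6 : (F * G * d ^ 2) * (E * (1 + D)) ≤ (E * (3 * t) ^ 2) * (E * (1 + D)) := by gcongr
  have : (d * F) * t ≤ (9 * E ^ 2 * (1 + D) * t) * t := by nlinarith
  exact le_of_mul_le_mul_right this t0

end Cyc

namespace Cyc
variable {A B a b K μ K' p L : ℝ} {g g1 g2 g3 : ℝ → ℝ} {n : ℕ} {u v : ℕ → ℝ}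

lemma mon_J (h : Cyc A B a b K μ K' g g1 g2 g3 n p u v) {i : ℕ} {x y : ℝ}
    (hx : x ∈ Ioo (u i) (v i)) (hy : y ∈ Ioo (u i) (v i)) (m : ℕ) : Mon A B g g1 m x y := by
  intro j _ w hw
  have hw' : w ∈ Ioo (u i) (v i) := ordConnected_Ioo.uIcc_subset hx hy hw
  have := h.iter hw' j
  exact ⟨Ioo_subset_Icc_self (h.memIoo this), fun _ _ => h.ne _ _ this⟩

lemma per2 (h : Cyc A B a b K μ K' g g1 g2 g3 n p u v) {z : ℝ} (hz : z ∈ Ioo (u 0) (v 0)) :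
    g^[2 * n] z ∈ Ioo (u 0) (v 0) := by
  have := h.orb hz (2 * n)
  have e1 : u (2 * n) = u 0 := by
    rw [two_mul, h.peru, show n = 0 + n by omega, h.peru]
  have e2 : v (2 * n) = v 0 := by
    rw [two_mul, h.perv, show n = 0 + n by omega, h.perv]
  rwa [e1, e2] at this

lemma fix2 (h : Cyc A B a b K μ K' g g1 g2 g3 n p u v) : g^[2 * n] p = p := by
  rw [two_mul, Function.iterate_add_apply, h.fix, h.fix]

lemma dist_lt (h : Cyc A B a b K μ K' g g1 g2 g3 n p u v) (ht : Tri g p L) {w : ℝ}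
    (hw : w ∈ Ioo (u 0) (v 0)) : |p - w| < L := by
  obtain ⟨i, k, h1, h2, h3⟩ := ht.ex
  have hp := h.mem 0
  simp only [Function.iterate_zero, id] at hp
  have n0 : 0 < n := by have := h.n3; omega
  have ne : ∀ i, g^[i] p ≠ p → g^[i] p ∉ Ioo (u 0) (v 0) := by
    intro i hi hmem
    have := h.disj i 0 _ (h.mem i) hmem
    apply hi
    rw [← h.mod i, this]; simp
  have hu : g^[i] p ≤ u 0 := by
    by_contra hn; push Not at hn
    exact ne i h1.ne ⟨hn, h1.trans hp.2⟩
  have hv : v 0 ≤ g^[k] p := by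
    by_contra hn; push Not at hn
    exact ne k h2.ne' ⟨hp.1.trans h2, hn⟩
  rw [abs_lt]
  constructor <;> linarith [hw.1, hw.2]

/-- If the branch around `z` reaches the size of the surrounding gaps of the orbit, some scale is
big. -/
lemma full_big (h : Cyc A B a b K μ K' g g1 g2 g3 n p u v) (ht : Tri g p L) {z κ E : ℝ}
    (hz : z ∈ Ioo (u 0) (v 0)) {l l' r' r : ℝ}
    (hF : Fan A B g g1 (2 * n) z (12 * L) l l' r' r)
    (hE : E = Real.exp (K' * (608 * (B - A) ^ 2))) (hκ0 : 0 < κ)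
    (hκ : K' * (2 * E ^ 2 * κ * (608 * (B - A))) ≤ Real.log (5 / 2)) :
    ∃ j ≤ 2 * n, κ ≤ wt g g1 (2 * n) z (12 * L) j := by
  by_contra hcon
  push Not at hcon
  have hL := ht.pos
  have hg := h.cls.d0
  have hg1 := h.cls.cont1
  have hp : p ∈ Ioo (u 0) (v 0) := h.mem 0
  have hne : ∀ j < 2 * n, g1 (g^[j] z) ≠ 0 := fun j _ => h.orb_ne hz j
  have hzp : Mon A B g g1 (2 * n) z p := h.mon_J hz hp _
  have hd := abs_lt.1 (h.dist_lt ht (h.per2 hz))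
  have hE0 : 0 < E := hE ▸ Real.exp_pos _
  have hM := hF.mon.sub hF.meml' hF.memr'
  have hzM := (mem_uIoo_iff.1 hF.hz).1
  have hpM : p ∈ uIoo l' r' := by
    have hmem : p ∈ uIcc l' r' := by
      rcases le_total (g^[2 * n] z) p with hle | hle
      · refine uIcc_subset_uIcc hzM right_mem_uIcc (Mon.compare hg hg1 hzp (hM.sub hzM right_mem_uIcc)
          hne (Or.inl rfl) (s := p - g^[2 * n] z) (s' := 6 * L) ?_ ?_ (by linarith) (by linarith))
        · rw [h.fix2]; ring
        · rw [hF.vr']; ring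
      · refine uIcc_subset_uIcc hzM left_mem_uIcc (Mon.compare hg hg1 hzp (hM.sub hzM left_mem_uIcc)
          hne (Or.inr rfl) (s := g^[2 * n] z - p) (s' := 6 * L) ?_ ?_ (by linarith) (by linarith))
        · rw [h.fix2]; ring
        · rw [hF.vl']; ring
    refine mem_uIoo_iff.2 ⟨hmem, fun e => ?_, fun e => ?_⟩
    · have := hF.vl'; rw [← e, h.fix2] at this; linarith
    · have := hF.vr'; rw [← e, h.fix2] at this; linarith
  have hpM' := (mem_uIoo_iff.1 hpM).1
  have k := hM.three_point h.st hpM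
  have hsum : ∑ j ∈ Finset.range (2 * n), |g^[j] p - g^[j] l'| * |g^[j] r' - g^[j] p| ≤
      2 * E ^ 2 * κ * (608 * (B - A)) := by
    have h1 := h.err_sum ht hz (Nat.zero_le _) (l := l') (r := p)
      (hM.sub hzM left_mem_uIcc) hzp
      (by rw [Nat.sub_zero, hF.vl', abs_le]; constructor <;> linarith)
      (by rw [Nat.sub_zero, h.fix2, abs_le]; constructor <;> linarith)
    rw [Nat.sub_zero] at h1
    calc _ ≤ ∑ j ∈ Finset.range (2 * n), |g^[j] p - g^[j] l'| * (2 * E ^ 2 * κ) := by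
          refine Finset.sum_le_sum fun j hj => mul_le_mul_of_nonneg_left ?_ (abs_nonneg _)
          have hj' := (Finset.mem_range.1 hj).le
          have k1 := h.fan_koebe ht hz hj' hF (by linarith) hE
          have k2 := hM.dist_le hg hg1 hj' hpM' right_mem_uIcc
          have k3 : E ^ 2 * wt g g1 (2 * n) z (12 * L) j ≤ E ^ 2 * κ :=
            mul_le_mul_of_nonneg_left (hcon j hj').le (by positivity)
          have k4 := abs_sub_le (g^[j] r') (g^[j] z) (g^[j] l')
          rw [abs_sub_comm (g^[j] z)] at k4
          linarith [k1.1.2.1, k1.2.2.1]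
      _ ≤ _ := by
          rw [← Finset.sum_mul, mul_comm]
          exact mul_le_mul_of_nonneg_left h1 (by positivity)
  have hexp : Real.exp (K' * ∑ j ∈ Finset.range (2 * n),
      |g^[j] p - g^[j] l'| * |g^[j] r' - g^[j] p|) ≤ 5 / 2 := by
    rw [← Real.exp_log (show (0:ℝ) < 5 / 2 by norm_num)]
    exact Real.exp_le_exp.2 ((mul_le_mul_of_nonneg_left hsum h.st.2.2.1.le).trans hκ)
  have hDp : |Dm g g1 (2 * n) p| ≤ 1 := by
    have h1 : 0 ≤ Dm g g1 (2 * n) p := by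
      rw [two_mul, Dm_add, h.fix]; exact mul_self_nonneg _
    rw [abs_of_nonneg h1]; exact h.mid 0
  have hin : invd (g^[2 * n] l') (g^[2 * n] p) (g^[2 * n] r') ≤ 2 / (5 * L) := by
    unfold invd
    rw [hF.vl', hF.vr', h.fix2, abs_of_pos (by linarith), abs_of_pos (by linarith)]
    have h1 : 1 / (p - (g^[2 * n] z - 12 * L / 2)) ≤ 1 / (5 * L) :=
      one_div_le_one_div_of_le (by positivity) (by linarith)
    have h2 : 1 / (g^[2 * n] z + 12 * L / 2 - p) ≤ 1 / (5 * L) :=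
      one_div_le_one_div_of_le (by positivity) (by linarith)
    have : 2 / (5 * L) = 1 / (5 * L) + 1 / (5 * L) := by ring
    linarith
  have hin0 : 0 ≤ invd (g^[2 * n] l') (g^[2 * n] p) (g^[2 * n] r') := by unfold invd; positivity
  have k' : invd l' p r' ≤ 1 / L := by
    refine k.trans ?_
    calc _ ≤ 5 / 2 * 1 * (2 / (5 * L)) := by gcongr
      _ = 1 / L := by field_simp
  obtain ⟨-, q1, q2⟩ := mem_uIoo_iff.1 hpM
  have a1 : 0 < |p - l'| := abs_pos.2 (sub_ne_zero.2 q1)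
  have a2 : 0 < |r' - p| := abs_pos.2 (sub_ne_zero.2 q2.symm)
  have i1 : 0 < 1 / |p - l'| := by positivity
  have i2 : 0 < 1 / |r' - p| := by positivity
  unfold invd at k'
  have b1 : L ≤ |p - l'| := (one_div_le_one_div a1 hL).1 (by linarith)
  have b2 : L ≤ |r' - p| := (one_div_le_one_div a2 hL).1 (by linarith)
  obtain ⟨i, k, h1, h2, h3⟩ := ht.ex
  have hsubset : Icc (p - L) (p + L) ⊆ uIcc l' r' := by
    intro x hx
    rw [mem_uIcc] at hpM' ⊢
    rcases hpM' with ⟨c1, c2⟩ | ⟨c1, c2⟩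
    · rw [abs_of_nonneg (by linarith)] at b1 b2
      left; constructor <;> linarith [hx.1, hx.2]
    · rw [abs_of_nonpos (by linarith)] at b1 b2
      right; constructor <;> linarith [hx.1, hx.2]
  have hM' := hM.sub (hsubset (show g^[i] p ∈ _ from ⟨by linarith, by linarith⟩))
    (hsubset (show g^[k] p ∈ _ from ⟨by linarith, by linarith⟩))
  have n0 : 0 < n := by have := h.n3; omega
  obtain ⟨j, hj, hmin⟩ := Finset.exists_min_image (Finset.range n) (fun j => g^[j] p) ⟨0, by simpa⟩
  have hj' := Finset.mem_range.1 hj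
  have hmin' : ∀ i, g^[j] p ≤ g^[i] p := fun i => by
    rw [← h.mod i]; exact hmin _ (Finset.mem_range.2 (Nat.mod_lt _ n0))
  have := (hM'.le (show j ≤ 2 * n by omega)).mem' hg hg1 (v := p) (by
    rw [uIoo_of_lt (h1.trans h2)]; exact ⟨h1, h2⟩)
  rw [← Function.iterate_add_apply, ← Function.iterate_add_apply] at this
  simp only [uIoo, mem_Ioo, inf_lt_iff] at this
  rcases this.1 with h | h
  · exact absurd (hmin' _) (not_le.2 h)
  · exact absurd (hmin' _) (not_le.2 h)

end Cyc

namespace Cyc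
variable {A B a b K μ K' p L : ℝ} {g g1 g2 g3 : ℝ → ℝ} {n : ℕ} {u v : ℕ → ℝ}

/-- Hits at many distinct times would pile up at a single point. -/
lemma not_many_hits (h : Cyc A B a b K μ K' g g1 g2 g3 n p u v) (ht : Tri g p L) {z σ : ℝ}
    (hz : z ∈ Ioo (u 0) (v 0)) (hσ : σ = 1 ∨ σ = -1) {N D : ℕ} (hD : N * 2 * 304 < D + 1)
    {col : ℝ → Fin N} (hcol : InjOn col {e | Gam A B g1 e}) {i : ℕ → ℕ} {e s : ℕ → ℝ}
    (hH : ∀ k ≤ D, Hit A B g g1 z (2 * n) σ (i k) (e k) (s k) ∧ s k ≤ 36 * L)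
    (hi : ∀ k k', k < k' → k' ≤ D → i k < i k') : False := by
  classical
  obtain ⟨y, -, hy⟩ := Finset.exists_lt_card_fiber_of_mul_lt_card_of_maps_to
    (s := Finset.range (D + 1)) (t := (Finset.univ : Finset (Fin N × Bool)))
    (f := fun k => (col (e k), decide (g^[i k] z < e k))) (n := 304)
    (fun _ _ => Finset.mem_univ _) (by simpa using hD)
  set T := (Finset.range (D + 1)).filter fun k => (col (e k), decide (g^[i k] z < e k)) = y with hT
  have hTD : ∀ k ∈ T, k ≤ D := fun k hk => by
    have := Finset.mem_range.1 (Finset.mem_filter.1 hk).1; omega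
  have hinj : InjOn i T := by
    intro k hk k' hk' he
    rcases lt_trichotomy k k' with hh | hh | hh
    · exact absurd he (hi k k' hh (hTD _ hk')).ne
    · exact hh
    · exact absurd he (hi k' k hh (hTD _ hk)).ne'
  have hcard : (T.image i).card = T.card := Finset.card_image_of_injOn hinj
  have hTne : T.Nonempty := Finset.card_pos.1 (by omega)
  obtain ⟨k0, hk0⟩ := hTne
  set e0 := e k0
  have he : ∀ k ∈ T, e k = e0 := fun k hk => by
    refine hcol (hH k (hTD k hk)).1.gam (hH k0 (hTD k0 hk0)).1.gam ?_
    have h1 := (Finset.mem_filter.1 hk).2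
    have h2 := (Finset.mem_filter.1 hk0).2
    rw [← h2] at h1
    exact (Prod.ext_iff.1 h1).1
  have hside : ∀ k ∈ T, (g^[i k] z < e0 ↔ g^[i k0] z < e0) := fun k hk => by
    have h1 := (Finset.mem_filter.1 hk).2
    have h2 := (Finset.mem_filter.1 hk0).2
    rw [← h2] at h1
    have := (Prod.ext_iff.1 h1).2
    simp only [he k hk, decide_eq_decide] at this
    exact this
  have habs : ∀ x : ℝ, 0 ≤ x → |σ * x| = x := fun x hx => by
    rw [abs_mul, abs_of_nonneg hx]; rcases hσ with rfl | rfl <;> simp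
  have hne : (T.image i).Nonempty := ⟨_, Finset.mem_image_of_mem i hk0⟩
  have fin : ∀ x : ℝ, (∀ k ∈ T, x ∈ uIoo (g^[i k] z) e0) → False := by
    intro x hx
    have := h.mult ht hz (le_refl (36 * L)) (T.image i) (y := fun _ => e0) (x := x) ?_ ?_ ?_ ?_
    · omega
    · intro j hj
      obtain ⟨k, hk, rfl⟩ := Finset.mem_image.1 hj
      exact (hH k (hTD k hk)).1.lt
    · intro j hj
      obtain ⟨k, hk, rfl⟩ := Finset.mem_image.1 hj
      have := (hH k (hTD k hk)).1.mon
      rwa [he k hk] at this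
    · intro j hj
      obtain ⟨k, hk, rfl⟩ := Finset.mem_image.1 hj
      have h1 := (hH k (hTD k hk)).1
      have := h1.val
      rw [he k hk] at this
      rw [this, add_sub_cancel_left, habs _ h1.pos.le]
      exact (hH k (hTD k hk)).2
    · intro j hj
      obtain ⟨k, hk, rfl⟩ := Finset.mem_image.1 hj
      exact hx k hk
  have hnee : ∀ k ∈ T, e0 ≠ g^[i k] z := fun k hk => he k hk ▸ (hH k (hTD k hk)).1.ne
  by_cases hs : g^[i k0] z < e0
  · obtain ⟨j, hj, hmax⟩ := Finset.exists_max_image _ (fun j => g^[j] z) hne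
    obtain ⟨k, hk, rfl⟩ := Finset.mem_image.1 hj
    have h1 := (hside k hk).2 hs
    refine fin ((g^[i k] z + e0) / 2) fun k' hk' => ?_
    have h2 := (hside k' hk').2 hs
    have h3 := hmax _ (Finset.mem_image_of_mem i hk')
    rw [uIoo_of_lt h2]
    constructor <;> linarith
  · obtain ⟨j, hj, hmin⟩ := Finset.exists_min_image _ (fun j => g^[j] z) hne
    obtain ⟨k, hk, rfl⟩ := Finset.mem_image.1 hj
    have h1 : e0 < g^[i k] z := lt_of_le_of_ne (not_lt.1 fun hh => hs ((hside k hk).1 hh)) (hnee k hk)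
    refine fin ((g^[i k] z + e0) / 2) fun k' hk' => ?_
    have h2 : e0 < g^[i k'] z :=
      lt_of_le_of_ne (not_lt.1 fun hh => hs ((hside k' hk').1 hh)) (hnee k' hk')
    have h3 := hmin _ (Finset.mem_image_of_mem i hk')
    rw [uIoo_of_gt h2]
    constructor <;> linarith

/-- Either some scale is big, or a failure of the fan to extend happens at a critical point at a
comparable distance. -/
lemma hit_big (h : Cyc A B a b K μ K' g g1 g2 g3 n p u v) (ht : Tri g p L) {z σ t c K3 c0 κ E : ℝ}
    (hz : z ∈ Ioo (u 0) (v 0)) (hσ : σ = 1 ∨ σ = -1) {N D : ℕ} (hD : N * 2 * 304 < D + 1)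
    (hD1 : 1 ≤ D)
    {col : ℝ → Fin N} (hcol : InjOn col {e | Gam A B g1 e}) {l l' r' r : ℝ}
    (hF : Fan A B g g1 (2 * n) z t l l' r' r) (htL : t ≤ 12 * L)
    (hn : ¬ Free A B g g1 z (2 * n) 0 (g^[2 * n] z + σ * (t * (1 + 1 / D))))
    (hE : E = Real.exp (K' * (608 * (B - A) ^ 2)))
    (hc : 0 < c) (hK3 : 0 < K3)
    (hSw : ∀ x ∈ Icc A B, g3 x * g1 x - 3 / 2 * g2 x ^ 2 ≤ K3 * g1 x ^ 2 - c)
    (hsum : 0 ≤ ∑ j ∈ Finset.range (2 * n), Sw g1 g2 g3 (g^[j] z) * Dm g g1 j z ^ 2)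
    (hc0 : ∀ x w, x ∈ Icc A B → w ∈ Icc A B → min (a - A) (B - b) ≤ w - x →
      (∀ y ∈ Ioo x w, g1 y ≠ 0) → c0 ≤ |g w - g x|)
    (hκ0 : 0 < κ) (hκ1 : 9 * E ^ 2 * (1 + D) * κ < c0)
    (hκ2 : K3 * (κ * (4 * E * (304 * (B - A)))) * (2 * (|K| + 1) * (9 * E ^ 2 * (1 + D))) ^ 2 < c) :
    ∃ j ≤ 2 * n, κ ≤ wt g g1 (2 * n) z t j := by
  by_contra hcon
  push Not at hcon
  have hg := h.cls.d0
  have hg1 := h.cls.cont1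
  have t0 := hF.t0
  have hDp : (1 : ℝ) ≤ D := by exact_mod_cast hD1
  have hD0 : (0 : ℝ) < D := by linarith
  have hne : ∀ j < 2 * n, g1 (g^[j] z) ≠ 0 := fun j _ => h.orb_ne hz j
  have hfree : Free A B g g1 z (2 * n) 0 (g^[2 * n] z + σ * t) := by
    rcases hσ with rfl | rfl
    · exact ⟨r, hF.mon.sub hF.mem right_mem_uIcc, by rw [Nat.sub_zero, hF.vr]; ring⟩
    · exact ⟨l, hF.mon.sub hF.mem left_mem_uIcc, by rw [Nat.sub_zero, hF.vl]; ring⟩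
  set lam : ℕ → ℝ := fun k => t * (1 + (k + 1) / D) with hlam
  have hmono : Monotone lam := by
    intro k k' hk
    have : (k : ℝ) ≤ k' := by exact_mod_cast hk
    simp only [hlam]
    gcongr
  have hlD : ∀ k ≤ D, lam k ≤ 3 * t := by
    intro k hk
    have h1 : (k : ℝ) ≤ D := by exact_mod_cast hk
    have h2 : ((k : ℝ) + 1) / D ≤ 2 := by rw [div_le_iff₀ hD0]; linarith
    simp only [hlam]
    nlinarith
  have hlz : (0:ℝ) ≤ lam 0 := by simp only [hlam]; positivity
  rcases hits (D := D) (lam := lam) hg hg1 (Nat.zero_le (2 * n))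
    (fun j _ => h.memIoo (h.orb hz j)) hne hσ hlz hmono
    (by simpa [hlam] using hn) with ⟨i, e, s, k, -, hk, hH, hs, hf⟩ | ⟨i, e, s, h1, h2⟩
  · have hi := hH.lt
    have hts : t ≤ s := hH.le_of_free hg hg1 hne hσ (Free.later hg hg1 (Nat.zero_le i) hi.le hfree)
    have hb := h.hit_bound ht hz hσ hH hDp t0 hts hs (s2 := lam (k + 1)) (by
      simp only [hlam]; push_cast; apply le_of_eq; field_simp; ring) (hlD _ hk) htL hf hE
    have hE0 : 0 < E := hE ▸ Real.exp_pos _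
    set C := 9 * E ^ 2 * (1 + D) with hC
    have hC0 : 0 < C := by positivity
    have hx := Ioo_subset_Icc_self (h.memIoo (h.orb hz i))
    have heI := hH.gam.1
    have hneu : ∀ v ∈ uIoo (g^[i] z) e, g1 v ≠ 0 := by
      intro w hw
      obtain ⟨w1, w2, w3⟩ := mem_uIoo_iff.1 hw
      exact (hH.mon 0 (by omega) w w1).2 w2 w3
    have hmac : min (a - A) (B - b) ≤ |e - g^[i] z| → False := by
      intro hm
      have : c0 ≤ |g e - g (g^[i] z)| := by
        rcases le_total (g^[i] z) e with hle | hle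
        · rw [abs_of_nonneg (by linarith)] at hm
          exact hc0 _ _ hx heI hm fun y hy => hneu y (Ioo_subset_uIoo hy)
        · rw [abs_of_nonpos (by linarith)] at hm
          rw [abs_sub_comm]
          exact hc0 _ _ heI hx (by linarith) fun y hy => hneu y (by rw [uIoo_comm]; exact Ioo_subset_uIoo hy)
      have : C * wt g g1 (2 * n) z t (i + 1) ≤ C * κ :=
        mul_le_mul_of_nonneg_left (hcon _ hi).le hC0.le
      linarith
    have hzi := h.memIcc (h.orb hz i)
    rcases hH.gam.2 with h0 | h0 | h0
    · have k1 := h.cls.crit_dist hx heI h0 hneu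
      rw [abs_sub_comm, ] at k1
      have k2 := h.wt_sq hz (t := t) hSw hsum
      have hw0 := wt_pos (q := 2 * n) t0 hne
      rw [wt_succ hne hi] at hb
      set G := |g1 (g^[i] z)| with hG
      have hGp : 0 < G := abs_pos.2 (hne i hi)
      set W := wt g g1 (2 * n) z t i with hW
      have hKK : K ≤ |K| + 1 := by linarith [le_abs_self K]
      have k3 : G ≤ 2 * (|K| + 1) * C * W := by
        have : G * G ≤ (2 * (|K| + 1) * C * W) * G := by
          rw [← sq, hG, sq_abs, ← hG]
          have hd := abs_nonneg (g e - g (g^[i] z))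
          nlinarith [mul_le_mul_of_nonneg_right hKK hd, mul_le_mul_of_nonneg_left hb (show 0 ≤ 2 * (|K| + 1) by positivity)]
        exact le_of_mul_le_mul_right this hGp
      have k4 : 1 ≤ (2 * (|K| + 1) * C) ^ 2 * (W / g1 (g^[i] z)) ^ 2 := by
        rw [← mul_pow, ← sq_abs, abs_mul, abs_div, ← hG, abs_of_pos (hw0 i), abs_of_pos (by positivity)]
        have : 1 ≤ 2 * (|K| + 1) * C * (W / G) := by
          rw [← mul_div_assoc, le_div_iff₀ hGp]; linarith
        exact one_le_pow₀ this
      have k5 : (W / g1 (g^[i] z)) ^ 2 ≤ ∑ j ∈ Finset.range (2 * n),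
          (wt g g1 (2 * n) z t j / g1 (g^[j] z)) ^ 2 :=
        Finset.single_le_sum (f := fun j => (wt g g1 (2 * n) z t j / g1 (g^[j] z)) ^ 2)
          (fun j _ => sq_nonneg _) (Finset.mem_range.2 hi)
      have k6 : ∑ j ∈ Finset.range (2 * n), wt g g1 (2 * n) z t j ^ 2 ≤
          κ * (4 * E * (304 * (B - A))) := by
        refine le_trans ?_ (mul_le_mul_of_nonneg_left (h.wt_sum ht hz hF (by linarith [ht.pos]) hE) hκ0.le)
        rw [Finset.mul_sum]
        refine Finset.sum_le_sum fun j hj => ?_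
        rw [sq]
        exact mul_le_mul_of_nonneg_right (hcon j (Finset.mem_range.1 hj).le).le (hw0 j).le
      have k7 : c * (W / g1 (g^[i] z)) ^ 2 ≤ K3 * (κ * (4 * E * (304 * (B - A)))) :=
        (mul_le_mul_of_nonneg_left k5 hc.le).trans (k2.trans (mul_le_mul_of_nonneg_left k6 hK3.le))
      have k8 : c ≤ c * (W / g1 (g^[i] z)) ^ 2 * (2 * (|K| + 1) * C) ^ 2 := by
        have := mul_le_mul_of_nonneg_left k4 hc.le
        linarith
      have := mul_le_mul_of_nonneg_right k7 (sq_nonneg (2 * (|K| + 1) * C))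
      linarith
    · refine hmac ((min_le_left _ _).trans ?_)
      rw [h0, abs_sub_comm]; exact (by linarith [hzi.1] : _ ≤ _).trans (le_abs_self _)
    · refine hmac ((min_le_right _ _).trans ?_)
      rw [h0]; exact (by linarith [hzi.2] : _ ≤ _).trans (le_abs_self _)
  · exact h.not_many_hits ht hz hσ hD hcol
      (fun k hk => ⟨(h1 k hk).2.1, (h1 k hk).2.2.trans ((hlD k hk).trans (by linarith))⟩)
      (fun k k' a b => (h2 k k' a b).1)

end Cyc

/-- A long monotone branch of definite size with summable geometry. -/
structure Out (A B κ c C : ℝ) (g g1 : ℝ → ℝ) (n s : ℕ) (y α l l' r' r : ℝ) : Prop where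
  big : κ ≤ α
  mon : Mon A B g g1 s l r
  ll' : c ≤ l' - l
  ly : l' < y
  yr : y < r'
  rr' : c ≤ r - r'
  bl : ∀ i ≤ s, c * (α * |Dm g g1 i y|) ≤ |g^[i] l' - g^[i] y| ∧
    |g^[i] l' - g^[i] y| ≤ C * (α * |Dm g g1 i y|)
  br : ∀ i ≤ s, c * (α * |Dm g g1 i y|) ≤ |g^[i] r' - g^[i] y| ∧
    |g^[i] r' - g^[i] y| ≤ C * (α * |Dm g g1 i y|)
  sum : ∑ i ∈ Finset.range s, α * |Dm g g1 i y| ≤ C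
  sq : ∑ i ∈ Finset.range s, (α * |Dm g g1 i y| / g1 (g^[i] y)) ^ 2 ≤ C
  last : α * |Dm g g1 s y| * (n - 4) ≤ C

namespace Cyc
variable {A B a b K μ K' p L : ℝ} {g g1 g2 g3 : ℝ → ℝ} {n : ℕ} {u v : ℕ → ℝ}

lemma free_small (h : Cyc A B a b K μ K' g g1 g2 g3 n p u v) {z : ℝ}
    (hz : z ∈ Ioo (u 0) (v 0)) {σ : ℝ} (hσ : σ = 1 ∨ σ = -1) :
    ∃ ε > 0, ∀ t, 0 ≤ t → t ≤ ε → Free A B g g1 z (2 * n) 0 (g^[2 * n] z + σ * t) := by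
  have hg := h.cls.d0
  have hg1 := h.cls.cont1
  have hl : (u 0 + z) / 2 ∈ Ioo (u 0) (v 0) := ⟨by linarith [hz.1], by linarith [hz.1, hz.2]⟩
  have hr : (z + v 0) / 2 ∈ Ioo (u 0) (v 0) := ⟨by linarith [hz.1, hz.2], by linarith [hz.2]⟩
  have hM := h.mon_J hl hr (2 * n)
  have hzm : z ∈ uIoo ((u 0 + z) / 2) ((z + v 0) / 2) := by
    rw [uIoo_of_lt (by linarith [hz.1, hz.2])]
    constructor <;> linarith [hz.1, hz.2]
  have hF := hM.mem' hg hg1 hzm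
  have main : ∀ w ∈ Ioo (u 0) (v 0), 0 < σ * (g^[2 * n] w - g^[2 * n] z) →
      ∃ ε > 0, ∀ t, 0 ≤ t → t ≤ ε → Free A B g g1 z (2 * n) 0 (g^[2 * n] z + σ * t) := by
    intro w hw hpos
    refine ⟨_, hpos, fun t h0 h1 => Free.mono hg (Nat.zero_le _) ⟨w, h.mon_J hz hw _, rfl⟩ ?_⟩
    have e : g^[2 * n - 0] w = g^[2 * n] z + σ * (σ * (g^[2 * n] w - g^[2 * n] z)) := by
      rcases hσ with rfl | rfl <;> simp
    rw [e, mem_uIcc_add hσ hpos.le]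
    exact ⟨t, h0, h1, rfl⟩
  simp only [uIoo, mem_Ioo, inf_lt_iff, lt_sup_iff] at hF
  rcases hσ with rfl | rfl
  · rcases hF.2 with h | h
    · exact main _ hl (by linarith)
    · exact main _ hr (by linarith)
  · rcases hF.1 with h | h
    · exact main _ hl (by linarith)
    · exact main _ hr (by linarith)

lemma exists_schwarz (h : Cyc A B a b K μ K' g g1 g2 g3 n p u v) :
    ∃ z ∈ Ioo (u 0) (v 0),
      0 ≤ ∑ j ∈ Finset.range (2 * n), Sw g1 g2 g3 (g^[j] z) * Dm g g1 j z ^ 2 := by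
  have hg := h.cls.d0
  have hg1 := h.cls.cont1
  have hp : p ∈ Ioo (u 0) (v 0) := h.mem 0
  have hcont : Continuous (Dm g g1 (2 * n)) := continuous_Dm h.cls.cont hg1 _
  have hne : ∀ x ∈ Ioo (u 0) (v 0), Dm g g1 (2 * n) x ≠ 0 := fun x hx =>
    Dm_ne_zero fun j _ => h.orb_ne hx j
  have hp0 : 0 < Dm g g1 (2 * n) p := by
    refine lt_of_le_of_ne ?_ (hne p hp).symm
    rw [two_mul, Dm_add, h.fix]; exact mul_self_nonneg _
  have hpos : ∀ x ∈ Ioo (u 0) (v 0), 0 < Dm g g1 (2 * n) x := by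
    rcases sign_of_ne hcont hne with hs | hs
    · exact hs
    · exact absurd (hs p hp) (not_lt.2 hp0.le)
  obtain ⟨x, hx, hmin⟩ := isCompact_Icc.exists_isMinOn
    (⟨p, Ioo_subset_Icc_self hp⟩ : (Icc (u 0) (v 0)).Nonempty) hcont.continuousOn
  have hmin : ∀ w ∈ Icc (u 0) (v 0), Dm g g1 (2 * n) x ≤ Dm g g1 (2 * n) w := hmin
  have hmid : Dm g g1 (2 * n) p ≤ 1 := h.mid 0
  have : ∃ z ∈ Ioo (u 0) (v 0), ∀ w ∈ Icc (u 0) (v 0), Dm g g1 (2 * n) z ≤ Dm g g1 (2 * n) w := by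
    by_cases hx' : x ∈ Ioo (u 0) (v 0)
    · exact ⟨x, hx', hmin⟩
    · refine ⟨p, hp, fun w hw => hmid.trans (le_trans ?_ (hmin w hw))⟩
      rcases eq_endpoints_or_mem_Ioo_of_mem_Icc hx with e | e | e
      · rw [e]; exact h.endu 0
      · rw [e]; exact h.endv 0
      · exact absurd e hx'
  obtain ⟨z, hz, hzm⟩ := this
  exact ⟨z, hz, schwarz_nonneg_of_min h.cls.d0 h.cls.d1 h.cls.d2 hz (fun x hx j _ => h.orb_ne hx j)
    hpos fun w hw => hzm w (Ioo_subset_Icc_self hw)⟩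

lemma fan_of_free (h : Cyc A B a b K μ K' g g1 g2 g3 n p u v) {z t : ℝ}
    (hz : z ∈ Ioo (u 0) (v 0)) (t0 : 0 < t)
    (hf : ∀ σ : ℝ, σ = 1 ∨ σ = -1 → Free A B g g1 z (2 * n) 0 (g^[2 * n] z + σ * t)) :
    ∃ l l' r' r, Fan A B g g1 (2 * n) z t l l' r' r := by
  obtain ⟨r, hr, hrv⟩ := hf 1 (Or.inl rfl)
  obtain ⟨l, hl, hlv⟩ := hf (-1) (Or.inr rfl)
  obtain ⟨l', r', hF⟩ := Fan.exists_of h.cls.d0 h.cls.cont1 t0 (fun j _ => h.orb_ne hz j)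
    (l := l) (r := r) hl (by rw [Nat.sub_zero] at hlv ⊢; rw [hlv]; ring) hr
    (by rw [Nat.sub_zero] at hrv ⊢; rw [hrv]; ring)
  exact ⟨l, l', r', r, hF⟩

lemma exists_big (A B a b K μ K' : ℝ) (hμ : 0 < μ) (aA : A < a) (ab : a < b) (bB : b < B) :
    ∃ κ > 0, ∀ (g g1 g2 g3 : ℝ → ℝ) (n : ℕ) (p : ℝ) (u v : ℕ → ℝ) (L z : ℝ),
      Cyc A B a b K μ K' g g1 g2 g3 n p u v → Tri g p L → z ∈ Ioo (u 0) (v 0) →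
      0 ≤ ∑ j ∈ Finset.range (2 * n), Sw g1 g2 g3 (g^[j] z) * Dm g g1 j z ^ 2 →
      ∃ t l l' r' r, t ≤ 12 * L ∧ Fan A B g g1 (2 * n) z t l l' r' r ∧
        ∃ j ≤ 2 * n, κ ≤ wt g g1 (2 * n) z t j := by
  obtain ⟨c, K3, hc, hK3, hSw⟩ := Cls.schwarz_bound K μ hμ
  obtain ⟨c0, hc0, hli⟩ := Cls.long_image K μ hμ (min (a - A) (B - b)) (lt_min (by linarith) (by linarith))
  obtain ⟨N, hN⟩ := Cls.coloring A B K μ hμ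
  obtain ⟨D, hD⟩ : ∃ D : ℕ, D = N * 2 * 304 + 1 := ⟨_, rfl⟩
  set E := Real.exp (K' * (608 * (B - A) ^ 2)) with hE
  have hE0 : 0 < E := Real.exp_pos _
  have hBA : 0 < B - A := by linarith
  have ev : ∀ (P : ℝ → ℝ) (x : ℝ), Continuous P → P 0 < x → ∀ᶠ κ in 𝓝[>] (0:ℝ), P κ < x :=
    fun P x hP hx => (hP.tendsto 0).mono_left nhdsWithin_le_nhds |>.eventually_lt_const hx
  have hlog : 0 < Real.log (5 / 2) := Real.log_pos (by norm_num)
  obtain ⟨κ, ⟨k1, k2, k3⟩, hκ0⟩ := (((ev (fun κ => K' * (2 * E ^ 2 * κ * (608 * (B - A)))) _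
    (by fun_prop) (by simpa using hlog)).and ((ev (fun κ => 9 * E ^ 2 * (1 + D) * κ) c0 (by fun_prop)
    (by simpa using hc0)).and (ev (fun κ => K3 * (κ * (4 * E * (304 * (B - A)))) *
      (2 * (|K| + 1) * (9 * E ^ 2 * (1 + D))) ^ 2) c (by fun_prop) (by simpa using hc)))).and
    self_mem_nhdsWithin).exists
  refine ⟨κ, hκ0, fun g g1 g2 g3 n p u v L z h ht hz hsum => ?_⟩
  obtain ⟨col, hcol⟩ := hN g g1 g2 g3 h.cls
  have hL := ht.pos
  have hD0 : (0 : ℝ) < D := by exact_mod_cast (show 0 < D by omega)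
  set ρ : ℝ := D / (D + 1) with hρ
  have hρ0 : 0 < ρ := by positivity
  have hρ1 : ρ < 1 := by rw [hρ, div_lt_one (by positivity)]; linarith
  classical
  let P : ℕ → Prop := fun k => ∀ σ : ℝ, σ = 1 ∨ σ = -1 →
    Free A B g g1 z (2 * n) 0 (g^[2 * n] z + σ * (12 * L * ρ ^ k))
  have hex : ∃ k, P k := by
    obtain ⟨ε1, h1, f1⟩ := h.free_small hz (σ := 1) (Or.inl rfl)
    obtain ⟨ε2, h2, f2⟩ := h.free_small hz (σ := -1) (Or.inr rfl)
    obtain ⟨k, hk⟩ := exists_pow_lt_of_lt_one (show 0 < min ε1 ε2 / (12 * L) by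
      have := lt_min h1 h2; positivity) hρ1
    rw [lt_div_iff₀ (by positivity)] at hk
    have hk1 := (mul_comm _ _).trans_le (hk.le.trans (min_le_left _ _))
    have hk2 := (mul_comm _ _).trans_le (hk.le.trans (min_le_right _ _))
    refine ⟨k, fun σ hσ => ?_⟩
    rcases hσ with rfl | rfl
    · exact f1 _ (by positivity) hk1
    · exact f2 _ (by positivity) hk2
  set k := Nat.find hex with hk
  have hPk : P k := Nat.find_spec hex
  have t0 : 0 < 12 * L * ρ ^ k := by positivity
  have htL : 12 * L * ρ ^ k ≤ 12 * L := by
    have : ρ ^ k ≤ 1 := pow_le_one₀ hρ0.le hρ1.le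
    nlinarith
  obtain ⟨l, l', r', r, hF⟩ := h.fan_of_free hz t0 hPk
  refine ⟨_, l, l', r', r, htL, hF, ?_⟩
  rcases Nat.eq_zero_or_pos k with e | e
  · rw [e, pow_zero, mul_one] at hF ⊢
    exact h.full_big ht hz hF hE hκ0 k1.le
  · have hnot : ¬ P (k - 1) := Nat.find_min hex (by omega)
    simp only [P] at hnot
    push Not at hnot
    obtain ⟨σ, hσ, hf⟩ := hnot
    refine h.hit_big ht hz hσ (D := D) (by omega) (by omega) hcol hF htL ?_ hE hc hK3
      (hSw A B g g1 g2 g3 h.cls) hsum (hli A B g g1 g2 g3 h.cls) hκ0 k2 k3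
    convert hf using 3
    obtain ⟨j, hj⟩ := Nat.exists_eq_add_of_lt e
    rw [hj, Nat.add_sub_cancel, pow_succ, hρ]
    simp only [zero_add]
    field_simp

lemma exists_out_aux (A B a b K μ K' : ℝ) (hμ : 0 < μ) (aA : A < a) (ab : a < b) (bB : b < B) :
    ∃ κ c C : ℝ, 0 < κ ∧ 0 < c ∧ 0 < C ∧ ∀ (g g1 g2 g3 : ℝ → ℝ) (n : ℕ) (p : ℝ)
      (u v : ℕ → ℝ) (L : ℝ), Cyc A B a b K μ K' g g1 g2 g3 n p u v → Tri g p L →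
      ∃ j s y α l l' r' r, y ∈ Ioo (u j) (v j) ∧ Out A B κ c C g g1 n s y α l l' r' r := by
  obtain ⟨κ, hκ, H⟩ := exists_big A B a b K μ K' hμ aA ab bB
  obtain ⟨c1, K3, hc1, hK3, hSw⟩ := Cls.schwarz_bound K μ hμ
  set E := Real.exp (K' * (608 * (B - A) ^ 2)) with hE
  have hE0 : 0 < E := Real.exp_pos _
  have hBA : 0 < B - A := by linarith
  set S := 4 * E * (304 * (B - A)) with hS
  have hS0 : 0 < S := by positivity
  set c := min (1 / (4 * E)) (κ / (16 * E ^ 4)) with hc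
  set C := E ^ 2 + S + K3 * (S * S) / c1 + 24 * (b - a) with hC
  have hc0 : 0 < c := by positivity
  have hba : 0 < b - a := by linarith
  have hT : 0 < K3 * (S * S) / c1 := by positivity
  have hC0 : 0 < C := by positivity
  have hE2 : 0 < E ^ 2 := by positivity
  refine ⟨κ, c, C, hκ, hc0, hC0, fun g g1 g2 g3 n p u v L h ht => ?_⟩
  obtain ⟨z, hz, hsum⟩ := h.exists_schwarz
  obtain ⟨t, l, l', r', r, htL, hF, j, hj, hjκ⟩ := H g g1 g2 g3 n p u v L z h ht hz hsum
  have hg := h.cls.d0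
  have hg1 := h.cls.cont1
  have hne : ∀ j < 2 * n, g1 (g^[j] z) ≠ 0 := fun j _ => h.orb_ne hz j
  have hw0 := wt_pos (q := 2 * n) hF.t0 hne
  have hL := ht.pos
  set α := wt g g1 (2 * n) z t j with hα
  have hα0 : 0 < α := hw0 j
  have hwt : ∀ i ≤ 2 * n - j, α * |Dm g g1 i (g^[j] z)| = wt g g1 (2 * n) z t (j + i) :=
    fun i hi => (wt_add hne (by omega)).symm
  have hws := h.wt_sum ht hz hF (by linarith) hE
  have hkoe := fun i (hi : i ≤ 2 * n) => h.fan_koebe ht hz hi hF (by linarith) hE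
  have hsplit : ∀ f : ℕ → ℝ, (∀ i, 0 ≤ f i) →
      ∑ i ∈ Finset.range (2 * n - j), f (j + i) ≤ ∑ i ∈ Finset.range (2 * n), f i := by
    intro f hf
    obtain ⟨m, hm⟩ := Nat.exists_eq_add_of_le hj
    rw [hm, Nat.add_sub_cancel_left, Finset.sum_range_add]
    have := Finset.sum_nonneg (s := Finset.range j) fun i _ => hf i
    linarith
  have hbd : ∀ i ≤ 2 * n - j, ∀ x, (wt g g1 (2 * n) z t (j + i) / (4 * E) ≤
      |g^[j + i] x - g^[j + i] z| ∧ |g^[j + i] x - g^[j + i] z| ≤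
      E ^ 2 * wt g g1 (2 * n) z t (j + i)) → c * (α * |Dm g g1 i (g^[j] z)|) ≤
      |g^[i] (g^[j] x) - g^[i] (g^[j] z)| ∧ |g^[i] (g^[j] x) - g^[i] (g^[j] z)| ≤
      C * (α * |Dm g g1 i (g^[j] z)|) := by
    intro i hi x hx
    rw [hwt i hi, ← Function.iterate_add_apply, ← Function.iterate_add_apply, add_comm i j]
    have := (hw0 (j + i)).le
    refine ⟨le_trans ?_ hx.1, hx.2.trans ?_⟩
    · rw [div_eq_mul_one_div, mul_comm]
      exact mul_le_mul_of_nonneg_left (min_le_left _ _) this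
    · exact mul_le_mul_of_nonneg_right (by rw [hC]; linarith) this
  have hsum1 : ∑ i ∈ Finset.range (2 * n - j), α * |Dm g g1 i (g^[j] z)| ≤ C := by
    calc _ = ∑ i ∈ Finset.range (2 * n - j), wt g g1 (2 * n) z t (j + i) :=
          Finset.sum_congr rfl fun i hi => hwt i (Finset.mem_range.1 hi).le
      _ ≤ S := (hsplit _ fun i => (hw0 i).le).trans hws
      _ ≤ C := by rw [hC]; linarith
  have hsum2 : ∑ i ∈ Finset.range (2 * n - j),
      (α * |Dm g g1 i (g^[j] z)| / g1 (g^[i] (g^[j] z))) ^ 2 ≤ C := by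
    have k1 := h.wt_sq hz (t := t) (hSw A B g g1 g2 g3 h.cls) hsum
    have k2 : ∑ i ∈ Finset.range (2 * n), wt g g1 (2 * n) z t i ^ 2 ≤ S * S := by
      calc _ ≤ ∑ i ∈ Finset.range (2 * n), S * wt g g1 (2 * n) z t i := by
            refine Finset.sum_le_sum fun i hi => ?_
            rw [sq]
            refine mul_le_mul_of_nonneg_right (le_trans ?_ hws) (hw0 i).le
            exact Finset.single_le_sum (f := fun i => wt g g1 (2 * n) z t i)
              (fun i _ => (hw0 i).le) hi
        _ ≤ _ := by rw [← Finset.mul_sum]; exact mul_le_mul_of_nonneg_left hws hS0.le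
    have k3 : ∑ i ∈ Finset.range (2 * n), (wt g g1 (2 * n) z t i / g1 (g^[i] z)) ^ 2 ≤
        K3 * (S * S) / c1 := by
      rw [le_div_iff₀ hc1, mul_comm]
      exact k1.trans (mul_le_mul_of_nonneg_left k2 hK3.le)
    calc _ = ∑ i ∈ Finset.range (2 * n - j),
          (wt g g1 (2 * n) z t (j + i) / g1 (g^[j + i] z)) ^ 2 :=
          Finset.sum_congr rfl fun i hi => by
            rw [hwt i (Finset.mem_range.1 hi).le, ← Function.iterate_add_apply, add_comm i j]
      _ ≤ _ := (hsplit (fun i => (wt g g1 (2 * n) z t i / g1 (g^[i] z)) ^ 2)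
          fun i => sq_nonneg _).trans k3
      _ ≤ C := by rw [hC]; linarith
  have hlast : α * |Dm g g1 (2 * n - j) (g^[j] z)| * (n - 4) ≤ C := by
    rw [hwt _ le_rfl, Nat.add_sub_cancel' hj]
    have e : wt g g1 (2 * n) z t (2 * n) = t := by simp [wt, Dm]
    rw [e]
    have := h.span_le ht
    rcases le_total ((n : ℝ) - 4) 0 with hneg | hnn
    · have := mul_nonpos_of_nonneg_of_nonpos hF.t0.le hneg
      linarith
    · have := mul_le_mul_of_nonneg_right htL hnn
      rw [hC]; linarith
  have hF' := hF.later' hg hg1 hj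
  have hcol : ∀ x, α / (16 * E ^ 4) ≤ x → c ≤ x := fun x hx => by
    refine (min_le_right _ _).trans (le_trans ?_ hx)
    gcongr
  have hkj := hkoe j hj
  have hy := h.orb hz j
  have hmem := mem_uIoo_iff.1 hF'.hz
  obtain ⟨a1, a2, a3⟩ := mem_uIoo_iff.1 hF'.hl'
  obtain ⟨b1, b2, b3⟩ := mem_uIoo_iff.1 hF'.hr'
  rcases lt_or_ge (g^[j] l') (g^[j] z) with hlt | hge
  · have hr : g^[j] z < g^[j] r' := by
      have := hF'.hz
      simp only [uIoo, mem_Ioo, lt_sup_iff] at this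
      rcases this.2 with h | h
      · linarith
      · exact h
    refine ⟨j, 2 * n - j, g^[j] z, α, g^[j] l, g^[j] l', g^[j] r', g^[j] r, hy, hjκ, hF'.mon, ?_, hlt,
      hr, ?_, fun i hi => hbd i hi _ ⟨(hkoe _ (by omega)).1.1, (hkoe _ (by omega)).1.2.1⟩,
      fun i hi => hbd i hi _ ⟨(hkoe _ (by omega)).2.1, (hkoe _ (by omega)).2.2.1⟩, hsum1, hsum2, hlast⟩
    · refine hcol _ (hkj.1.2.2.trans (le_of_eq ?_))
      rw [abs_of_nonpos, neg_sub]
      rw [mem_uIcc] at a1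
      rcases a1 with a1 | a1 <;> linarith
    · refine hcol _ (hkj.2.2.2.trans (le_of_eq ?_))
      rw [abs_of_nonneg]
      rw [mem_uIcc] at b1
      rcases b1 with b1 | b1 <;> linarith
  · have hlt : g^[j] z < g^[j] l' := lt_of_le_of_ne hge (by simpa using a3.symm)
    have hr : g^[j] r' < g^[j] z := by
      have := hF'.hz
      simp only [uIoo, mem_Ioo, inf_lt_iff] at this
      rcases this.1 with h | h
      · linarith
      · exact h
    refine ⟨j, 2 * n - j, g^[j] z, α, g^[j] r, g^[j] r', g^[j] l', g^[j] l, hy, hjκ, hF'.mon.symm, ?_, hr,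
      hlt, ?_, fun i hi => hbd i hi _ ⟨(hkoe _ (by omega)).2.1, (hkoe _ (by omega)).2.2.1⟩,
      fun i hi => hbd i hi _ ⟨(hkoe _ (by omega)).1.1, (hkoe _ (by omega)).1.2.1⟩, hsum1, hsum2, hlast⟩
    · refine hcol _ (hkj.2.2.2.trans (le_of_eq ?_))
      rw [abs_of_nonpos, neg_sub]
      rw [mem_uIcc] at b1
      rcases b1 with b1 | b1 <;> linarith
    · refine hcol _ (hkj.1.2.2.trans (le_of_eq ?_))
      rw [abs_of_nonneg]
      rw [mem_uIcc] at a1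
      rcases a1 with a1 | a1 <;> linarith

/-- Every cycle of basins without critical points carries a branch with uniform geometry. -/
theorem exists_out (A B a b K μ K' : ℝ) (hμ : 0 < μ) (aA : A < a) (ab : a < b) (bB : b < B) :
    ∃ κ c C : ℝ, 0 < κ ∧ 0 < c ∧ 0 < C ∧ ∀ (g g1 g2 g3 : ℝ → ℝ) (n : ℕ) (p : ℝ)
      (u v : ℕ → ℝ), Cyc A B a b K μ K' g g1 g2 g3 n p u v →
      ∃ j s y α l l' r' r, y ∈ Ioo (u j) (v j) ∧ Out A B κ c C g g1 n s y α l l' r' r := by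
  obtain ⟨κ, c, C, hκ, hc, hC, H⟩ := exists_out_aux A B a b K μ K' hμ aA ab bB
  refine ⟨κ, c, C, hκ, hc, hC, fun g g1 g2 g3 n p u v h => ?_⟩
  obtain ⟨k, L, ht⟩ := h.exists_tri
  obtain ⟨j, s, y, α, l, l', r', r, hy, ho⟩ := H g g1 g2 g3 n _ _ _ L (h.shift k) ht
  exact ⟨j + k, s, y, α, l, l', r', r, hy, ho⟩

end Cyc

/-- The basin `W` of a periodic orbit through `p`, containing no critical points. -/
structure Bas (a b : ℝ) (G G1 : ℝ → ℝ) (p : ℝ) (n : ℕ) (W : Set ℝ) : Prop where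
  d : ∀ x, HasDerivAt G (G1 x) x
  c1 : Continuous G1
  maps : MapsTo G (Icc a b) (Icc a b)
  n0 : 0 < n
  fix : G^[n] p = p
  ex : ∀ m, G^[m] p = p → m % n = 0
  sub : W ⊆ Icc a b
  orb : ∀ i, G^[i] p ∈ W
  step : ∀ x ∈ Icc a b, (G x ∈ W ↔ x ∈ W)
  opn : ∀ x ∈ W, ∀ᶠ y in 𝓝 x, y ∈ Icc a b → y ∈ W
  lim : ∀ x ∈ W, ∀ m, 0 < m → ∀ y, Tendsto (fun k => G^[m * k] x) atTop (𝓝 y) → ∃ i, y = G^[i] p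
  ne : ∀ x ∈ W, G1 x ≠ 0

namespace Bas
variable {a b p : ℝ} {G G1 : ℝ → ℝ} {n : ℕ} {W : Set ℝ}

lemma cont (h : Bas a b G G1 p n W) : Continuous G :=
  continuous_iff_continuousAt.2 fun x => (h.d x).continuousAt

lemma iter (h : Bas a b G G1 p n W) {x : ℝ} (hx : x ∈ W) (m : ℕ) : G^[m] x ∈ W := by
  induction m with
  | zero => exact hx
  | succ m ih => rw [Function.iterate_succ_apply']; exact (h.step _ (h.sub ih)).2 ih

lemma iter_iff (h : Bas a b G G1 p n W) {x : ℝ} (hx : x ∈ Icc a b) (m : ℕ) :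
    G^[m] x ∈ Icc a b ∧ (G^[m] x ∈ W ↔ x ∈ W) := by
  induction m with
  | zero => exact ⟨hx, Iff.rfl⟩
  | succ m ih =>
    rw [Function.iterate_succ_apply']
    exact ⟨h.maps ih.1, (h.step _ ih.1).trans ih.2⟩

lemma mod (h : Bas a b G G1 p n W) (i : ℕ) : G^[i % n] p = G^[i] p := by
  conv_rhs => rw [← Nat.mod_add_div i n, Function.iterate_add_apply, Function.iterate_mul]
  rw [Function.iterate_fixed h.fix]

lemma fixed_mem_orb (h : Bas a b G G1 p n W) {x : ℝ} (hx : x ∈ W) {m : ℕ} (hm : 0 < m)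
    (e : G^[m] x = x) : ∃ i, x = G^[i] p := by
  refine h.lim x hx m hm x ?_
  have : (fun k => G^[m * k] x) = fun _ => x := by
    funext k; rw [Function.iterate_mul, Function.iterate_fixed e]
  rw [this]; exact tendsto_const_nhds

lemma back (h : Bas a b G G1 p n W) (i : ℕ) : ∃ l, ∀ m, G^[l] (G^[m] (G^[i] p)) = G^[m] p ∧
    (l + i) % n = 0 := by
  obtain ⟨l, hl⟩ : ∃ l, l + i = n * i := ⟨n * i - i, by have := Nat.le_mul_of_pos_left i h.n0; omega⟩
  refine ⟨l, fun m => ⟨?_, by rw [hl]; simp⟩⟩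
  rw [← Function.iterate_add_apply, ← Function.iterate_add_apply,
    show l + m + i = m + n * i by omega, Function.iterate_add_apply, Function.iterate_mul,
    Function.iterate_fixed h.fix]

lemma orb_fix (h : Bas a b G G1 p n W) {i m : ℕ} (e : G^[m] (G^[i] p) = G^[i] p) : m % n = 0 := by
  obtain ⟨l, hl⟩ := h.back i
  apply h.ex
  have h1 := (hl m).1
  rw [e] at h1
  have h2 := (hl 0).1
  simp only [Function.iterate_zero, id] at h2
  rw [← h1, h2]

lemma mono_fix {H : ℝ → ℝ} {C : Set ℝ} (hH : MonotoneOn H C) (hC : MapsTo H C C) {x : ℝ} (hx : x ∈ C)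
    {k : ℕ} (hk : 0 < k) (e : H^[k] x = x) : H x = x := by
  have mem : ∀ j, H^[j] x ∈ C := fun j => hC.iterate j hx
  obtain ⟨j, rfl⟩ := Nat.exists_eq_add_of_lt hk
  rw [zero_add] at e
  rcases lt_trichotomy (H x) x with hh | hh | hh
  · have : ∀ j, H^[j + 1] x ≤ H x := by
      intro j
      induction j with
      | zero => simp
      | succ j ih =>
        rw [Function.iterate_succ_apply']
        exact hH (mem _) hx (ih.trans hh.le)
    linarith [this j]
  · exact hh
  · have : ∀ j, H x ≤ H^[j + 1] x := by
      intro j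
      induction j with
      | zero => simp
      | succ j ih =>
        rw [Function.iterate_succ_apply']
        exact hH hx (mem _) (hh.le.trans ih)
    linarith [this j]

lemma dm_ne (h : Bas a b G G1 p n W) {x : ℝ} (hx : x ∈ W) (m : ℕ) : Dm G G1 m x ≠ 0 :=
  Dm_ne_zero fun j _ => h.ne _ (h.iter hx j)

lemma mono_or (h : Bas a b G G1 p n W) {C : Set ℝ} (hC : C.OrdConnected) (hCW : C ⊆ W) (m : ℕ) :
    MonotoneOn (G^[m]) C ∨ AntitoneOn (G^[m]) C := by
  have hd : ∀ x, HasDerivAt (G^[m]) (Dm G G1 m x) x := hasDerivAt_iterate h.d m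
  have hs : (∀ x ∈ C, 0 ≤ Dm G G1 m x) ∨ (∀ x ∈ C, Dm G G1 m x ≤ 0) := by
    by_contra! hh
    obtain ⟨⟨x, hx, hx0⟩, y, hy, hy0⟩ := hh
    obtain ⟨z, hz, hz0⟩ := hC.isPreconnected.intermediate_value hx hy
      (continuous_Dm h.cont h.c1 m).continuousOn ⟨hx0.le, hy0.le⟩
    exact h.dm_ne (hCW hz) m hz0
  have hdiff : Differentiable ℝ (G^[m]) := fun x => (hd x).differentiableAt
  rcases hs with hs | hs
  · left
    refine monotoneOn_of_deriv_nonneg hC.convex hdiff.continuous.continuousOn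
      hdiff.differentiableOn fun x hx => ?_
    rw [(hd x).deriv]; exact hs x (interior_subset hx)
  · right
    refine antitoneOn_of_deriv_nonpos hC.convex hdiff.continuous.continuousOn
      hdiff.differentiableOn fun x hx => ?_
    rw [(hd x).deriv]; exact hs x (interior_subset hx)

lemma orb_sep_aux (h : Bas a b G G1 p n W) {i m : ℕ}
    (hs : uIcc (G^[i] p) (G^[m] (G^[i] p)) ⊆ W) : m % n = 0 := by
  by_contra hm
  have hm0 : 0 < m := Nat.pos_of_ne_zero fun e => hm (by simp [e])
  set C := connectedComponentIn W (G^[i] p) with hC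
  have hCp : IsPreconnected C := isPreconnected_connectedComponentIn
  have hCW : C ⊆ W := connectedComponentIn_subset _ _
  have hpC : G^[i] p ∈ C := mem_connectedComponentIn (h.orb i)
  have hsC : uIcc (G^[i] p) (G^[m] (G^[i] p)) ⊆ C :=
    isPreconnected_uIcc.subset_connectedComponentIn left_mem_uIcc hs
  have hC2 : C.OrdConnected := hCp.ordConnected
  have hcont : Continuous (G^[m]) := h.cont.iterate m
  have hmap : MapsTo (G^[m]) C C := by
    intro x hx
    have h1 : G^[m] '' C ⊆ connectedComponentIn W (G^[m] (G^[i] p)) :=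
      (hCp.image _ hcont.continuousOn).subset_connectedComponentIn (mem_image_of_mem _ hpC)
        (image_subset_iff.2 fun x hx => h.iter (hCW hx) m)
    rw [← connectedComponentIn_eq (hsC right_mem_uIcc)] at h1
    exact h1 (mem_image_of_mem _ hx)
  have hmono : MonotoneOn (fun x => G^[m] (G^[m] x)) C := by
    rcases h.mono_or hC2 hCW m with hh | hh
    · exact hh.comp hh hmap
    · exact hh.comp hh hmap
  have e2 : G^[m] (G^[m] (G^[i] p)) = G^[i] p := by
    refine mono_fix hmono (fun x hx => hmap (hmap hx)) hpC h.n0 ?_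
    have : (fun x => G^[m] (G^[m] x)) = G^[m + m] := (Function.iterate_add G m m).symm
    rw [this, ← Function.iterate_mul, ← Function.iterate_add_apply,
      show (m + m) * n + i = i + n * (m + m) by ring, Function.iterate_add_apply,
      Function.iterate_mul, Function.iterate_fixed h.fix]
  have hφ : ContinuousOn (fun x => G^[m] x - x) (uIcc (G^[i] p) (G^[m] (G^[i] p))) :=
    (hcont.sub continuous_id).continuousOn
  have := intermediate_value_uIcc hφ
  obtain ⟨y, hy, hy0⟩ := this (show (0:ℝ) ∈ _ by
    simp only [e2, mem_uIcc]
    rcases le_total (G^[i] p) (G^[m] (G^[i] p)) with hh | hh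
    · right; constructor <;> linarith
    · left; constructor <;> linarith)
  have hy0 : G^[m] y = y := by simpa [sub_eq_zero] using hy0
  obtain ⟨l, rfl⟩ := h.fixed_mem_orb (hs hy) hm0 hy0
  exact hm (h.orb_fix hy0)

lemma orb_sep (h : Bas a b G G1 p n W) {i j : ℕ} (hs : uIcc (G^[i] p) (G^[j] p) ⊆ W) :
    i % n = j % n := by
  wlog hij : i ≤ j generalizing i j
  · exact (this (by rwa [uIcc_comm]) (by omega)).symm
  obtain ⟨m, rfl⟩ := Nat.exists_eq_add_of_le hij
  have := h.orb_sep_aux (i := i) (m := m) (by rwa [← Function.iterate_add_apply, add_comm m i])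
  rw [Nat.add_mod, this]; simp

lemma left_end (h : Bas a b G G1 p n W) {x : ℝ} (hx : x ∈ W) :
    Icc a x ⊆ W ∨ ∃ u, a ≤ u ∧ u < x ∧ u ∉ W ∧ Ioc u x ⊆ W := by
  by_cases hc : Icc a x ⊆ W
  · exact Or.inl hc
  right
  have hcl : IsClosed {y | y ∈ Icc a x ∧ y ∉ W} := by
    rw [← isOpen_compl_iff, isOpen_iff_mem_nhds]
    intro y hy
    by_cases hyI : y ∈ Icc a x
    · have hyW : y ∈ W := by by_contra hn; exact hy ⟨hyI, hn⟩
      filter_upwards [h.opn y hyW] with w hw ⟨h1, h2⟩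
      exact h2 (hw ⟨h1.1, h1.2.trans (h.sub hx).2⟩)
    · filter_upwards [isClosed_Icc.isOpen_compl.mem_nhds hyI] with w hw ⟨h1, _⟩
      exact hw h1
  have hcp : IsCompact {y | y ∈ Icc a x ∧ y ∉ W} :=
    isCompact_Icc.of_isClosed_subset hcl fun y hy => hy.1
  obtain ⟨y, hy, hyW⟩ := not_subset.1 hc
  obtain ⟨u, ⟨hu, huW⟩, hmax⟩ := hcp.exists_isGreatest ⟨y, hy, hyW⟩
  refine ⟨u, hu.1, lt_of_le_of_ne hu.2 fun e => huW (e ▸ hx), huW, fun w hw => ?_⟩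
  by_contra hn
  have := hmax ⟨⟨hu.1.trans hw.1.le, hw.2⟩, hn⟩
  linarith [hw.1]

lemma right_end (h : Bas a b G G1 p n W) {x : ℝ} (hx : x ∈ W) :
    Icc x b ⊆ W ∨ ∃ v, v ≤ b ∧ x < v ∧ v ∉ W ∧ Ico x v ⊆ W := by
  by_cases hc : Icc x b ⊆ W
  · exact Or.inl hc
  right
  have hcl : IsClosed {y | y ∈ Icc x b ∧ y ∉ W} := by
    rw [← isOpen_compl_iff, isOpen_iff_mem_nhds]
    intro y hy
    by_cases hyI : y ∈ Icc x b
    · have hyW : y ∈ W := by by_contra hn; exact hy ⟨hyI, hn⟩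
      filter_upwards [h.opn y hyW] with w hw ⟨h1, h2⟩
      exact h2 (hw ⟨(h.sub hx).1.trans h1.1, h1.2⟩)
    · filter_upwards [isClosed_Icc.isOpen_compl.mem_nhds hyI] with w hw ⟨h1, _⟩
      exact hw h1
  have hcp : IsCompact {y | y ∈ Icc x b ∧ y ∉ W} :=
    isCompact_Icc.of_isClosed_subset hcl fun y hy => hy.1
  obtain ⟨y, hy, hyW⟩ := not_subset.1 hc
  obtain ⟨v, ⟨hv, hvW⟩, hmin⟩ := hcp.exists_isLeast ⟨y, hy, hyW⟩
  refine ⟨v, hv.2, lt_of_le_of_ne hv.1 fun e => hvW (e ▸ hx), hvW, fun w hw => ?_⟩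
  by_contra hn
  have := hmin ⟨⟨hw.1, hw.2.le.trans hv.2⟩, hn⟩
  linarith [hw.2]

/-- A component of the basin with ends outside the basin. -/
structure Comp (a b : ℝ) (W : Set ℝ) (x u v : ℝ) : Prop where
  au : a ≤ u
  vb : v ≤ b
  ux : u < x
  xv : x < v
  uW : u ∉ W
  vW : v ∉ W
  sub : Ioo u v ⊆ W

lemma comp_mono (h : Bas a b G G1 p n W) {x u v : ℝ} (hc : Comp a b W x u v) (m : ℕ) :
    StrictMonoOn (G^[m]) (Icc u v) ∨ StrictAntiOn (G^[m]) (Icc u v) := by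
  have hcont : Continuous (Dm G G1 m) := continuous_Dm h.cont h.c1 m
  have hd : ∀ x, HasDerivAt (G^[m]) (Dm G G1 m x) x := hasDerivAt_iterate h.d m
  rcases sign_of_ne hcont (fun x hx => h.dm_ne (hc.sub hx) m) with hs | hs
  · left
    refine strictMonoOn_of_deriv_pos (convex_Icc _ _) (h.cont.iterate m).continuousOn fun x hx => ?_
    rw [interior_Icc] at hx
    rw [(hd x).deriv]; exact hs x hx
  · right
    refine strictAntiOn_of_deriv_neg (convex_Icc _ _) (h.cont.iterate m).continuousOn fun x hx => ?_
    rw [interior_Icc] at hx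
    rw [(hd x).deriv]; exact hs x hx

lemma comp_or (h : Bas a b G G1 p n W) {x : ℝ} (hx : x ∈ W) :
    (Icc a x ⊆ W ∨ Icc x b ⊆ W) ∨ ∃ u v, Comp a b W x u v := by
  rcases h.left_end hx with h1 | ⟨u, u1, u2, u3, u4⟩
  · exact Or.inl (Or.inl h1)
  rcases h.right_end hx with h1 | ⟨v, v1, v2, v3, v4⟩
  · exact Or.inl (Or.inr h1)
  refine Or.inr ⟨u, v, u1, v1, u2, v2, u3, v3, fun y hy => ?_⟩
  rcases le_total y x with hh | hh
  · exact u4 ⟨hy.1, hh⟩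
  · exact v4 ⟨hh, hy.2⟩

lemma bad_back (h : Bas a b G G1 p n W) {x : ℝ} (hx : x ∈ W)
    (hb : Icc a (G x) ⊆ W ∨ Icc (G x) b ⊆ W) : Icc a x ⊆ W ∨ Icc x b ⊆ W := by
  rcases h.comp_or hx with h1 | ⟨u, v, hc⟩
  · exact h1
  exfalso
  have hu : u ∈ Icc a b := ⟨hc.au, (hc.ux.trans hc.xv).le.trans hc.vb⟩
  have hv : v ∈ Icc a b := ⟨hc.au.trans (hc.ux.trans hc.xv).le, hc.vb⟩
  have huW : G u ∉ W := fun hh => hc.uW ((h.step u hu).1 hh)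
  have hvW : G v ∉ W := fun hh => hc.vW ((h.step v hv).1 hh)
  have huI := h.maps hu
  have hvI := h.maps hv
  have mu : u ∈ Icc u v := ⟨le_rfl, (hc.ux.trans hc.xv).le⟩
  have mv : v ∈ Icc u v := ⟨(hc.ux.trans hc.xv).le, le_rfl⟩
  have mx : x ∈ Icc u v := ⟨hc.ux.le, hc.xv.le⟩
  rcases h.comp_mono hc 1 with hm | hm
  · have h1 : G u < G x := hm mu mx hc.ux
    have h2 : G x < G v := hm mx mv hc.xv
    rcases hb with hb | hb
    · exact huW (hb ⟨huI.1, h1.le⟩)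
    · exact hvW (hb ⟨h2.le, hvI.2⟩)
  · have h1 : G x < G u := hm mu mx hc.ux
    have h2 : G v < G x := hm mx mv hc.xv
    rcases hb with hb | hb
    · exact hvW (hb ⟨hvI.1, h2.le⟩)
    · exact huW (hb ⟨h1.le, huI.2⟩)

lemma exists_comp (h : Bas a b G G1 p n W) (hn : 3 ≤ n) (i : ℕ) : ∃ u v, Comp a b W (G^[i] p) u v := by
  rcases h.comp_or (h.orb i) with hb | hc
  swap
  · exact hc
  exfalso
  have hback : ∀ k, ∀ j, (Icc a (G^[j + k] p) ⊆ W ∨ Icc (G^[j + k] p) b ⊆ W) →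
      (Icc a (G^[j] p) ⊆ W ∨ Icc (G^[j] p) b ⊆ W) := by
    intro k
    induction k with
    | zero => exact fun j hj => hj
    | succ k ih =>
      intro j hj
      refine ih j (h.bad_back (h.orb _) ?_)
      rwa [← Function.iterate_succ_apply' G (j + k) p]
  have hall : ∀ j, j < 3 → (Icc a (G^[j] p) ⊆ W ∨ Icc (G^[j] p) b ⊆ W) := by
    intro j hj
    refine hback (i + n * 3 - j) j ?_
    rw [show j + (i + n * 3 - j) = i + n * 3 by omega, Function.iterate_add_apply,
      Function.iterate_mul, Function.iterate_fixed h.fix]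
    exact hb
  have sepa : ∀ i j, i < 3 → j < 3 → Icc a (G^[i] p) ⊆ W → Icc a (G^[j] p) ⊆ W → i = j := by
    intro i j hi hj h1 h2
    have := h.orb_sep (i := i) (j := j) (by
      intro x hx
      rw [mem_uIcc] at hx
      rcases hx with hx | hx
      · exact h2 ⟨(h.sub (h.orb i)).1.trans hx.1, hx.2⟩
      · exact h1 ⟨(h.sub (h.orb j)).1.trans hx.1, hx.2⟩)
    rwa [Nat.mod_eq_of_lt (by omega), Nat.mod_eq_of_lt (by omega)] at this
  have sepb : ∀ i j, i < 3 → j < 3 → Icc (G^[i] p) b ⊆ W → Icc (G^[j] p) b ⊆ W → i = j := by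
    intro i j hi hj h1 h2
    have := h.orb_sep (i := i) (j := j) (by
      intro x hx
      rw [mem_uIcc] at hx
      rcases hx with hx | hx
      · exact h1 ⟨hx.1, hx.2.trans (h.sub (h.orb j)).2⟩
      · exact h2 ⟨hx.1, hx.2.trans (h.sub (h.orb i)).2⟩)
    rwa [Nat.mod_eq_of_lt (by omega), Nat.mod_eq_of_lt (by omega)] at this
  have a01 := sepa 0 1 (by omega) (by omega)
  have a02 := sepa 0 2 (by omega) (by omega)
  have a12 := sepa 1 2 (by omega) (by omega)
  have b01 := sepb 0 1 (by omega) (by omega)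
  have b02 := sepb 0 2 (by omega) (by omega)
  have b12 := sepb 1 2 (by omega) (by omega)
  rcases hall 0 (by omega) with x | x <;> rcases hall 1 (by omega) with y | y <;>
    rcases hall 2 (by omega) with w | w
  · exact absurd (a01 x y) (by omega)
  · exact absurd (a01 x y) (by omega)
  · exact absurd (a02 x w) (by omega)
  · exact absurd (b12 y w) (by omega)
  · exact absurd (a12 y w) (by omega)
  · exact absurd (b02 x w) (by omega)
  · exact absurd (b01 x y) (by omega)
  · exact absurd (b01 x y) (by omega)

end Bas

lemma deriv_nonneg_of_right {φ : ℝ → ℝ} {u w d : ℝ} (hd : HasDerivAt φ d u) (huw : u < w)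
    (h : ∀ x ∈ Ioo u w, φ u ≤ φ x) : 0 ≤ d := by
  have h1 := (hasDerivWithinAt_iff_tendsto_slope' (by simp)).1 (hd.hasDerivWithinAt (s := Ioi u))
  refine ge_of_tendsto h1 ?_
  filter_upwards [Ioo_mem_nhdsGT huw] with x hx
  rw [slope_def_field]
  exact div_nonneg (sub_nonneg.2 (h x hx)) (sub_nonneg.2 hx.1.le)

lemma deriv_nonpos_of_left {φ : ℝ → ℝ} {u w d : ℝ} (hd : HasDerivAt φ d u) (huw : w < u)
    (h : ∀ x ∈ Ioo w u, φ u ≤ φ x) : d ≤ 0 := by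
  have h1 := (hasDerivWithinAt_iff_tendsto_slope' (by simp)).1 (hd.hasDerivWithinAt (s := Iio u))
  refine le_of_tendsto h1 ?_
  filter_upwards [Ioo_mem_nhdsLT huw] with x hx
  rw [slope_def_field]
  exact div_nonpos_of_nonneg_of_nonpos (sub_nonneg.2 (h x hx)) (sub_nonpos.2 hx.2.le)

namespace Bas
variable {A B a b K μ K' p : ℝ} {G G1 G2 G3 : ℝ → ℝ} {n : ℕ} {W : Set ℝ}

lemma comp_img (h : Bas a b G G1 p n W) {x u v u' v' : ℝ} (hc : Comp a b W x u v)
    (hc' : Comp a b W (G x) u' v') : ∀ y ∈ Ioo u v, G y ∈ Ioo u' v' := by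
  intro y hy
  have hs : uIcc (G y) (G x) ⊆ W := by
    refine (intermediate_value_uIcc h.cont.continuousOn).trans ?_
    rintro _ ⟨w, hw, rfl⟩
    have : w ∈ W := hc.sub ((ordConnected_Ioo.uIcc_subset hy ⟨hc.ux, hc.xv⟩) hw)
    exact (h.step _ (h.sub this)).2 this
  refine ⟨?_, ?_⟩
  · by_contra hh
    exact hc'.uW (hs (mem_uIcc.2 (Or.inl ⟨not_lt.1 hh, hc'.ux.le⟩)))
  · by_contra hh
    exact hc'.vW (hs (mem_uIcc.2 (Or.inr ⟨hc'.xv.le, not_lt.1 hh⟩)))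

/-- A return map on a component of the basin which fixes its periodic point. -/
structure Ret (F : ℝ → ℝ) (q u v : ℝ) : Prop where
  cont : Continuous F
  ux : u < q
  xv : q < v
  fix : F q = q
  mono : StrictMonoOn F (Icc u v)
  maps : MapsTo F (Ioo u v) (Ioo u v)
  lim : ∀ x ∈ Ioo u v, ∀ y ∈ Icc u v, Tendsto (fun k => F^[k] x) atTop (𝓝 y) → y = q

lemma Ret.left {F : ℝ → ℝ} {q u v : ℝ} (h : Ret F q u v) : ∀ x ∈ Ioo u q, x < F x := by
  intro x hx
  by_contra! hh
  have hxJ : x ∈ Ioo u v := ⟨hx.1, hx.2.trans h.xv⟩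
  have mem : ∀ k, F^[k] x ∈ Ioo u v := fun k => h.maps.iterate k hxJ
  have anti : Antitone fun k => F^[k] x := by
    refine antitone_nat_of_succ_le fun k => ?_
    induction k with
    | zero => simpa using hh
    | succ k ih =>
      rw [Function.iterate_succ_apply']
      exact (h.mono.monotoneOn (Ioo_subset_Icc_self (mem (k + 1))) (Ioo_subset_Icc_self (mem k))
        ih).trans_eq (Function.iterate_succ_apply' F k x).symm
  have hb : BddBelow (range fun k => F^[k] x) := ⟨u, by rintro _ ⟨k, rfl⟩; exact (mem k).1.le⟩
  have ht := tendsto_atTop_ciInf anti hb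
  set y := ⨅ k, F^[k] x
  have hyx : y ≤ x := anti.le_of_tendsto ht 0
  have huy : u ≤ y := ge_of_tendsto' ht fun k => (mem k).1.le
  have := h.lim x hxJ y ⟨huy, hyx.trans hxJ.2.le⟩ ht
  linarith [hx.2]

lemma Ret.right {F : ℝ → ℝ} {q u v : ℝ} (h : Ret F q u v) : ∀ x ∈ Ioo q v, F x < x := by
  intro x hx
  by_contra! hh
  have hxJ : x ∈ Ioo u v := ⟨h.ux.trans hx.1, hx.2⟩
  have mem : ∀ k, F^[k] x ∈ Ioo u v := fun k => h.maps.iterate k hxJ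
  have mono : Monotone fun k => F^[k] x := by
    refine monotone_nat_of_le_succ fun k => ?_
    induction k with
    | zero => simpa using hh
    | succ k ih =>
      rw [Function.iterate_succ_apply', Function.iterate_succ_apply' F (k + 1)]
      exact h.mono.monotoneOn (Ioo_subset_Icc_self (mem k)) (Ioo_subset_Icc_self (mem (k + 1))) ih
  have hb : BddAbove (range fun k => F^[k] x) := ⟨v, by rintro _ ⟨k, rfl⟩; exact (mem k).2.le⟩
  have ht := tendsto_atTop_ciSup mono hb
  set y := ⨆ k, F^[k] x
  have hyx : x ≤ y := mono.ge_of_tendsto ht 0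
  have hyv : y ≤ v := le_of_tendsto' ht fun k => (mem k).2.le
  have := h.lim x hxJ y ⟨hxJ.1.le.trans hyx, hyv⟩ ht
  linarith [hx.1]

lemma exists_cyc (h : Bas a b G G1 p n W) (cls : Cls A B K μ G G1 G2 G3) (st : Sturm A B K' G G1)
    (hμ : 0 < μ) (aA : A < a) (bB : b < B) (hn : 3 ≤ n) :
    ∃ u v, Cyc A B a b K μ K' G G1 G2 G3 n p u v := by
  choose U V hUV using h.exists_comp hn
  set u : ℕ → ℝ := fun i => U (i % n) with hu
  set v : ℕ → ℝ := fun i => V (i % n) with hv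
  have hc : ∀ i, Comp a b W (G^[i] p) (u i) (v i) := fun i => by
    have := hUV (i % n); rwa [h.mod i] at this
  have img : ∀ i, ∀ x ∈ Ioo (u i) (v i), G x ∈ Ioo (u (i + 1)) (v (i + 1)) := fun i =>
    h.comp_img (hc i) (by have := hc (i + 1); rwa [Function.iterate_succ_apply'] at this)
  have imgm : ∀ m i, ∀ x ∈ Ioo (u i) (v i), G^[m] x ∈ Ioo (u (i + m)) (v (i + m)) := by
    intro m
    induction m with
    | zero => exact fun i x hx => hx
    | succ m ih =>
      intro i x hx
      rw [Function.iterate_succ_apply', ← add_assoc]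
      exact img _ _ (ih i x hx)
  have per : ∀ i, u (i + 2 * n) = u i ∧ v (i + 2 * n) = v i := fun i => by
    simp [hu, hv]
  have mem : ∀ i, G^[i] p ∈ Ioo (u i) (v i) := fun i => ⟨(hc i).ux, (hc i).xv⟩
  have fixn : ∀ i, G^[n] (G^[i] p) = G^[i] p := fun i => by
    rw [← Function.iterate_add_apply, add_comm, Function.iterate_add_apply, h.fix]
  have hdF : ∀ x, HasDerivAt (G^[2 * n]) (Dm G G1 (2 * n) x) x := hasDerivAt_iterate h.d _
  have fix2 : ∀ i, G^[2 * n] (G^[i] p) = G^[i] p := fun i => by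
    rw [two_mul, Function.iterate_add_apply, fixn, fixn]
  have ret : ∀ i, Ret (G^[2 * n]) (G^[i] p) (u i) (v i) := by
    intro i
    refine ⟨h.cont.iterate _, (hc i).ux, (hc i).xv, fix2 i, ?_, ?_, ?_⟩
    · have hpos : 0 < Dm G G1 (2 * n) (G^[i] p) := by
        rw [two_mul, Dm_add, fixn]
        exact mul_self_pos.2 (h.dm_ne (h.orb i) n)
      rcases sign_of_ne (continuous_Dm h.cont h.c1 (2 * n))
        (fun x hx => h.dm_ne ((hc i).sub hx) (2 * n)) with hs | hs
      · refine strictMonoOn_of_deriv_pos (convex_Icc _ _) (h.cont.iterate _).continuousOn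
          fun x hx => ?_
        rw [interior_Icc] at hx
        rw [(hdF x).deriv]; exact hs x hx
      · exact absurd (hs _ (mem i)) hpos.not_gt
    · intro x hx
      have := imgm (2 * n) i x hx
      rwa [(per i).1, (per i).2] at this
    · intro x hx y hy ht
      obtain ⟨j, hj⟩ := h.lim x ((hc i).sub hx) (2 * n) (by omega) y (by
        simpa only [Function.iterate_mul] using ht)
      have hyW : y ∈ W := hj ▸ h.orb j
      have hyJ : y ∈ Ioo (u i) (v i) :=
        ⟨hy.1.lt_of_ne fun e => (hc i).uW (e ▸ hyW), hy.2.lt_of_ne fun e => (hc i).vW (e ▸ hyW)⟩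
      have : j % n = i % n := h.orb_sep (by
        rw [← hj]; exact (ordConnected_Ioo.uIcc_subset hyJ (mem i)).trans (hc i).sub)
      rw [hj, ← h.mod j, this, h.mod]
  have huv : ∀ i, u i < v i := fun i => (hc i).ux.trans (hc i).xv
  have ends : ∀ i, G^[2 * n] (u i) = u i ∧ G^[2 * n] (v i) = v i := by
    intro i
    have hcl : MapsTo (G^[2 * n]) (Icc (u i) (v i)) (Icc (u i) (v i)) := by
      have := (ret i).maps.closure (ret i).cont
      rwa [closure_Ioo (huv i).ne] at this
    have hu1 := hcl (left_mem_Icc.2 (huv i).le)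
    have hv1 := hcl (right_mem_Icc.2 (huv i).le)
    have hlt : G^[2 * n] (u i) < G^[2 * n] (v i) :=
      (ret i).mono (left_mem_Icc.2 (huv i).le) (right_mem_Icc.2 (huv i).le) (huv i)
    have huN : u i ∈ Icc a b := ⟨(hc i).au, (huv i).le.trans (hc i).vb⟩
    have hvN : v i ∈ Icc a b := ⟨(hc i).au.trans (huv i).le, (hc i).vb⟩
    have hu2 := fun hh => (hc i).uW ((h.iter_iff huN (2 * n)).2.1 hh)
    have hv2 := fun hh => (hc i).vW ((h.iter_iff hvN (2 * n)).2.1 hh)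
    constructor
    · by_contra hne
      exact hu2 ((hc i).sub ⟨hu1.1.lt_of_ne' hne, hlt.trans_le hv1.2⟩)
    · by_contra hne
      exact hv2 ((hc i).sub ⟨hu1.1.trans_lt hlt, hv1.2.lt_of_ne hne⟩)
  refine ⟨u, v, ⟨cls, st, hμ, aA, bB, h.maps, hn, fun i => ⟨(hc i).au, (hc i).vb⟩, img,
    fun i x hx => h.ne x ((hc i).sub hx), ?_, fun i => by simp [hu], fun i => by simp [hv],
    h.fix, mem, ?_, ?_, ?_⟩⟩
  · intro i j w hi hj
    apply h.orb_sep
    refine (uIcc_subset_uIcc_union_uIcc (b := w)).trans (union_subset ?_ ?_)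
    · exact (ordConnected_Ioo.uIcc_subset (mem i) hi).trans (hc i).sub
    · exact (ordConnected_Ioo.uIcc_subset hj (mem j)).trans (hc j).sub
  · intro i
    have := deriv_nonneg_of_right ((hdF (u i)).sub (hasDerivAt_id _)) (hc i).ux fun x hx => by
      have := (ret i).left x hx
      simp [(ends i).1]; linarith
    linarith
  · intro i
    have := deriv_nonpos_of_left ((hasDerivAt_id _).sub (hdF (v i))) (hc i).xv fun x hx => by
      have := (ret i).right x hx
      simp [(ends i).2]; linarith
    linarith
  · intro i
    have := deriv_nonpos_of_left ((hdF (G^[i] p)).sub (hasDerivAt_id _)) (hc i).ux fun x hx => by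
      have := (ret i).left x hx
      simp [fix2 i]; linarith
    linarith

end Bas

section Orbit
variable {g G : ℝ → ℝ} {N : Set ℝ} {p x : ℝ} {n : ℕ}

lemma iterate_eq_of_eqOn (hm : MapsTo g N N) (he : EqOn g G N) (hx : x ∈ N) (k : ℕ) :
    G^[k] x = g^[k] x := by
  induction k with
  | zero => rfl
  | succ k ih =>
    rw [Function.iterate_succ_apply', Function.iterate_succ_apply', ih, he (hm.iterate k hx)]

lemma orbitSet_congr (hm : MapsTo g N N) (he : EqOn g G N) (hx : x ∈ N) :
    orbitSet G x = orbitSet g x := by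
  simp only [orbitSet, iterate_eq_of_eqOn hm he hx]

lemma convergesToOrbit_congr (hm : MapsTo g N N) (he : EqOn g G N) (hx : x ∈ N) (O : Set ℝ) :
    ConvergesToOrbit G x O ↔ ConvergesToOrbit g x O := by
  simp only [ConvergesToOrbit, iterate_eq_of_eqOn hm he hx]

lemma AttractingIn.congr (h : AttractingIn g N p n) (hm : MapsTo g N N) (he : EqOn g G N)
    (hp : p ∈ N) : AttractingIn G N p n := by
  obtain ⟨⟨h0, h1, h2⟩, U, hU, hpU, hc⟩ := h
  refine ⟨⟨h0, ?_, fun m hm0 hmn => ?_⟩, U, hU, hpU, fun x hx => ?_⟩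
  · rw [iterate_eq_of_eqOn hm he hp, h1]
  · rw [iterate_eq_of_eqOn hm he hp]; exact h2 m hm0 hmn
  · rw [orbitSet_congr hm he hp, convergesToOrbit_congr hm he hx.2]; exact hc x hx

lemma convergesToOrbit_iterate (O : Set ℝ) (k : ℕ) :
    ConvergesToOrbit g (g^[k] x) O ↔ ConvergesToOrbit g x O := by
  simp only [ConvergesToOrbit, ← Function.iterate_add_apply]
  exact tendsto_add_atTop_iff_nat (f := fun j => Metric.infDist (g^[j] x) O) k

lemma orbitSet_finite (h0 : 0 < n) (hfix : g^[n] p = p) : (orbitSet g p).Finite := by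
  refine ((finite_Iio n).image fun i => g^[i] p).subset ?_
  rintro _ ⟨k, rfl⟩
  refine ⟨k % n, Nat.mod_lt _ h0, ?_⟩
  show g^[k % n] p = g^[k] p
  conv_rhs => rw [← Nat.mod_add_div k n, Function.iterate_add_apply, Function.iterate_mul]
  rw [Function.iterate_fixed hfix]

lemma convergesToOrbit_of_mem {O : Set ℝ} (h : ∀ k, g^[k] x ∈ O) : ConvergesToOrbit g x O := by
  simp only [ConvergesToOrbit, fun k => Metric.infDist_zero_of_mem (h k)]
  exact tendsto_const_nhds

lemma ConvergesToOrbit.mem_of_tendsto (h0 : 0 < n) (hfix : g^[n] p = p)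
    (h : ConvergesToOrbit g x (orbitSet g p)) {φ : ℕ → ℕ} (hφ : Tendsto φ atTop atTop) {y : ℝ}
    (hy : Tendsto (fun k => g^[φ k] x) atTop (𝓝 y)) : y ∈ orbitSet g p := by
  have h1 := h.comp hφ
  have h2 := ((Metric.continuous_infDist_pt (orbitSet g p)).tendsto y).comp hy
  have h3 := tendsto_nhds_unique h2 h1
  exact ((orbitSet_finite h0 hfix).isClosed.mem_iff_infDist_zero ⟨p, 0, rfl⟩).2 h3

lemma AttractingIn.eventually (h : AttractingIn g N p n) (hg : Continuous g) (hm : MapsTo g N N)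
    (hx : ConvergesToOrbit g x (orbitSet g p)) :
    ∀ᶠ y in 𝓝 x, y ∈ N → ConvergesToOrbit g y (orbitSet g p) := by
  obtain ⟨⟨h0, h1, -⟩, U, hU, hpU, hc⟩ := h
  have hV : IsOpen (⋃ l : ℕ, (g^[l]) ⁻¹' U) := isOpen_iUnion fun l => hU.preimage (hg.iterate l)
  have hOV : orbitSet g p ⊆ ⋃ l : ℕ, (g^[l]) ⁻¹' U := by
    rintro _ ⟨i, rfl⟩
    refine mem_iUnion.2 ⟨n * i - i, ?_⟩
    have : n * i - i + i = n * i := Nat.sub_add_cancel (Nat.le_mul_of_pos_left i h0)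
    show g^[n * i - i] (g^[i] p) ∈ U
    rw [← Function.iterate_add_apply, this, Function.iterate_mul, Function.iterate_fixed h1]
    exact hpU
  obtain ⟨δ, hδ, hδV⟩ := (orbitSet_finite h0 h1).isCompact.exists_thickening_subset_open hV hOV
  obtain ⟨k, hk⟩ := (hx.eventually (gt_mem_nhds hδ)).exists
  have hkV := hδV ((Metric.mem_thickening_iff_infDist_lt (E := orbitSet g p) ⟨p, 0, rfl⟩).2 hk)
  obtain ⟨l, hl⟩ := mem_iUnion.1 hkV
  have hl' : g^[l + k] x ∈ U := by rw [Function.iterate_add_apply]; exact hl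
  filter_upwards [(hU.preimage (hg.iterate (l + k))).mem_nhds hl'] with y hy hyN
  exact (convergesToOrbit_iterate _ (l + k)).1 (hc _ ⟨hy, hm.iterate _ hyN⟩)

lemma PeriodicPt.mod_eq (h : PeriodicPt g p n) {m : ℕ} (e : g^[m] p = p) : m % n = 0 := by
  by_contra hne
  refine h.2.2 (m % n) (Nat.pos_of_ne_zero hne) (Nat.mod_lt _ h.1) ?_
  conv_rhs => rw [← e, ← Nat.mod_add_div m n, Function.iterate_add_apply, Function.iterate_mul]
  rw [Function.iterate_fixed h.2.1]

lemma AttractingIn.bas {a b : ℝ} {g1 : ℝ → ℝ} (h : AttractingIn g (Icc a b) p n)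
    (hd : ∀ x, HasDerivAt g (g1 x) x) (hc1 : Continuous g1) (hm : MapsTo g (Icc a b) (Icc a b))
    (hp : p ∈ Icc a b)
    (hcrit : ∀ x ∈ Icc a b, g1 x = 0 → ¬ ConvergesToOrbit g x (orbitSet g p)) :
    Bas a b g g1 p n {x ∈ Icc a b | ConvergesToOrbit g x (orbitSet g p)} := by
  have hg : Continuous g := continuous_iff_continuousAt.2 fun x => (hd x).continuousAt
  have hper := h.1
  refine ⟨hd, hc1, hm, hper.1, hper.2.1, fun m => hper.mod_eq, fun x hx => hx.1, fun i => ?_,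
    fun x hx => ?_, fun x hx => ?_, fun x hx m hm0 y hy => ?_, fun x hx h0 => hcrit x hx.1 h0 hx.2⟩
  · refine ⟨hm.iterate i hp, convergesToOrbit_of_mem fun k => ⟨k + i, ?_⟩⟩
    exact Function.iterate_add_apply g k i p
  · exact ⟨fun hh => ⟨hx, (convergesToOrbit_iterate _ 1).1 hh.2⟩,
      fun hh => ⟨hm hx, (convergesToOrbit_iterate _ 1).2 hh.2⟩⟩
  · filter_upwards [h.eventually hg hm hx.2] with y hy hyN using ⟨hyN, hy hyN⟩
  · obtain ⟨i, hi⟩ := hx.2.mem_of_tendsto hper.1 hper.2.1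
      (Filter.tendsto_id.const_mul_atTop' hm0) hy
    exact ⟨i, hi.symm⟩

end Orbit

section Joint
variable {F F1 : ℝ → ℝ} {G G1 : ℕ → ℝ → ℝ}

lemma tendsto_iterate_prod
    (hG : ∀ w, Tendsto (fun q : ℕ × ℝ => G q.1 q.2) (atTop ×ˢ 𝓝 w) (𝓝 (F w))) (m : ℕ) (w : ℝ) :
    Tendsto (fun q : ℕ × ℝ => (G q.1)^[m] q.2) (atTop ×ˢ 𝓝 w) (𝓝 (F^[m] w)) := by
  induction m with
  | zero => exact tendsto_snd
  | succ m ih =>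
    simp only [Function.iterate_succ_apply']
    exact (hG _).comp (tendsto_fst.prodMk ih)

lemma tendsto_Dm_prod
    (hG : ∀ w, Tendsto (fun q : ℕ × ℝ => G q.1 q.2) (atTop ×ˢ 𝓝 w) (𝓝 (F w)))
    (hG1 : ∀ w, Tendsto (fun q : ℕ × ℝ => G1 q.1 q.2) (atTop ×ˢ 𝓝 w) (𝓝 (F1 w))) (m : ℕ) (w : ℝ) :
    Tendsto (fun q : ℕ × ℝ => Dm (G q.1) (G1 q.1) m q.2) (atTop ×ˢ 𝓝 w) (𝓝 (Dm F F1 m w)) :=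
  tendsto_finsetProd _ fun j _ =>
    (hG1 _).comp (tendsto_fst.prodMk (tendsto_iterate_prod hG j w))

lemma three_Ioo {y u₀ v₀ u₁ v₁ u₂ v₂ : ℝ} (h0 : u₀ < v₀) (h1 : u₁ < v₁) (h2 : u₂ < v₂)
    (y0 : y ∈ Icc u₀ v₀) (y1 : y ∈ Icc u₁ v₁) (y2 : y ∈ Icc u₂ v₂) :
    ∃ w, (w ∈ Ioo u₀ v₀ ∧ w ∈ Ioo u₁ v₁) ∨ (w ∈ Ioo u₀ v₀ ∧ w ∈ Ioo u₂ v₂) ∨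
      (w ∈ Ioo u₁ v₁ ∧ w ∈ Ioo u₂ v₂) := by
  have hr : ∀ {u v u' v' : ℝ}, y ∈ Icc u v → y ∈ Icc u' v' → y < v → y < v' →
      ∃ w, w ∈ Ioo u v ∧ w ∈ Ioo u' v' := by
    intro u v u' v' h h' hv hv'
    obtain ⟨w, hw, hw'⟩ := exists_between (lt_min hv hv')
    exact ⟨w, ⟨h.1.trans_lt hw, hw'.trans_le (min_le_left _ _)⟩,
      h'.1.trans_lt hw, hw'.trans_le (min_le_right _ _)⟩
  have hl : ∀ {u v u' v' : ℝ}, y ∈ Icc u v → y ∈ Icc u' v' → u < y → u' < y →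
      ∃ w, w ∈ Ioo u v ∧ w ∈ Ioo u' v' := by
    intro u v u' v' h h' hv hv'
    obtain ⟨w, hw', hw⟩ := exists_between (max_lt hv hv')
    exact ⟨w, ⟨(le_max_left _ _).trans_lt hw', hw.trans_le h.2⟩,
      (le_max_right _ _).trans_lt hw', hw.trans_le h'.2⟩
  have c0 : y < v₀ ∨ u₀ < y := by by_contra! h; linarith
  have c1 : y < v₁ ∨ u₁ < y := by by_contra! h; linarith
  have c2 : y < v₂ ∨ u₂ < y := by by_contra! h; linarith
  rcases c0 with c0 | c0 <;> rcases c1 with c1 | c1 <;> rcases c2 with c2 | c2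
  · obtain ⟨w, hw⟩ := hr y0 y1 c0 c1; exact ⟨w, Or.inl hw⟩
  · obtain ⟨w, hw⟩ := hr y0 y1 c0 c1; exact ⟨w, Or.inl hw⟩
  · obtain ⟨w, hw⟩ := hr y0 y2 c0 c2; exact ⟨w, Or.inr (Or.inl hw)⟩
  · obtain ⟨w, hw⟩ := hl y1 y2 c1 c2; exact ⟨w, Or.inr (Or.inr hw)⟩
  · obtain ⟨w, hw⟩ := hr y1 y2 c1 c2; exact ⟨w, Or.inr (Or.inr hw)⟩
  · obtain ⟨w, hw⟩ := hl y0 y2 c0 c2; exact ⟨w, Or.inr (Or.inl hw)⟩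
  · obtain ⟨w, hw⟩ := hl y0 y1 c0 c1; exact ⟨w, Or.inl hw⟩
  · obtain ⟨w, hw⟩ := hl y0 y1 c0 c1; exact ⟨w, Or.inl hw⟩

lemma exists_tendsto_of_contracting {T T' : ℝ → ℝ} {c δ lam : ℝ} (hd : ∀ x, HasDerivAt T (T' x) x)
    (hlam : lam < 1) (hT' : ∀ x ∈ Metric.closedBall c δ, |T' x| ≤ lam)
    (hc : |T c - c| ≤ (1 - lam) * δ) {x : ℝ} (hx : x ∈ Metric.closedBall c δ) :
    ∃ y, Tendsto (fun m => T^[m] x) atTop (𝓝 y) := by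
  have hδ : 0 ≤ δ := dist_nonneg.trans hx
  have hcB : c ∈ Metric.closedBall c δ := Metric.mem_closedBall_self hδ
  have hlam0 : 0 ≤ lam := (abs_nonneg _).trans (hT' c hcB)
  lift lam to NNReal using hlam0
  have hlip : LipschitzOnWith lam T (Metric.closedBall c δ) :=
    (convex_closedBall c δ).lipschitzOnWith_of_nnnorm_hasDerivWithin_le
      (fun x _ => (hd x).hasDerivWithinAt) (fun x hx => by
        rw [← NNReal.coe_le_coe]; exact hT' x hx)
  have hmaps : MapsTo T (Metric.closedBall c δ) (Metric.closedBall c δ) := by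
    intro x hx
    have h1 := hlip.dist_le_mul x hx c hcB
    have h2 : dist x c ≤ δ := hx
    have h3 : dist (T c) c ≤ (1 - lam) * δ := hc
    have := dist_triangle (T x) (T c) c
    rw [Metric.mem_closedBall]
    nlinarith [mul_le_mul_of_nonneg_left h2 lam.2]
  have hcon : ContractingWith lam (hmaps.restrict T _ _) :=
    ⟨by rw [← NNReal.coe_lt_coe]; exact hlam, hlip.mapsToRestrict hmaps⟩
  obtain ⟨y, -, -, hy, -⟩ := hcon.exists_fixedPoint' (Metric.isClosed_closedBall.isComplete) hmaps
    hx (edist_ne_top _ _)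
  exact ⟨y, hy⟩

variable {A B a b K μ K' : ℝ} {G2 G3 : ℕ → ℝ → ℝ} {n : ℕ → ℕ} {p : ℕ → ℝ} {u v : ℕ → ℕ → ℝ}

lemma Cyc.not_tendsto {g g1 g2 g3 : ℝ → ℝ} {n : ℕ} {p : ℝ} {u v : ℕ → ℝ}
    (h : Cyc A B a b K μ K' g g1 g2 g3 n p u v) {k j : ℕ} (hk : 0 < k) (hkn : 2 * k < n) {x y : ℝ}
    (hx : x ∈ Ioo (u j) (v j)) (hy : Tendsto (fun m => (g^[k])^[m] x) atTop (𝓝 y)) : False := by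
  have key : ∀ i, y ∈ Icc (u (j + k * i)) (v (j + k * i)) := by
    intro i
    have h1 : Tendsto (fun m => n * m + i) atTop atTop :=
      tendsto_atTop_mono (fun m => (Nat.le_mul_of_pos_left m (by omega)).trans
        (Nat.le_add_right _ i)) tendsto_id
    have h2 : ∀ m, (g^[k])^[n * m + i] x ∈ Icc (u (j + k * i)) (v (j + k * i)) := by
      intro m
      have h3 := h.iter hx (k * (n * m + i))
      have h4 : ∀ q, u (j + k * i + n * q) = u (j + k * i) ∧ v (j + k * i + n * q) = v (j + k * i) := by
        intro q
        induction q with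
        | zero => simp
        | succ q ih => rw [mul_add, mul_one, ← add_assoc, h.peru, h.perv]; exact ih
      rw [show j + k * (n * m + i) = j + k * i + n * (k * m) by ring, (h4 _).1, (h4 _).2,
        Function.iterate_mul] at h3
      exact Ioo_subset_Icc_self h3
    exact isClosed_Icc.mem_of_tendsto (hy.comp h1) (Eventually.of_forall h2)
  have lt : ∀ i, u i < v i := fun i => (h.mem i).1.trans (h.mem i).2
  obtain ⟨w, hw⟩ := three_Ioo (lt _) (lt _) (lt _) (key 0) (key 1) (key 2)
  have aux : ∀ e e', e < e' → e' ≤ 2 → (j + k * e) % n ≠ (j + k * e') % n := by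
    intro e e' he he' hh
    have h1 : k * e' ≤ k * 2 := Nat.mul_le_mul_left k he'
    have h2 : k * e < k * e' := Nat.mul_lt_mul_of_pos_left he hk
    have h3 : k * e ≡ k * e' [MOD n] := Nat.ModEq.add_left_cancel' j hh
    have h4 := h3.eq_of_lt_of_lt (by omega) (by omega)
    omega
  rcases hw with hw | hw | hw
  · exact aux 0 1 (by omega) (by omega) (h.disj _ _ w hw.1 hw.2)
  · exact aux 0 2 (by omega) (by omega) (h.disj _ _ w hw.1 hw.2)
  · exact aux 1 2 (by omega) (by omega) (h.disj _ _ w hw.1 hw.2)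

lemma not_attracted (hF : Continuous F)
    (hG : ∀ w, Tendsto (fun q : ℕ × ℝ => G q.1 q.2) (atTop ×ˢ 𝓝 w) (𝓝 (F w)))
    (hG1 : ∀ w, Tendsto (fun q : ℕ × ℝ => G1 q.1 q.2) (atTop ×ˢ 𝓝 w) (𝓝 (F1 w)))
    (hc : ∀ t, Cyc A B a b K μ K' (G t) (G1 t) (G2 t) (G3 t) (n t) (p t) (u t) (v t))
    (hn : Tendsto n atTop atTop) {Y : ℕ → ℝ} {j : ℕ → ℕ} (hY : ∀ t, Y t ∈ Ioo (u t (j t)) (v t (j t)))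
    {y : ℝ} (hYy : Tendsto Y atTop (𝓝 y)) {k i : ℕ} (hk : 0 < k) {z : ℝ}
    (hz : Tendsto (fun m => F^[k * m] (F^[i] y)) atTop (𝓝 z)) (hD : |Dm F F1 k z| < 1) : False := by
  have hfix : F^[k] z = z := by
    have h1 := hz.comp (tendsto_add_atTop_nat 1)
    have h2 := ((hF.iterate k).tendsto z).comp hz
    refine tendsto_nhds_unique h2 (h1.congr fun m => ?_)
    simp only [Function.comp_apply, ← Function.iterate_add_apply]
    congr 1; ring_nf
  obtain ⟨lam, hl1, hl2⟩ := exists_between hD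
  have e1 : ∀ᶠ q : ℕ × ℝ in atTop ×ˢ 𝓝 z, |Dm (G q.1) (G1 q.1) k q.2| < lam :=
    (tendsto_Dm_prod hG hG1 k z).abs.eventually (gt_mem_nhds hl1)
  obtain ⟨P, hP, Q, hQ, hPQ⟩ := eventually_prod_iff.1 e1
  obtain ⟨δ, hδ, hδQ⟩ := Metric.nhds_basis_closedBall.eventually_iff.1 hQ
  have e2 : ∀ᶠ t in atTop, |(G t)^[k] z - z| < (1 - lam) * δ := by
    have h1 : Tendsto (fun t => (G t)^[k] z) atTop (𝓝 (F^[k] z)) :=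
      (tendsto_iterate_prod hG k z).comp (tendsto_id.prodMk tendsto_const_nhds)
    rw [hfix] at h1
    have h2 := (h1.sub_const z).abs
    rw [sub_self, abs_zero] at h2
    exact h2.eventually (gt_mem_nhds (mul_pos (by linarith) hδ))
  obtain ⟨m, hm⟩ := (hz.eventually (Metric.ball_mem_nhds z hδ)).exists
  have e3 : ∀ᶠ t in atTop, (G t)^[k * m + i] (Y t) ∈ Metric.ball z δ := by
    have h1 : Tendsto (fun t => (G t)^[k * m + i] (Y t)) atTop (𝓝 (F^[k * m + i] y)) :=
      (tendsto_iterate_prod hG _ y).comp (tendsto_id.prodMk hYy)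
    refine h1.eventually (Metric.isOpen_ball.mem_nhds ?_)
    rwa [Function.iterate_add_apply]
  obtain ⟨t, t1, t2, t3, t4⟩ := (hP.and (e2.and (e3.and (hn.eventually_gt_atTop (2 * k))))).exists
  obtain ⟨y', hy'⟩ := exists_tendsto_of_contracting
    (hasDerivAt_iterate (hc t).cls.d0 k) hl2 (fun x hx => (hPQ t1 (hδQ hx)).le)
    t2.le (Metric.ball_subset_closedBall t3)
  exact (hc t).not_tendsto hk t4 ((hc t).iter (hY t) (k * m + i)) hy'

end Joint

lemma Out.sub {A B κ c C : ℝ} {g g1 : ℝ → ℝ} {n s : ℕ} {y α l l' r' r : ℝ}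
    (h : Out A B κ c C g g1 n s y α l l' r' r) {j : ℕ} (hj : j < s) {w : ℝ} (hw : w ∈ Ioo l r) :
    g^[j] w ∈ Icc A B ∧ g1 (g^[j] w) ≠ 0 := by
  obtain ⟨h1, h2⟩ := h.mon j hj w (by
    rw [uIcc_of_le (hw.1.trans hw.2).le]; exact Ioo_subset_Icc_self hw)
  exact ⟨h1, h2 hw.1.ne' hw.2.ne⟩

lemma out_dist_lower (K μ : ℝ) (hμ : 0 < μ) {κ c : ℝ} (hκ : 0 < κ) (hc : 0 < c) (i : ℕ) :
    ∃ δ > 0, ∀ A B C g g1 g2 g3 n s y α l l' r' r, Cls A B K μ g g1 g2 g3 →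
      Out A B κ c C g g1 n s y α l l' r' r → i ≤ s → δ ≤ |g^[i] l' - g^[i] y| := by
  induction i with
  | zero =>
    refine ⟨c * κ, mul_pos hc hκ, fun A B C g g1 g2 g3 n s y α l l' r' r _ h hs => ?_⟩
    have h1 := (h.bl 0 hs).1
    rw [Dm_zero, abs_one, mul_one] at h1
    exact (mul_le_mul_of_nonneg_left h.big hc.le).trans h1
  | succ i ih =>
    obtain ⟨δ, hδ, H⟩ := ih
    obtain ⟨δ', hδ', H'⟩ := Cls.long_image K μ hμ δ hδ
    refine ⟨δ', hδ', fun A B C g g1 g2 g3 n s y α l l' r' r hcl h hs => ?_⟩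
    have h1 := H A B C g g1 g2 g3 n s y α l l' r' r hcl h (by omega)
    have hl : l < l' := by linarith [h.ll']
    have hr : r' < r := by linarith [h.rr']
    have hsub : ∀ w ∈ Icc l' y, w ∈ Ioo l r := fun w hw =>
      ⟨hl.trans_le hw.1, hw.2.trans_lt (h.yr.trans hr)⟩
    have hl' := hsub l' ⟨le_rfl, h.ly.le⟩
    have hy := hsub y ⟨h.ly.le, le_rfl⟩
    have hne : ∀ v ∈ uIcc (g^[i] l') (g^[i] y), g1 v ≠ 0 := by
      intro v hv
      obtain ⟨w, hw, rfl⟩ := Mon.surj hcl.d0 i hv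
      rw [uIcc_of_le h.ly.le] at hw
      exact (h.sub (by omega) (hsub w hw)).2
    have m1 := (h.sub (by omega : i < s) hl').1
    have m2 := (h.sub (by omega : i < s) hy).1
    rw [Function.iterate_succ_apply', Function.iterate_succ_apply']
    rcases le_total (g^[i] l') (g^[i] y) with hh | hh
    · rw [abs_sub_comm, abs_of_nonneg (by linarith)] at h1
      rw [abs_sub_comm]
      exact H' A B g g1 g2 g3 hcl _ _ m1 m2 h1 fun v hv =>
        hne v (by rw [uIcc_of_le hh]; exact Ioo_subset_Icc_self hv)
    · rw [abs_of_nonneg (by linarith)] at h1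
      exact H' A B g g1 g2 g3 hcl _ _ m2 m1 h1 fun v hv =>
        hne v (by rw [uIcc_of_ge hh]; exact Ioo_subset_Icc_self hv)

lemma hasDerivAt_zero_of_mul_nonneg {φ : ℝ → ℝ} {d v u w : ℝ} (hv : v ∈ Ioo u w)
    (hd : HasDerivAt φ d v) (h0 : φ v = 0) (h : ∀ x ∈ Ioo u w, ∀ y ∈ Ioo u w, 0 ≤ φ x * φ y) :
    d = 0 := by
  by_cases hp : ∃ x ∈ Ioo u w, 0 < φ x
  · obtain ⟨x, hx, hx0⟩ := hp
    have : IsLocalMin φ v := by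
      filter_upwards [Ioo_mem_nhds hv.1 hv.2] with y hy
      rw [h0]; exact nonneg_of_mul_nonneg_right (h x hx y hy) hx0
    exact this.hasDerivAt_eq_zero hd
  · push Not at hp
    have : IsLocalMax φ v := by
      filter_upwards [Ioo_mem_nhds hv.1 hv.2] with y hy
      rw [h0]; exact hp y hy
    exact this.hasDerivAt_eq_zero hd

lemma not_repelled {F F1 : ℝ → ℝ} (hF : Continuous F) (hF1 : Continuous F1) {y z al : ℝ} {k i : ℕ}
    (hk : 0 < k) (hal : 0 < al) (hne : ∀ m, Dm F F1 m y ≠ 0)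
    (hsum : Summable fun i => al * |Dm F F1 i y|)
    (hz : Tendsto (fun m => F^[k * m] (F^[i] y)) atTop (𝓝 z)) : ¬ 1 < |Dm F F1 k z| := by
  intro hD
  have h1 : Tendsto (fun m => |Dm F F1 k (F^[k * m] (F^[i] y))|) atTop (𝓝 |Dm F F1 k z|) :=
    (((continuous_Dm hF hF1 k).tendsto z).comp hz).abs
  obtain ⟨M, hM⟩ := eventually_atTop.1 (h1.eventually (lt_mem_nhds hD))
  have step : ∀ m ≥ M, |Dm F F1 (i + k * m) y| ≤ |Dm F F1 (i + k * (m + 1)) y| := by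
    intro m hm
    rw [show i + k * (m + 1) = (i + k * m) + k by ring, Dm_add (i + k * m) k, abs_mul,
      show F^[i + k * m] y = F^[k * m] (F^[i] y) by rw [add_comm, Function.iterate_add_apply]]
    exact le_mul_of_one_le_right (abs_nonneg _) (hM m hm).le
  have low : ∀ m, |Dm F F1 (i + k * M) y| ≤ |Dm F F1 (i + k * (M + m)) y| := by
    intro m
    induction m with
    | zero => exact le_rfl
    | succ m ih => exact ih.trans (step (M + m) (by omega))
  have h2 := hsum.tendsto_atTop_zero
  have h3 : Tendsto (fun m => i + k * (M + m)) atTop atTop :=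
    tendsto_atTop_mono (fun m => by
      have := Nat.le_mul_of_pos_left (M + m) hk
      show id m ≤ _
      simp only [id]; omega) tendsto_id
  have h4 := ge_of_tendsto' (h2.comp h3) fun m => mul_le_mul_of_nonneg_left (low m) hal.le
  have := mul_pos hal (abs_pos.2 (hne (i + k * M)))
  linarith

section Limit
variable {A B a b K μ K' κ c C y al L R : ℝ} {F F1 F2 F3 : ℝ → ℝ} {G G1 G2 G3 : ℕ → ℝ → ℝ}
  {n s : ℕ → ℕ} {Y α l l' r' r : ℕ → ℝ}

lemma out_tendsto (hμ : 0 < μ) (hκ : 0 < κ) (hc : 0 < c) (hC : 0 < C)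
    (hcl : ∀ t, Cls A B K μ (G t) (G1 t) (G2 t) (G3 t))
    (hout : ∀ t, Out A B κ c C (G t) (G1 t) (n t) (s t) (Y t) (α t) (l t) (l' t) (r' t) (r t))
    (hn : Tendsto n atTop atTop) (M : ℕ) : ∀ᶠ t in atTop, M ≤ s t := by
  induction M with
  | zero => simp
  | succ M ih =>
    obtain ⟨δ, hδ, H⟩ := out_dist_lower K μ hμ hκ hc M
    obtain ⟨N, hN⟩ := exists_nat_gt (C * C / δ + 4)
    filter_upwards [ih, hn.eventually_ge_atTop N] with t ht hNt
    refine Nat.succ_le_of_lt (ht.lt_of_ne fun e => ?_)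
    have h1 := H A B C _ _ _ _ _ _ _ _ _ _ _ _ (hcl t) (hout t) ht
    have h2 := ((hout t).bl (s t) le_rfl).2
    have h3 := (hout t).last
    rw [← e] at h2 h3
    have hNt' : (N : ℝ) ≤ n t := by exact_mod_cast hNt
    have h4 : C * C / δ < (n t : ℝ) - 4 := by linarith
    rw [div_lt_iff₀ hδ] at h4
    have hpos : 0 < (n t : ℝ) - 4 := by
      have : 0 < C * C / δ := by positivity
      linarith
    have h5 := mul_le_mul_of_nonneg_right (h1.trans h2) hpos.le
    nlinarith [mul_le_mul_of_nonneg_left h3 hC.le]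

lemma hom_limit (hμ : 0 < μ) (hc : 0 < c) (cls : Cls A B K μ F F1 F2 F3)
    (hG : ∀ w, Tendsto (fun q : ℕ × ℝ => G q.1 q.2) (atTop ×ˢ 𝓝 w) (𝓝 (F w)))
    (hG1 : ∀ w, Tendsto (fun q : ℕ × ℝ => G1 q.1 q.2) (atTop ×ˢ 𝓝 w) (𝓝 (F1 w)))
    (hcl : ∀ t, Cls A B K μ (G t) (G1 t) (G2 t) (G3 t))
    (hout : ∀ t, Out A B κ c C (G t) (G1 t) (n t) (s t) (Y t) (α t) (l t) (l' t) (r' t) (r t))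
    (hs : ∀ M, ∀ᶠ t in atTop, M ≤ s t)
    (hL : Tendsto l' atTop (𝓝 L)) (hR : Tendsto r' atTop (𝓝 R)) (v : ℝ) (hv : v ∈ Icc L R) :
    Hom A B F F1 v := by
  set I := Ioo (L - c / 2) (R + c / 2) with hI
  have hvI : v ∈ I := ⟨by linarith [hv.1], by linarith [hv.2]⟩
  have hIt : ∀ᶠ t in atTop, I ⊆ Ioo (l t) (r t) := by
    filter_upwards [hL.eventually (gt_mem_nhds (show L < L + c / 2 by linarith)),
      hR.eventually (lt_mem_nhds (show R - c / 2 < R by linarith))] with t h1 h2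
    have := (hout t).ll'
    have := (hout t).rr'
    exact Ioo_subset_Ioo (by linarith) (by linarith)
  have hgood : ∀ j, ∀ᶠ t in atTop, ∀ w ∈ I, (G t)^[j] w ∈ Icc A B ∧ G1 t ((G t)^[j] w) ≠ 0 := by
    intro j
    filter_upwards [hIt, hs (j + 1)] with t h1 h2 w hw
    exact (hout t).sub (by omega) (h1 hw)
  have hlim : ∀ j w, Tendsto (fun t => (G t)^[j] w) atTop (𝓝 (F^[j] w)) := fun j w =>
    (tendsto_iterate_prod hG j w).comp (tendsto_id.prodMk tendsto_const_nhds)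
  have hlim1 : ∀ j w, Tendsto (fun t => G1 t ((G t)^[j] w)) atTop (𝓝 (F1 (F^[j] w))) := fun j w =>
    (hG1 _).comp (tendsto_id.prodMk (hlim j w))
  have hmem : ∀ j, ∀ w ∈ I, F^[j] w ∈ Icc A B := fun j w hw =>
    isClosed_Icc.mem_of_tendsto (hlim j w) ((hgood j).mono fun t ht => (ht w hw).1)
  have hsign : ∀ j, ∀ w ∈ I, ∀ w' ∈ I, 0 ≤ F1 (F^[j] w) * F1 (F^[j] w') := by
    intro j w hw w' hw'
    refine ge_of_tendsto ((hlim1 j w).mul (hlim1 j w')) ((hgood j).mono fun t ht => ?_)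
    have hcont : Continuous fun x => G1 t ((G t)^[j] x) := (hcl t).cont1.comp ((hcl t).cont.iterate j)
    rcases sign_of_ne hcont (fun x hx => (ht x hx).2) with h | h
    · exact (mul_pos (h w hw) (h w' hw')).le
    · exact (mul_pos_of_neg_of_neg (h w hw) (h w' hw')).le
  have hne : ∀ j, F1 (F^[j] v) ≠ 0 := by
    intro j
    induction j using Nat.strong_induction_on with
    | _ j ih =>
      intro h0
      have hd : HasDerivAt (fun x => F1 (F^[j] x)) (F2 (F^[j] v) * Dm F F1 j v) v :=
        (cls.d1 _).comp v (hasDerivAt_iterate cls.d0 j v)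
      have := hasDerivAt_zero_of_mul_nonneg hvI hd h0 (hsign j)
      rcases mul_eq_zero.1 this with h | h
      · have h2 := cls.nd _ (hmem j v hvI)
        rw [h, h0] at h2
        simp at h2; linarith
      · exact Dm_ne_zero ih h
  exact fun j => ⟨hmem j v hvI, hne j⟩

lemma limit_false (hμ : 0 < μ) (hκ : 0 < κ) (hc : 0 < c) (hC : 0 < C) (aA : A < a) (bB : b < B)
    (cls : Cls A B K μ F F1 F2 F3) (st : Sturm A B K' F F1) (maps : MapsTo F (Icc a b) (Icc a b))
    (hneut : ∀ z ∈ Icc a b, ∀ k, 0 < k → F^[k] z = z → |Dm F F1 k z| ≠ 1)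
    (hG : ∀ w, Tendsto (fun q : ℕ × ℝ => G q.1 q.2) (atTop ×ˢ 𝓝 w) (𝓝 (F w)))
    (hG1 : ∀ w, Tendsto (fun q : ℕ × ℝ => G1 q.1 q.2) (atTop ×ˢ 𝓝 w) (𝓝 (F1 w)))
    {p : ℕ → ℝ} {u v : ℕ → ℕ → ℝ}
    (hcyc : ∀ t, Cyc A B a b K μ K' (G t) (G1 t) (G2 t) (G3 t) (n t) (p t) (u t) (v t))
    (hout : ∀ t, Out A B κ c C (G t) (G1 t) (n t) (s t) (Y t) (α t) (l t) (l' t) (r' t) (r t))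
    (hn : Tendsto n atTop atTop) {j : ℕ → ℕ} (hYJ : ∀ t, Y t ∈ Ioo (u t (j t)) (v t (j t)))
    (hY : Tendsto Y atTop (𝓝 y)) (hα : Tendsto α atTop (𝓝 al))
    (hL : Tendsto l' atTop (𝓝 L)) (hR : Tendsto r' atTop (𝓝 R)) : False := by
  have hcl := fun t => (hcyc t).cls
  have hs := out_tendsto hμ hκ hc hC hcl hout hn
  have hom := hom_limit hμ hc cls hG hG1 hcl hout hs hL hR
  have hal : κ ≤ al := ge_of_tendsto' hα fun t => (hout t).big
  have hal0 : 0 < al := hκ.trans_le hal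
  have hit : ∀ i {X : ℕ → ℝ} {x : ℝ}, Tendsto X atTop (𝓝 x) →
      Tendsto (fun t => (G t)^[i] (X t)) atTop (𝓝 (F^[i] x)) := fun i X x hX =>
    (tendsto_iterate_prod hG i x).comp (tendsto_id.prodMk hX)
  have hDm : ∀ i, Tendsto (fun t => α t * |Dm (G t) (G1 t) i (Y t)|) atTop
      (𝓝 (al * |Dm F F1 i y|)) := fun i =>
    hα.mul ((tendsto_Dm_prod hG hG1 i y).comp (tendsto_id.prodMk hY)).abs
  have hyI : y ∈ Icc a b := isClosed_Icc.mem_of_tendsto hY (Eventually.of_forall fun t =>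
    ⟨((hcyc t).sub _).1.trans (hYJ t).1.le, (hYJ t).2.le.trans ((hcyc t).sub _).2⟩)
  have bl : ∀ i, c * (al * |Dm F F1 i y|) ≤ |F^[i] L - F^[i] y| ∧
      |F^[i] L - F^[i] y| ≤ C * (al * |Dm F F1 i y|) := fun i =>
    ⟨le_of_tendsto_of_tendsto ((hDm i).const_mul c) ((hit i hL).sub (hit i hY)).abs
      ((hs i).mono fun t ht => ((hout t).bl i ht).1),
    le_of_tendsto_of_tendsto ((hit i hL).sub (hit i hY)).abs ((hDm i).const_mul C)
      ((hs i).mono fun t ht => ((hout t).bl i ht).2)⟩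
  have br : ∀ i, c * (al * |Dm F F1 i y|) ≤ |F^[i] R - F^[i] y| ∧
      |F^[i] R - F^[i] y| ≤ C * (al * |Dm F F1 i y|) := fun i =>
    ⟨le_of_tendsto_of_tendsto ((hDm i).const_mul c) ((hit i hR).sub (hit i hY)).abs
      ((hs i).mono fun t ht => ((hout t).br i ht).1),
    le_of_tendsto_of_tendsto ((hit i hR).sub (hit i hY)).abs ((hDm i).const_mul C)
      ((hs i).mono fun t ht => ((hout t).br i ht).2)⟩
  have hpos : 0 < c * (al * |Dm F F1 0 y|) := by
    rw [Dm_zero, abs_one, mul_one]; exact mul_pos hc hal0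
  have lx : L < y := by
    have h1 : L ≤ y := le_of_tendsto_of_tendsto' hL hY fun t => (hout t).ly.le
    refine h1.lt_of_ne fun e => ?_
    have := (bl 0).1
    rw [e, sub_self, abs_zero] at this
    linarith
  have hxr : y < R := by
    have h1 : y ≤ R := le_of_tendsto_of_tendsto' hY hR fun t => (hout t).yr.le
    refine h1.lt_of_ne fun e => ?_
    have := (br 0).1
    rw [← e, sub_self, abs_zero] at this
    linarith
  have homy := hom y ⟨lx.le, hxr.le⟩
  have hsum : Summable fun i => al * |Dm F F1 i y| := by
    refine summable_of_sum_range_le (c := C) (fun i => by positivity) fun m => ?_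
    refine le_of_tendsto (tendsto_finsetSum _ fun i _ => hDm i) ((hs m).mono fun t ht => ?_)
    refine le_trans (Finset.sum_le_sum_of_subset_of_nonneg (Finset.range_mono ht)
      fun i _ _ => ?_) (hout t).sum
    exact mul_nonneg (hκ.le.trans (hout t).big) (abs_nonneg _)
  have hsq : Summable fun i => (al * |Dm F F1 i y| / F1 (F^[i] y)) ^ 2 := by
    refine summable_of_sum_range_le (c := C) (fun i => by positivity) fun m => ?_
    have hF1 : ∀ i, Tendsto (fun t => G1 t ((G t)^[i] (Y t))) atTop (𝓝 (F1 (F^[i] y))) := fun i =>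
      (hG1 _).comp (tendsto_id.prodMk (hit i hY))
    refine le_of_tendsto (tendsto_finsetSum _ fun i _ =>
      ((hDm i).div (hF1 i) (homy i).2).pow 2) ((hs m).mono fun t ht => ?_)
    exact le_trans (Finset.sum_le_sum_of_subset_of_nonneg (Finset.range_mono ht)
      fun i _ _ => sq_nonneg _) (hout t).sq
  have hrat : Tendsto (fun i => al * |Dm F F1 i y| / |F1 (F^[i] y)|) atTop (𝓝 0) := by
    have h1 := hsq.tendsto_atTop_zero.sqrt
    rw [Real.sqrt_zero] at h1
    refine h1.congr fun i => ?_
    rw [Real.sqrt_sq_eq_abs, abs_div, abs_of_nonneg (by positivity : 0 ≤ al * |Dm F F1 i y|)]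
  refine Wand.false (A := A) (B := B) (a := a) (b := b) (K := K) (μ := μ) (K' := K') (α := al) (c := c)
    (C := C) (f := F) (f1 := F1) (f2 := F2) (f3 := F3) (x := y) (l := L) (r := R)
    ⟨cls, st, hμ, aA, bB, maps, hyI, lx, hxr, hom, hal0, hc, hC, bl, br, hsum, hrat, ?_⟩
  rintro k hk i ⟨z, hz⟩
  have hzI : z ∈ Icc a b := isClosed_Icc.mem_of_tendsto hz (Eventually.of_forall fun m =>
    maps.iterate _ (maps.iterate _ hyI))
  have hfix : F^[k] z = z := by
    have h1 := hz.comp (tendsto_add_atTop_nat 1)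
    have h2 := ((cls.cont.iterate k).tendsto z).comp hz
    refine tendsto_nhds_unique h2 (h1.congr fun m => ?_)
    simp only [Function.comp_apply, ← Function.iterate_add_apply]
    congr 1; ring_nf
  rcases lt_trichotomy |Dm F F1 k z| 1 with h | h | h
  · exact not_attracted cls.cont hG hG1 hcyc hn hYJ hY hk hz h
  · exact hneut z hzI k hk hfix h
  · exact not_repelled cls.cont cls.cont1 hk hal0 (fun m => Dm_ne_zero fun j _ => (homy j).2) hsum hz h

end Limit

section Bound
variable {A B a b K μ K' κ c C y α l l' r' r : ℝ} {g g1 g2 g3 : ℝ → ℝ} {n s : ℕ}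

lemma Out.mem (h : Out A B κ c C g g1 n s y α l l' r' r) (hκ : 0 < κ) (hc : 0 < c)
    (hn : C < κ * (n - 4)) :
    l' ∈ Icc A B ∧ r' ∈ Icc A B ∧ y ∈ Icc A B ∧ α ∈ Icc κ ((B - A) / c) := by
  have hs : 0 < s := by
    refine Nat.pos_of_ne_zero fun e => ?_
    have h1 := h.last
    rw [e, Dm_zero, abs_one, mul_one] at h1
    have h2 : (0 : ℝ) < n - 4 := by
      have := h.sum
      rw [e, Finset.range_zero, Finset.sum_empty] at this
      exact pos_of_mul_pos_right (this.trans_lt hn) hκ.le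
    have := mul_le_mul_of_nonneg_right h.big h2.le
    linarith
  have hlr : l ≤ r := by linarith [h.ll', h.ly, h.yr, h.rr']
  have hl := (h.mon 0 hs l left_mem_uIcc).1
  have hr := (h.mon 0 hs r right_mem_uIcc).1
  simp only [Function.iterate_zero, id] at hl hr
  have := h.ll'
  have := h.rr'
  have := h.ly
  have := h.yr
  obtain ⟨hl1, hl2⟩ := hl
  obtain ⟨hr1, hr2⟩ := hr
  refine ⟨⟨by linarith, by linarith⟩, ⟨by linarith, by linarith⟩, ⟨by linarith, by linarith⟩,
    h.big, ?_⟩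
  have h3 := (h.bl 0 hs.le).1
  simp only [Dm_zero, abs_one, mul_one, Function.iterate_zero, id] at h3
  rw [le_div_iff₀ hc, mul_comm]
  refine h3.trans ?_
  rw [abs_le]; constructor <;> linarith

end Bound

section Nhds
variable {A B a b K μ K' : ℝ} {F F1 F2 F3 E : ℝ → ℝ}

lemma tendsto_of_close {G : ℕ → ℝ → ℝ} (hF : Continuous F) (hE : Continuous E)
    (h : ∀ t x, |G t x - F x| ≤ 1 / ((t : ℝ) + 1) * E x) (w : ℝ) :
    Tendsto (fun q : ℕ × ℝ => G q.1 q.2) (atTop ×ˢ 𝓝 w) (𝓝 (F w)) := by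
  have h1 : Tendsto (fun q : ℕ × ℝ => F q.2) (atTop ×ˢ 𝓝 w) (𝓝 (F w)) :=
    (hF.tendsto w).comp tendsto_snd
  have h2 : Tendsto (fun q : ℕ × ℝ => 1 / ((q.1 : ℝ) + 1) * E q.2) (atTop ×ˢ 𝓝 w) (𝓝 0) := by
    rw [← zero_mul (E w)]
    exact (tendsto_one_div_add_atTop_nhds_zero_nat.comp tendsto_fst).mul
      ((hE.tendsto w).comp tendsto_snd)
  have h3 : Tendsto (fun q : ℕ × ℝ => G q.1 q.2 - F q.2) (atTop ×ˢ 𝓝 w) (𝓝 0) :=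
    squeeze_zero_norm (fun q => h q.1 q.2) h2
  simpa using h3.add h1

lemma exists_period_bound (hμ : 0 < μ) (aA : A < a) (ab : a < b) (bB : b < B)
    (cls : Cls A B K μ F F1 F2 F3) (st : Sturm A B K' F F1) (maps : MapsTo F (Icc a b) (Icc a b))
    (hneut : ∀ z ∈ Icc a b, ∀ k, 0 < k → F^[k] z = z → |Dm F F1 k z| ≠ 1) (hE : Continuous E) :
    ∃ (η : ℝ) (n₀ : ℕ), 0 < η ∧ ∀ (G G1 G2 G3 : ℝ → ℝ) (n : ℕ) (p : ℝ) (u v : ℕ → ℝ),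
      Cyc A B a b K μ K' G G1 G2 G3 n p u v → (∀ x, |G x - F x| ≤ η * E x) →
      (∀ x, |G1 x - F1 x| ≤ η * E x) → n < n₀ := by
  by_contra! hcon
  obtain ⟨κ, c, C, hκ, hc, hC, H⟩ := Cyc.exists_out A B a b K μ K' hμ aA ab bB
  obtain ⟨N, hN⟩ := exists_nat_gt (C / κ + 4)
  choose G G1 G2 G3 n p u v hcyc hd hd1 hn using fun t : ℕ =>
    hcon (1 / ((t : ℝ) + 1)) (t + N) (by positivity)
  choose j s Y α l l' r' r hYJ hout using fun t => H _ _ _ _ _ _ _ _ (hcyc t)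
  have hbd : ∀ t, (l' t, r' t, Y t, α t) ∈
      Icc A B ×ˢ Icc A B ×ˢ Icc A B ×ˢ Icc κ ((B - A) / c) := by
    intro t
    have h1 : (N : ℝ) ≤ n t := by exact_mod_cast (Nat.le_add_left N t).trans (hn t)
    have h2 : C < κ * (n t - 4) := by
      rw [mul_comm, ← div_lt_iff₀ hκ]; linarith
    obtain ⟨h3, h4, h5, h6⟩ := (hout t).mem hκ hc h2
    exact ⟨h3, h4, h5, h6⟩
  obtain ⟨⟨L, R, y, al⟩, -, φ, hφ, hlim⟩ := (isCompact_Icc.prod (isCompact_Icc.prod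
    (isCompact_Icc.prod isCompact_Icc))).tendsto_subseq hbd
  have hlim' := hlim
  rw [Prod.tendsto_iff, Prod.tendsto_iff, Prod.tendsto_iff] at hlim'
  obtain ⟨hL, hR, hY, hα⟩ := hlim'
  have hsub : ∀ w, Tendsto (fun q : ℕ × ℝ => (φ q.1, q.2)) (atTop ×ˢ 𝓝 w) (atTop ×ˢ 𝓝 w) :=
    fun w => (hφ.tendsto_atTop.comp tendsto_fst).prodMk tendsto_snd
  refine limit_false (G := G ∘ φ) (G1 := G1 ∘ φ) (G2 := G2 ∘ φ) (G3 := G3 ∘ φ) hμ hκ hc hC aA bB cls st maps hneut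
    (fun w => (tendsto_of_close cls.cont hE hd w).comp (hsub w))
    (fun w => (tendsto_of_close cls.cont1 hE hd1 w).comp (hsub w))
    (fun t => hcyc (φ t)) (fun t => hout (φ t)) ?_ (fun t => hYJ (φ t)) hY hα hL hR
  exact tendsto_atTop_mono (fun t => ((Nat.le_add_right _ N).trans (hn (φ t))))
    hφ.tendsto_atTop

end Nhds

/-- `G` extends `g` from `[a, b]` to a map of the line whose third derivative is constant on
either side of `[a, b]`. -/
structure LineExt (a b : ℝ) (g G G1 G2 G3 : ℝ → ℝ) : Prop where
  d0 : ∀ x, HasDerivAt G (G1 x) x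
  d1 : ∀ x, HasDerivAt G1 (G2 x) x
  d2 : ∀ x, HasDerivAt G2 (G3 x) x
  c3 : Continuous G3
  eq3 : ∀ x, G3 x = iteratedDeriv 3 g (max a (min x b))
  eq0 : EqOn g G (Icc a b)
  eq1 : EqOn (deriv g) G1 (Icc a b)
  eq2 : EqOn (iteratedDeriv 2 g) G2 (Icc a b)

lemma exists_primitive {a b : ℝ} {h h' H' : ℝ → ℝ} (hd : ∀ x, HasDerivAt h (h' x) x)
    (hc' : Continuous h') (hc : Continuous H') (he : EqOn h' H' (Icc a b)) :
    ∃ H : ℝ → ℝ, (∀ x, HasDerivAt H (H' x) x) ∧ EqOn h H (Icc a b) := by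
  refine ⟨fun x => h a + ∫ t in a..x, H' t, fun x =>
    (hc.integral_hasStrictDerivAt a x).hasDerivAt.const_add _, fun x hx => ?_⟩
  have h1 : ∫ t in a..x, h' t = h x - h a :=
    intervalIntegral.integral_eq_sub_of_hasDerivAt (fun t _ => hd t) (hc'.intervalIntegrable _ _)
  have h2 : ∫ t in a..x, H' t = ∫ t in a..x, h' t := by
    refine intervalIntegral.integral_congr fun t ht => (he ?_).symm
    rw [uIcc_of_le hx.1] at ht
    exact ⟨ht.1, ht.2.trans hx.2⟩
  show h x = h a + ∫ t in a..x, H' t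
  rw [h2, h1]; ring

lemma hasDerivAt_iteratedDeriv {g : ℝ → ℝ} (hg : ContDiff ℝ 3 g) {i : ℕ} (hi : i < 3) (x : ℝ) :
    HasDerivAt (iteratedDeriv i g) (iteratedDeriv (i + 1) g x) x := by
  rw [iteratedDeriv_succ]
  exact (hg.differentiable_iteratedDeriv i (by exact_mod_cast hi) x).hasDerivAt

lemma continuous_iteratedDeriv_of_le {g : ℝ → ℝ} (hg : ContDiff ℝ 3 g) {i : ℕ} (hi : i ≤ 3) :
    Continuous (iteratedDeriv i g) :=
  hg.continuous_iteratedDeriv i (by exact_mod_cast hi)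

lemma exists_ext {a b : ℝ} {g : ℝ → ℝ} (hg : ContDiff ℝ 3 g) :
    ∃ G G1 G2 G3, LineExt a b g G G1 G2 G3 := by
  have c3 : Continuous fun x => iteratedDeriv 3 g (max a (min x b)) :=
    (continuous_iteratedDeriv_of_le hg le_rfl).comp (by fun_prop)
  have e3 : EqOn (iteratedDeriv 3 g) (fun x => iteratedDeriv 3 g (max a (min x b))) (Icc a b) := by
    intro x hx
    show _ = iteratedDeriv 3 g (max a (min x b))
    rw [min_eq_left hx.2, max_eq_right hx.1]
  obtain ⟨G2, d2, e2⟩ := exists_primitive (hasDerivAt_iteratedDeriv hg (i := 2) (by norm_num))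
    (continuous_iteratedDeriv_of_le hg le_rfl) c3 e3
  obtain ⟨G1, d1, e1⟩ := exists_primitive (hasDerivAt_iteratedDeriv hg (i := 1) (by norm_num))
    (continuous_iteratedDeriv_of_le hg (by norm_num))
    (continuous_iff_continuousAt.2 fun x => (d2 x).continuousAt) e2
  obtain ⟨G, d0, e0⟩ := exists_primitive (hasDerivAt_iteratedDeriv hg (i := 0) (by norm_num))
    (continuous_iteratedDeriv_of_le hg (by norm_num))
    (continuous_iff_continuousAt.2 fun x => (d1 x).continuousAt) e1
  rw [iteratedDeriv_one] at e1
  rw [iteratedDeriv_zero] at e0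
  exact ⟨G, G1, G2, _, d0, d1, d2, c3, fun x => rfl, e0, e1, e2⟩

lemma abs_le_of_hasDerivAt {a η : ℝ} {k : ℕ} {D D' : ℝ → ℝ} (hη : 0 ≤ η)
    (hd : ∀ x, HasDerivAt D (D' x) x)
    (h0 : |D a| ≤ η) (h' : ∀ x, |D' x| ≤ η * (1 + |x - a|) ^ k) (x : ℝ) :
    |D x| ≤ η * (1 + |x - a|) ^ (k + 1) := by
  have h1 : ‖D x - D a‖ ≤ η * (1 + |x - a|) ^ k * ‖x - a‖ := by
    refine (convex_uIcc a x).norm_image_sub_le_of_norm_hasDerivWithin_le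
      (fun y _ => (hd y).hasDerivWithinAt) (fun y hy => (h' y).trans ?_)
      left_mem_uIcc right_mem_uIcc
    have := abs_sub_left_of_mem_uIcc hy
    gcongr
  rw [Real.norm_eq_abs, Real.norm_eq_abs] at h1
  have h2 : |D x| ≤ |D x - D a| + |D a| := by
    simpa using abs_add_le (D x - D a) (D a)
  have h3 : 1 ≤ (1 + |x - a|) ^ k := one_le_pow₀ (by linarith [abs_nonneg (x - a)])
  have h4 := mul_le_mul_of_nonneg_left h3 hη
  rw [pow_succ]
  nlinarith

section Close
variable {a b η : ℝ} {f g F F1 F2 F3 G G1 G2 G3 : ℝ → ℝ}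

lemma LineExt.close (hab : a ≤ b) (hη : 0 ≤ η) (hF : LineExt a b f F F1 F2 F3) (hG : LineExt a b g G G1 G2 G3)
    (h : CkClose 3 f g (Icc a b) η) (x : ℝ) :
    |G x - F x| ≤ η * (1 + |x - a|) ^ 3 ∧ |G1 x - F1 x| ≤ η * (1 + |x - a|) ^ 3 ∧
    |G2 x - F2 x| ≤ η * (1 + |x - a|) ^ 3 ∧ |G3 x - F3 x| ≤ η * (1 + |x - a|) ^ 3 := by
  have ha : a ∈ Icc a b := left_mem_Icc.2 hab
  have h3 : ∀ y, |G3 y - F3 y| ≤ η * (1 + |y - a|) ^ 0 := by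
    intro y
    rw [pow_zero, mul_one, hF.eq3, hG.eq3]
    exact h 3 le_rfl _ ⟨le_max_left _ _, max_le hab (min_le_right _ _)⟩
  have h2 := abs_le_of_hasDerivAt (D := fun y => G2 y - F2 y) hη (fun y => (hG.d2 y).sub (hF.d2 y))
    (by have := h 2 (by norm_num) a ha
        rwa [hF.eq2 ha, hG.eq2 ha] at this) h3
  have h1 := abs_le_of_hasDerivAt (D := fun y => G1 y - F1 y) hη (fun y => (hG.d1 y).sub (hF.d1 y))
    (by have := h 1 (by norm_num) a ha
        rwa [iteratedDeriv_one, iteratedDeriv_one, hF.eq1 ha, hG.eq1 ha] at this) h2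
  have h0 := abs_le_of_hasDerivAt (D := fun y => G y - F y) hη (fun y => (hG.d0 y).sub (hF.d0 y))
    (by have := h 0 (by norm_num) a ha
        rwa [iteratedDeriv_zero, iteratedDeriv_zero, hF.eq0 ha, hG.eq0 ha] at this) h1
  have hle : ∀ i ≤ 3, η * (1 + |x - a|) ^ i ≤ η * (1 + |x - a|) ^ 3 := fun i hi =>
    mul_le_mul_of_nonneg_left (pow_le_pow_right₀ (by linarith [abs_nonneg (x - a)]) hi) hη
  exact ⟨h0 x, (h1 x).trans (hle _ (by norm_num)), (h2 x).trans (hle _ (by norm_num)),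
    (h3 x).trans (hle _ (by norm_num))⟩

lemma LineExt.exists_cls (hab : a < b) (hF : LineExt a b f F F1 F2 F3)
    (hquad : ∀ c ∈ Icc a b, deriv f c = 0 → iteratedDeriv 2 f c ≠ 0) :
    ∃ A B K μ η : ℝ, A < a ∧ b < B ∧ 0 < μ ∧ 0 < η ∧ Cls A B K μ F F1 F2 F3 ∧
      ∀ g G G1 G2 G3, LineExt a b g G G1 G2 G3 → CkClose 3 f g (Icc a b) η →
        Cls A B K μ G G1 G2 G3 := by
  have c1 : Continuous F1 := continuous_iff_continuousAt.2 fun x => (hF.d1 x).continuousAt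
  have c2 : Continuous F2 := continuous_iff_continuousAt.2 fun x => (hF.d2 x).continuousAt
  have c12 : Continuous fun x => |F1 x| + |F2 x| := c1.abs.add c2.abs
  have hpos : ∀ x ∈ Icc a b, 0 < |F1 x| + |F2 x| := by
    intro x hx
    by_cases h : F1 x = 0
    · have h2 := hquad x hx ((hF.eq1 hx).trans h)
      rw [hF.eq2 hx] at h2
      have := abs_pos.2 h2
      have := abs_nonneg (F1 x)
      linarith
    · have := abs_pos.2 h
      have := abs_nonneg (F2 x)
      linarith
  obtain ⟨ρ₁, hρ₁, H₁⟩ := Metric.eventually_nhds_iff.1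
    ((c12.tendsto a).eventually (lt_mem_nhds (hpos a (left_mem_Icc.2 hab.le))))
  obtain ⟨ρ₂, hρ₂, H₂⟩ := Metric.eventually_nhds_iff.1
    ((c12.tendsto b).eventually (lt_mem_nhds (hpos b (right_mem_Icc.2 hab.le))))
  set A := a - ρ₁ / 2 with hA
  set B := b + ρ₂ / 2 with hB
  have hpos' : ∀ x ∈ Icc A B, 0 < |F1 x| + |F2 x| := by
    intro x hx
    rcases lt_or_ge x a with h | h
    · refine H₁ ?_
      rw [Real.dist_eq, abs_lt]
      constructor <;> linarith [hx.1]
    · rcases lt_or_ge b x with h' | h'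
      · refine H₂ ?_
        rw [Real.dist_eq, abs_lt]
        constructor <;> linarith [hx.2]
      · exact hpos x ⟨h, h'⟩
  have hne : (Icc A B).Nonempty := ⟨a, by linarith, by linarith⟩
  obtain ⟨x₀, hx₀, hmin⟩ := isCompact_Icc.exists_isMinOn hne c12.continuousOn
  obtain ⟨x₁, hx₁, hmax⟩ := isCompact_Icc.exists_isMaxOn hne
    (c12.add hF.c3.abs).continuousOn
  set m := |F1 x₀| + |F2 x₀| with hm
  set M := |F1 x₁| + |F2 x₁| + |F3 x₁| with hM
  have hm0 : 0 < m := hpos' x₀ hx₀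
  have hP : 0 < (1 + (B - A)) ^ 3 := by
    have : 0 < B - A := by linarith
    positivity
  set η := min 1 (m / 4) / (1 + (B - A)) ^ 3 with hη
  have hη0 : 0 < η := by positivity
  have hlow : ∀ x ∈ Icc A B, m ≤ |F1 x| + |F2 x| := fun x hx => hmin hx
  have hup : ∀ x ∈ Icc A B, |F1 x| + |F2 x| + |F3 x| ≤ M := fun x hx => hmax hx
  have hEb : ∀ x ∈ Icc A B, η * (1 + |x - a|) ^ 3 ≤ min 1 (m / 4) := by
    intro x hx
    have h1 : |x - a| ≤ B - A := by
      rw [abs_le]; constructor <;> linarith [hx.1, hx.2]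
    calc η * (1 + |x - a|) ^ 3 ≤ η * (1 + (B - A)) ^ 3 := by gcongr
      _ = _ := by rw [hη, div_mul_cancel₀ _ hP.ne']
  refine ⟨A, B, M + 1, m / 2, η, by linarith, by linarith, by linarith, hη0,
    ⟨hF.d0, hF.d1, hF.d2, fun x hx => ?_, fun x hx => ?_, fun x hx => ?_, fun x hx => ?_⟩,
    fun g G G1 G2 G3 hG hcl => ⟨hG.d0, hG.d1, hG.d2, fun x hx => ?_, fun x hx => ?_,
      fun x hx => ?_, fun x hx => ?_⟩⟩
  · linarith [hup x hx, abs_nonneg (F1 x), abs_nonneg (F2 x), abs_nonneg (F3 x)]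
  · linarith [hup x hx, abs_nonneg (F1 x), abs_nonneg (F2 x), abs_nonneg (F3 x)]
  · linarith [hup x hx, abs_nonneg (F1 x), abs_nonneg (F2 x), abs_nonneg (F3 x)]
  · linarith [hlow x hx]
  all_goals
    obtain ⟨-, e1, e2, e3⟩ := LineExt.close hab.le hη0.le hF hG hcl x
    have hb1 := (hEb x hx).trans (min_le_left _ _)
    have hb2 := (hEb x hx).trans (min_le_right _ _)
    have hu := hup x hx
    have hl := hlow x hx
    have t1 := abs_sub_abs_le_abs_sub (G1 x) (F1 x)
    have t2 := abs_sub_abs_le_abs_sub (G2 x) (F2 x)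
    have t3 := abs_sub_abs_le_abs_sub (G3 x) (F3 x)
    have t1' := abs_sub_abs_le_abs_sub (F1 x) (G1 x)
    have t2' := abs_sub_abs_le_abs_sub (F2 x) (G2 x)
    rw [abs_sub_comm] at t1' t2'
    have p1 := abs_nonneg (F1 x)
    have p2 := abs_nonneg (F2 x)
    have p3 := abs_nonneg (F3 x)
    linarith

lemma Dm_congr {N : Set ℝ} {g1 G1 : ℝ → ℝ} (hm : MapsTo g N N) (he : EqOn g G N)
    (he1 : EqOn g1 G1 N) {x : ℝ} (hx : x ∈ N) (k : ℕ) : Dm G G1 k x = Dm g g1 k x := by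
  refine Finset.prod_congr rfl fun j _ => ?_
  rw [iterate_eq_of_eqOn hm he hx]
  exact (he1 (hm.iterate j hx)).symm

/-- An attracting periodic orbit of large period of a map close to `f` attracts a critical point. -/
theorem exists_attracted_crit (hab : a < b) (hf : ContDiff ℝ 3 f)
    (hmaps : MapsTo f (Icc a b) (Icc a b))
    (hquad : ∀ c ∈ Icc a b, deriv f c = 0 → iteratedDeriv 2 f c ≠ 0)
    (hneut : ¬ ∃ p ∈ Icc a b, ∃ n : ℕ, NeutralPeriodicPt f p n) :
    ∃ (η : ℝ) (n₀ : ℕ), 0 < η ∧ ∀ g : ℝ → ℝ, ContDiff ℝ 3 g → MapsTo g (Icc a b) (Icc a b) →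
      CkClose 3 f g (Icc a b) η → ∀ p ∈ Icc a b, ∀ n : ℕ, AttractingIn g (Icc a b) p n →
        n < n₀ ∨ ∃ c ∈ Icc a b, deriv g c = 0 ∧ ConvergesToOrbit g c (orbitSet g p) := by
  obtain ⟨F, F1, F2, F3, hF⟩ := exists_ext (a := a) (b := b) hf
  obtain ⟨A, B, K, μ, η₁, aA, bB, hμ, hη₁, cls, hcls⟩ := hF.exists_cls hab hquad
  obtain ⟨K', hK', hst⟩ := Cls.sturm K μ hμ
  have sturm : ∀ {G G1 G2 G3 : ℝ → ℝ}, Cls A B K μ G G1 G2 G3 → Sturm A B K' G G1 := fun h =>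
    ⟨h.d0, h.cont1, hK', fun u w hu hw huw hne => hst _ _ _ _ _ _ h u w hu hw huw hne⟩
  have hmF : MapsTo F (Icc a b) (Icc a b) := hmaps.congr hF.eq0
  have hneutF : ∀ z ∈ Icc a b, ∀ k, 0 < k → F^[k] z = z → |Dm F F1 k z| ≠ 1 := by
    intro z hz k hk hfix hD
    have h1 : HasDerivAt (f^[k]) (Dm f (deriv f) k z) z :=
      hasDerivAt_iterate (fun x => (hf.differentiable (by norm_num) x).hasDerivAt) k z
    rw [iterate_eq_of_eqOn hmaps hF.eq0 hz] at hfix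
    refine hneut ⟨z, hz, k, hk, hfix, ?_⟩
    rw [h1.deriv, ← Dm_congr hmaps hF.eq0 hF.eq1 hz, hD]
  obtain ⟨η₂, n₀, hη₂, H⟩ := exists_period_bound hμ aA hab bB cls (sturm cls) hmF hneutF
    (E := fun x => (1 + |x - a|) ^ 3) (by fun_prop)
  refine ⟨min η₁ η₂, max n₀ 3, lt_min hη₁ hη₂, fun g hg hm hcl p hp n hatt => ?_⟩
  by_contra! hcon
  obtain ⟨hn, hcrit⟩ := hcon
  have hcl₁ : CkClose 3 f g (Icc a b) η₁ := fun i hi x hx =>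
    (hcl i hi x hx).trans (min_le_left _ _)
  have hcl₂ : CkClose 3 f g (Icc a b) η₂ := fun i hi x hx =>
    (hcl i hi x hx).trans (min_le_right _ _)
  obtain ⟨G, G1, G2, G3, hG⟩ := exists_ext (a := a) (b := b) hg
  have hGc := hcls g G G1 G2 G3 hG hcl₁
  have hbas := (hatt.congr hm hG.eq0 hp).bas hG.d0 hGc.cont1 (hm.congr hG.eq0) hp
    fun x hx h0 hx' => hcrit x hx ((hG.eq1 hx).trans h0) (by
      rw [orbitSet_congr hm hG.eq0 hp] at hx'
      exact (convergesToOrbit_congr hm hG.eq0 hx _).1 hx')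
  obtain ⟨u, v, hcyc⟩ := hbas.exists_cyc hGc (sturm hGc) hμ aA bB ((le_max_right _ _).trans hn)
  have hclose := LineExt.close hab.le hη₂.le hF hG hcl₂
  have := H G G1 G2 G3 n p u v hcyc (fun x => (hclose x).1) (fun x => (hclose x).2.1)
  exact absurd ((le_max_left n₀ 3).trans hn) (not_le.2 this)

end Close

lemma infinite_accPt {S : Set ℝ} {a b : ℝ} (hS : S ⊆ Icc a b) (h : S.Infinite) :
    ∃ z ∈ Icc a b, ∃ᶠ x in 𝓝[≠] z, x ∈ S := by
  obtain ⟨z, hz, hacc⟩ := h.exists_accPt_of_subset_isCompact isCompact_Icc hS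
  exact ⟨z, hz, accPt_iff_frequently_nhdsNE.1 hacc⟩

lemma isCompact_zeros {a b c : ℝ} {h : ℝ → ℝ} (hc : Continuous h) :
    IsCompact {x ∈ Icc a b | h x = c} :=
  isCompact_Icc.inter_right (isClosed_singleton.preimage hc)

lemma finite_zeros {a b : ℝ} {h h' : ℝ → ℝ} (hd : ∀ x, HasDerivAt h (h' x) x)
    (hs : ∀ x ∈ Icc a b, h x = 0 → h' x ≠ 0) : {x ∈ Icc a b | h x = 0}.Finite := by
  by_contra hinf
  have hc : Continuous h := continuous_iff_continuousAt.2 fun x => (hd x).continuousAt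
  obtain ⟨z, hz, hf⟩ := infinite_accPt (fun x hx => hx.1) hinf
  have hz0 : h z = 0 := by
    by_contra hne
    have h1 := (hc.tendsto z).eventually_ne hne
    obtain ⟨x, hx, hx'⟩ := (hf.and_eventually (h1.filter_mono nhdsWithin_le_nhds)).exists
    exact hx' hx.2
  obtain ⟨x, hx, hx'⟩ := (hf.and_eventually ((hd z).eventually_ne (c := 0) (hs z hz hz0))).exists
  exact hx' hx.2

lemma exists_zero_map {a b : ℝ} {h h' : ℝ → ℝ} (hd : ∀ x, HasDerivAt h (h' x) x)
    (hc' : Continuous h') (hs : ∀ x ∈ Icc a b, h x = 0 → h' x ≠ 0) {ε : ℝ} (hε : 0 < ε) :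
    ∃ η > 0, ∀ k k' : ℝ → ℝ, (∀ x, HasDerivAt k (k' x) x) → (∀ x ∈ Icc a b, |k x - h x| ≤ η) →
      (∀ x ∈ Icc a b, |k' x - h' x| ≤ η) → ∃ φ : ℝ → ℝ,
      (∀ x ∈ Icc a b, k x = 0 → φ x ∈ Icc a b ∧ h (φ x) = 0 ∧ |x - φ x| < ε ∧
        |k' x - h' (φ x)| < ε ∧ k' x ≠ 0) ∧ InjOn φ {x ∈ Icc a b | k x = 0} := by
  have hc : Continuous h := continuous_iff_continuousAt.2 fun x => (hd x).continuousAt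
  obtain ⟨m, hm, hmZ⟩ := (isCompact_zeros (a := a) (b := b) (c := 0) hc).exists_forall_le'
    hc'.abs.continuousOn (a := 0) fun z hz => abs_pos.2 (hs z hz.1 hz.2)
  obtain ⟨δ, hδ, hδu⟩ := Metric.uniformContinuousOn_iff.1
    (isCompact_Icc.uniformContinuousOn_of_continuous (s := Icc a b) hc'.continuousOn)
    (min (ε / 2) (m / 2)) (by positivity)
  set ρ := min ε δ with hρ
  have hρ0 : 0 < ρ := lt_min hε hδ
  have hK : IsCompact {x ∈ Icc a b | ∀ z ∈ {x ∈ Icc a b | h x = 0}, ρ ≤ |x - z|} := by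
    have e : {x ∈ Icc a b | ∀ z ∈ {x ∈ Icc a b | h x = 0}, ρ ≤ |x - z|} =
        Icc a b ∩ ⋂ z ∈ {x ∈ Icc a b | h x = 0}, {x | ρ ≤ |x - z|} := by
      ext x
      rw [mem_inter_iff, mem_iInter₂]
      rfl
    rw [e]
    exact isCompact_Icc.inter_right
      (isClosed_biInter fun z _ => isClosed_le continuous_const (by fun_prop))
  obtain ⟨m', hm', hmK⟩ := hK.exists_forall_le' hc.abs.continuousOn (a := 0) fun x hx => by
    refine abs_pos.2 fun h0 => ?_
    have := hx.2 x ⟨hx.1, h0⟩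
    rw [sub_self, abs_zero] at this
    linarith
  refine ⟨min (m' / 2) (min (ε / 4) (m / 4)), by positivity, fun k k' hk h0 h1 => ?_⟩
  have near : ∀ x ∈ Icc a b, k x = 0 → ∃ z, z ∈ {x ∈ Icc a b | h x = 0} ∧ |x - z| < ρ := by
    intro x hx hkx
    by_contra! hcon
    have e1 := hmK x ⟨hx, hcon⟩
    have e2 := (h0 x hx).trans (min_le_left _ _)
    rw [hkx, zero_sub, abs_neg] at e2
    linarith
  choose! φ hφ using near
  have key : ∀ x ∈ Icc a b, ∀ z ∈ {x ∈ Icc a b | h x = 0}, |x - z| < ρ →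
      |k' x - h' z| < ε ∧ k' x ≠ 0 := by
    intro x hx z hz hxz
    have e1 := hδu x hx z hz.1 (by rw [Real.dist_eq]; exact hxz.trans_le (min_le_right _ _))
    rw [Real.dist_eq] at e1
    have e2 := h1 x hx
    have e3 : |k' x - h' z| ≤ |k' x - h' x| + |h' x - h' z| := abs_sub_le _ _ _
    have e4 := hmZ z hz
    have := min_le_left (ε / 2) (m / 2)
    have := min_le_right (ε / 2) (m / 2)
    have := min_le_right (m' / 2) (min (ε / 4) (m / 4))
    have := min_le_left (ε / 4) (m / 4)
    have := min_le_right (ε / 4) (m / 4)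
    refine ⟨by linarith, fun e => ?_⟩
    simp only [e, zero_sub, abs_neg] at e2 e3
    linarith
  refine ⟨φ, fun x hx hkx => ?_, ?_⟩
  · obtain ⟨hz, hxz⟩ := hφ x hx hkx
    exact ⟨hz.1, hz.2, hxz.trans_le (min_le_left _ _), key x hx _ hz hxz⟩
  · have lt : ∀ x ∈ Icc a b, k x = 0 → ∀ y ∈ Icc a b, k y = 0 → φ x = φ y → ¬ x < y := by
      intro x hx hkx y hy hky e hxy
      obtain ⟨w, hw, hw0⟩ := exists_hasDerivAt_eq_zero hxy
        (fun t _ => (hk t).continuousAt.continuousWithinAt) (hkx.trans hky.symm) fun t _ => hk t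
      obtain ⟨hz, hxz⟩ := hφ x hx hkx
      have hyz := (hφ y hy hky).2
      rw [← e] at hyz
      refine (key w ⟨hx.1.trans hw.1.le, hw.2.le.trans hy.2⟩ _ hz ?_).2 hw0
      rw [abs_lt] at hxz hyz ⊢
      constructor <;> linarith [hw.1, hw.2]
    intro x hx y hy e
    exact le_antisymm (not_lt.1 (lt y hy.1 hy.2 x hx.1 hx.2 e.symm))
      (not_lt.1 (lt x hx.1 hx.2 y hy.1 hy.2 e))

lemma exists_sep {Z : Set ℝ} (hZ : Z.Finite) :
    ∃ ε > 0, ∀ x ∈ Z, ∀ y ∈ Z, |x - y| < ε → x = y := by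
  obtain ⟨ε, hε, H⟩ := hZ.offDiag.isCompact.exists_forall_le' (f := fun q : ℝ × ℝ => |q.1 - q.2|)
    (by fun_prop) (a := 0) fun q hq => abs_pos.2 (sub_ne_zero.2 hq.2.2)
  refine ⟨ε, hε, fun x hx y hy hxy => ?_⟩
  by_contra hne
  exact (H (x, y) ⟨hx, hy, hne⟩).not_gt hxy

lemma iterate_close {a b : ℝ} {f f1 : ℝ → ℝ} (hf : Continuous f) (hf1 : Continuous f1)
    (hm : MapsTo f (Icc a b) (Icc a b)) (k : ℕ) : ∀ ε > 0, ∃ η > 0, ∀ g g1 : ℝ → ℝ,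
      MapsTo g (Icc a b) (Icc a b) → (∀ x ∈ Icc a b, |g x - f x| ≤ η) →
      (∀ x ∈ Icc a b, |g1 x - f1 x| ≤ η) → ∀ x ∈ Icc a b,
        |g^[k] x - f^[k] x| < ε ∧ |Dm g g1 k x - Dm f f1 k x| < ε := by
  induction k with
  | zero => exact fun ε hε => ⟨1, one_pos, fun g g1 _ _ _ x _ => by simp [hε]⟩
  | succ k ih =>
    intro ε hε
    obtain ⟨M, hM⟩ := isCompact_Icc.exists_bound_of_continuousOn (s := Icc a b) hf1.continuousOn
    obtain ⟨M', hM'⟩ := isCompact_Icc.exists_bound_of_continuousOn (s := Icc a b)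
      (continuous_Dm hf hf1 k).continuousOn
    simp only [Real.norm_eq_abs] at hM hM'
    set P := |M| + |M'| + 2 with hP
    have hP0 : 0 < P := by positivity
    set θ := min 1 (ε / (4 * P)) with hθ
    have hθ0 : 0 < θ := by positivity
    have hθ1 : θ ≤ 1 := min_le_left _ _
    have hθ2 : θ * P ≤ ε / 4 := by
      have := mul_le_mul_of_nonneg_right (min_le_right 1 (ε / (4 * P))) hP0.le
      rw [← hθ] at this
      refine this.trans (le_of_eq ?_)
      field_simp
    obtain ⟨δ₀, hδ₀, hu₀⟩ := Metric.uniformContinuousOn_iff.1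
      (isCompact_Icc.uniformContinuousOn_of_continuous (s := Icc a b) hf.continuousOn) (ε / 2)
      (by positivity)
    obtain ⟨δ₁, hδ₁, hu₁⟩ := Metric.uniformContinuousOn_iff.1
      (isCompact_Icc.uniformContinuousOn_of_continuous (s := Icc a b) hf1.continuousOn) θ hθ0
    simp only [Real.dist_eq] at hu₀ hu₁
    obtain ⟨η, hη, H⟩ := ih (min (min δ₀ δ₁) θ) (by positivity)
    refine ⟨min η (min (ε / 4) θ), by positivity, fun g g1 hg h0 h1 x hx => ?_⟩
    obtain ⟨c0, c1⟩ := H g g1 hg (fun y hy => (h0 y hy).trans (min_le_left _ _))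
      (fun y hy => (h1 y hy).trans (min_le_left _ _)) x hx
    have hgx := hg.iterate k hx
    have hfx := hm.iterate k hx
    have b0 := (h0 _ hgx).trans ((min_le_right _ _).trans (min_le_left _ _))
    have b1 := (h1 _ hgx).trans ((min_le_right _ _).trans (min_le_right _ _))
    have u0 := hu₀ _ hgx _ hfx (c0.trans_le ((min_le_left _ _).trans (min_le_left _ _)))
    have u1 := hu₁ _ hgx _ hfx (c0.trans_le ((min_le_left _ _).trans (min_le_right _ _)))
    have c2 := c1.trans_le (min_le_right _ _)
    constructor
    · rw [Function.iterate_succ_apply', Function.iterate_succ_apply']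
      have := abs_sub_le (g (g^[k] x)) (f (g^[k] x)) (f (f^[k] x))
      linarith
    · rw [Dm_succ, Dm_succ]
      have e1 : |g1 (g^[k] x) - f1 (f^[k] x)| ≤ 2 * θ := by
        have := abs_sub_le (g1 (g^[k] x)) (f1 (g^[k] x)) (f1 (f^[k] x))
        linarith
      have e2 : |g1 (g^[k] x)| ≤ |M| + 2 := by
        have := abs_sub_abs_le_abs_sub (g1 (g^[k] x)) (f1 (f^[k] x))
        have := (hM _ hfx).trans (le_abs_self M)
        linarith
      have e3 := (hM' x hx).trans (le_abs_self M')
      have e4 : Dm g g1 k x * g1 (g^[k] x) - Dm f f1 k x * f1 (f^[k] x) =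
        (Dm g g1 k x - Dm f f1 k x) * g1 (g^[k] x) +
          Dm f f1 k x * (g1 (g^[k] x) - f1 (f^[k] x)) := by ring
      rw [e4]
      refine (abs_add_le _ _).trans_lt ?_
      rw [abs_mul, abs_mul]
      have e5 : |Dm g g1 k x - Dm f f1 k x| * |g1 (g^[k] x)| ≤ θ * (|M| + 2) :=
        mul_le_mul c2.le e2 (abs_nonneg _) hθ0.le
      have e6 : |Dm f f1 k x| * |g1 (g^[k] x) - f1 (f^[k] x)| ≤ |M'| * (2 * θ) :=
        mul_le_mul e3 e1 (abs_nonneg _) (abs_nonneg _)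
      have e7 : θ * P = θ * |M| + θ * |M'| + 2 * θ := by rw [hP]; ring
      have := mul_nonneg hθ0.le (abs_nonneg M)
      have := mul_nonneg hθ0.le (abs_nonneg M')
      nlinarith

lemma finite_fiber {a b : ℝ} {g g1 g2 : ℝ → ℝ} (h0 : ∀ x, HasDerivAt g (g1 x) x)
    (h1 : ∀ x, HasDerivAt g1 (g2 x) x) (hq : ∀ x ∈ Icc a b, g1 x = 0 → g2 x ≠ 0) (c : ℝ) :
    {x ∈ Icc a b | g x = c}.Finite := by
  by_contra hinf
  have hc : Continuous g := continuous_iff_continuousAt.2 fun x => (h0 x).continuousAt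
  obtain ⟨z, hz, hf⟩ := infinite_accPt (fun x hx => hx.1) hinf
  have hz0 : g z = c := by
    by_contra hne
    have h1 := (hc.tendsto z).eventually_ne hne
    obtain ⟨x, hx, hx'⟩ := (hf.and_eventually (h1.filter_mono nhdsWithin_le_nhds)).exists
    exact hx' hx.2
  have hz1 : g1 z = 0 := by
    by_contra hne
    obtain ⟨x, hx, hx'⟩ := (hf.and_eventually ((h0 z).eventually_ne (c := c) hne)).exists
    exact hx' hx.2
  have h2 := (h1 z).eventually_ne (c := 0) (hq z hz hz1)
  obtain ⟨δ, hδ, H⟩ := Metric.eventually_nhds_iff.1 (eventually_nhdsWithin_iff.1 h2)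
  obtain ⟨x, hx, hx', hxz⟩ := (hf.and_eventually ((eventually_mem_nhdsWithin (a := z)
    (s := {z}ᶜ)).and (mem_nhdsWithin_of_mem_nhds (Metric.ball_mem_nhds z hδ)))).exists
  have hxz' : |x - z| < δ := hxz
  have roll : ∀ s t, s < t → g s = g t → |s - z| < δ → |t - z| < δ → (∀ w ∈ Ioo s t, w ≠ z) →
      False := by
    intro s t hst e hs ht hne
    obtain ⟨w, hw, hw0⟩ := exists_hasDerivAt_eq_zero hst hc.continuousOn e fun t _ => h0 t
    refine H (y := w) ?_ (hne w hw) hw0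
    rw [Real.dist_eq, abs_lt]
    rw [abs_lt] at hs ht
    constructor <;> linarith [hw.1, hw.2]
  have hzz : |z - z| < δ := by rwa [sub_self, abs_zero]
  rcases lt_or_gt_of_ne (show x ≠ z from hx') with hlt | hlt
  · exact roll x z hlt (hx.2.trans hz0.symm) hxz' hzz fun w hw => hw.2.ne
  · exact roll z x hlt (hz0.trans hx.2.symm) hzz hxz' fun w hw => hw.1.ne'

lemma finite_iterate_preimage {a b : ℝ} {g : ℝ → ℝ} (hm : MapsTo g (Icc a b) (Icc a b))
    (hfib : ∀ c, {x ∈ Icc a b | g x = c}.Finite) {O : Set ℝ} (hO : O.Finite) (k : ℕ) :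
    {x ∈ Icc a b | g^[k] x ∈ O}.Finite := by
  induction k with
  | zero => exact hO.subset fun x hx => hx.2
  | succ k ih =>
    refine (ih.biUnion fun c _ => hfib c).subset fun x hx => ?_
    exact mem_biUnion (x := g x) ⟨hm hx.1, by rw [← Function.iterate_succ_apply]; exact hx.2⟩
      ⟨hx.1, rfl⟩

section Orbits
variable {g g1 g2 : ℝ → ℝ} {p x y : ℝ} {n m : ℕ}

lemma orbitSet_eq (h0 : 0 < n) (hfix : g^[n] p = p) (hy : y ∈ orbitSet g p) :
    orbitSet g y = orbitSet g p := by
  obtain ⟨i, rfl⟩ := hy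
  apply Subset.antisymm
  · rintro _ ⟨k, rfl⟩
    exact ⟨k + i, Function.iterate_add_apply g k i p⟩
  · rintro _ ⟨k, rfl⟩
    refine ⟨k + (n * i - i), ?_⟩
    have e : k + (n * i - i) + i = k + n * i := by
      have := Nat.le_mul_of_pos_left i h0
      omega
    show g^[k + (n * i - i)] (g^[i] p) = g^[k] p
    rw [← Function.iterate_add_apply, e, Function.iterate_add_apply, Function.iterate_mul,
      Function.iterate_fixed hfix]

lemma ConvergesToOrbit.orbitSet_eq {a b q : ℝ} {n' : ℕ} (hm : MapsTo g (Icc a b) (Icc a b))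
    (hx : x ∈ Icc a b) (h0 : 0 < n) (hfix : g^[n] p = p) (h0' : 0 < n') (hfix' : g^[n'] q = q)
    (h : ConvergesToOrbit g x (orbitSet g p)) (h' : ConvergesToOrbit g x (orbitSet g q)) :
    orbitSet g p = orbitSet g q := by
  obtain ⟨y, -, φ, hφ, hlim⟩ := isCompact_Icc.tendsto_subseq fun k => hm.iterate k hx
  rw [← _root_.orbitSet_eq h0 hfix (h.mem_of_tendsto h0 hfix hφ.tendsto_atTop hlim),
    ← _root_.orbitSet_eq h0' hfix' (h'.mem_of_tendsto h0' hfix' hφ.tendsto_atTop hlim)]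

lemma Dm_orbit (hfix : g^[m] p = p) (hm : 0 < m) (hne : Dm g g1 m p ≠ 0) (i : ℕ) :
    Dm g g1 m (g^[i] p) = Dm g g1 m p := by
  have h1 : ∀ j, g1 (g^[j] p) ≠ 0 := by
    intro j h
    have e : g^[j % m] p = g^[j] p := by
      conv_rhs => rw [← Nat.mod_add_div j m, Function.iterate_add_apply, Function.iterate_mul,
        Function.iterate_fixed hfix]
    exact hne (Finset.prod_eq_zero (Finset.mem_range.2 (Nat.mod_lt j hm)) (by rw [e, h]))
  have h2 : Dm g g1 i p ≠ 0 := Finset.prod_ne_zero_iff.2 fun j _ => h1 j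
  have e1 := Dm_add (g := g) (g1 := g1) i m p
  have e2 := Dm_add (g := g) (g1 := g1) m i p
  rw [hfix, add_comm, e1] at e2
  refine mul_left_cancel₀ h2 (e2.trans (mul_comm _ _))

lemma not_converges_repelling {O : Set ℝ} {T T' : ℝ → ℝ} (hO : O.Finite) (hOn : O.Nonempty)
    (hT : ∀ q ∈ O, HasDerivAt T (T' q) q) (hfix : ∀ q ∈ O, T q = q) (hrep : ∀ q ∈ O, 1 < |T' q|)
    (hlim : Tendsto (fun k => Metric.infDist (T^[k] x) O) atTop (𝓝 0)) : ∃ k, T^[k] x ∈ O := by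
  obtain ⟨ε, hε, hsep⟩ := exists_sep hO
  have loc : ∀ q ∈ O, ∀ᶠ y in 𝓝 q, |y - q| ≤ |T y - q| ∧ |T y - q| < ε / 2 := by
    intro q hq
    have h1 := (hasDerivAt_iff_tendsto_slope.1 (hT q hq)).abs.eventually (lt_mem_nhds (hrep q hq))
    have h2 : ∀ᶠ y in 𝓝 q, |T y - q| < ε / 2 := by
      have := Metric.tendsto_nhds.1 (hT q hq).continuousAt (ε / 2) (by positivity)
      simpa only [hfix q hq, Real.dist_eq] using this
    filter_upwards [eventually_nhdsWithin_iff.1 h1, h2] with y h3 h4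
    refine ⟨?_, h4⟩
    by_cases hy : y = q
    · rw [hy, sub_self, abs_zero]; exact abs_nonneg _
    · have h5 := h3 hy
      have h6 : 0 < |y - q| := abs_pos.2 (sub_ne_zero.2 hy)
      rw [slope_def_field, abs_div, hfix q hq, lt_div_iff₀ h6, one_mul] at h5
      exact h5.le
  obtain ⟨δ, hδ, hloc⟩ : ∃ δ > 0, ∀ q ∈ O, ∀ y, |y - q| < δ →
      |y - q| ≤ |T y - q| ∧ |T y - q| < ε / 2 := by
    choose! d hd using fun q hq => Metric.eventually_nhds_iff.1 (loc q hq)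
    obtain ⟨q₀, hq₀, H⟩ := Set.exists_min_image O d hO hOn
    exact ⟨d q₀, (hd q₀ hq₀).1, fun q hq y hy => (hd q hq).2 (hy.trans_le (H q hq))⟩
  have grow : ∀ y, Metric.infDist y O < δ → Metric.infDist (T y) O < ε / 2 →
      Metric.infDist y O ≤ Metric.infDist (T y) O := by
    intro y hy hTy
    obtain ⟨q, hq, e⟩ := hO.isCompact.exists_infDist_eq_dist hOn y
    obtain ⟨q', hq', e'⟩ := hO.isCompact.exists_infDist_eq_dist hOn (T y)
    rw [Real.dist_eq] at e e'
    rw [e] at hy ⊢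
    rw [e'] at hTy ⊢
    obtain ⟨h1, h2⟩ := hloc q hq y hy
    have : q = q' := by
      refine hsep q hq q' hq' ?_
      have := abs_sub_le q (T y) q'
      rw [abs_sub_comm q (T y)] at this
      linarith
    rwa [← this]
  obtain ⟨K, hK⟩ := eventually_atTop.1 (hlim.eventually (gt_mem_nhds (lt_min hδ (half_pos hε))))
  have low : ∀ j, Metric.infDist (T^[K] x) O ≤ Metric.infDist (T^[K + j] x) O := by
    intro j
    induction j with
    | zero => exact le_rfl
    | succ j ih =>
      refine ih.trans ?_
      have e : T^[K + (j + 1)] x = T (T^[K + j] x) := Function.iterate_succ_apply' T (K + j) x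
      have h1 := hK (K + (j + 1)) (by omega)
      rw [e] at h1 ⊢
      exact grow _ ((hK (K + j) (by omega)).trans_le (min_le_left _ _))
        (h1.trans_le (min_le_right _ _))
  have h0 : Metric.infDist (T^[K] x) O ≤ 0 :=
    ge_of_tendsto' (hlim.comp (tendsto_atTop_mono (fun j => Nat.le_add_left j K) tendsto_id)) low
  exact ⟨K, (hO.isClosed.mem_iff_infDist_zero hOn).2 (h0.antisymm Metric.infDist_nonneg)⟩

lemma AttractingIn.not_repelling {a b : ℝ} (h : AttractingIn g (Icc a b) p n) (hab : a < b)
    (hp : p ∈ Icc a b) (hm : MapsTo g (Icc a b) (Icc a b)) (h0 : ∀ x, HasDerivAt g (g1 x) x)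
    (h1 : ∀ x, HasDerivAt g1 (g2 x) x) (hq : ∀ x ∈ Icc a b, g1 x = 0 → g2 x ≠ 0)
    (hm0 : 0 < m) (hfix : g^[m] p = p) : ¬ 1 < |Dm g g1 m p| := by
  intro hrep
  obtain ⟨hper, U, hU, hpU, hconv⟩ := h
  have hO := orbitSet_finite hper.1 hper.2.1
  have hfin := fun k => finite_iterate_preimage hm (finite_fiber h0 h1 hq) hO k
  have hne : Dm g g1 m p ≠ 0 := fun e => by rw [e, abs_zero] at hrep; linarith
  have hsub : U ∩ Icc a b ⊆ ⋃ k : ℕ, {x ∈ Icc a b | g^[k] x ∈ orbitSet g p} := by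
    intro x hx
    have hOfix : ∀ q ∈ orbitSet g p, g^[m] q = q := by
      rintro _ ⟨i, rfl⟩
      show g^[m] (g^[i] p) = g^[i] p
      rw [← Function.iterate_add_apply, add_comm, Function.iterate_add_apply, hfix]
    obtain ⟨k, hk⟩ := not_converges_repelling (T := g^[m]) (T' := Dm g g1 m) (x := x) hO
      ⟨p, 0, rfl⟩ (fun q _ => hasDerivAt_iterate h0 m q) hOfix (by
        rintro _ ⟨i, rfl⟩
        show 1 < |Dm g g1 m (g^[i] p)|
        rwa [Dm_orbit hfix hm0 hne]) (by
        have h2 := (hconv x hx).comp (tendsto_id.const_mul_atTop' hm0)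
        refine h2.congr fun k => ?_
        simp only [Function.comp, id]
        rw [Function.iterate_mul])
    exact mem_iUnion.2 ⟨m * k, hx.2, by rw [Function.iterate_mul]; exact hk⟩
  have hcount : (U ∩ Icc a b).Countable :=
    (countable_iUnion fun k => (hfin k).countable).mono hsub
  obtain ⟨δ, hδ, hball⟩ := Metric.isOpen_iff.1 hU p hpU
  obtain ⟨s, t, hst, hI⟩ : ∃ s t, s < t ∧ Ioo s t ⊆ U ∩ Icc a b := by
    refine ⟨max a (p - δ), min b (p + δ), ?_, fun y hy => ⟨hball ?_, ?_, ?_⟩⟩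
    · rw [max_lt_iff, lt_min_iff, lt_min_iff]
      exact ⟨⟨hab, by linarith [hp.1]⟩, by linarith [hp.2], by linarith⟩
    · rw [Metric.mem_ball, Real.dist_eq, abs_lt]
      have := (le_max_right a (p - δ)).trans_lt hy.1
      have := hy.2.trans_le (min_le_right b (p + δ))
      constructor <;> linarith
    · exact ((le_max_left a (p - δ)).trans_lt hy.1).le
    · exact (hy.2.trans_le (min_le_left b (p + δ))).le
  have := (hcount.mono hI).measure_zero volume
  rw [Real.volume_Ioo, ENNReal.ofReal_eq_zero] at this
  linarith

lemma exists_attracting_of_contracting {N : Set ℝ} (h0 : ∀ x, HasDerivAt g (g1 x) x)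
    (hm0 : 0 < m) (hfix : g^[m] p = p) (hD : |Dm g g1 m p| < 1) : ∃ n, AttractingIn g N p n := by
  have hex : ∃ n, 0 < n ∧ g^[n] p = p := ⟨m, hm0, hfix⟩
  have hg : Continuous g := continuous_iff_continuousAt.2 fun x => (h0 x).continuousAt
  refine ⟨Nat.find hex, ⟨(Nat.find_spec hex).1, (Nat.find_spec hex).2, fun k hk hkn e =>
    Nat.find_min hex hkn ⟨hk, e⟩⟩, ?_⟩
  obtain ⟨c, hDc, hc1⟩ := exists_between hD
  have hc0 : 0 < c := (abs_nonneg _).trans_lt hDc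
  have h1 := (hasDerivAt_iff_tendsto_slope.1 (hasDerivAt_iterate h0 m p)).abs.eventually
    (gt_mem_nhds hDc)
  have h2 : ∀ᶠ y in 𝓝 p, |g^[m] y - p| ≤ c * |y - p| := by
    filter_upwards [eventually_nhdsWithin_iff.1 h1] with y h3
    by_cases hy : y = p
    · rw [hy, hfix, sub_self, abs_zero, mul_zero]
    · have h5 := h3 hy
      have h6 : 0 < |y - p| := abs_pos.2 (sub_ne_zero.2 hy)
      rw [slope_def_field, abs_div, hfix, div_lt_iff₀ h6] at h5
      exact h5.le
  obtain ⟨δ, hδ, H⟩ := Metric.eventually_nhds_iff.1 h2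
  refine ⟨Metric.ball p δ, Metric.isOpen_ball, Metric.mem_ball_self hδ, fun x hx => ?_⟩
  have hxd : |x - p| < δ := hx.1
  have hk : ∀ k, |(g^[m])^[k] x - p| ≤ c ^ k * |x - p| := by
    intro k
    induction k with
    | zero => simp
    | succ k ih =>
      rw [Function.iterate_succ_apply', pow_succ]
      have h3 : |(g^[m])^[k] x - p| < δ :=
        (ih.trans (mul_le_of_le_one_left (abs_nonneg _) (pow_le_one₀ hc0.le hc1.le))).trans_lt hxd
      have h4 := H (y := (g^[m])^[k] x) h3
      have h5 := mul_le_mul_of_nonneg_left ih hc0.le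
      linarith
  have hlim : Tendsto (fun k => (g^[m])^[k] x) atTop (𝓝 p) := by
    rw [tendsto_iff_dist_tendsto_zero]
    have h3 := (tendsto_pow_atTop_nhds_zero_of_lt_one hc0.le hc1).mul_const |x - p|
    rw [zero_mul] at h3
    exact squeeze_zero (fun _ => dist_nonneg) hk h3
  rw [ConvergesToOrbit, Metric.tendsto_atTop]
  intro ε hε
  have hr : ∀ r, ∀ᶠ k in atTop, Metric.infDist (g^[r] ((g^[m])^[k] x)) (orbitSet g p) < ε := by
    intro r
    have h3 := (((hg.iterate r).tendsto p).comp hlim).eventually (Metric.ball_mem_nhds _ hε)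
    filter_upwards [h3] with k hk
    exact (Metric.infDist_le_dist_of_mem (show g^[r] p ∈ orbitSet g p from ⟨r, rfl⟩)).trans_lt hk
  obtain ⟨K, hK⟩ := eventually_atTop.1
    ((Finset.eventually_all (Finset.range m)).2 fun r _ => hr r)
  refine ⟨m * K, fun k hk => ?_⟩
  have h4 := hK (k / m) ((Nat.le_div_iff_mul_le hm0).2 (by rwa [mul_comm])) (k % m)
    (Finset.mem_range.2 (Nat.mod_lt k hm0))
  rw [← Function.iterate_mul, ← Function.iterate_add_apply, Nat.mod_add_div] at h4
  rwa [Real.dist_eq, sub_zero, abs_of_nonneg Metric.infDist_nonneg]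

end Orbits

section Count
variable {a b : ℝ} {f g : ℝ → ℝ}

lemma CkClose.mono {k : ℕ} {N : Set ℝ} {η η' : ℝ} (h : CkClose k f g N η) (hη : η ≤ η') :
    CkClose k f g N η' := fun i hi x hx => (h i hi x hx).trans hη

lemma CkClose.zero {N : Set ℝ} {η : ℝ} (h : CkClose 3 f g N η) : ∀ x ∈ N, |g x - f x| ≤ η :=
  fun x hx => by simpa only [iteratedDeriv_zero] using h 0 (by norm_num) x hx

lemma CkClose.one {N : Set ℝ} {η : ℝ} (h : CkClose 3 f g N η) :
    ∀ x ∈ N, |deriv g x - deriv f x| ≤ η :=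
  fun x hx => by simpa only [iteratedDeriv_one] using h 1 (by norm_num) x hx

lemma hasDerivAt_of_contDiff (hf : ContDiff ℝ 3 f) (x : ℝ) : HasDerivAt f (deriv f x) x :=
  (hf.differentiable (by norm_num) x).hasDerivAt

lemma hasDerivAt_deriv (hf : ContDiff ℝ 3 f) (x : ℝ) :
    HasDerivAt (deriv f) (iteratedDeriv 2 f x) x := by
  simpa only [iteratedDeriv_one] using hasDerivAt_iteratedDeriv hf (i := 1) (by norm_num) x

lemma exists_crit_map (hf : ContDiff ℝ 3 f)
    (hquad : ∀ c ∈ Icc a b, deriv f c = 0 → iteratedDeriv 2 f c ≠ 0) :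
    ∃ η > 0, ∀ g : ℝ → ℝ, ContDiff ℝ 3 g → CkClose 3 f g (Icc a b) η →
      (∀ c ∈ Icc a b, deriv g c = 0 → iteratedDeriv 2 g c ≠ 0) ∧
      ∃ ψ : ℝ → ℝ, MapsTo ψ {c ∈ Icc a b | deriv g c = 0} {c ∈ Icc a b | deriv f c = 0} ∧
        InjOn ψ {c ∈ Icc a b | deriv g c = 0} := by
  obtain ⟨η, hη, H⟩ := exists_zero_map (hasDerivAt_deriv hf)
    (continuous_iteratedDeriv_of_le hf (by norm_num)) hquad one_pos
  refine ⟨η, hη, fun g hg hcl => ?_⟩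
  obtain ⟨ψ, hψ, hinj⟩ := H _ _ (hasDerivAt_deriv hg) hcl.one (hcl 2 (by norm_num))
  exact ⟨fun c hc h0 => (hψ c hc h0).2.2.2.2, ψ,
    fun c hc => ⟨(hψ c hc.1 hc.2).1, (hψ c hc.1 hc.2).2.1⟩, hinj⟩

lemma Dm_ne_one (hf : ContDiff ℝ 3 f)
    (hneut : ¬ ∃ p ∈ Icc a b, ∃ n : ℕ, NeutralPeriodicPt f p n) {Q : ℕ} (hQ : 0 < Q) {z : ℝ}
    (hz : z ∈ Icc a b) (hfix : f^[Q] z = z) : |Dm f (deriv f) Q z| ≠ 1 := by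
  intro hD
  have h1 : HasDerivAt (f^[Q]) (Dm f (deriv f) Q z) z :=
    hasDerivAt_iterate (hasDerivAt_of_contDiff hf) Q z
  exact hneut ⟨z, hz, Q, hQ, hfix, by rw [h1.deriv, hD]⟩

lemma finite_fixed (hf : ContDiff ℝ 3 f)
    (hneut : ¬ ∃ p ∈ Icc a b, ∃ n : ℕ, NeutralPeriodicPt f p n) {Q : ℕ} (hQ : 0 < Q) :
    {z ∈ Icc a b | f^[Q] z - z = 0}.Finite := by
  refine finite_zeros (h' := fun x => Dm f (deriv f) Q x - 1)
    (fun x => (hasDerivAt_iterate (hasDerivAt_of_contDiff hf) Q x).sub (hasDerivAt_id x))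
    fun x hx h0 e => Dm_ne_one hf hneut hQ hx (sub_eq_zero.1 h0) ?_
  rw [sub_eq_zero.1 e, abs_one]

lemma exists_fixed_map (hf : ContDiff ℝ 3 f) (hmaps : MapsTo f (Icc a b) (Icc a b))
    (hneut : ¬ ∃ p ∈ Icc a b, ∃ n : ℕ, NeutralPeriodicPt f p n) {Q : ℕ} (hQ : 0 < Q) :
    ∃ η > 0, ∀ g : ℝ → ℝ, ContDiff ℝ 3 g → MapsTo g (Icc a b) (Icc a b) →
      CkClose 3 f g (Icc a b) η → ∃ φ : ℝ → ℝ, ∀ p ∈ Icc a b, g^[Q] p = p →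
        φ p ∈ Icc a b ∧ f^[Q] (φ p) = φ p ∧
        (1 < |Dm f (deriv f) Q (φ p)| → 1 < |Dm g (deriv g) Q p|) ∧
        ∀ q ∈ Icc a b, g^[Q] q = q → orbitSet f (φ p) = orbitSet f (φ q) →
          orbitSet g p = orbitSet g q := by
  have hc1 : Continuous (deriv f) := by
    simpa only [iteratedDeriv_one] using continuous_iteratedDeriv_of_le hf (i := 1) (by norm_num)
  have hZ := finite_fixed hf hneut hQ
  obtain ⟨σ, hσ, hsep⟩ := exists_sep hZ
  obtain ⟨δ, hδ, hu⟩ := Metric.uniformContinuousOn_iff.1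
    (isCompact_Icc.uniformContinuousOn_of_continuous (s := Icc a b) hf.continuous.continuousOn)
    (σ / 3) (by positivity)
  simp only [Real.dist_eq] at hu
  have hDc := continuous_Dm hf.continuous hc1 Q
  obtain ⟨m, hm, hmZ⟩ := hZ.isCompact.exists_forall_le' (a := 0)
    (f := fun z => |(|Dm f (deriv f) Q z| - 1)|) (by fun_prop) fun z hz =>
      abs_pos.2 (sub_ne_zero.2 (Dm_ne_one hf hneut hQ hz.1 (sub_eq_zero.1 hz.2)))
  obtain ⟨η₁, hη₁, H₁⟩ := exists_zero_map (a := a) (b := b) (h := fun x => f^[Q] x - x)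
    (h' := fun x => Dm f (deriv f) Q x - 1)
    (fun x => (hasDerivAt_iterate (hasDerivAt_of_contDiff hf) Q x).sub (hasDerivAt_id x))
    (hDc.sub continuous_const)
    (fun x hx h0 e => Dm_ne_one hf hneut hQ hx (sub_eq_zero.1 h0) (by
      rw [sub_eq_zero.1 e, abs_one]))
    (ε := min (min δ (σ / 3)) m) (by positivity)
  obtain ⟨η₂, hη₂, H₂⟩ := iterate_close hf.continuous hc1 hmaps Q η₁ hη₁
  refine ⟨min η₂ (σ / 3), by positivity, fun g hg hmg hcl => ?_⟩
  have hcl₂ := H₂ g (deriv g) hmg (hcl.mono (min_le_left _ _)).zero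
    (hcl.mono (min_le_left _ _)).one
  obtain ⟨φ, hφ, hinj⟩ := H₁ (fun x => g^[Q] x - x) (fun x => Dm g (deriv g) Q x - 1)
    (fun x => (hasDerivAt_iterate (hasDerivAt_of_contDiff hg) Q x).sub (hasDerivAt_id x))
    (fun x hx => by rw [sub_sub_sub_cancel_right]; exact (hcl₂ x hx).1.le)
    (fun x hx => by rw [sub_sub_sub_cancel_right]; exact (hcl₂ x hx).2.le)
  have fixIter : ∀ {h : ℝ → ℝ} {x : ℝ} (i : ℕ), h^[Q] x = x → h^[Q] (h^[i] x) = h^[i] x := by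
    intro h x i hx
    rw [← Function.iterate_add_apply, add_comm, Function.iterate_add_apply, hx]
  have comm : ∀ p ∈ Icc a b, g^[Q] p = p → φ (g p) = f (φ p) := by
    intro p hp hfix
    obtain ⟨h1, h2, h3, -⟩ := hφ p hp (sub_eq_zero.2 hfix)
    obtain ⟨h1', h2', h3', -⟩ := hφ (g p) (hmg hp) (sub_eq_zero.2 (fixIter 1 hfix))
    have e1 := hu p hp (φ p) h1 (h3.trans_le ((min_le_left _ _).trans (min_le_left _ _)))
    have e2 := h3'.trans_le ((min_le_left _ _).trans (min_le_right _ _))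
    have e3 := (hcl.mono (min_le_right _ _)).zero p hp
    refine hsep _ ⟨h1', h2'⟩ _ ⟨hmaps h1, sub_eq_zero.2 (fixIter 1 (sub_eq_zero.1 h2))⟩ ?_
    rw [abs_sub_comm] at e2
    have := abs_sub_le (φ (g p)) (g p) (f (φ p))
    have := abs_sub_le (g p) (f p) (f (φ p))
    linarith
  have commIter : ∀ p ∈ Icc a b, g^[Q] p = p → ∀ i, φ (g^[i] p) = f^[i] (φ p) := by
    intro p hp hfix i
    induction i with
    | zero => rfl
    | succ i ih =>
      rw [Function.iterate_succ_apply', Function.iterate_succ_apply',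
        comm _ (hmg.iterate i hp) (fixIter i hfix), ih]
  refine ⟨φ, fun p hp hfix => ?_⟩
  obtain ⟨h1, h2, -, h4, -⟩ := hφ p hp (sub_eq_zero.2 hfix)
  refine ⟨h1, sub_eq_zero.1 h2, fun hD => ?_, fun q hq hfixq e => ?_⟩
  · rw [sub_sub_sub_cancel_right] at h4
    have h5 := hmZ _ ⟨h1, h2⟩
    simp only [abs_of_pos (sub_pos.2 hD)] at h5
    have h6 := h4.trans_le (min_le_right _ _)
    rw [abs_sub_comm] at h6
    have := abs_sub_abs_le_abs_sub (Dm f (deriv f) Q (φ p)) (Dm g (deriv g) Q p)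
    linarith
  · obtain ⟨i, hi⟩ : φ q ∈ orbitSet f (φ p) := by rw [e]; exact ⟨0, rfl⟩
    simp only at hi
    rw [← commIter p hp hfix] at hi
    have := hinj ⟨hmg.iterate i hp, sub_eq_zero.2 (fixIter i hfix)⟩
      ⟨hq, sub_eq_zero.2 hfixq⟩ hi
    exact (orbitSet_eq hQ hfix ⟨i, this⟩).symm

/-- The attracting periodic orbits of `g` in `N`. -/
def attractors (g : ℝ → ℝ) (N : Set ℝ) : Set (Set ℝ) :=
  {O | ∃ p ∈ N, ∃ n : ℕ, AttractingIn g N p n ∧ O = orbitSet g p}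

lemma attractors_bound (hab : a < b) (hf : ContDiff ℝ 3 f) (hmaps : MapsTo f (Icc a b) (Icc a b))
    (hquad : ∀ c ∈ Icc a b, deriv f c = 0 → iteratedDeriv 2 f c ≠ 0)
    (hneut : ¬ ∃ p ∈ Icc a b, ∃ n : ℕ, NeutralPeriodicPt f p n) (n₀ : ℕ) :
    ∃ η > 0, ∀ g : ℝ → ℝ, ContDiff ℝ 3 g → MapsTo g (Icc a b) (Icc a b) →
      CkClose 3 f g (Icc a b) η →
      (∀ p ∈ Icc a b, ∀ n : ℕ, AttractingIn g (Icc a b) p n →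
        n < n₀ ∨ ∃ c ∈ Icc a b, deriv g c = 0 ∧ ConvergesToOrbit g c (orbitSet g p)) →
      (attractors g (Icc a b)).Finite ∧ ((attractors f (Icc a b)).Finite →
        (attractors g (Icc a b)).ncard ≤
          (attractors f (Icc a b)).ncard + {c ∈ Icc a b | deriv f c = 0}.ncard) := by
  obtain ⟨η₁, hη₁, H₁⟩ := exists_crit_map hf hquad
  obtain ⟨η₂, hη₂, H₂⟩ := exists_fixed_map hf hmaps hneut n₀.factorial_pos
  refine ⟨min η₁ η₂, lt_min hη₁ hη₂, fun g hg hmg hcl hatt => ?_⟩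
  obtain ⟨hquadg, ψ, hψ, hψinj⟩ := H₁ g hg (hcl.mono (min_le_left _ _))
  obtain ⟨φ, hφ⟩ := H₂ g hg hmg (hcl.mono (min_le_right _ _))
  have hcritf : {c ∈ Icc a b | deriv f c = 0}.Finite := finite_zeros (hasDerivAt_deriv hf) hquad
  have hZ := finite_fixed hf hneut n₀.factorial_pos
  have hex : ∀ O : Set ℝ, O ∈ attractors g (Icc a b) →
      ∃ p ∈ Icc a b, ∃ n : ℕ, AttractingIn g (Icc a b) p n ∧ O = orbitSet g p := fun O hO => hO
  choose! p hp n hn hO using hex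
  set Low := {O ∈ attractors g (Icc a b) | n O < n₀} with hLow
  set High := {O ∈ attractors g (Icc a b) | ¬ n O < n₀} with hHigh
  have hunion : attractors g (Icc a b) = Low ∪ High := by
    ext O
    constructor
    · intro h
      by_cases h' : n O < n₀
      · exact Or.inl ⟨h, h'⟩
      · exact Or.inr ⟨h, h'⟩
    · rintro (h | h) <;> exact h.1
  have hfixg : ∀ O ∈ Low, g^[n₀.factorial] (p O) = p O := by
    intro O hO'
    have hper := (hn O hO'.1).1
    obtain ⟨k, hk⟩ := Nat.dvd_factorial hper.1 hO'.2.le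
    rw [hk, Function.iterate_mul, Function.iterate_fixed hper.2.1]
  have hLowMaps : MapsTo (fun O => orbitSet f (φ (p O))) Low (attractors f (Icc a b) ∩
      orbitSet f '' {z ∈ Icc a b | f^[n₀.factorial] z - z = 0}) := by
    intro O hO'
    obtain ⟨h1, h2, h3, -⟩ := hφ _ (hp O hO'.1) (hfixg O hO')
    refine ⟨?_, mem_image_of_mem _ ⟨h1, sub_eq_zero.2 h2⟩⟩
    have hle : |Dm f (deriv f) n₀.factorial (φ (p O))| < 1 := by
      refine lt_of_le_of_ne (not_lt.1 fun hD => ?_) (Dm_ne_one hf hneut n₀.factorial_pos h1 h2)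
      exact (hn O hO'.1).not_repelling hab (hp O hO'.1) hmg (hasDerivAt_of_contDiff hg)
        (hasDerivAt_deriv hg) hquadg n₀.factorial_pos (hfixg O hO') (h3 hD)
    obtain ⟨k, hk⟩ := exists_attracting_of_contracting (N := Icc a b) (hasDerivAt_of_contDiff hf)
      n₀.factorial_pos h2 hle
    exact ⟨_, h1, k, hk, rfl⟩
  have hLowInj : InjOn (fun O => orbitSet f (φ (p O))) Low := by
    intro O hO₁ O' hO₂ e
    rw [hO O hO₁.1, hO O' hO₂.1]
    exact (hφ _ (hp O hO₁.1) (hfixg O hO₁)).2.2.2 _ (hp O' hO₂.1) (hfixg O' hO₂) e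
  have hcex : ∀ O : Set ℝ, O ∈ High →
      ∃ c ∈ Icc a b, deriv g c = 0 ∧ ConvergesToOrbit g c (orbitSet g (p O)) := fun O hO' =>
    (hatt _ (hp O hO'.1) _ (hn O hO'.1)).resolve_left hO'.2
  choose! c hc hc0 hcO using hcex
  have hHighMaps : MapsTo (fun O => ψ (c O)) High {c ∈ Icc a b | deriv f c = 0} := fun O hO' =>
    hψ ⟨hc O hO', hc0 O hO'⟩
  have hHighInj : InjOn (fun O => ψ (c O)) High := by
    intro O hO₁ O' hO₂ e
    have hcc : c O = c O' := hψinj ⟨hc O hO₁, hc0 O hO₁⟩ ⟨hc O' hO₂, hc0 O' hO₂⟩ e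
    have h1 := (hn O hO₁.1).1
    have h2 := (hn O' hO₂.1).1
    rw [hO O hO₁.1, hO O' hO₂.1]
    exact (hcO O hO₁).orbitSet_eq hmg (hc O hO₁) h1.1 h1.2.1 h2.1 h2.2.1 (hcc ▸ hcO O' hO₂)
  refine ⟨?_, fun hfin => ?_⟩
  · rw [hunion]
    exact (Finite.of_injOn hLowMaps hLowInj ((hZ.image _).subset inter_subset_right)).union
      (Finite.of_injOn hHighMaps hHighInj hcritf)
  · rw [hunion]
    exact (ncard_union_le _ _).trans (add_le_add
      (ncard_le_ncard_of_injOn _ (fun O hO' => (hLowMaps hO').1) hLowInj hfin)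
      (ncard_le_ncard_of_injOn _ hHighMaps hHighInj hcritf))

end Count

/-- A C³ map of a compact interval with quadratic critical points and no
neutral periodic orbits has a C³-neighbourhood `F` and an `n₀` such that any attracting
periodic orbit of any `g ∈ F` either has period `< n₀` or attracts a critical point of `g`;
consequently every `g ∈ F` has finitely many periodic attractors, bounded in number by the
number of periodic attractors of `f` plus the number of critical points of `f`. -/
theorem stmt_0 (a b : ℝ) (hab : a < b) (f : ℝ → ℝ)
    (hf : ContDiff ℝ 3 f) (hmaps : MapsTo f (Icc a b) (Icc a b))
    (hquad : ∀ c ∈ Icc a b, deriv f c = 0 → iteratedDeriv 2 f c ≠ 0)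
    (hneut : ¬ ∃ p ∈ Icc a b, ∃ n : ℕ, NeutralPeriodicPt f p n) :
    ∃ (η : ℝ) (n₀ : ℕ), 0 < η ∧
      ∀ g : ℝ → ℝ, ContDiff ℝ 3 g → MapsTo g (Icc a b) (Icc a b) →
        CkClose 3 f g (Icc a b) η →
        (∀ p ∈ Icc a b, ∀ n : ℕ, AttractingIn g (Icc a b) p n →
            n < n₀ ∨ ∃ c ∈ Icc a b, deriv g c = 0 ∧
              ConvergesToOrbit g c (orbitSet g p)) ∧
        {O : Set ℝ | ∃ p ∈ Icc a b, ∃ n : ℕ,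
            AttractingIn g (Icc a b) p n ∧ O = orbitSet g p}.Finite ∧
        {O : Set ℝ | ∃ p ∈ Icc a b, ∃ n : ℕ,
            AttractingIn g (Icc a b) p n ∧ O = orbitSet g p}.ncard ≤
          {O : Set ℝ | ∃ p ∈ Icc a b, ∃ n : ℕ,
              AttractingIn f (Icc a b) p n ∧ O = orbitSet f p}.ncard +
          {c ∈ Icc a b | deriv f c = 0}.ncard := by
  obtain ⟨η₁, n₀, hη₁, H₁⟩ := exists_attracted_crit hab hf hmaps hquad hneut
  obtain ⟨η₂, hη₂, H₂⟩ := attractors_bound hab hf hmaps hquad hneut n₀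
  have hself : ∀ {η : ℝ}, 0 < η → CkClose 3 f f (Icc a b) η := fun hη i _ x _ => by
    rw [sub_self, abs_zero]; exact hη.le
  have hfin := (H₂ f hf hmaps (hself hη₂) (H₁ f hf hmaps (hself hη₁))).1
  refine ⟨min η₁ η₂, n₀, lt_min hη₁ hη₂, fun g hg hmg hcl => ?_⟩
  have h1 := H₁ g hg hmg (hcl.mono (min_le_left _ _))
  obtain ⟨h2, h3⟩ := H₂ g hg hmg (hcl.mono (min_le_right _ _)) h1
  exact ⟨h1, h2, h3 hfin⟩
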